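/- For any regular uncountable cardinal θ, the existence of a virtually θ-strong cardinal is equiconsistent (over ZFC) with the existence of a faintly θ-measurable cardinal. In particular, if κ is faintly θ-measurable in L, then κ is virtually θ-pre-strong in L. -/

import Mathlib

open FirstOrder FirstOrder.Language

namespace VLC

universe u v

/- ## The language of set theory (with two auxiliary unary predicates) -/

/-- Function symbols: none. -/
inductive Funcs : ℕ → Type
/-- Relation symbols: two unary predicate symbols and one binary (membership) symbol. -/
inductive Rels : ℕ → Type
  | u1 : Rels 1
  | u2 : Rels 1
  | mem : Rels 2

/-- The first-order language with one binary relation symbol (membership) and two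
unary predicate symbols (used for expanded structures `(M, ∈, A, B)`; when a unary
predicate is not needed it is interpreted as the always-false predicate, which does
not change the notion of elementarity). -/
def L3 : Language := ⟨Funcs, Rels⟩

/-- The `L3`-structure on the subclass `{x // dom x}` of a "universe" `V`, with
membership interpreted by `r` and the two unary predicates by `A1`, `A2`. -/
def mstr {V : Type u} (dom : V → Prop) (r : V → V → Prop) (A1 A2 : V → Prop) :
    L3.Structure {x : V // dom x} where
  funMap := fun f _ => nomatch f
  RelMap := fun rel v =>
    match rel with
    | .u1 => A1 (v 0).1
    | .u2 => A2 (v 0).1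
    | .mem => r (v 0).1 (v 1).1

/-- The `L3`-structure on all of `V` with membership `r` (unary predicates empty). -/
def memStr {V : Type u} (r : V → V → Prop) : L3.Structure V where
  funMap := fun f _ => nomatch f
  RelMap := fun rel v =>
    match rel with
    | .u1 => False
    | .u2 => False
    | .mem => r (v 0) (v 1)

/-- An elementary embedding between the structures `({x // domV x}, rV, A1, A2)` and
`({y // domW y}, rW, B1, B2)`: a map preserving the satisfaction of all first-order
formulas of the language of set theory (with two predicates). -/
def ElemEmb {V : Type u} {W : Type v} (domV : V → Prop) (rV : V → V → Prop) (A1 A2 : V → Prop)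
    (domW : W → Prop) (rW : W → W → Prop) (B1 B2 : W → Prop) : Type (max u v) :=
  @ElementaryEmbedding L3 {x : V // domV x} {y : W // domW y}
    (mstr domV rV A1 A2) (mstr domW rW B1 B2)

/-- Application of an elementary embedding. -/
def eApp {V : Type u} {W : Type v} {domV : V → Prop} {rV : V → V → Prop} {A1 A2 : V → Prop}
    {domW : W → Prop} {rW : W → W → Prop} {B1 B2 : W → Prop}
    (e : ElemEmb domV rV A1 A2 domW rW B1 B2) (x : {x : V // domV x}) : {y : W // domW y} :=
  @ElementaryEmbedding.toFun L3 {x : V // domV x} {y : W // domW y}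
    (mstr domV rV A1 A2) (mstr domW rW B1 B2) e x

/-- Realization of a formula with parameters in the full structure `(V, r)`. -/
def RealizeIn {V : Type u} (r : V → V → Prop) {n l : ℕ} (φ : L3.BoundedFormula (Fin n) l)
    (prm : Fin n → V) (xs : Fin l → V) : Prop :=
  @BoundedFormula.Realize L3 V (memStr r) (Fin n) l φ prm xs

/-- Realization of a sentence-with-parameters in the substructure of `(V, r)` on `{x // dom x}`. -/
def RealizeSub {V : Type u} (dom : V → Prop) (r : V → V → Prop) {n l : ℕ}
    (φ : L3.BoundedFormula (Fin n) l) (prm : Fin n → {x : V // dom x})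
    (xs : Fin l → {x : V // dom x}) : Prop :=
  @BoundedFormula.Realize L3 {x : V // dom x} (mstr dom r (fun _ => False) (fun _ => False))
    (Fin n) l φ prm xs

/- ## Basic set-theoretic notions over an abstract membership relation -/

section Basic

variable {V : Type u} (r : V → V → Prop)

/-- `a ⊆ b`. -/
def SubW (a b : V) : Prop := ∀ x, r x a → r x b

/-- `a` is a transitive set. -/
def TransW (a : V) : Prop := ∀ x y, r x a → r y x → r y a

/-- `a` is an ordinal (a transitive set of transitive sets; this is equivalent to the usual
definition in the presence of foundation). -/
def OrdW (a : V) : Prop := TransW r a ∧ ∀ x, r x a → TransW r x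

/-- `a ≤ b` for ordinals: `a ∈ b ∨ a = b`. -/
def ordLe (a b : V) : Prop := r a b ∨ a = b

/-- `p = {a, b}`. -/
def IsUPair (p a b : V) : Prop := ∀ x, r x p ↔ (x = a ∨ x = b)

/-- `p` is the (Kuratowski) ordered pair `⟨a, b⟩`. -/
def IsOPair (p a b : V) : Prop :=
  ∃ sa sab, IsUPair r sa a a ∧ IsUPair r sab a b ∧ IsUPair r p sa sab

/-- The pair `⟨x, y⟩` belongs to `f` (i.e. `f(x) = y` when `f` is a function). -/
def FApp (f x y : V) : Prop := ∃ z, r z f ∧ IsOPair r z x y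

/-- `f` is a function with domain `a`. -/
def IsFunOn (f a : V) : Prop :=
  (∀ z, r z f → ∃ x y, r x a ∧ IsOPair r z x y) ∧
  (∀ x, r x a → ∃ y, FApp r f x y) ∧
  (∀ x y y', FApp r f x y → FApp r f x y' → y = y')

/-- `f : a → b` is a function. -/
def IsFuncW (f a b : V) : Prop := IsFunOn r f a ∧ ∀ x y, FApp r f x y → r y b

/-- `f : a → b` is an injective function. -/
def IsInjW (f a b : V) : Prop :=
  IsFuncW r f a b ∧ ∀ x x' y, FApp r f x y → FApp r f x' y → x = x'

/-- `f : a → b` is a surjective function. -/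
def IsSurjW (f a b : V) : Prop :=
  IsFuncW r f a b ∧ ∀ y, r y b → ∃ x, r x a ∧ FApp r f x y

/-- `a` and `b` are equinumerous. -/
def EquinumW (a b : V) : Prop := ∃ f, IsInjW r f a b ∧ IsSurjW r f a b

/-- `t` is the transitive closure of `x` (the least transitive superset). -/
def TCW (t x : V) : Prop :=
  SubW r x t ∧ TransW r t ∧ ∀ s, SubW r x s → TransW r s → SubW r t s

/-- `|a| < θ` for a cardinal `θ`: `a` injects into some element of `θ`. -/
def CardLtW (a θ : V) : Prop := ∃ β f, r β θ ∧ IsInjW r f a β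

/-- `x ∈ H_θ`: the transitive closure of `x` has cardinality `< θ`. -/
def InHW (θ x : V) : Prop := ∃ t, TCW r t x ∧ CardLtW r t θ

/-- `h = H_θ`, the collection of sets whose transitive closure has size `< θ`. -/
def IsHW (θ h : V) : Prop := ∀ x, r x h ↔ InHW r θ x

/-- `κ` is a cardinal: an ordinal not equinumerous with any of its elements. -/
def IsCardW (κ : V) : Prop := OrdW r κ ∧ ∀ β, r β κ → ¬ EquinumW r β κ

/-- `e = ∅`. -/
def IsEmptyW (e : V) : Prop := ∀ x, ¬ r x e

/-- `s = x ∪ {x}` is the ordinal successor of `x`. -/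
def IsSuccOf (s x : V) : Prop := ∀ z, r z s ↔ (r z x ∨ z = x)

/-- `o` is a limit ordinal. -/
def LimitOrdW (o : V) : Prop := OrdW r o ∧ (∃ x, r x o) ∧ ∀ x, r x o → ∃ y, r y o ∧ r x y

/-- `o = ω`, the least limit ordinal. -/
def IsOmegaW (o : V) : Prop := LimitOrdW r o ∧ ∀ x, r x o → ¬ LimitOrdW r x

/-- `θ` is a regular cardinal: no function from an element of `θ` into `θ` has unbounded range. -/
def RegularW (θ : V) : Prop := IsCardW r θ ∧
  ∀ β f, r β θ → IsFunOn r f β → (∀ x y, FApp r f x y → r y θ) →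
    ∃ γ, r γ θ ∧ ∀ x y, FApp r f x y → r y γ

/-- `θ` is a regular uncountable cardinal. -/
def RegUncW (θ : V) : Prop := RegularW r θ ∧ ∃ o, IsOmegaW r o ∧ r o θ

/-- `θ` is an infinite regular cardinal. -/
def RegularInfW (θ : V) : Prop := RegularW r θ ∧ ∃ o, IsOmegaW r o ∧ ordLe r o θ

/-- `p = 𝒫(x)`. -/
def IsPowW (p x : V) : Prop := ∀ z, r z p ↔ SubW r z x

/-- `θ` is inaccessible: an uncountable regular strong limit cardinal. -/
def InaccW (θ : V) : Prop :=
  RegUncW r θ ∧ ∀ β p, r β θ → IsPowW r p β → CardLtW r p θ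

/-- `s = κ⁺` is the cardinal successor of `κ`. -/
def CardSuccOf (κ s : V) : Prop := IsCardW r s ∧ r κ s ∧ ∀ c, IsCardW r c → r κ c → ordLe r s c

/-- `C` is a club (closed unbounded set) in `δ`. -/
def ClubInW (C δ : V) : Prop :=
  SubW r C δ ∧ (∀ x, r x C → OrdW r x) ∧
  (∀ α, r α δ → ∃ β, r β C ∧ (r α β ∨ α = β)) ∧
  (∀ γ, r γ δ → OrdW r γ → (∃ x, r x γ) →
    (∀ α, r α γ → ∃ β, r β C ∧ r α β ∧ r β γ) → r γ C)

/-- `δ` is a Mahlo cardinal: inaccessible, and every club in `δ` contains a regular cardinal. -/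
def MahloW (δ : V) : Prop :=
  InaccW r δ ∧ ∀ C, ClubInW r C δ → ∃ κ, r κ C ∧ RegularInfW r κ

/-- `g = f ↾ κ` is the restriction of the function `f` to `κ`. -/
def RestrOf (g f κ : V) : Prop :=
  ∀ z, r z g ↔ (r z f ∧ ∃ x y, IsOPair r z x y ∧ r x κ)

/-- `κ` is a closure point of the function `f`: `f '' κ ⊆ κ`. -/
def ClosurePtW (f κ : V) : Prop := ∀ x y, r x κ → FApp r f x y → r y κ

/-- `⟨p, q⟩` belongs to the relation (set of ordered pairs) `rel`. -/
def RelIn (rel p q : V) : Prop := ∃ z, r z rel ∧ IsOPair r z p q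

/-- `a` is countable: `a` injects into `ω`. -/
def CountableW (a : V) : Prop := ∃ o f, IsOmegaW r o ∧ IsInjW r f a o

end Basic

/- ## ZFC universes -/

/-- A universe of ZFC: a (well-founded) type with a membership relation satisfying the ZFC
axioms; the separation and replacement schemas are stated for all first-order formulas
(with parameters) of the language of set theory. Foundation is strengthened to
well-foundedness, i.e. we consider standard models. -/
structure ZFUniv : Type (u + 1) where
  V : Type u
  mem : V → V → Prop
  wf : WellFounded mem
  extensionality : ∀ x y : V, (∀ z, mem z x ↔ mem z y) → x = y
  pairing : ∀ x y : V, ∃ p, IsUPair mem p x y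
  unions : ∀ x : V, ∃ u, ∀ z, mem z u ↔ ∃ y, mem y x ∧ mem z y
  power : ∀ x : V, ∃ p, IsPowW mem p x
  infinity : ∃ o : V, IsOmegaW mem o
  separation : ∀ (n : ℕ) (φ : L3.BoundedFormula (Fin n) 1) (prm : Fin n → V) (a : V),
    ∃ b, ∀ x, mem x b ↔ (mem x a ∧ RealizeIn mem φ prm (fun _ => x))
  replacement : ∀ (n : ℕ) (φ : L3.BoundedFormula (Fin n) 2) (prm : Fin n → V) (a : V),
    (∀ x y y', mem x a → RealizeIn mem φ prm ![x, y] → RealizeIn mem φ prm ![x, y'] → y = y') →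
    ∃ b, ∀ y, mem y b ↔ ∃ x, mem x a ∧ RealizeIn mem φ prm ![x, y]
  choice : ∀ a : V, (∀ x, mem x a → ∃ y, mem y x) →
    ∃ f, IsFunOn mem f a ∧ ∀ x y, mem x a → FApp mem f x y → mem y x

/- ## Set-forcing extensions -/

/-- A set-forcing extension of the universe `u`: a universe `W` together with an
inclusion of `u` as a transitive subclass, a forcing poset `pos` (with preorder `lerel`,
a set of ordered pairs, where `RelIn lerel p q` means `p` is stronger than `q`)
belonging to `u`, a filter `G ⊆ pos` meeting every dense subset of `pos` that belongs
to `u`, such that `G ∈ W` and every element of `W` is the value `val τ` of some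
`pos`-name `τ ∈ u`, where names are evaluated by `G` in the standard recursive fashion.
This pins `W` down as the generic extension `u[G]`. -/
structure Extension (u : ZFUniv.{u}) : Type (u + 1) where
  W : ZFUniv.{u}
  inc : u.V → W.V
  inc_inj : Function.Injective inc
  inc_mem : ∀ x y, W.mem (inc x) (inc y) ↔ u.mem x y
  inc_trans : ∀ (x : u.V) (w : W.V), W.mem w (inc x) → ∃ y, u.mem y x ∧ w = inc y
  pos : u.V
  lerel : u.V
  le_pairs : ∀ z, u.mem z lerel → ∃ p q, u.mem p pos ∧ u.mem q pos ∧ IsOPair u.mem z p q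
  le_refl : ∀ p, u.mem p pos → RelIn u.mem lerel p p
  le_trans : ∀ p q s, RelIn u.mem lerel p q → RelIn u.mem lerel q s → RelIn u.mem lerel p s
  G : u.V → Prop
  G_sub : ∀ p, G p → u.mem p pos
  G_ne : ∃ p, G p
  G_up : ∀ p q, G p → u.mem q pos → RelIn u.mem lerel p q → G q
  G_dir : ∀ p q, G p → G q → ∃ s, G s ∧ RelIn u.mem lerel s p ∧ RelIn u.mem lerel s q
  G_gen : ∀ D, (∀ d, u.mem d D → u.mem d pos) →
    (∀ p, u.mem p pos → ∃ d, u.mem d D ∧ RelIn u.mem lerel d p) → ∃ p, G p ∧ u.mem p D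
  Gset : W.V
  Gset_spec : ∀ w, W.mem w Gset ↔ ∃ p, G p ∧ w = inc p
  val : u.V → W.V
  val_spec : ∀ τ w, W.mem w (val τ) ↔
    ∃ σ p z, u.mem z τ ∧ IsOPair u.mem z σ p ∧ G p ∧ w = val σ
  val_surj : ∀ w, ∃ τ, w = val τ

/- ## Generic elementary embeddings -/

/-- A generic elementary embedding from the structure `(h, ∈, A1, A2)`, where `h` is a set
of the universe `u`, to a structure `(tgt, ∈, bset, b2)` living in some set-forcing
extension of `u`: the embedding is an element (`code`) of the extension `E.W`, and `emb`
is its externalization, an elementary embedding in the model-theoretic sense. -/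
structure GenEmb (u : ZFUniv.{u}) (h : u.V) (A1 A2 : u.V → Prop) : Type (u + 1) where
  E : Extension u
  tgt : E.W.V
  bset : E.W.V
  b2 : E.W.V → Prop := fun _ => False
  emb : ElemEmb (u.mem · h) u.mem A1 A2 (E.W.mem · tgt) E.W.mem (E.W.mem · bset) b2
  code : E.W.V
  code_fun : IsFuncW E.W.mem code (E.inc h) tgt
  code_graph : ∀ x (hx : u.mem x h), FApp E.W.mem code (E.inc x) (eApp emb ⟨x, hx⟩).1

namespace GenEmb

variable {u : ZFUniv.{u}} {h : u.V} {A1 A2 : u.V → Prop} (D : GenEmb u h A1 A2)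

/-- The critical point of the embedding is `κ`: `κ` is an ordinal, all ordinals below `κ`
are fixed, and `κ` is moved. -/
def crit (κ : u.V) : Prop :=
  OrdW u.mem κ ∧ ∃ hκ : u.mem κ h,
    (∀ α (hα : u.mem α h), u.mem α κ → (eApp D.emb ⟨α, hα⟩).1 = D.E.inc α) ∧
    (eApp D.emb ⟨κ, hκ⟩).1 ≠ D.E.inc κ

/-- `π(x) = y` where `y` is (the copy of) a set of the ground universe. -/
def mapsTo (x y : u.V) : Prop := ∃ hx : u.mem x h, (eApp D.emb ⟨x, hx⟩).1 = D.E.inc y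

/-- `π(κ) > θ`. -/
def jGT (κ θ : u.V) : Prop := ∃ hκ : u.mem κ h, D.E.W.mem (D.E.inc θ) (eApp D.emb ⟨κ, hκ⟩).1

/-- `π(κ) ≤ θ`. -/
def jLE (κ θ : u.V) : Prop := ∃ hκ : u.mem κ h, ordLe D.E.W.mem (eApp D.emb ⟨κ, hκ⟩).1 (D.E.inc θ)

/-- `H_θ ⊆ N`, i.e. the domain `h` is contained in the target. -/
def hSub : Prop := ∀ x, u.mem x h → D.E.W.mem (D.E.inc x) D.tgt

/-- The target is a transitive set (of the extension). -/
def tgtTrans : Prop := TransW D.E.W.mem D.tgt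

/-- The target is (the copy of) the ground-universe set `N`; in particular `N ⊆ V`. -/
def tgtIs (N : u.V) : Prop := D.tgt = D.E.inc N

/-- `B ∩ h = A` where `B` is the predicate of the target structure. -/
def bMatch (A : u.V → Prop) : Prop :=
  ∀ x, u.mem x h → (D.E.W.mem (D.E.inc x) D.bset ↔ A x)

/-- The target is closed under `<θ`-sequences from the ground universe: every function
in `u` from an ordinal `γ < θ` into the target belongs to the target. -/
def closedLt (θ : u.V) : Prop := ∀ s γ, u.mem γ θ → OrdW u.mem γ → IsFunOn u.mem s γ →
  (∀ x y, FApp u.mem s x y → D.E.W.mem (D.E.inc y) D.tgt) → D.E.W.mem (D.E.inc s) D.tgt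

/-- The embedding is `κ`-powerset preserving: its domain and target have the same subsets
of `κ` (in the extension). -/
def powerPres (κ : u.V) : Prop :=
  ∀ w, SubW D.E.W.mem w (D.E.inc κ) → (D.E.W.mem w (D.E.inc h) ↔ D.E.W.mem w D.tgt)

/-- `H_θ = H_θ^N` : the domain `h = H_θ` coincides with `H_θ` as computed inside the
(possibly generic) transitive target `N = tgt`, namely the collection of `x ∈ N` having,
in `N`, a transitive closure `t` and an injection of `t` into some `β ∈ θ`. -/
def hEqHtgt (θ : u.V) : Prop :=
  ∀ w, D.E.W.mem w (D.E.inc h) ↔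
    (D.E.W.mem w D.tgt ∧ ∃ t f β, D.E.W.mem t D.tgt ∧ TCW D.E.W.mem t w ∧
      D.E.W.mem β (D.E.inc θ) ∧ D.E.W.mem f D.tgt ∧ IsInjW D.E.W.mem f t β)

end GenEmb

/-- A generic elementary embedding of plain ∈-structures (no predicates). -/
abbrev PlainEmb (u : ZFUniv.{u}) (h : u.V) : Type (u + 1) :=
  GenEmb u h (fun _ => False) (fun _ => False)


section Notions

variable (u : ZFUniv.{u})

/- ### Measurable / strong / supercompact family -/

/-- `κ` is faintly `θ`-measurable: in a forcing extension there are a transitive set `N`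
and an elementary embedding `π : H_θ → N` with critical point `κ`. -/
def FaintMeasAt (θ κ : u.V) : Prop := ∃ h, IsHW u.mem θ h ∧
  ∃ D : PlainEmb u h, D.tgtTrans ∧ D.crit κ

/-- `κ` is virtually `θ`-measurable: moreover `N ⊆ V` (the target is a set of the ground
universe). -/
def VirtMeasAt (θ κ : u.V) : Prop := ∃ h, IsHW u.mem θ h ∧
  ∃ (N : u.V) (D : PlainEmb u h), D.tgtIs N ∧ TransW u.mem N ∧ D.crit κ

/-- `κ` is faintly `θ`-pre-strong: faintly `θ`-measurable with `H_θ ⊆ N`. -/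
def FaintPreStrongAt (θ κ : u.V) : Prop := ∃ h, IsHW u.mem θ h ∧
  ∃ D : PlainEmb u h, D.tgtTrans ∧ D.crit κ ∧ D.hSub

/-- `κ` is faintly `θ`-strong: faintly `θ`-pre-strong with `π(κ) > θ`. -/
def FaintStrongAt (θ κ : u.V) : Prop := ∃ h, IsHW u.mem θ h ∧
  ∃ D : PlainEmb u h, D.tgtTrans ∧ D.crit κ ∧ D.hSub ∧ D.jGT κ θ

/-- `κ` is virtually `θ`-pre-strong: `N ⊆ V`, `H_θ ⊆ N`, `crit π = κ`. -/
def VirtPreStrongAt (θ κ : u.V) : Prop := ∃ h, IsHW u.mem θ h ∧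
  ∃ (N : u.V) (D : PlainEmb u h), D.tgtIs N ∧ TransW u.mem N ∧ D.crit κ ∧ D.hSub

/-- `κ` is virtually `θ`-strong: virtually `θ`-pre-strong with `π(κ) > θ`. -/
def VirtStrongAt (θ κ : u.V) : Prop := ∃ h, IsHW u.mem θ h ∧
  ∃ (N : u.V) (D : PlainEmb u h), D.tgtIs N ∧ TransW u.mem N ∧ D.crit κ ∧ D.hSub ∧ D.jGT κ θ

/-- `κ` is virtually `θ`-supercompact: virtually `θ`-measurable with target closed under
`<θ`-sequences from the ground universe and `π(κ) > θ`. -/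
def VirtSupercompactAt (θ κ : u.V) : Prop := ∃ h, IsHW u.mem θ h ∧
  ∃ (N : u.V) (D : PlainEmb u h), D.tgtIs N ∧ TransW u.mem N ∧ D.crit κ ∧
    D.closedLt θ ∧ D.jGT κ θ

/-- `κ` is virtually `θ`-supercompact ala Magidor: there are `κ̄ < θ̄ < κ` and a generic
elementary embedding `π : H_θ̄ → H_θ` with `crit π = κ̄` and `π(κ̄) = κ`. -/
def VirtMagidorAt (θ κ : u.V) : Prop := ∃ κ' θ', u.mem κ' θ' ∧ u.mem θ' κ ∧
  ∃ h' h, IsHW u.mem θ' h' ∧ IsHW u.mem θ h ∧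
    ∃ D : PlainEmb u h', D.tgtIs h ∧ D.crit κ' ∧ D.mapsTo κ' κ

/-- `κ` is virtually strong: virtually `θ`-strong for all regular (uncountable) `θ > κ`. -/
def VirtStrong (κ : u.V) : Prop := ∀ θ, RegUncW u.mem θ → u.mem κ θ → VirtStrongAt u θ κ

/-- `κ` is virtually supercompact. -/
def VirtSupercompact (κ : u.V) : Prop :=
  ∀ θ, RegUncW u.mem θ → u.mem κ θ → VirtSupercompactAt u θ κ

/-- `κ` is virtually supercompact ala Magidor. -/
def VirtMagidor (κ : u.V) : Prop := ∀ θ, RegUncW u.mem θ → u.mem κ θ → VirtMagidorAt u θ κ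

/-- `κ` is virtually pre-strong. -/
def VirtPreStrong (κ : u.V) : Prop := ∀ θ, RegUncW u.mem θ → u.mem κ θ → VirtPreStrongAt u θ κ

/- ### Power(set-preserving) variants -/

/-- `κ` is faintly power-`θ`-measurable: the generic embedding is moreover
`κ`-powerset preserving. -/
def FaintPowerMeasAt (θ κ : u.V) : Prop := ∃ h, IsHW u.mem θ h ∧
  ∃ D : PlainEmb u h, D.tgtTrans ∧ D.crit κ ∧ D.powerPres κ

/-- `κ` is faintly power-`θ`-pre-strong. -/
def FaintPowerPreStrongAt (θ κ : u.V) : Prop := ∃ h, IsHW u.mem θ h ∧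
  ∃ D : PlainEmb u h, D.tgtTrans ∧ D.crit κ ∧ D.hSub ∧ D.powerPres κ

/-- `κ` is faintly power-`θ`-strong. -/
def FaintPowerStrongAt (θ κ : u.V) : Prop := ∃ h, IsHW u.mem θ h ∧
  ∃ D : PlainEmb u h, D.tgtTrans ∧ D.crit κ ∧ D.hSub ∧ D.jGT κ θ ∧ D.powerPres κ

/- ### Superstrong / rank-into-rank family -/

/-- `κ` is virtually `(θ,1)`-superstrong: as virtually `θ`-pre-strong, with `π(κ) ≤ θ`. -/
def VirtSuperstrong1At (θ κ : u.V) : Prop := ∃ h, IsHW u.mem θ h ∧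
  ∃ (N : u.V) (D : PlainEmb u h), D.tgtIs N ∧ TransW u.mem N ∧ D.crit κ ∧ D.hSub ∧ D.jLE κ θ

/-- `κ` is faintly `(θ,1)`-superstrong. -/
def FaintSuperstrong1At (θ κ : u.V) : Prop := ∃ h, IsHW u.mem θ h ∧
  ∃ D : PlainEmb u h, D.tgtTrans ∧ D.crit κ ∧ D.hSub ∧ D.jLE κ θ

/-- `κ` is faintly superstrong: faintly `(θ,1)`-superstrong for some regular uncountable
`θ > κ`. -/
def FaintSuperstrong (κ : u.V) : Prop :=
  ∃ θ, RegUncW u.mem θ ∧ u.mem κ θ ∧ FaintSuperstrong1At u θ κ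

/-- `κ` is virtually `(θ,ω)`-superstrong: as virtually `θ`-pre-strong, together with the
full critical sequence `κ = π⁰(κ), π¹(κ), π²(κ), …` satisfying `πⁿ(κ) < θ` for all `n`
(equivalently `π^ω(κ) = sup_n πⁿ(κ) ≤ θ`). -/
def VirtOmegaSuperstrongAt (θ κ : u.V) : Prop := ∃ h, IsHW u.mem θ h ∧
  ∃ (N : u.V) (D : PlainEmb u h), D.tgtIs N ∧ TransW u.mem N ∧ D.crit κ ∧ D.hSub ∧
    ∃ c : ℕ → u.V, c 0 = κ ∧ ∀ n, u.mem (c n) θ ∧ D.mapsTo (c n) (c (n + 1))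

/-- `κ` is virtually rank-into-rank: there is a cardinal `θ > κ` and a generic elementary
embedding `π : H_θ → H_θ` with `crit π = κ`. -/
def VirtRankToRank (κ : u.V) : Prop := ∃ θ h, IsCardW u.mem θ ∧ u.mem κ θ ∧ IsHW u.mem θ h ∧
  ∃ D : PlainEmb u h, D.tgtIs h ∧ D.crit κ

/- ### (θ, A)-strong family (for a set `A`) and Woodin cardinals -/

/-- `κ` is virtually `(θ, A)`-strong (`A` a set of the ground universe): there is a generic
elementary embedding `π : (H_θ, ∈, A ∩ H_θ) → (N, ∈, B)` with `N` transitive, `N ⊆ V`,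
`crit π = κ`, `π(κ) > θ`, `H_θ ⊆ N` and `B ∩ H_θ = A ∩ H_θ`. -/
def VirtAStrongAt (θ κ A : u.V) : Prop := ∃ h, IsHW u.mem θ h ∧
  ∃ (N : u.V) (D : GenEmb u h (u.mem · A) (fun _ => False)), D.tgtIs N ∧ TransW u.mem N ∧
    D.crit κ ∧ D.jGT κ θ ∧ D.hSub ∧ D.bMatch (u.mem · A)

/-- `κ` is faintly `(θ, A)`-strong: as above but `N` is merely a transitive set of the
extension. -/
def FaintAStrongAt (θ κ A : u.V) : Prop := ∃ h, IsHW u.mem θ h ∧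
  ∃ D : GenEmb u h (u.mem · A) (fun _ => False), D.tgtTrans ∧
    D.crit κ ∧ D.jGT κ θ ∧ D.hSub ∧ D.bMatch (u.mem · A)

/-- `κ` is virtually `(θ, A)`-supercompact: moreover the target is closed under
`<θ`-sequences from the ground universe. -/
def VirtASupercompactAt (θ κ A : u.V) : Prop := ∃ h, IsHW u.mem θ h ∧
  ∃ (N : u.V) (D : GenEmb u h (u.mem · A) (fun _ => False)), D.tgtIs N ∧ TransW u.mem N ∧
    D.crit κ ∧ D.jGT κ θ ∧ D.hSub ∧ D.bMatch (u.mem · A) ∧ D.closedLt θ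

/-- `κ` is virtually `(θ, A)`-extendible: moreover the target is `H_μ` for some cardinal
`μ` of the ground universe. -/
def VirtAExtendibleAt (θ κ A : u.V) : Prop := ∃ h, IsHW u.mem θ h ∧
  ∃ (N : u.V) (D : GenEmb u h (u.mem · A) (fun _ => False)), D.tgtIs N ∧ TransW u.mem N ∧
    D.crit κ ∧ D.jGT κ θ ∧ D.hSub ∧ D.bMatch (u.mem · A) ∧
    ∃ μ, IsCardW u.mem μ ∧ IsHW u.mem μ N

/-- The weakening of virtual `(θ, A)`-strongness in which `N ⊆ V` is replaced by
`H_θ = H_θ^N`. -/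
def WeakAStrongAt (θ κ A : u.V) : Prop := ∃ h, IsHW u.mem θ h ∧
  ∃ D : GenEmb u h (u.mem · A) (fun _ => False), D.tgtTrans ∧
    D.crit κ ∧ D.jGT κ θ ∧ D.hEqHtgt θ ∧ D.bMatch (u.mem · A)

/-- `κ` is virtually `(<δ, A)`-strong: virtually `(θ, A ∩ H_θ)`-strong for all regular
(uncountable) `θ` with `κ < θ < δ`. -/
def VirtLtAStrong (δ κ A : u.V) : Prop :=
  ∀ θ, RegUncW u.mem θ → u.mem κ θ → u.mem θ δ → VirtAStrongAt u θ κ A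

/-- `κ` is faintly `(<δ, A)`-strong. -/
def FaintLtAStrong (δ κ A : u.V) : Prop :=
  ∀ θ, RegUncW u.mem θ → u.mem κ θ → u.mem θ δ → FaintAStrongAt u θ κ A

/-- `κ` is virtually `(<δ, A)`-supercompact. -/
def VirtLtASupercompact (δ κ A : u.V) : Prop :=
  ∀ θ, RegUncW u.mem θ → u.mem κ θ → u.mem θ δ → VirtASupercompactAt u θ κ A

/-- `κ` is virtually `(<δ, A)`-extendible. -/
def VirtLtAExtendible (δ κ A : u.V) : Prop :=
  ∀ θ, RegUncW u.mem θ → u.mem κ θ → u.mem θ δ → VirtAExtendibleAt u θ κ A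

/-- `δ` is virtually Woodin: for every `A ⊆ H_δ` there is a virtually `(<δ, A)`-strong
cardinal `κ < δ`. -/
def VirtWoodin (δ : u.V) : Prop := ∀ A, (∀ x, u.mem x A → InHW u.mem δ x) →
  ∃ κ, u.mem κ δ ∧ VirtLtAStrong u δ κ A

/-- `δ` is faintly Woodin. -/
def FaintWoodin (δ : u.V) : Prop := ∀ A, (∀ x, u.mem x A → InHW u.mem δ x) →
  ∃ κ, u.mem κ δ ∧ FaintLtAStrong u δ κ A

/- ### Class (`On`) versions, for GBC statements; classes are predicates on the universe -/

/-- `κ` is virtually `(θ, A)`-pre-strong for a class `A`. -/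
def VirtClassPreStrongAt (θ κ : u.V) (A : u.V → Prop) : Prop := ∃ h, IsHW u.mem θ h ∧
  ∃ (N : u.V) (D : GenEmb u h A (fun _ => False)), D.tgtIs N ∧ TransW u.mem N ∧
    D.crit κ ∧ D.hSub ∧ D.bMatch A

/-- `κ` is virtually `(θ, A)`-strong for a class `A`. -/
def VirtClassStrongAt (θ κ : u.V) (A : u.V → Prop) : Prop := ∃ h, IsHW u.mem θ h ∧
  ∃ (N : u.V) (D : GenEmb u h A (fun _ => False)), D.tgtIs N ∧ TransW u.mem N ∧
    D.crit κ ∧ D.jGT κ θ ∧ D.hSub ∧ D.bMatch A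

/-- `κ` is faintly `(θ, A)`-pre-strong for a class `A`. -/
def FaintClassPreStrongAt (θ κ : u.V) (A : u.V → Prop) : Prop := ∃ h, IsHW u.mem θ h ∧
  ∃ D : GenEmb u h A (fun _ => False), D.tgtTrans ∧ D.crit κ ∧ D.hSub ∧ D.bMatch A

/-- `On` is virtually pre-Woodin: for every class `A` there is a cardinal `κ` which is
virtually `(θ, A)`-pre-strong for all regular `θ > κ`. -/
def OnVirtPreWoodin : Prop := ∀ A : u.V → Prop, ∃ κ, IsCardW u.mem κ ∧
  ∀ θ, RegUncW u.mem θ → u.mem κ θ → VirtClassPreStrongAt u θ κ A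

/-- `On` is faintly pre-Woodin. -/
def OnFaintPreWoodin : Prop := ∀ A : u.V → Prop, ∃ κ, IsCardW u.mem κ ∧
  ∀ θ, RegUncW u.mem θ → u.mem κ θ → FaintClassPreStrongAt u θ κ A

/-- `On` is virtually Woodin. -/
def OnVirtWoodin : Prop := ∀ A : u.V → Prop, ∃ κ, IsCardW u.mem κ ∧
  ∀ θ, RegUncW u.mem θ → u.mem κ θ → VirtClassStrongAt u θ κ A

/- ### Berkeley cardinals -/

/-- `δ` is virtually proto-Berkeley: for every transitive set `M ⊇ δ` there is a generic
elementary embedding `π : M → M` with `crit π < δ`. -/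
def VirtProtoBerkeley (δ : u.V) : Prop := ∀ M, TransW u.mem M → SubW u.mem δ M →
  ∃ (D : PlainEmb u M) (κ : u.V), D.tgtIs M ∧ D.crit κ ∧ u.mem κ δ

/-- `δ` is virtually Berkeley: for every transitive set `M ⊇ δ` and every `η < δ` there is
a generic elementary embedding `π : M → M` with `η < crit π < δ`. -/
def VirtBerkeley (δ : u.V) : Prop := ∀ M, TransW u.mem M → SubW u.mem δ M → ∀ η, u.mem η δ →
  ∃ (D : PlainEmb u M) (κ : u.V), D.tgtIs M ∧ D.crit κ ∧ u.mem η κ ∧ u.mem κ δ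

/-- `δ` is virtually club Berkeley: for every transitive set `M ⊇ δ` and every club
`C ⊆ δ` there is a generic elementary embedding `π : M → M` with `crit π ∈ C`. -/
def VirtClubBerkeley (δ : u.V) : Prop := ∀ M, TransW u.mem M → SubW u.mem δ M →
  ∀ C, ClubInW u.mem C δ →
    ∃ (D : PlainEmb u M) (κ : u.V), D.tgtIs M ∧ D.crit κ ∧ u.mem κ C

/- ### The virtual Vopěnka principle -/

/-- `m` is (an ordered pair coding) a first-order structure with universe `a` and binary
relation `rel` (structures in an arbitrary common language are rendered, by the standard
coding, as structures with a single binary relation). -/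
def GraphStr (m a rel : u.V) : Prop := IsOPair u.mem m a rel ∧
  ∀ z, u.mem z rel → ∃ x y, u.mem x a ∧ u.mem y a ∧ IsOPair u.mem z x y

/-- `C` is a proper class (not included in any set). -/
def ProperClass (C : u.V → Prop) : Prop := ¬ ∃ s, ∀ m, C m → u.mem m s

end Notions

/-- A generic elementary embedding between two structures `(a, rel)` and `(a', rel')` of
the ground universe `u`, existing in (i.e. coded by an element of) a set-forcing
extension of `u`. -/
structure GenGraphEmb (u : ZFUniv.{u}) (a rel a' rel' : u.V) : Type (u + 1) where
  E : Extension u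
  emb : ElemEmb (u.mem · a) (RelIn u.mem rel) (fun _ => False) (fun _ => False)
    (E.W.mem · (E.inc a')) (RelIn E.W.mem (E.inc rel')) (fun _ => False) (fun _ => False)
  code : E.W.V
  code_fun : IsFuncW E.W.mem code (E.inc a) (E.inc a')
  code_graph : ∀ x (hx : u.mem x a), FApp E.W.mem code (E.inc x) (eApp emb ⟨x, hx⟩).1

/-- The virtual Vopěnka Principle: for every (proper) class `C` of structures in a common
language there are distinct `m, m' ∈ C` with a generic elementary embedding from `m`
to `m'`. -/
def VirtVP (u : ZFUniv.{u}) : Prop := ∀ C : u.V → Prop,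
  (∀ m, C m → ∃ a rel, GraphStr u m a rel) → ProperClass u C →
  ∃ m m' a rel a' rel', C m ∧ C m' ∧ m ≠ m' ∧ GraphStr u m a rel ∧ GraphStr u m' a' rel' ∧
    Nonempty (GenGraphEmb u a rel a' rel')

/- ### The cumulative hierarchy, natural sequences and the Vopěnka filter -/

/-- `IsVrank u α v` says `v = V_α`, the `α`-th level of the cumulative hierarchy
(`V_α = ⋃_{β ∈ α} 𝒫(V_β)`), defined by well-founded recursion. -/
def IsVrank (u : ZFUniv.{u}) : u.V → u.V → Prop :=
  u.wf.fix (C := fun _ => u.V → Prop)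
    (fun α ih v => ∀ x, u.mem x v ↔ ∃ β, ∃ hβ : u.mem β α, ∃ w, ih β hβ w ∧ SubW u.mem x w)

/-- A natural `On`-sequence of structures `M_α = (V_{f(α)}, ∈, {α}, R_α)`, given by an
indexing (class) function `f = F` and (class-many) unary relations `R_α ⊆ V_{f(α)}`;
`Vr α` realizes the level `V_{f(α)}`. -/
structure NatSeq (u : ZFUniv.{u}) : Type (u + 1) where
  F : u.V → u.V
  R : u.V → u.V
  Vr : u.V → u.V
  F_ord : ∀ α, OrdW u.mem α → OrdW u.mem (F α)
  F_gt : ∀ α, OrdW u.mem α → u.mem α (F α)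
  F_mono : ∀ α β, OrdW u.mem β → u.mem α β → ordLe u.mem (F α) (F β)
  Vr_spec : ∀ α, OrdW u.mem α → IsVrank u (F α) (Vr α)
  R_sub : ∀ α, OrdW u.mem α → SubW u.mem (R α) (Vr α)

/-- A generic elementary embedding `M_α → M_β` between two structures of a natural
sequence, where `M_α = (V_{f(α)}, ∈, R_α, {α})`. -/
structure GenNatEmb (u : ZFUniv.{u}) (S : NatSeq u) (α β : u.V) : Type (u + 1) where
  E : Extension u
  emb : ElemEmb (u.mem · (S.Vr α)) u.mem (u.mem · (S.R α)) (· = α)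
    (E.W.mem · (E.inc (S.Vr β))) E.W.mem (E.W.mem · (E.inc (S.R β))) (· = E.inc β)
  code : E.W.V
  code_fun : IsFuncW E.W.mem code (E.inc (S.Vr α)) (E.inc (S.Vr β))
  code_graph : ∀ x (hx : u.mem x (S.Vr α)), FApp E.W.mem code (E.inc x) (eApp emb ⟨x, hx⟩).1

/-- The critical point of a generic embedding between members of a natural sequence. -/
def GenNatEmb.crit {u : ZFUniv.{u}} {S : NatSeq u} {α β : u.V} (D : GenNatEmb u S α β)
    (κ : u.V) : Prop :=
  OrdW u.mem κ ∧ ∃ hκ : u.mem κ (S.Vr α),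
    (∀ γ (hγ : u.mem γ (S.Vr α)), u.mem γ κ → (eApp D.emb ⟨γ, hγ⟩).1 = D.E.inc γ) ∧
    (eApp D.emb ⟨κ, hκ⟩).1 ≠ D.E.inc κ

/-- The class `X` belongs to the virtual Vopěnka filter on `On`: there is a natural
sequence such that the critical point of any generic elementary embedding `M_α → M_β`
(`α < β`) lies in `X`. -/
def InVopFilter (u : ZFUniv.{u}) (X : u.V → Prop) : Prop := ∃ S : NatSeq u,
  ∀ α β, OrdW u.mem α → OrdW u.mem β → u.mem α β →
    ∀ (D : GenNatEmb u S α β) (κ : u.V), D.crit κ → X κ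

/-- `C` is a class club of ordinals. -/
def ClassClub (u : ZFUniv.{u}) (C : u.V → Prop) : Prop := (∀ x, C x → OrdW u.mem x) ∧
  (∀ α, OrdW u.mem α → ∃ β, C β ∧ u.mem α β) ∧
  (∀ γ, OrdW u.mem γ → (∃ x, u.mem x γ) →
    (∀ α, u.mem α γ → ∃ β, C β ∧ u.mem α β ∧ u.mem β γ) → C γ)

/-- `On` is Mahlo: every class club of ordinals contains a regular cardinal. -/
def OnMahlo (u : ZFUniv.{u}) : Prop :=
  ∀ C : u.V → Prop, ClassClub u C → ∃ κ, C κ ∧ RegularInfW u.mem κ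

/- ### The constructible universe -/

/-- `x` is a definable (with parameters) subset of the structure `(m, ∈)`. -/
def DefOverSet (u : ZFUniv.{u}) (m x : u.V) : Prop := SubW u.mem x m ∧
  ∃ (n : ℕ) (φ : L3.BoundedFormula (Fin n) 1) (prm : Fin n → {y : u.V // u.mem y m}),
    ∀ y (hy : u.mem y m),
      u.mem y x ↔ RealizeSub (u.mem · m) u.mem φ prm (fun _ => ⟨y, hy⟩)

/-- `IsL u α ℓ` says `ℓ = L_α`, the `α`-th level of Gödel's constructible hierarchy
(`L_α = ⋃_{β ∈ α} Def(L_β)`), defined by well-founded recursion. -/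
def IsL (u : ZFUniv.{u}) : u.V → u.V → Prop :=
  u.wf.fix (C := fun _ => u.V → Prop)
    (fun α ih ℓ => ∀ x, u.mem x ℓ ↔ ∃ β, ∃ hβ : u.mem β α, ∃ ℓβ, ih β hβ ℓβ ∧ DefOverSet u ℓβ x)

/-- The constructible universe `L` of `u`, as a class. -/
def ClassL (u : ZFUniv.{u}) (x : u.V) : Prop := ∃ α ℓ, OrdW u.mem α ∧ IsL u α ℓ ∧ u.mem x ℓ

/-- The universe `u` satisfies `V = L`. -/
def VeqL (u : ZFUniv.{u}) : Prop := ∀ x, ClassL u x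

end VLC

namespace VLC

universe u v w

set_option linter.style.haveILetI false
set_option linter.unusedVariables false
set_option linter.unusedSectionVars false

/-- The membership symbol. -/
def memRel : L3.Relations 2 := Rels.mem

section Calculus

variable {ι : Type w} {V : ι → Type u} (r : ∀ i, V i → V i → Prop) (P : (∀ i, V i) → Prop)

/-- A family of relations on tuples, over a family `(V i, r i)` of structures, which is
first-order definable by a single formula, with parameters among the sections in `P`. -/
class Df {n : ℕ} (R : ∀ i, (Fin n → V i) → Prop) : Prop where
  out : ∃ φ : L3.Formula ({c : ∀ i, V i // P c} ⊕ Fin n), ∀ i v,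
    @Formula.Realize L3 (V i) (memStr (r i)) _ φ (Sum.elim (fun c => c.1 i) v) ↔ R i v

/-- A family of functions on tuples with definable graph. -/
class DFn {n : ℕ} (f : ∀ i, (Fin n → V i) → V i) : Prop where
  out : Df r P (fun i (w : Fin (n + 1) → V i) => w (Fin.last n) = f i (fun j => w j.castSucc))

variable {r P} {n : ℕ}

theorem Df.congr {R S : ∀ i, (Fin n → V i) → Prop} (h : Df r P R) (e : ∀ i v, R i v ↔ S i v) :
    Df r P S := by
  obtain ⟨φ, hφ⟩ := h.out
  exact ⟨φ, fun i v => (hφ i v).trans (e i v)⟩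

theorem Df.rename {m : ℕ} {R : ∀ i, (Fin n → V i) → Prop} (h : Df r P R) (ρ : Fin n → Fin m) :
    Df r P (fun i (v : Fin m → V i) => R i (fun j => v (ρ j))) := by
  obtain ⟨φ, hφ⟩ := h.out
  refine ⟨φ.relabel (Sum.map id ρ), fun i v => ?_⟩
  letI := memStr (r i)
  rw [Formula.realize_relabel, ← hφ]
  have : (Sum.elim (fun c : {c : ∀ i, V i // P c} => c.1 i) v ∘ Sum.map id ρ) =
      Sum.elim (fun c => c.1 i) (fun j => v (ρ j)) := by
    ext x; cases x <;> rfl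
  rw [this]

/-- Pull back along a map of index sets. -/
theorem Df.pull {κ : Type*} (g : κ → ι) {Q : (∀ k, V (g k)) → Prop}
    (hQ : ∀ c, P c → Q (fun k => c (g k))) {R : ∀ i, (Fin n → V i) → Prop} (h : Df r P R) :
    Df (fun k => r (g k)) Q (fun k v => R (g k) v) := by
  obtain ⟨φ, hφ⟩ := h.out
  refine ⟨φ.relabel (Sum.map (fun c => ⟨fun k => c.1 (g k), hQ _ c.2⟩) id), fun i v => ?_⟩
  letI := memStr (r (g i))
  rw [Formula.realize_relabel, ← hφ]
  refine iff_of_eq (congrArg _ ?_)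
  ext x; cases x <;> rfl

instance Df.imp {R S : ∀ i, (Fin n → V i) → Prop} [hR : Df r P R] [hS : Df r P S] :
    Df r P (fun i v => R i v → S i v) := by
  obtain ⟨φ, hφ⟩ := hR.out
  obtain ⟨ψ, hψ⟩ := hS.out
  exact ⟨BoundedFormula.imp φ ψ, fun i v => by
    letI := memStr (r i)
    rw [Formula.Realize, BoundedFormula.realize_imp, ← hφ, ← hψ]; rfl⟩

instance Df.not {R : ∀ i, (Fin n → V i) → Prop} [hR : Df r P R] :
    Df r P (fun i v => ¬ R i v) := by
  obtain ⟨φ, hφ⟩ := hR.out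
  exact ⟨BoundedFormula.not φ, fun i v => by
    letI := memStr (r i)
    rw [Formula.Realize, BoundedFormula.realize_not, ← hφ]; rfl⟩

instance Df.and {R S : ∀ i, (Fin n → V i) → Prop} [Df r P R] [Df r P S] :
    Df r P (fun i v => R i v ∧ S i v) :=
  (inferInstance : Df r P (fun i v => ¬ (R i v → ¬ S i v))).congr fun i v => by tauto

instance Df.or {R S : ∀ i, (Fin n → V i) → Prop} [Df r P R] [Df r P S] :
    Df r P (fun i v => R i v ∨ S i v) :=
  (inferInstance : Df r P (fun i v => ¬ R i v → S i v)).congr fun i v => by tauto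

instance Df.iff {R S : ∀ i, (Fin n → V i) → Prop} [Df r P R] [Df r P S] :
    Df r P (fun i v => R i v ↔ S i v) :=
  (inferInstance : Df r P (fun i v => (R i v → S i v) ∧ (S i v → R i v))).congr
    fun i v => by tauto

theorem Df.ex' {R : ∀ i, (Fin (n + 1) → V i) → Prop} (h : Df r P R) :
    Df r P (fun i (v : Fin n → V i) => ∃ y : V i, R i (Fin.snoc (α := fun _ => V i) v y)) := by
  obtain ⟨φ, hφ⟩ := h.out
  let g : {c : ∀ i, V i // P c} ⊕ Fin (n + 1) → ({c : ∀ i, V i // P c} ⊕ Fin n) ⊕ Fin 1 :=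
    Sum.elim (fun c => .inl (.inl c)) (Fin.lastCases (.inr 0) (fun i => .inl (.inr i)))
  refine ⟨(BoundedFormula.relabel g φ :
    L3.BoundedFormula ({c : ∀ i, V i // P c} ⊕ Fin n) 1).ex, fun i v => ?_⟩
  letI := memStr (r i)
  rw [Formula.Realize, BoundedFormula.realize_ex]
  refine exists_congr fun y => ?_
  have key := BoundedFormula.realize_relabel (M := V i) (L := L3) (φ := φ) (g := g)
    (v := Sum.elim (fun c => c.1 i) v) (xs := Fin.snoc default y)
  rw [← hφ, key, Formula.Realize]
  have e1 : (Sum.elim (Sum.elim (fun c : {c : ∀ i, V i // P c} => c.1 i) v)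
      ((Fin.snoc (default : Fin 0 → V i) y : Fin 1 → V i) ∘ Fin.castAdd 0) ∘ g)
      = Sum.elim (fun c => c.1 i) (Fin.snoc (α := fun _ => V i) v y) := by
    ext x
    rcases x with c | j
    · rfl
    · refine Fin.lastCases ?_ (fun j => ?_) j
      · simp [g, Fin.snoc]
      · simp [g]
  rw [e1]
  exact iff_of_eq (congrArg _ (funext fun j => j.elim0))

instance Df.ex {R : ∀ i, (Fin n → V i) → V i → Prop}
    [h : Df r P (fun i (w : Fin (n + 1) → V i) =>
      R i (fun j => w j.castSucc) (w (Fin.last n)))] :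
    Df r P (fun i v => ∃ y, R i v y) :=
  h.ex'.congr fun i v => by simp

instance Df.all {R : ∀ i, (Fin n → V i) → V i → Prop}
    [h : Df r P (fun i (w : Fin (n + 1) → V i) =>
      R i (fun j => w j.castSucc) (w (Fin.last n)))] :
    Df r P (fun i v => ∀ y, R i v y) :=
  (inferInstance : Df r P (fun i v => ¬ ∃ y, ¬ R i v y)).congr fun i v => by simp

theorem Df.memv (j k : Fin n) : Df r P (fun i v => r i (v j) (v k)) :=
  ⟨Relations.formula₂ memRel (Term.var (.inr j)) (Term.var (.inr k)), fun i v => by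
    letI := memStr (r i); rw [Formula.realize_rel₂]; rfl⟩

theorem Df.eqv (j k : Fin n) : Df r P (fun _ v => v j = v k) :=
  ⟨Term.equal (L := L3) (Term.var (.inr j)) (Term.var (.inr k)), fun i v => by
    letI := memStr (r i); rw [Formula.realize_equal]; rfl⟩

theorem Df.eqc (j : Fin n) (c : ∀ i, V i) (hc : P c) : Df r P (fun i v => v j = c i) :=
  ⟨Term.equal (L := L3) (Term.var (.inr j)) (Term.var (.inl ⟨c, hc⟩)), fun i v => by
    letI := memStr (r i); rw [Formula.realize_equal]; rfl⟩

instance DFn.var (j : Fin n) : DFn r P (fun _ v => v j) :=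
  ⟨Df.eqv (Fin.last n) j.castSucc⟩

theorem DFn.constP (c : ∀ i, V i) (hc : P c) : DFn r P (fun i (_ : Fin n → V i) => c i) :=
  ⟨Df.eqc (Fin.last n) c hc⟩

/-- substitution of a definable function for the last variable -/
theorem Df.subst {R : ∀ i, (Fin n → V i) → V i → Prop} {f : ∀ i, (Fin n → V i) → V i}
    [hf : DFn r P f]
    (h : Df r P (fun i (w : Fin (n + 1) → V i) =>
      R i (fun j => w j.castSucc) (w (Fin.last n)))) :
    Df r P (fun i v => R i v (f i v)) :=
  haveI := hf.out
  ((inferInstance : Df r P (fun i (w : Fin (n + 1) → V i) =>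
    w (Fin.last n) = f i (fun j => w j.castSucc) ∧
      R i (fun j => w j.castSucc) (w (Fin.last n)))).ex').congr fun i v => by simp

theorem DFn.lift {f : ∀ i, (Fin n → V i) → V i} (hf : DFn r P f) :
    DFn r P (fun i (w : Fin (n + 1) → V i) => f i (fun j => w j.castSucc)) :=
  ⟨(hf.out.rename (m := n + 2)
    (Fin.lastCases (Fin.last (n+1)) (fun j => j.castSucc.castSucc))).congr fun i v => by simp⟩

theorem Df.comp1 {Q : ∀ i, V i → Prop} (h : Df r P (fun i (v : Fin 1 → V i) => Q i (v 0)))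
    (f : ∀ i, (Fin n → V i) → V i) [DFn r P f] : Df r P (fun i v => Q i (f i v)) :=
  Df.subst (R := fun i _ y => Q i y) (h.rename (fun _ => Fin.last n))

theorem Df.comp2 {Q : ∀ i, V i → V i → Prop}
    (h : Df r P (fun i (v : Fin 2 → V i) => Q i (v 0) (v 1)))
    (f g : ∀ i, (Fin n → V i) → V i) [hf : DFn r P f] [DFn r P g] :
    Df r P (fun i v => Q i (f i v) (g i v)) := by
  refine Df.subst (R := fun i v y => Q i (f i v) y) ?_
  haveI := hf.lift
  refine Df.subst (R := fun i (w : Fin (n+1) → V i) y => Q i y (w (Fin.last n))) ?_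
  exact (h.rename (m := n + 2) ![Fin.last (n+1), (Fin.last n).castSucc])

theorem Df.comp3 {Q : ∀ i, V i → V i → V i → Prop}
    (h : Df r P (fun i (v : Fin 3 → V i) => Q i (v 0) (v 1) (v 2)))
    (f g k : ∀ i, (Fin n → V i) → V i) [hf : DFn r P f] [hg : DFn r P g] [DFn r P k] :
    Df r P (fun i v => Q i (f i v) (g i v) (k i v)) := by
  refine Df.subst (R := fun i v y => Q i (f i v) (g i v) y) ?_
  haveI := hf.lift
  haveI := hg.lift
  refine Df.subst
    (R := fun i (w : Fin (n+1) → V i) y => Q i (f i fun j => w j.castSucc) y (w (Fin.last n))) ?_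
  haveI := hf.lift.lift
  refine Df.subst (R := fun i (w : Fin (n+2) → V i) y =>
    Q i y (w (Fin.last (n+1))) (w (Fin.last n).castSucc)) ?_
  exact (h.rename (m := n + 3) ![Fin.last (n+2), (Fin.last (n+1)).castSucc,
    (Fin.last n).castSucc.castSucc])

theorem Df.comp4 {Q : ∀ i, V i → V i → V i → V i → Prop}
    (h : Df r P (fun i (v : Fin 4 → V i) => Q i (v 0) (v 1) (v 2) (v 3)))
    (f g k l : ∀ i, (Fin n → V i) → V i) [hf : DFn r P f] [hg : DFn r P g] [hk : DFn r P k]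
    [DFn r P l] : Df r P (fun i v => Q i (f i v) (g i v) (k i v) (l i v)) := by
  refine Df.subst (R := fun i v y => Q i (f i v) (g i v) (k i v) y) ?_
  haveI := hf.lift
  haveI := hg.lift
  haveI := hk.lift
  refine Df.subst (R := fun i (w : Fin (n+1) → V i) y =>
    Q i (f i fun j => w j.castSucc) (g i fun j => w j.castSucc) y (w (Fin.last n))) ?_
  haveI := hf.lift.lift
  haveI := hg.lift.lift
  refine Df.subst (R := fun i (w : Fin (n+2) → V i) y =>
    Q i (f i fun j => w j.castSucc.castSucc) y (w (Fin.last (n+1))) (w (Fin.last n).castSucc)) ?_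
  haveI := hf.lift.lift.lift
  refine Df.subst (R := fun i (w : Fin (n+3) → V i) y =>
    Q i y (w (Fin.last (n+2))) (w (Fin.last (n+1)).castSucc) (w (Fin.last n).castSucc.castSucc)) ?_
  exact (h.rename (m := n + 4) ![Fin.last (n+3), (Fin.last (n+2)).castSucc,
    (Fin.last (n+1)).castSucc.castSucc, (Fin.last n).castSucc.castSucc.castSucc])

theorem DFn.comp1 {F : ∀ i, V i → V i} (h : DFn r P (fun i (v : Fin 1 → V i) => F i (v 0)))
    (f : ∀ i, (Fin n → V i) → V i) [hf : DFn r P f] : DFn r P (fun i v => F i (f i v)) := by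
  haveI := hf.lift
  exact ⟨Df.comp2 (Q := fun i x y => y = F i x) (h.out) (fun i w => f i fun j => w j.castSucc)
    (fun i w => w (Fin.last n))⟩

theorem DFn.comp2 {F : ∀ i, V i → V i → V i}
    (h : DFn r P (fun i (v : Fin 2 → V i) => F i (v 0) (v 1)))
    (f g : ∀ i, (Fin n → V i) → V i) [hf : DFn r P f] [hg : DFn r P g] :
    DFn r P (fun i v => F i (f i v) (g i v)) := by
  haveI := hf.lift
  haveI := hg.lift
  exact ⟨Df.comp3 (Q := fun i x x' y => y = F i x x') (h.out)
    (fun i w => f i fun j => w j.castSucc) (fun i w => g i fun j => w j.castSucc)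
    (fun i w => w (Fin.last n))⟩

theorem DFn.comp3 {F : ∀ i, V i → V i → V i → V i}
    (h : DFn r P (fun i (v : Fin 3 → V i) => F i (v 0) (v 1) (v 2)))
    (f g k : ∀ i, (Fin n → V i) → V i) [hf : DFn r P f] [hg : DFn r P g] [hk : DFn r P k] :
    DFn r P (fun i v => F i (f i v) (g i v) (k i v)) := by
  haveI := hf.lift
  haveI := hg.lift
  haveI := hk.lift
  exact ⟨Df.comp4 (Q := fun i x x' x'' y => y = F i x x' x'') (h.out)
    (fun i w => f i fun j => w j.castSucc) (fun i w => g i fun j => w j.castSucc)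
    (fun i w => k i fun j => w j.castSucc) (fun i w => w (Fin.last n))⟩

instance Df.mem {f g : ∀ i, (Fin n → V i) → V i} [DFn r P f] [DFn r P g] :
    Df r P (fun i v => r i (f i v) (g i v)) := Df.comp2 (Df.memv 0 1) f g

instance Df.eq {f g : ∀ i, (Fin n → V i) → V i} [DFn r P f] [DFn r P g] :
    Df r P (fun i v => f i v = g i v) := Df.comp2 (Q := fun i a b => a = b) (Df.eqv 0 1) f g

/-- A function is definable as soon as its graph is. -/
theorem DFn.of {f : ∀ i, (Fin n → V i) → V i} {R : ∀ i, (Fin n → V i) → V i → Prop}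
    [h : Df r P (fun i (w : Fin (n + 1) → V i) =>
      R i (fun j => w j.castSucc) (w (Fin.last n)))]
    (e : ∀ i v y, y = f i v ↔ R i v y) : DFn r P f :=
  ⟨h.congr fun i w => (e i _ _).symm⟩

end Calculus

section Single

variable {V : Type u} (r : V → V → Prop) {n : ℕ}

/-- Definability with parameters in a single structure. -/
abbrev Dfb (R : (Fin n → V) → Prop) : Prop :=
  Df (ι := Unit) (V := fun _ => V) (fun _ => r) (fun _ => True) (fun _ v => R v)

instance DFn.const (c : V) :
    DFn (ι := Unit) (V := fun _ => V) (fun _ => r) (fun _ => True)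
      (fun _ (_ : Fin n → V) => c) := DFn.constP (fun _ => c) trivial

variable {r}

theorem Df.at {ι : Type w} {V : ι → Type u} {r : ∀ i, V i → V i → Prop} {P : (∀ i, V i) → Prop}
    {R : ∀ i, (Fin n → V i) → Prop} (h : Df r P R) (i : ι) : Dfb (r i) (R i) :=
  h.pull (fun _ : Unit => i) (fun _ _ => trivial)

theorem Dfb.realizeIn {k m : ℕ} (φ : L3.BoundedFormula (Fin k) m) (prm : Fin k → V) :
    Dfb r (fun xs : Fin m → V => RealizeIn r φ prm xs) := by
  letI := memStr r
  refine ⟨φ.toFormula.relabel (Sum.map (fun i => ⟨fun _ => prm i, trivial⟩) id), fun _ v => ?_⟩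
  rw [Formula.realize_relabel, BoundedFormula.realize_toFormula]
  exact Iff.rfl

theorem Dfb.exists_realizeIn [Nonempty V] {m : ℕ} {R : (Fin m → V) → Prop} (h : Dfb r R) :
    ∃ (N : ℕ) (φ : L3.BoundedFormula (Fin N) m) (prm : Fin N → V),
      ∀ xs, RealizeIn r φ prm xs ↔ R xs := by
  classical
  obtain ⟨φ, hφ⟩ := h.out
  letI := memStr r
  let e := φ.freeVarFinset.equivFin
  let f : φ.freeVarFinset → Fin φ.freeVarFinset.card ⊕ Fin m := fun x =>
    match x.1 with
    | .inl _ => .inl (e x)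
    | .inr i => .inr i
  let ψ : L3.Formula (Fin φ.freeVarFinset.card ⊕ Fin m) := φ.restrictFreeVar f
  let prm : Fin φ.freeVarFinset.card → V := fun j =>
    match (e.symm j).1 with
    | .inl c => c.1 ()
    | .inr _ => Classical.arbitrary V
  refine ⟨_, BoundedFormula.relabel (n := m) id ψ, prm, fun xs => ?_⟩
  rw [← hφ ()]
  refine (BoundedFormula.realize_relabel (M := V) (L := L3) (φ := ψ) (g := id)
    (v := prm) (xs := xs)).trans ?_
  refine (iff_of_eq (congrArg _ (funext fun i => i.elim0))).trans
    (BoundedFormula.realize_restrictFreeVar (M := V) (L := L3) (φ := φ) (f := f)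
      (v := Sum.elim prm xs) (xs := default) (Sum.elim (fun c => c.1 ()) xs) ?_)
  rintro ⟨c | i, hx⟩
  · simp [f, prm]
  · simp [f]

end Single

section Basics

variable {ι : Type w} {V : ι → Type u} {r : ∀ i, V i → V i → Prop} {P : (∀ i, V i) → Prop} {n : ℕ}

variable (f g k l : ∀ i, (Fin n → V i) → V i) [DFn r P f] [DFn r P g] [DFn r P k] [DFn r P l]

instance : Df r P (fun i v => SubW (r i) (f i v) (g i v)) :=
  Df.comp2 (Q := fun i => SubW (r i)) (by unfold SubW; infer_instance) f g
instance : Df r P (fun i v => TransW (r i) (f i v)) :=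
  Df.comp1 (Q := fun i => TransW (r i)) (by unfold TransW; infer_instance) f
instance : Df r P (fun i v => OrdW (r i) (f i v)) :=
  Df.comp1 (Q := fun i => OrdW (r i)) (by unfold OrdW; infer_instance) f
instance : Df r P (fun i v => IsUPair (r i) (f i v) (g i v) (k i v)) :=
  Df.comp3 (Q := fun i => IsUPair (r i)) (by unfold IsUPair; infer_instance) f g k
instance : Df r P (fun i v => IsOPair (r i) (f i v) (g i v) (k i v)) :=
  Df.comp3 (Q := fun i => IsOPair (r i)) (by unfold IsOPair; infer_instance) f g k
instance : Df r P (fun i v => FApp (r i) (f i v) (g i v) (k i v)) :=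
  Df.comp3 (Q := fun i => FApp (r i)) (by unfold FApp; infer_instance) f g k
instance : Df r P (fun i v => IsFunOn (r i) (f i v) (g i v)) :=
  Df.comp2 (Q := fun i => IsFunOn (r i)) (by unfold IsFunOn; infer_instance) f g
instance : Df r P (fun i v => IsFuncW (r i) (f i v) (g i v) (k i v)) :=
  Df.comp3 (Q := fun i => IsFuncW (r i)) (by unfold IsFuncW; infer_instance) f g k
instance : Df r P (fun i v => IsInjW (r i) (f i v) (g i v) (k i v)) :=
  Df.comp3 (Q := fun i => IsInjW (r i)) (by unfold IsInjW; infer_instance) f g k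
instance : Df r P (fun i v => IsSurjW (r i) (f i v) (g i v) (k i v)) :=
  Df.comp3 (Q := fun i => IsSurjW (r i)) (by unfold IsSurjW; infer_instance) f g k
instance : Df r P (fun i v => EquinumW (r i) (f i v) (g i v)) :=
  Df.comp2 (Q := fun i => EquinumW (r i)) (by unfold EquinumW; infer_instance) f g
instance : Df r P (fun i v => TCW (r i) (f i v) (g i v)) :=
  Df.comp2 (Q := fun i => TCW (r i)) (by unfold TCW; infer_instance) f g
instance : Df r P (fun i v => CardLtW (r i) (f i v) (g i v)) :=
  Df.comp2 (Q := fun i => CardLtW (r i)) (by unfold CardLtW; infer_instance) f g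
instance : Df r P (fun i v => InHW (r i) (f i v) (g i v)) :=
  Df.comp2 (Q := fun i => InHW (r i)) (by unfold InHW; infer_instance) f g
instance : Df r P (fun i v => IsHW (r i) (f i v) (g i v)) :=
  Df.comp2 (Q := fun i => IsHW (r i)) (by unfold IsHW; infer_instance) f g
instance : Df r P (fun i v => IsCardW (r i) (f i v)) :=
  Df.comp1 (Q := fun i => IsCardW (r i)) (by unfold IsCardW; infer_instance) f
instance : Df r P (fun i v => LimitOrdW (r i) (f i v)) :=
  Df.comp1 (Q := fun i => LimitOrdW (r i)) (by unfold LimitOrdW; infer_instance) f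
instance : Df r P (fun i v => IsOmegaW (r i) (f i v)) :=
  Df.comp1 (Q := fun i => IsOmegaW (r i)) (by unfold IsOmegaW; infer_instance) f
instance : Df r P (fun i v => IsPowW (r i) (f i v) (g i v)) :=
  Df.comp2 (Q := fun i => IsPowW (r i)) (by unfold IsPowW; infer_instance) f g
instance : Df r P (fun i v => RegularW (r i) (f i v)) :=
  Df.comp1 (Q := fun i => RegularW (r i)) (by unfold RegularW; infer_instance) f
instance : Df r P (fun i v => RegUncW (r i) (f i v)) :=
  Df.comp1 (Q := fun i => RegUncW (r i)) (by unfold RegUncW; infer_instance) f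

end Basics

section Fix

variable {ι : Type w} {V : ι → Type u} {r : ∀ i, V i → V i → Prop} {P : (∀ i, V i) → Prop} {n : ℕ}

theorem Dfb.fix {V : Type u} {r : V → V → Prop} {n m : ℕ} {R : (Fin n → V) → Prop}
    (h : Dfb r R) (c : Fin n → V ⊕ Fin m) :
    Dfb r (fun w : Fin m → V => R (fun j => Sum.elim id w (c j))) := by
  obtain ⟨φ, hφ⟩ := h.out
  letI := memStr r
  refine ⟨φ.relabel (Sum.elim Sum.inl (fun j => Sum.map (fun x => ⟨fun _ => x, trivial⟩) id (c j))),
    fun i v => ?_⟩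
  rw [Formula.realize_relabel]
  refine (iff_of_eq (congrArg _ ?_)).trans (hφ () _)
  ext x
  rcases x with x | j
  · rfl
  · simp only [Function.comp, Sum.elim_inr]
    cases c j <;> rfl

theorem Df.fixv {R : ∀ i, (Fin n → V i) → V i → Prop}
    (h : Df r P (fun i (w : Fin (n + 1) → V i) => R i (fun j => w j.castSucc) (w (Fin.last n))))
    (i : ι) (v : Fin n → V i) : Dfb (r i) (fun w : Fin 1 → V i => R i v (w 0)) :=
  ((h.at i).fix (m := 1) (Fin.lastCases (.inr 0) fun j => .inl (v j))).congr fun _ w => by simp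

theorem DFn.fixv {F : ∀ i, (Fin n → V i) → V i → V i}
    (h : DFn r P (fun i (w : Fin (n + 1) → V i) => F i (fun j => w j.castSucc) (w (Fin.last n))))
    (i : ι) (v : Fin n → V i) :
    DFn (ι := Unit) (V := fun _ => V i) (fun _ => r i) (fun _ => True)
      (fun _ (w : Fin 1 → V i) => F i v (w 0)) :=
  ⟨((h.out.at i).fix (m := 2) (Fin.lastCases (.inr 1) (Fin.lastCases (.inr 0) fun j => .inl (v j)))).congr
    fun _ w => by simp⟩

theorem DFn.fixv₂ {F : ∀ i, (Fin n → V i) → V i → V i → V i}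
    (h : DFn r P (fun i (w : Fin (n + 1 + 1) → V i) => F i (fun j => w j.castSucc.castSucc)
      (w (Fin.last n).castSucc) (w (Fin.last (n + 1)))))
    (i : ι) (v : Fin n → V i) :
    DFn (ι := Unit) (V := fun _ => V i) (fun _ => r i) (fun _ => True)
      (fun _ (w : Fin 2 → V i) => F i v (w 0) (w 1)) :=
  ⟨((h.out.at i).fix (m := 3) (Fin.lastCases (.inr 2)
    (Fin.lastCases (.inr 1) (Fin.lastCases (.inr 0) fun j => .inl (v j))))).congr
      fun _ w => by simp⟩

end Fix

/-- Definable unary predicate (with parameters). -/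
abbrev Dp {V : Type u} (r : V → V → Prop) (Q : V → Prop) : Prop :=
  Df (ι := Unit) (V := fun _ => V) (fun _ => r) (fun _ => True) (fun _ (v : Fin 1 → V) => Q (v 0))

/-- Definable binary predicate (with parameters). -/
abbrev Dp₂ {V : Type u} (r : V → V → Prop) (Q : V → V → Prop) : Prop :=
  Df (ι := Unit) (V := fun _ => V) (fun _ => r) (fun _ => True)
    (fun _ (v : Fin 2 → V) => Q (v 0) (v 1))

/-- Definable unary function (with parameters). -/
abbrev Df₁ {V : Type u} (r : V → V → Prop) (F : V → V) : Prop :=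
  DFn (ι := Unit) (V := fun _ => V) (fun _ => r) (fun _ => True) (fun _ (v : Fin 1 → V) => F (v 0))

/-- Definable binary function (with parameters). -/
abbrev Df₂ {V : Type u} (r : V → V → Prop) (F : V → V → V) : Prop :=
  DFn (ι := Unit) (V := fun _ => V) (fun _ => r) (fun _ => True)
    (fun _ (v : Fin 2 → V) => F (v 0) (v 1))

/-- Well-founded models of `ZF` without power set. -/
class ZFm {V : Type u} (r : V → V → Prop) : Prop where
  wf : WellFounded r
  ext : ∀ {x y : V}, (∀ z, r z x ↔ r z y) → x = y
  pairing : ∀ x y : V, ∃ p, IsUPair r p x y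
  unions : ∀ x : V, ∃ u, ∀ z, r z u ↔ ∃ y, r y x ∧ r z y
  infinity : ∃ o : V, IsOmegaW r o
  sep : ∀ Q : V → Prop, Dp r Q → ∀ a, ∃ b, ∀ x, r x b ↔ (r x a ∧ Q x)
  repl : ∀ Q : V → V → Prop, Dp₂ r Q → ∀ a,
    (∀ x y y', r x a → Q x y → Q x y' → y = y') → ∃ b, ∀ y, r y b ↔ ∃ x, r x a ∧ Q x y

section Sets

variable {V : Type u} (r : V → V → Prop) [hr : ZFm r]

/-- The set of all `x` with `Q x`, if there is one. -/
noncomputable def cset (Q : V → Prop) : V :=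
  haveI : Nonempty V := ⟨hr.infinity.choose⟩
  Classical.epsilon (fun b => ∀ x, r x b ↔ Q x)

variable {r}

theorem mem_cset {Q : V → Prop} (h : ∃ b, ∀ x, r x b ↔ Q x) {x : V} : r x (cset r Q) ↔ Q x :=
  haveI : Nonempty V := ⟨hr.infinity.choose⟩
  Classical.epsilon_spec (p := fun b => ∀ x, r x b ↔ Q x) h x

theorem eq_cset {Q : V → Prop} (h : ∃ b, ∀ x, r x b ↔ Q x) {y : V} :
    y = cset r Q ↔ ∀ x, r x y ↔ Q x :=
  ⟨fun e x => e ▸ mem_cset h, fun e => hr.ext fun z => (e z).trans (mem_cset h).symm⟩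

theorem cset_congr {Q Q' : V → Prop} (h : ∀ x, Q x ↔ Q' x) : cset r Q = cset r Q' := by
  rw [show Q = Q' from funext fun x => propext (h x)]

theorem ZFm.not_self (x : V) : ¬ r x x := fun h => hr.wf.asymmetric x x h h

variable (r)

/-- Subset of `a` given by a predicate. -/
noncomputable def sepS (a : V) (Q : V → Prop) : V := cset r (fun x => r x a ∧ Q x)
/-- Image of `a` under a function. -/
noncomputable def imS (a : V) (F : V → V) : V := cset r (fun y => ∃ x, r x a ∧ y = F x)
/-- Union of a family indexed by `a`. -/
noncomputable def iUn (a : V) (F : V → V) : V := cset r (fun y => ∃ x, r x a ∧ r y (F x))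
/-- Unordered pair. -/
noncomputable def up (x y : V) : V := cset r (fun z => z = x ∨ z = y)
/-- Union of the elements of `x`. -/
noncomputable def sUn (x : V) : V := cset r (fun z => ∃ y, r y x ∧ r z y)
/-- Binary union. -/
noncomputable def un (x y : V) : V := cset r (fun z => r z x ∨ r z y)
/-- `x ∪ {y}`. -/
noncomputable def adj (x y : V) : V := cset r (fun z => r z x ∨ z = y)
/-- Empty set. -/
noncomputable def emp : V := cset r (fun _ => False)
/-- Ordered pair. -/
noncomputable def op (x y : V) : V := up r (up r x x) (up r x y)

variable {r}

theorem exists_up (x y : V) : ∃ b, ∀ z, r z b ↔ (z = x ∨ z = y) := hr.pairing x y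

theorem mem_up {x y z : V} : r z (up r x y) ↔ z = x ∨ z = y := mem_cset (exists_up x y)

theorem mem_sUn {x z : V} : r z (sUn r x) ↔ ∃ y, r y x ∧ r z y := mem_cset (hr.unions x)

theorem exists_un (x y : V) : ∃ b, ∀ z, r z b ↔ (r z x ∨ r z y) :=
  ⟨sUn r (up r x y), fun z => by simp [mem_sUn, mem_up]⟩

theorem mem_un {x y z : V} : r z (un r x y) ↔ r z x ∨ r z y := mem_cset (exists_un x y)

theorem exists_adj (x y : V) : ∃ b, ∀ z, r z b ↔ (r z x ∨ z = y) :=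
  ⟨un r x (up r y y), fun z => by simp [mem_un, mem_up]⟩

theorem mem_adj {x y z : V} : r z (adj r x y) ↔ r z x ∨ z = y := mem_cset (exists_adj x y)

theorem exists_emp : ∃ b : V, ∀ z, r z b ↔ False := by
  obtain ⟨b, hb⟩ := hr.sep (fun x => ¬ x = x) inferInstance hr.infinity.choose
  exact ⟨b, fun z => by simp [hb]⟩

theorem mem_emp {z : V} : ¬ r z (emp r) := fun h => (mem_cset exists_emp).1 h

theorem eq_emp {x : V} : x = emp r ↔ ∀ z, ¬ r z x :=
  (eq_cset exists_emp).trans (by simp)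

theorem isOPair_op (x y : V) : IsOPair r (op r x y) x y :=
  ⟨up r x x, up r x y, fun _ => mem_up, fun _ => mem_up, fun _ => mem_up⟩

theorem isUPair_iff {p x y : V} : IsUPair r p x y ↔ p = up r x y := (eq_cset (exists_up x y)).symm

theorem isOPair_iff {p x y : V} : IsOPair r p x y ↔ p = op r x y := by
  simp [IsOPair, isUPair_iff, op]

theorem up_inj {a b c : V} (h : up r a b = up r a c) : b = c := by
  have h1 : r b (up r a c) := h ▸ mem_up.2 (.inr rfl)
  have h2 : r c (up r a b) := h ▸ mem_up.2 (.inr rfl)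
  rw [mem_up (r := r)] at h1 h2
  grind

theorem op_inj {a b c d : V} : op r a b = op r c d ↔ a = c ∧ b = d := by
  refine ⟨fun h => ?_, fun h => by rw [h.1, h.2]⟩
  have e : a = c := by
    have h1 : r (up r a a) (op r c d) := h ▸ mem_up.2 (.inl rfl)
    have h2 : r c (up r a a) := by
      rcases mem_up.1 h1 with h1 | h1 <;> rw [h1] <;> exact mem_up.2 (.inl rfl)
    rcases mem_up.1 h2 with h2 | h2 <;> exact h2.symm
  subst e
  exact ⟨rfl, up_inj (up_inj h)⟩

theorem fApp_iff {f x y : V} : FApp r f x y ↔ r (op r x y) f := by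
  simp [FApp, isOPair_iff]

theorem relIn_iff {f x y : V} : RelIn r f x y ↔ r (op r x y) f := by
  simp [RelIn, isOPair_iff]

theorem mem_sepS {a : V} {Q : V → Prop} [h : Dp r Q] {x : V} :
    r x (sepS r a Q) ↔ r x a ∧ Q x := mem_cset (hr.sep Q h a)

theorem exists_imS (a : V) (F : V → V) [h : Df₁ r F] : ∃ b, ∀ y, r y b ↔ ∃ x, r x a ∧ y = F x :=
  hr.repl (fun x y => y = F x) h.out a (fun _ _ _ _ h h' => h.trans h'.symm)

theorem mem_imS {a : V} {F : V → V} [Df₁ r F] {y : V} :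
    r y (imS r a F) ↔ ∃ x, r x a ∧ y = F x := mem_cset (exists_imS a F)

theorem exists_iUn (a : V) (F : V → V) [h : Df₁ r F] : ∃ b, ∀ y, r y b ↔ ∃ x, r x a ∧ r y (F x) :=
  ⟨sUn r (imS r a F), fun y => by
    rw [mem_sUn (r := r)]
    constructor
    · rintro ⟨z, hz, h⟩
      obtain ⟨x, hx, rfl⟩ := mem_imS.1 hz
      exact ⟨x, hx, h⟩
    · rintro ⟨x, hx, h⟩
      exact ⟨_, mem_imS.2 ⟨x, hx, rfl⟩, h⟩⟩

theorem mem_iUn {a : V} {F : V → V} [Df₁ r F] {y : V} :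
    r y (iUn r a F) ↔ ∃ x, r x a ∧ r y (F x) := mem_cset (exists_iUn a F)

end Sets

section SetFns

variable {ι : Type w} {V : ι → Type u} {r : ∀ i, V i → V i → Prop} {P : (∀ i, V i) → Prop} {n : ℕ}
  [hr : ∀ i, ZFm (r i)]

theorem DFn.cset {R : ∀ i, (Fin n → V i) → V i → Prop}
    [h : Df r P (fun i (w : Fin (n + 1) → V i) => R i (fun j => w j.castSucc) (w (Fin.last n)))]
    (ex : ∀ i v, ∃ b, ∀ x, r i x b ↔ R i v x) : DFn r P (fun i v => cset (r i) (R i v)) := by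
  have h2 : Df r P (fun i (w : Fin (n + 1 + 1) → V i) =>
      R i (fun j => w j.castSucc.castSucc) (w (Fin.last (n + 1)))) :=
    (h.rename (m := n + 2) (Fin.lastCases (Fin.last (n+1)) (fun j => j.castSucc.castSucc))).congr
      fun i v => by simp
  exact DFn.of (R := fun i v y => ∀ x, r i x y ↔ R i v x) fun i v y => eq_cset (ex i v)

instance DFn.sepS {a : ∀ i, (Fin n → V i) → V i} {Q : ∀ i, (Fin n → V i) → V i → Prop}
    [ha : DFn r P a]
    [h : Df r P (fun i (w : Fin (n + 1) → V i) => Q i (fun j => w j.castSucc) (w (Fin.last n)))] :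
    DFn r P (fun i v => sepS (r i) (a i v) (Q i v)) := by
  haveI := ha.lift
  exact DFn.cset (R := fun i v x => r i x (a i v) ∧ Q i v x) fun i v =>
    (hr i).sep _ (h.fixv i v) _

instance DFn.imS {a : ∀ i, (Fin n → V i) → V i} {F : ∀ i, (Fin n → V i) → V i → V i}
    [ha : DFn r P a]
    [h : DFn r P (fun i (w : Fin (n + 1) → V i) => F i (fun j => w j.castSucc) (w (Fin.last n)))] :
    DFn r P (fun i v => imS (r i) (a i v) (F i v)) := by
  haveI := ha.lift
  haveI := ha.lift.lift
  have h2 : Df r P (fun i (w : Fin (n + 1 + 1) → V i) =>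
      w (Fin.last n).castSucc = F i (fun j => w j.castSucc.castSucc) (w (Fin.last (n + 1)))) :=
    (h.out.rename (m := n + 2) (Fin.lastCases (Fin.last n).castSucc (Fin.lastCases (Fin.last (n+1))
      (fun j => j.castSucc.castSucc)))).congr fun i v => by simp
  exact DFn.cset (R := fun i v y => ∃ x, r i x (a i v) ∧ y = F i v x) fun i v =>
    haveI := h.fixv i v
    exists_imS _ _

instance DFn.iUn {a : ∀ i, (Fin n → V i) → V i} {F : ∀ i, (Fin n → V i) → V i → V i}
    [ha : DFn r P a]
    [h : DFn r P (fun i (w : Fin (n + 1) → V i) => F i (fun j => w j.castSucc) (w (Fin.last n)))] :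
    DFn r P (fun i v => iUn (r i) (a i v) (F i v)) := by
  haveI := ha.lift
  haveI := ha.lift.lift
  have h2 : Df r P (fun i (w : Fin (n + 1 + 1) → V i) =>
      r i (w (Fin.last n).castSucc) (F i (fun j => w j.castSucc.castSucc) (w (Fin.last (n + 1))))) := by
    have h3 : DFn r P (fun i (w : Fin (n + 1 + 1) → V i) =>
      F i (fun j => w j.castSucc.castSucc) (w (Fin.last (n + 1)))) :=
      ⟨(h.out.rename (m := n + 3) (Fin.lastCases (Fin.last (n+2)) (Fin.lastCases (Fin.last (n+1)).castSucc
        (fun j => j.castSucc.castSucc.castSucc)))).congr fun i v => by simp⟩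
    infer_instance
  exact DFn.cset (R := fun i v y => ∃ x, r i x (a i v) ∧ r i y (F i v x)) fun i v =>
    haveI := h.fixv i v
    exists_iUn _ _

variable (f g k : ∀ i, (Fin n → V i) → V i) [DFn r P f] [DFn r P g] [DFn r P k]

instance : DFn r P (fun i v => up (r i) (f i v) (g i v)) :=
  DFn.comp2 (F := fun i => up (r i))
    (DFn.cset (R := fun i v z => z = v 0 ∨ z = v 1) fun i v => exists_up _ _) f g
instance : DFn r P (fun i v => sUn (r i) (f i v)) :=
  DFn.comp1 (F := fun i => sUn (r i))
    (DFn.cset (R := fun i v z => ∃ y, r i y (v 0) ∧ r i z y) fun i v => (hr i).unions _) f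
instance : DFn r P (fun i v => un (r i) (f i v) (g i v)) :=
  DFn.comp2 (F := fun i => un (r i))
    (DFn.cset (R := fun i v z => r i z (v 0) ∨ r i z (v 1)) fun i v => exists_un _ _) f g
instance : DFn r P (fun i v => adj (r i) (f i v) (g i v)) :=
  DFn.comp2 (F := fun i => adj (r i))
    (DFn.cset (R := fun i v z => r i z (v 0) ∨ z = (v 1)) fun i v => exists_adj _ _) f g
instance : DFn r P (fun i (_ : Fin n → V i) => emp (r i)) :=
  DFn.of (R := fun i _ y => ∀ z, ¬ r i z y) fun i v y => eq_emp
instance : DFn r P (fun i v => op (r i) (f i v) (g i v)) :=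
  DFn.comp2 (F := fun i => op (r i)) (by unfold op; infer_instance) f g

end SetFns

section CompVec

variable {ι : Type w} {V : ι → Type u} {r : ∀ i, V i → V i → Prop} {P : (∀ i, V i) → Prop} {n : ℕ}

theorem Df.compv_aux (k : ℕ) {R : ∀ i, (Fin n → V i) → Prop} (h : Df r P R) :
    ∀ {m : ℕ} (t : Fin n → ∀ i, (Fin m → V i) → V i), (∀ j, DFn r P (t j)) →
      (∀ j : Fin n, k ≤ j → ∃ l, t j = fun i v => v l) →
      Df r P (fun i v => R i (fun j => t j i v)) := by
  induction k with
  | zero =>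
    intro m t _ hk
    choose l hl using fun j => hk j (Nat.zero_le _)
    exact (h.rename l).congr fun i v => by simp [hl]
  | succ k ih =>
    intro m t ht hk
    by_cases hkn : k < n
    · let j₀ : Fin n := ⟨k, hkn⟩
      haveI := ht j₀
      let t' : Fin n → ∀ i, (Fin (m + 1) → V i) → V i := fun j =>
        if j = j₀ then fun i w => w (Fin.last m) else fun i w => t j i (fun l => w l.castSucc)
      have key := ih t' (fun j => by
        by_cases hj : j = j₀
        · simp only [t', hj, if_true]; infer_instance
        · simp only [t', hj, if_false]; exact (ht j).lift) (fun j hj => by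
        by_cases hj' : j = j₀
        · exact ⟨Fin.last m, by simp [t', hj']⟩
        · obtain ⟨l, hl⟩ := hk j (by
            have : (j : ℕ) ≠ k := fun e => hj' (Fin.ext e)
            omega)
          exact ⟨l.castSucc, by simp [t', hj', hl]⟩)
      refine (Df.subst (f := t j₀) (R := fun i v y => R i (fun j => if j = j₀ then y else t j i v))
        (key.congr fun i w => ?_)).congr fun i v => ?_
      · refine iff_of_eq (congrArg _ (funext fun j => ?_))
        by_cases hj : j = j₀ <;> simp [t', hj]
      · refine iff_of_eq (congrArg _ (funext fun j => ?_))
        by_cases hj : j = j₀ <;> simp [hj]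
    · exact ih t ht fun j hj => absurd j.2 (by omega)

theorem Df.compv {m : ℕ} {R : ∀ i, (Fin n → V i) → Prop} (h : Df r P R)
    (t : Fin n → ∀ i, (Fin m → V i) → V i) (ht : ∀ j, DFn r P (t j)) :
    Df r P (fun i v => R i (fun j => t j i v)) :=
  Df.compv_aux n h t ht fun j hj => absurd j.2 (by omega)

theorem DFn.compv {m : ℕ} {f : ∀ i, (Fin n → V i) → V i} (h : DFn r P f)
    (t : Fin n → ∀ i, (Fin m → V i) → V i) (ht : ∀ j, DFn r P (t j)) :
    DFn r P (fun i v => f i (fun j => t j i v)) :=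
  ⟨(h.out.compv (m := m + 1) (Fin.lastCases (fun i w => w (Fin.last m))
      fun j i w => t j i fun l => w l.castSucc) (Fin.lastCases (by simpa using DFn.var _)
      fun j => by simpa using (ht j).lift)).congr fun i v => by simp⟩

theorem DFn.comp_ctx₁ {G : ∀ i, (Fin n → V i) → V i → V i}
    (h : DFn r P (fun i (w : Fin (n + 1) → V i) => G i (fun j => w j.castSucc) (w (Fin.last n))))
    {m : ℕ} (ρ : Fin n → Fin m) (a : ∀ i, (Fin m → V i) → V i) [DFn r P a] :
    DFn r P (fun i w => G i (fun j => w (ρ j)) (a i w)) := by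
  have := h.compv (m := m) (Fin.lastCases a fun j i w => w (ρ j)) (Fin.lastCases (by simpa)
    fun j => by simpa using DFn.var _)
  simpa using this

theorem DFn.comp_ctx₂ {G : ∀ i, (Fin n → V i) → V i → V i → V i}
    (h : DFn r P (fun i (w : Fin (n + 1 + 1) → V i) => G i (fun j => w j.castSucc.castSucc)
      (w (Fin.last n).castSucc) (w (Fin.last (n + 1)))))
    {m : ℕ} (ρ : Fin n → Fin m) (a b : ∀ i, (Fin m → V i) → V i) [DFn r P a] [DFn r P b] :
    DFn r P (fun i w => G i (fun j => w (ρ j)) (a i w) (b i w)) := by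
  have := h.compv (m := m) (Fin.lastCases b (Fin.lastCases a fun j i w => w (ρ j)))
    (Fin.lastCases (by simpa) (Fin.lastCases (by simpa) fun j => by simpa using DFn.var _))
  simpa using this

end CompVec

section Rec

variable {V : Type u} (r : V → V → Prop) [hr : ZFm r]

theorem exists_tc (x : V) : ∃ t, TCW r t x := by
  induction x using hr.wf.induction with
  | _ x ih =>
  have huniq : ∀ y t t', TCW r t y → TCW r t' y → t = t' := fun y t t' h h' =>
    hr.ext fun z => ⟨fun hz => h.2.2 _ h'.1 h'.2.1 z hz, fun hz => h'.2.2 _ h.1 h.2.1 z hz⟩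
  obtain ⟨S, hS⟩ := hr.repl (fun y t => TCW r t y) inferInstance x
    (fun y t t' _ h h' => huniq y t t' h h')
  refine ⟨un r x (sUn r S), fun z hz => mem_un.2 (.inl hz), fun z y hz hy => ?_, fun s hs hs' z hz => ?_⟩
  · rcases mem_un.1 hz with hz | hz
    · obtain ⟨t, ht⟩ := ih z hz
      exact mem_un.2 (.inr (mem_sUn.2 ⟨t, (hS t).2 ⟨z, hz, ht⟩, ht.1 y hy⟩))
    · obtain ⟨t, ht, hzt⟩ := mem_sUn.1 hz
      obtain ⟨y', hy', ht'⟩ := (hS t).1 ht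
      exact mem_un.2 (.inr (mem_sUn.2 ⟨t, ht, ht'.2.1 z y hzt hy⟩))
  · rcases mem_un.1 hz with hz | hz
    · exact hs z hz
    · obtain ⟨t, ht, hzt⟩ := mem_sUn.1 hz
      obtain ⟨y', hy', ht'⟩ := (hS t).1 ht
      exact ht'.2.2 s (fun a ha => hs' y' a (hs y' hy') ha) hs' z hzt

/-- Transitive closure. -/
noncomputable def tc (x : V) : V := (exists_tc r x).choose

variable {r}

theorem tcw_tc (x : V) : TCW r (tc r x) x := (exists_tc r x).choose_spec

theorem TCW.eq {t x : V} (h : TCW r t x) : t = tc r x :=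
  hr.ext fun z => ⟨fun hz => h.2.2 _ (tcw_tc x).1 (tcw_tc x).2.1 z hz,
    fun hz => (tcw_tc x).2.2 _ h.1 h.2.1 z hz⟩

theorem eq_tc_iff {t x : V} : t = tc r x ↔ TCW r t x :=
  ⟨fun h => h ▸ tcw_tc x, TCW.eq⟩

theorem mem_tc_of_mem {x y : V} (h : r y x) : r y (tc r x) := (tcw_tc x).1 y h

theorem trans_tc (x : V) : TransW r (tc r x) := (tcw_tc x).2.1

theorem tc_subset {x s : V} (h : SubW r x s) (hs : TransW r s) : SubW r (tc r x) s :=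
  (tcw_tc x).2.2 s h hs

theorem tc_mono {x y : V} (h : r y (tc r x)) : SubW r (tc r y) (tc r x) :=
  tc_subset (fun z hz => trans_tc x y z h hz) (trans_tc x)

theorem tc_eq_self {x : V} (h : TransW r x) : tc r x = x :=
  hr.ext fun z => ⟨tc_subset (fun _ h => h) h z, mem_tc_of_mem⟩

theorem mem_tc_iff {x z : V} : r z (tc r x) ↔ r z x ∨ ∃ y, r y x ∧ r z (tc r y) := by
  constructor
  · refine fun hz => Classical.not_not.1 fun hn => ?_
    have := (tcw_tc (r := r) x).2.2 (sepS r (tc r x) (fun z => r z x ∨ ∃ y, r y x ∧ ∃ t, TCW r t y ∧ r z t))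
      (fun a ha => mem_sepS.2 ⟨mem_tc_of_mem ha, .inl ha⟩)
      (fun a b ha hb => by
        rw [mem_sepS (r := r)] at ha ⊢
        refine ⟨trans_tc x a b ha.1 hb, .inr ?_⟩
        rcases ha.2 with h | ⟨y, hy, t, ht, hat⟩
        · exact ⟨a, h, _, tcw_tc a, mem_tc_of_mem hb⟩
        · exact ⟨y, hy, t, ht, ht.2.1 a b hat hb⟩) z hz
    rcases (mem_sepS.1 this).2 with h | ⟨y, hy, t, ht, hzt⟩
    · exact hn (.inl h)
    · exact hn (.inr ⟨y, hy, ht.eq ▸ hzt⟩)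
  · rintro (h | ⟨y, hy, h⟩)
    · exact mem_tc_of_mem h
    · exact tc_mono (mem_tc_of_mem hy) z h

theorem transGen_of_mem_tc {x y : V} (h : r y (tc r x)) : Relation.TransGen r y x := by
  induction x using hr.wf.induction with
  | _ x ih =>
  rcases mem_tc_iff.1 h with h | ⟨z, hz, h⟩
  · exact .single h
  · exact (ih z hz h).tail hz

theorem wf_tc : WellFounded (fun y x => r y (tc r x)) :=
  Subrelation.wf (fun h => transGen_of_mem_tc h) hr.wf.transGen

variable (r)

/-- The function `F` restricted to the set `a`. -/
noncomputable def lamS (a : V) (F : V → V) : V := imS r a (fun x => op r x (F x))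

/-- The restriction of a set function `s` to `a`. -/
noncomputable def resS (s a : V) : V := sepS r s (fun z => ∃ y w, r y a ∧ z = op r y w)

/-- Recursion on transitive closures. -/
noncomputable def recF (G : V → V → V) : V → V :=
  wf_tc.fix (C := fun _ => V) (fun x ih =>
    G x (cset r (fun z => ∃ y, ∃ h : r y (tc r x), z = op r y (ih y h))))

/-- `s` is the restriction to `tc x` of the function defined from `G` by recursion. -/
def Att (G : V → V → V) (x s : V) : Prop :=
  (∀ z, r z s → ∃ y, r y (tc r x) ∧ z = op r y (G y (resS r s (tc r y)))) ∧
  ∀ y, r y (tc r x) → r (op r y (G y (resS r s (tc r y)))) s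

variable {r}

theorem mem_resS {s a z : V} : r z (resS r s a) ↔ r z s ∧ ∃ y w, r y a ∧ z = op r y w :=
  mem_sepS

theorem recF_eq (G : V → V → V) (x : V) :
    recF r G x = G x (lamS r (tc r x) (recF r G)) := by
  rw [recF, WellFounded.fix_eq]
  refine congrArg (G x) (cset_congr fun z => ?_)
  simp only [exists_prop]

theorem att_iff {G : V → V → V} {x s : V} :
    Att r G x s ↔ ∀ z, r z s ↔ ∃ y, r y (tc r x) ∧ z = op r y (recF r G y) := by
  have aux : ∀ y s, (∀ z, (∃ y' w, r y' (tc r y) ∧ z = op r y' w) → (r z s ↔ ∃ y', r y' (tc r y) ∧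
      z = op r y' (recF r G y'))) → resS r s (tc r y) = lamS r (tc r y) (recF r G) := by
    intro y s h
    have key : ∀ z, r z (resS r s (tc r y)) ↔
        ∃ y', r y' (tc r y) ∧ z = op r y' (recF r G y') := by
      intro z
      rw [mem_resS (r := r)]
      constructor
      · rintro ⟨h1, h2⟩
        exact (h z h2).1 h1
      · rintro ⟨y', h1, h2⟩
        exact ⟨(h z ⟨y', _, h1, h2⟩).2 ⟨y', h1, h2⟩, y', _, h1, h2⟩
    exact (eq_cset ⟨_, key⟩).2 key
  constructor
  · rintro ⟨h1, h2⟩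
    have key : ∀ y, r y (tc r x) → G y (resS r s (tc r y)) = recF r G y := by
      intro y
      induction y using wf_tc (r := r).induction with
      | _ y ih =>
      intro hy
      rw [recF_eq, aux y s]
      rintro z ⟨y', w, hy', rfl⟩
      constructor
      · intro hz
        obtain ⟨y'', h3, h4⟩ := h1 _ hz
        obtain ⟨rfl, rfl⟩ := op_inj.1 h4
        exact ⟨y', hy', by rw [ih y' hy' h3]⟩
      · rintro ⟨y'', h3, h4⟩
        obtain ⟨rfl, rfl⟩ := op_inj.1 h4
        have := h2 y' (tc_mono hy _ hy')
        rwa [ih y' hy' (tc_mono hy _ hy')] at this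
    intro z
    constructor
    · intro hz
      obtain ⟨y, hy, h⟩ := h1 z hz
      exact ⟨y, hy, key y hy ▸ h⟩
    · rintro ⟨y, hy, rfl⟩
      exact key y hy ▸ h2 y hy
  · intro h
    have key : ∀ y, r y (tc r x) → G y (resS r s (tc r y)) = recF r G y := by
      intro y hy
      rw [recF_eq, aux y s]
      rintro z ⟨y', w, hy', rfl⟩
      rw [h]
      constructor
      · rintro ⟨y'', h3, h4⟩
        obtain ⟨rfl, rfl⟩ := op_inj.1 h4
        exact ⟨y', hy', rfl⟩
      · rintro ⟨y'', h3, h4⟩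
        exact ⟨y'', tc_mono hy _ h3, h4⟩
    refine ⟨fun z hz => ?_, fun y hy => ?_⟩
    · obtain ⟨y, hy, h'⟩ := (h z).1 hz
      exact ⟨y, hy, (key y hy).symm ▸ h'⟩
    · exact (h _).2 ⟨y, hy, by rw [key y hy]⟩

theorem Att.eq {G : V → V → V} {x s : V} (h : Att r G x s) :
    s = lamS r (tc r x) (recF r G) :=
  (eq_cset ⟨s, att_iff.1 h⟩).2 (att_iff.1 h)

theorem att_recF (G : V → V → V) [hG : Df₂ r G] (hA : Dp₂ r (Att r G)) (x : V) :
    Att r G x (lamS r (tc r x) (recF r G)) := by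
  suffices h : ∃ s, Att r G x s by
    obtain ⟨s, hs⟩ := h
    rwa [← hs.eq]
  induction x using wf_tc (r := r).induction with
  | _ x ih =>
  have hi : Dp₂ r (fun y z => ∃ s, Att r G y s ∧ z = op r y (G y s)) := by
    haveI h1 : Df (ι := Unit) (V := fun _ => V) (fun _ => r) (fun _ => True)
        (fun _ (v : Fin 3 → V) => Att r G (v 0) (v 2)) :=
      Df.comp2 (Q := fun _ => Att r G) hA (fun _ v => v 0) (fun _ v => v 2)
    haveI h2 : DFn (ι := Unit) (V := fun _ => V) (fun _ => r) (fun _ => True)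
        (fun _ (v : Fin 3 → V) => G (v 0) (v 2)) :=
      DFn.comp2 (F := fun _ => G) hG (fun _ v => v 0) (fun _ v => v 2)
    have h3 : Df (ι := Unit) (V := fun _ => V) (fun _ => r) (fun _ => True)
        (fun _ (v : Fin 3 → V) => Att r G (v 0) (v 2) ∧ v 1 = op r (v 0) (G (v 0) (v 2))) :=
      inferInstance
    exact h3.ex'.congr fun _ v => Iff.rfl
  obtain ⟨b, hb⟩ := hr.repl (fun y z => ∃ s, Att r G y s ∧ z = op r y (G y s)) hi
    (tc r x) (by
      rintro y z z' _ ⟨s, hs, rfl⟩ ⟨s', hs', rfl⟩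
      rw [hs.eq, hs'.eq])
  refine ⟨b, att_iff.2 fun z => (hb z).trans ⟨?_, ?_⟩⟩
  · rintro ⟨y, hy, s, hs, rfl⟩
    exact ⟨y, hy, by rw [recF_eq, hs.eq]⟩
  · rintro ⟨y, hy, rfl⟩
    obtain ⟨s, hs⟩ := ih y hy
    exact ⟨y, hy, s, hs, by rw [recF_eq, hs.eq]⟩

end Rec

section RecFns

variable {ι : Type w} {V : ι → Type u} {r : ∀ i, V i → V i → Prop} {P : (∀ i, V i) → Prop} {n : ℕ}
  [hr : ∀ i, ZFm (r i)]

instance (f : ∀ i, (Fin n → V i) → V i) [DFn r P f] : DFn r P (fun i v => tc (r i) (f i v)) :=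
  DFn.comp1 (F := fun i => tc (r i)) (DFn.of (R := fun i v y => TCW (r i) y (v 0))
    fun i v y => eq_tc_iff) f

instance (f g : ∀ i, (Fin n → V i) → V i) [DFn r P f] [DFn r P g] :
    DFn r P (fun i v => resS (r i) (f i v) (g i v)) :=
  DFn.comp2 (F := fun i => resS (r i)) (by unfold resS; infer_instance) f g

theorem Df.att {G : ∀ i, (Fin n → V i) → V i → V i → V i}
    (h : DFn r P (fun i (w : Fin (n + 1 + 1) → V i) => G i (fun j => w j.castSucc.castSucc)
      (w (Fin.last n).castSucc) (w (Fin.last (n + 1))))) :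
    Df r P (fun i (w : Fin (n + 1 + 1) → V i) => Att (r i) (G i (fun j => w j.castSucc.castSucc))
      (w (Fin.last n).castSucc) (w (Fin.last (n + 1)))) := by
  unfold Att
  have h1 : DFn r P (fun i (w : Fin (n + 1 + 1 + 1) → V i) =>
      G i (fun j => w j.castSucc.castSucc.castSucc) (w (Fin.last (n + 1 + 1)))
        (resS (r i) (w (Fin.last (n + 1)).castSucc) (tc (r i) (w (Fin.last (n + 1 + 1)))))) :=
    DFn.comp_ctx₂ h (m := n + 3) (fun j => j.castSucc.castSucc.castSucc) _ _
  have h2 : DFn r P (fun i (w : Fin (n + 1 + 1 + 1 + 1) → V i) =>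
      G i (fun j => w j.castSucc.castSucc.castSucc.castSucc) (w (Fin.last (n + 1 + 1 + 1)))
        (resS (r i) (w (Fin.last (n + 1)).castSucc.castSucc) (tc (r i) (w (Fin.last (n + 1 + 1 + 1)))))) :=
    DFn.comp_ctx₂ h (m := n + 4) (fun j => j.castSucc.castSucc.castSucc.castSucc) _ _
  infer_instance

theorem att_lam_recF {V : Type u} {r : V → V → Prop} [hr : ZFm r] (G : V → V → V)
    [hG : Df₂ r G] (x : V) : Att r G x (lamS r (tc r x) (recF r G)) := by
  refine att_recF G ?_ x
  exact Df.att (n := 0) (r := fun _ : Unit => r) (G := fun _ _ => G) (h := hG)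

instance DFn.recF {G : ∀ i, (Fin n → V i) → V i → V i → V i} {x : ∀ i, (Fin n → V i) → V i}
    [h : DFn r P (fun i (w : Fin (n + 1 + 1) → V i) => G i (fun j => w j.castSucc.castSucc)
      (w (Fin.last n).castSucc) (w (Fin.last (n + 1))))] [hx : DFn r P x] :
    DFn r P (fun i v => VLC.recF (r i) (G i v) (x i v)) := by
  have hA := Df.att h
  haveI hh : DFn r P (fun i (w : Fin (n + 1) → V i) =>
      VLC.recF (r i) (G i (fun j => w j.castSucc)) (w (Fin.last n))) := by
    have h1 : Df r P (fun i (w : Fin (n + 1 + 1 + 1) → V i) =>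
        Att (r i) (G i (fun j => w j.castSucc.castSucc.castSucc)) (w (Fin.last n).castSucc.castSucc)
          (w (Fin.last (n + 1 + 1)))) :=
      (hA.rename (m := n + 3) (Fin.lastCases (Fin.last (n + 2)) (Fin.lastCases
        (Fin.last n).castSucc.castSucc fun j => j.castSucc.castSucc.castSucc))).congr
          fun i v => by simp
    have h2 : DFn r P (fun i (w : Fin (n + 1 + 1 + 1) → V i) =>
        G i (fun j => w j.castSucc.castSucc.castSucc) (w (Fin.last n).castSucc.castSucc)
          (w (Fin.last (n + 1 + 1)))) :=
      DFn.comp_ctx₂ h (m := n + 3) (fun j => j.castSucc.castSucc.castSucc) _ _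
    refine DFn.of (R := fun i w y => ∃ s, Att (r i) (G i (fun j => w j.castSucc)) (w (Fin.last n)) s ∧
      y = G i (fun j => w j.castSucc) (w (Fin.last n)) s) fun i v y => ?_
    haveI := h.fixv₂ i (fun j => v j.castSucc)
    rw [recF_eq]
    constructor
    · rintro rfl
      exact ⟨_, att_lam_recF _ _, rfl⟩
    · rintro ⟨s, hs, rfl⟩
      rw [hs.eq]
  exact DFn.comp_ctx₁ (G := fun i v x => VLC.recF (r i) (G i v) x) hh (fun j => j) x

end RecFns

section Ord

variable {V : Type u} {r : V → V → Prop} [hr : ZFm r]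

theorem OrdW.mem {α β : V} (h : OrdW r α) (hb : r β α) : OrdW r β :=
  ⟨h.2 β hb, fun x hx => h.2 x (h.1 β x hb hx)⟩

theorem OrdW.trans {α β γ : V} (h : OrdW r α) (hb : r β α) (hc : r γ β) : r γ α := h.1 β γ hb hc

theorem OrdW.trich {α β : V} (ha : OrdW r α) (hb : OrdW r β) : r α β ∨ α = β ∨ r β α := by
  induction α using hr.wf.induction generalizing β with
  | _ α iha =>
  induction β using hr.wf.induction with
  | _ β ihb =>
  by_contra hn
  push Not at hn
  refine hn.2.1 (hr.ext fun z => ⟨fun hz => ?_, fun hz => ?_⟩)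
  · rcases iha z hz (ha.mem hz) hb with h | h | h
    · exact h
    · exact absurd (h ▸ hz) hn.2.2
    · exact absurd (ha.trans hz h) hn.2.2
  · rcases ihb z hz (hb.mem hz) with h | h | h
    · exact absurd (hb.trans hz h) hn.1
    · exact absurd (h ▸ hz) hn.1
    · exact h

theorem OrdW.sub_iff {α β : V} (ha : OrdW r α) (hb : OrdW r β) :
    SubW r α β ↔ r α β ∨ α = β := by
  constructor
  · intro h
    rcases ha.trich hb with h1 | h1 | h1
    · exact .inl h1
    · exact .inr h1
    · exact absurd (h β h1) (ZFm.not_self β)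
  · rintro (h | rfl)
    · exact fun z hz => hb.trans h hz
    · exact fun z hz => hz

theorem OrdW.not_mem {α β : V} (ha : OrdW r α) (hb : OrdW r β) (h : ¬ r α β) : SubW r β α :=
  (hb.sub_iff ha).2 (by rcases ha.trich hb with h1 | h1 | h1 <;> [exact absurd h1 h; exact .inr h1.symm; exact .inl h1])

/-- Successor. -/
noncomputable def succ (r : V → V → Prop) [ZFm r] (x : V) : V := adj r x x

theorem mem_succ {x z : V} : r z (succ r x) ↔ r z x ∨ z = x := mem_adj

theorem self_mem_succ (x : V) : r x (succ r x) := mem_succ.2 (.inr rfl)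

theorem OrdW.succ {α : V} (h : OrdW r α) : OrdW r (VLC.succ r α) := by
  refine ⟨fun x y hx hy => mem_succ.2 ?_, fun x hx => ?_⟩
  · rcases mem_succ.1 hx with hx | rfl
    · exact .inl (h.trans hx hy)
    · exact .inl hy
  · rcases mem_succ.1 hx with hx | rfl
    · exact h.2 x hx
    · exact h.1

theorem OrdW.sUn {x : V} (h : ∀ y, r y x → OrdW r y) : OrdW r (VLC.sUn r x) := by
  refine ⟨fun a b ha hb => ?_, fun a ha => ?_⟩
  · obtain ⟨y, hy, ha⟩ := mem_sUn.1 ha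
    exact mem_sUn.2 ⟨y, hy, (h y hy).trans ha hb⟩
  · obtain ⟨y, hy, ha⟩ := mem_sUn.1 ha
    exact (h y hy).2 a ha

theorem ordW_emp : OrdW r (emp r) :=
  ⟨fun _ _ h => absurd h mem_emp, fun _ h => absurd h mem_emp⟩

theorem OrdW.tc {α : V} (h : OrdW r α) : VLC.tc r α = α := tc_eq_self h.1

/-- A set of ordinals is bounded. -/
theorem exists_ord_bound {x : V} (h : ∀ y, r y x → OrdW r y) : ∃ α, OrdW r α ∧ ∀ y, r y x → r y α := by
  refine ⟨VLC.succ r (VLC.sUn r x), (OrdW.sUn h).succ, fun y hy => mem_succ.2 ?_⟩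
  exact ((h y hy).sub_iff (OrdW.sUn h)).1 fun z hz => mem_sUn.2 ⟨y, hy, hz⟩

theorem OrdW.le_trans {α β γ : V} (h : OrdW r γ) (h1 : r α β ∨ α = β) (h2 : r β γ) : r α γ := by
  rcases h1 with h1 | rfl
  · exact h.trans h2 h1
  · exact h2

/-- Least ordinal. -/
theorem exists_least {Q : V → Prop} (h : ∃ α, OrdW r α ∧ Q α) :
    ∃ α, OrdW r α ∧ Q α ∧ ∀ β, r β α → ¬ Q β := by
  obtain ⟨α, ⟨h1, h2⟩, h3⟩ := hr.wf.has_min {α | OrdW r α ∧ Q α} h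
  exact ⟨α, h1, h2, fun β hb hq => h3 β ⟨h1.mem hb, hq⟩ hb⟩

theorem succ_mem_of_limit {o : V} (h : LimitOrdW r o) {x : V} (hx : r x o) : r (succ r x) o := by
  obtain ⟨y, hy, hxy⟩ := h.2.2 x hx
  have := ((h.1.mem hx).succ.sub_iff (h.1.mem hy)).1 fun z hz => by
    rcases mem_succ.1 hz with hz | rfl
    · exact (h.1.mem hy).trans hxy hz
    · exact hxy
  exact h.1.le_trans this hy

theorem emp_mem {α : V} (h : OrdW r α) (hne : ∃ x, r x α) : r (emp r) α := by
  rcases ordW_emp.trich h with h | rfl | h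
  · exact h
  · obtain ⟨x, hx⟩ := hne
    exact absurd hx mem_emp
  · exact absurd h mem_emp

theorem ord_cases {α : V} (h : OrdW r α) : α = emp r ∨ (∃ β, r β α ∧ α = succ r β) ∨ LimitOrdW r α := by
  by_cases h1 : α = emp r
  · exact .inl h1
  by_cases h2 : LimitOrdW r α
  · exact .inr (.inr h2)
  refine .inr (.inl ?_)
  have hne : ∃ x, r x α := by
    by_contra hn
    push Not at hn
    exact h1 (eq_emp.2 hn)
  have : ∃ x, r x α ∧ ∀ y, r y α → ¬ r x y := by
    by_contra hn
    push Not at hn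
    exact h2 ⟨h, hne, hn⟩
  obtain ⟨β, hb, hmax⟩ := this
  refine ⟨β, hb, hr.ext fun z => ⟨fun hz => ?_, fun hz => ?_⟩⟩
  · rcases (h.mem hz).trich (h.mem hb) with h3 | h3 | h3
    · exact mem_succ.2 (.inl h3)
    · exact mem_succ.2 (.inr h3)
    · exact absurd h3 (hmax z hz)
  · rcases mem_succ.1 hz with hz | rfl
    · exact h.trans hb hz
    · exact hb

theorem isOmegaW_unique {a b : V} (ha : IsOmegaW r a) (hb : IsOmegaW r b) : a = b := by
  rcases ha.1.1.trich hb.1.1 with h | h | h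
  · exact absurd ha.1 (hb.2 a h)
  · exact h
  · exact absurd hb.1 (ha.2 b h)

variable (r)

/-- The ordinal `ω`. -/
noncomputable def om : V := hr.infinity.choose

variable {r}

theorem isOmegaW_om : IsOmegaW r (om r) := hr.infinity.choose_spec

theorem eq_om_iff {x : V} : x = om r ↔ IsOmegaW r x :=
  ⟨fun h => h ▸ isOmegaW_om, fun h => isOmegaW_unique h isOmegaW_om⟩

theorem ordW_om : OrdW r (om r) := isOmegaW_om.1.1

variable (r)

/-- The finite ordinals. -/
noncomputable def nat : ℕ → V
  | 0 => emp r
  | n + 1 => succ r (nat n)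

variable {r}

theorem nat_mem_om (n : ℕ) : r (nat r n) (om r) := by
  induction n with
  | zero => exact emp_mem ordW_om isOmegaW_om.1.2.1
  | succ n ih => exact succ_mem_of_limit isOmegaW_om.1 ih

theorem mem_om {x : V} : r x (om r) ↔ ∃ n, x = nat r n := by
  constructor
  · intro h
    induction x using hr.wf.induction with
    | _ x ih =>
    rcases ord_cases (ordW_om.mem h) with rfl | ⟨β, hb, rfl⟩ | h1
    · exact ⟨0, rfl⟩
    · obtain ⟨n, rfl⟩ := ih β hb (ordW_om.trans h hb)
      exact ⟨n + 1, rfl⟩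
    · exact absurd h1 (isOmegaW_om.2 x h)
  · rintro ⟨n, rfl⟩
    exact nat_mem_om n

theorem ordW_nat (n : ℕ) : OrdW r (nat r n) := ordW_om.mem (nat_mem_om n)

theorem mem_nat {n : ℕ} {x : V} : r x (nat r n) ↔ ∃ k < n, x = nat r k := by
  induction n with
  | zero => simp [nat, mem_emp]
  | succ n ih =>
    rw [nat, mem_succ (r := r), ih]
    constructor
    · rintro (⟨k, hk, rfl⟩ | rfl)
      · exact ⟨k, by omega, rfl⟩
      · exact ⟨n, by omega, rfl⟩
    · rintro ⟨k, hk, rfl⟩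
      rcases Nat.lt_succ_iff_lt_or_eq.1 hk with h | rfl
      · exact .inl ⟨k, h, rfl⟩
      · exact .inr rfl

theorem nat_mem_nat {k n : ℕ} : r (nat r k) (nat r n) ↔ k < n := by
  refine ⟨fun h => ?_, fun h => mem_nat.2 ⟨k, h, rfl⟩⟩
  by_contra hn
  have h2 : r (nat r k) (nat r k) := by
    rcases (not_lt.1 hn).lt_or_eq with h3 | rfl
    · exact (ordW_nat k).trans (mem_nat.2 ⟨n, h3, rfl⟩) h
    · exact h
  exact ZFm.not_self _ h2

theorem nat_inj {k n : ℕ} (h : nat r k = nat r n) : k = n := by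
  by_contra hn
  rcases lt_or_gt_of_ne hn with h1 | h1
  · exact ZFm.not_self (r := r) (nat r k) (by conv => rhs; rw [h]
                                              exact nat_mem_nat.2 h1)
  · exact ZFm.not_self (r := r) (nat r n) (by conv => rhs; rw [← h]
                                              exact nat_mem_nat.2 h1)

/-- Function application. -/
noncomputable def app (r : V → V → Prop) [ZFm r] (f x : V) : V :=
  sUn r (sepS r (sUn r (sUn r f)) (fun y => r (op r x y) f))

theorem app_eq {f x y : V} (h : r (op r x y) f) (hu : ∀ y', r (op r x y') f → y' = y) :
    app r f x = y := by
  refine hr.ext fun z => ?_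
  rw [app, mem_sUn (r := r)]
  constructor
  · rintro ⟨y', hy', hz⟩
    rw [← hu y' (mem_sepS.1 hy').2]; exact hz
  · intro hz
    refine ⟨y, mem_sepS.2 ⟨mem_sUn.2 ⟨up r x y, mem_sUn.2 ⟨_, h, ?_⟩, ?_⟩, h⟩, hz⟩
    · exact mem_up.2 (.inr rfl)
    · exact mem_up.2 (.inr rfl)

theorem mem_lamS {a z : V} {F : V → V} [Df₁ r F] :
    r z (lamS r a F) ↔ ∃ x, r x a ∧ z = op r x (F x) := by
  unfold lamS; exact mem_imS

theorem op_mem_lamS {a x y : V} {F : V → V} [Df₁ r F] :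
    r (op r x y) (lamS r a F) ↔ r x a ∧ y = F x := by
  rw [mem_lamS (r := r)]
  constructor
  · rintro ⟨x', hx, h⟩
    obtain ⟨rfl, rfl⟩ := op_inj.1 h
    exact ⟨hx, rfl⟩
  · rintro ⟨hx, rfl⟩
    exact ⟨x, hx, rfl⟩

theorem app_lamS {a x : V} {F : V → V} [Df₁ r F] (hx : r x a) : app r (lamS r a F) x = F x :=
  app_eq (op_mem_lamS.2 ⟨hx, rfl⟩) fun _ h => (op_mem_lamS.1 h).2

theorem isFunOn_lamS (a : V) (F : V → V) [Df₁ r F] : IsFunOn r (lamS r a F) a := by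
  refine ⟨fun z hz => ?_, fun x hx => ?_, fun x y y' h h' => ?_⟩
  · obtain ⟨x, hx, rfl⟩ := mem_lamS.1 hz
    exact ⟨x, _, hx, isOPair_op _ _⟩
  · exact ⟨F x, fApp_iff.2 (op_mem_lamS.2 ⟨hx, rfl⟩)⟩
  · rw [fApp_iff (r := r), op_mem_lamS (r := r)] at h h'
    rw [h.2, h'.2]

theorem fApp_lamS {a x y : V} {F : V → V} [Df₁ r F] : FApp r (lamS r a F) x y ↔ r x a ∧ y = F x := by
  rw [fApp_iff (r := r), op_mem_lamS (r := r)]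

theorem IsFunOn.fApp_app {f a x : V} (h : IsFunOn r f a) (hx : r x a) : FApp r f x (app r f x) := by
  obtain ⟨y, hy⟩ := h.2.1 x hx
  rw [app_eq (fApp_iff.1 hy) fun y' h' => h.2.2 x _ _ (fApp_iff.2 h') hy]
  exact hy

theorem IsFunOn.fApp_iff {f a x y : V} (h : IsFunOn r f a) : FApp r f x y ↔ r x a ∧ y = app r f x := by
  constructor
  · intro h1
    have hx : r x a := by
      obtain ⟨z, hz, hp⟩ := h1
      obtain ⟨x', y', hx', hp'⟩ := h.1 z hz
      rw [isOPair_iff (r := r)] at hp hp'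
      obtain ⟨rfl, rfl⟩ := op_inj.1 (hp.symm.trans hp')
      exact hx'
    exact ⟨hx, h.2.2 x _ _ h1 (h.fApp_app hx)⟩
  · rintro ⟨hx, rfl⟩
    exact h.fApp_app hx

/-- Cartesian product. -/
noncomputable def prd (r : V → V → Prop) [ZFm r] (a b : V) : V :=
  iUn r a (fun x => imS r b (fun y => op r x y))

theorem mem_prd {a b z : V} : r z (prd r a b) ↔ ∃ x y, r x a ∧ r y b ∧ z = op r x y := by
  rw [prd, mem_iUn (r := r)]
  simp only [mem_imS]
  exact ⟨fun ⟨x, hx, y, hy, h⟩ => ⟨x, y, hx, hy, h⟩, fun ⟨x, y, hx, hy, h⟩ => ⟨x, hx, y, hy, h⟩⟩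

end Ord

section Fns
variable {ι : Type w} {V : ι → Type u} {r : ∀ i, V i → V i → Prop} {P : (∀ i, V i) → Prop} {n : ℕ}
  [hr : ∀ i, ZFm (r i)] (f g : ∀ i, (Fin n → V i) → V i) [DFn r P f] [DFn r P g]

instance : DFn r P (fun i v => succ (r i) (f i v)) := by unfold succ; infer_instance
instance : DFn r P (fun i (v : Fin n → V i) => om (r i)) :=
  DFn.of (R := fun i v y => IsOmegaW (r i) y) fun i v y => eq_om_iff
instance : DFn r P (fun i v => app (r i) (f i v) (g i v)) :=
  DFn.comp2 (F := fun i => app (r i)) (by unfold app; infer_instance) f g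
instance : DFn r P (fun i v => prd (r i) (f i v) (g i v)) :=
  DFn.comp2 (F := fun i => prd (r i)) (by unfold prd; infer_instance) f g

end Fns

section FinSets

variable {V : Type u} {r : V → V → Prop} [hr : ZFm r]

/-- The set whose elements are listed by `l`. -/
noncomputable def lset (r : V → V → Prop) [ZFm r] (l : List V) : V := l.foldr (fun x p => adj r p x) (emp r)

theorem mem_lset {l : List V} {x : V} : r x (lset r l) ↔ x ∈ l := by
  induction l with
  | nil => simp [lset, mem_emp]
  | cons y l ih =>
    rw [lset, List.foldr_cons, mem_adj (r := r), ← lset, ih, List.mem_cons, or_comm]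

/-- The recursion step for the finite subsets. -/
noncomputable def finStep (r : V → V → Prop) [ZFm r] (a n s : V) : V :=
  adj r (iUn r n (fun k => iUn r (app r s k) (fun p => imS r a (fun x => adj r p x)))) (emp r)

/-- The set of finite subsets of `a`. -/
noncomputable def fin (r : V → V → Prop) [ZFm r] (a : V) : V :=
  iUn r (om r) (recF r (finStep r a))

instance {ι : Type w} {V : ι → Type u} {r : ∀ i, V i → V i → Prop} {P : (∀ i, V i) → Prop} {n : ℕ}
    [hr : ∀ i, ZFm (r i)] (f g h : ∀ i, (Fin n → V i) → V i) [DFn r P f] [DFn r P g] [DFn r P h] :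
    DFn r P (fun i v => finStep (r i) (f i v) (g i v) (h i v)) :=
  DFn.comp3 (F := fun i => finStep (r i)) (by unfold finStep; infer_instance) f g h

instance {ι : Type w} {V : ι → Type u} {r : ∀ i, V i → V i → Prop} {P : (∀ i, V i) → Prop} {n : ℕ}
    [hr : ∀ i, ZFm (r i)] (f : ∀ i, (Fin n → V i) → V i) [DFn r P f] :
    DFn r P (fun i v => fin (r i) (f i v)) :=
  DFn.comp1 (F := fun i => fin (r i)) (by unfold fin; infer_instance) f

instance DFn.recF_const (G : V → V → V) [h : Df₂ r G] {n : ℕ} (x : Unit → (Fin n → V) → V)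
    [DFn (ι := Unit) (V := fun _ => V) (fun _ => r) (fun _ => True) x] :
    DFn (ι := Unit) (V := fun _ => V) (fun _ => r) (fun _ => True)
      (fun i v => VLC.recF r G (x i v)) :=
  DFn.comp1 (F := fun _ => VLC.recF r G) (by
    haveI : DFn (ι := Unit) (V := fun _ => V) (fun _ => r) (fun _ => True)
        (fun _ (v : Fin 3 → V) => G (v 1) (v 2)) :=
      DFn.comp2 (F := fun _ => G) h (fun _ v => v 1) (fun _ v => v 2)
    exact DFn.recF (ι := Unit) (V := fun _ => V) (r := fun _ => r) (G := fun _ _ => G) (n := 1)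
      (x := fun _ v => v 0) (h := this)) x

theorem recF_nat (G : V → V → V) [Df₂ r G] {n : ℕ} {k : ℕ} (h : k < n) :
    app r (lamS r (tc r (nat r n)) (recF r G)) (nat r k) = recF r G (nat r k) :=
  app_lamS (by rw [(ordW_nat n).tc]; exact nat_mem_nat.2 h)

theorem mem_finStep_nat {a : V} {n : ℕ} {p : V} : r p (recF r (finStep r a) (nat r n)) ↔
    p = emp r ∨ ∃ k < n, ∃ q x, r q (recF r (finStep r a) (nat r k)) ∧ r x a ∧ p = adj r q x := by
  rw [recF_eq, finStep, mem_adj (r := r), mem_iUn (r := r), or_comm]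
  refine or_congr Iff.rfl ?_
  simp only [mem_iUn, mem_imS, mem_nat]
  constructor
  · rintro ⟨_, ⟨k, hk, rfl⟩, q, hq, x, hx, rfl⟩
    rw [recF_nat _ hk] at hq
    exact ⟨k, hk, q, x, hq, hx, rfl⟩
  · rintro ⟨k, hk, q, x, hq, hx, rfl⟩
    refine ⟨_, ⟨k, hk, rfl⟩, q, ?_, x, hx, rfl⟩
    rwa [recF_nat _ hk]

theorem mem_fin {a p : V} : r p (fin r a) ↔ ∃ l : List V, (∀ x ∈ l, r x a) ∧ p = lset r l := by
  rw [fin, mem_iUn (r := r)]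
  constructor
  · rintro ⟨_, hn, hp⟩
    obtain ⟨n, rfl⟩ := mem_om.1 hn
    clear hn
    induction n using Nat.strong_induction_on generalizing p with
    | _ n ih =>
    rcases mem_finStep_nat.1 hp with rfl | ⟨k, hk, q, x, hq, hx, rfl⟩
    · exact ⟨[], by simp, rfl⟩
    · obtain ⟨l, hl, rfl⟩ := ih k hk hq
      exact ⟨x :: l, by simp [hx]; exact hl, rfl⟩
  · rintro ⟨l, hl, rfl⟩
    refine ⟨nat r l.length, nat_mem_om _, ?_⟩
    induction l with
    | nil => exact mem_finStep_nat.2 (.inl rfl)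
    | cons x l ih =>
      exact mem_finStep_nat.2 (.inr ⟨l.length, by simp, lset r l, x,
        ih fun y hy => hl y (by simp [hy]), hl x (by simp), rfl⟩)

theorem fin_sub {a p x : V} (hp : r p (fin r a)) (hx : r x p) : r x a := by
  obtain ⟨l, hl, rfl⟩ := mem_fin.1 hp
  exact hl x (mem_lset.1 hx)

end FinSets

section Types

/-- Codes for the types of quantifier rank `n` in `k` variables. -/
def Typ : ℕ → ℕ → Type
  | 0, k => Set (Fin k × Fin k) × Set (Fin k × Fin k)
  | n + 1, k => (Set (Fin k × Fin k) × Set (Fin k × Fin k)) × Set (Typ n (k + 1))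

instance Typ.finite (n k : ℕ) : Finite (Typ n k) := by
  induction n generalizing k with
  | zero => unfold Typ; infer_instance
  | succ n ih => haveI := ih (k + 1); unfold Typ; infer_instance

/-- The atomic type of a tuple. -/
def atp {M : Type u} (r : M → M → Prop) {k : ℕ} (v : Fin k → M) :
    Set (Fin k × Fin k) × Set (Fin k × Fin k) :=
  ({q | r (v q.1) (v q.2)}, {q | v q.1 = v q.2})

/-- The type of quantifier rank `n` of a tuple. -/
def tp {M : Type u} (r : M → M → Prop) : ∀ (n : ℕ) {k : ℕ}, (Fin k → M) → Typ n k
  | 0, _, v => atp r v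
  | n + 1, k, v => (atp r v, {t | ∃ x : M, t = tp r n (Fin.snoc v x : Fin (k + 1) → M)})

variable {M : Type u} {N : Type v} {r : M → M → Prop} {s : N → N → Prop} {k : ℕ}

theorem atp_eq_iff {v : Fin k → M} {w : Fin k → N} : atp r v = atp s w ↔
    ∀ i j, (r (v i) (v j) ↔ s (w i) (w j)) ∧ (v i = v j ↔ w i = w j) := by
  simp only [atp, Prod.mk.injEq, Set.ext_iff, Prod.forall, Set.mem_ofPred_eq]
  exact ⟨fun h i j => ⟨h.1 i j, h.2 i j⟩, fun h => ⟨fun i j => (h i j).1, fun i j => (h i j).2⟩⟩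

theorem tp_succ_iff {n : ℕ} {v : Fin k → M} {w : Fin k → N} :
    tp r (n + 1) v = tp s (n + 1) w ↔ atp r v = atp s w ∧
      (∀ x : M, ∃ y : N, tp r n (Fin.snoc v x : Fin (k + 1) → M) =
        tp s n (Fin.snoc w y : Fin (k + 1) → N)) ∧
      ∀ y : N, ∃ x : M, tp r n (Fin.snoc v x : Fin (k + 1) → M) =
        tp s n (Fin.snoc w y : Fin (k + 1) → N) := by
  refine Prod.ext_iff.trans (and_congr Iff.rfl ?_)
  dsimp only [tp]
  rw [Set.ext_iff]
  constructor
  · intro h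
    exact ⟨fun x => (h _).1 ⟨x, rfl⟩, fun y => let ⟨x, hx⟩ := (h _).2 ⟨y, rfl⟩; ⟨x, hx.symm⟩⟩
  · rintro ⟨h1, h2⟩ t
    constructor
    · rintro ⟨x, rfl⟩; exact h1 x
    · rintro ⟨y, rfl⟩; obtain ⟨x, hx⟩ := h2 y; exact ⟨x, hx.symm⟩

theorem atp_of_tp {n : ℕ} {v : Fin k → M} {w : Fin k → N} (h : tp r n v = tp s n w) :
    atp r v = atp s w := by
  cases n with
  | zero => exact h
  | succ n => exact (tp_succ_iff.1 h).1

theorem tp_of_succ {n : ℕ} {v : Fin k → M} {w : Fin k → N} (h : tp r (n + 1) v = tp s (n + 1) w) :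
    tp r n v = tp s n w := by
  induction n generalizing k with
  | zero => exact (tp_succ_iff.1 h).1
  | succ n ih =>
    obtain ⟨h1, h2, h3⟩ := tp_succ_iff.1 h
    exact tp_succ_iff.2 ⟨h1, fun x => (h2 x).imp fun _ => ih, fun x => (h3 x).imp fun _ => ih⟩

theorem tp_mono {m n : ℕ} (hmn : m ≤ n) {v : Fin k → M} {w : Fin k → N}
    (h : tp r n v = tp s n w) : tp r m v = tp s m w := by
  induction n, hmn using Nat.le_induction with
  | base => exact h
  | succ n _ ih => exact ih (tp_of_succ h)

/-- Tuples of the same type of sufficiently high rank satisfy the same formulas. -/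
theorem exists_rank {α : Type*} {l : ℕ} (φ : L3.BoundedFormula α l) : ∃ n : ℕ,
    ∀ {M : Type u} {N : Type v} {r : M → M → Prop} {s : N → N → Prop} {k : ℕ} (e : α → Fin k)
      (f : Fin l → Fin k) (v : Fin k → M) (w : Fin k → N), tp r n v = tp s n w →
      (@BoundedFormula.Realize L3 M (memStr r) α l φ (fun a => v (e a)) (fun a => v (f a)) ↔
       @BoundedFormula.Realize L3 N (memStr s) α l φ (fun a => w (e a)) (fun a => w (f a))) := by
  have hterm : ∀ {l : ℕ} (t : L3.Term (α ⊕ Fin l)), ∃ a, t = Term.var a := fun t => by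
    cases t with
    | var a => exact ⟨a, rfl⟩
    | func f _ => exact nomatch f
  induction φ with
  | falsum => exact ⟨0, fun e f v w h => Iff.rfl⟩
  | equal t₁ t₂ =>
    obtain ⟨a, rfl⟩ := hterm t₁
    obtain ⟨b, rfl⟩ := hterm t₂
    refine ⟨0, fun {M N r s k} e f v w h => ?_⟩
    have := fun i j => (atp_eq_iff.1 (atp_of_tp h) i j).2
    rcases a with a | a <;> rcases b with b | b <;> exact this _ _
  | @rel l m R ts =>
    refine ⟨0, fun {M N r s k} e f v w h => ?_⟩
    have hR := fun i j => (atp_eq_iff.1 (atp_of_tp h) i j).1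
    cases R with
    | u1 => exact Iff.rfl
    | u2 => exact Iff.rfl
    | mem =>
      obtain ⟨a, ha⟩ := hterm (ts 0)
      obtain ⟨b, hb⟩ := hterm (ts 1)
      letI := memStr r
      letI := memStr s
      change r ((ts 0).realize _) ((ts 1).realize _) ↔ s ((ts 0).realize _) ((ts 1).realize _)
      rw [ha, hb]
      rcases a with a | a <;> rcases b with b | b <;> exact hR _ _
  | imp φ ψ ih1 ih2 =>
    obtain ⟨n, hn⟩ := ih1
    obtain ⟨m, hm⟩ := ih2
    refine ⟨max n m, fun e f v w h => ?_⟩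
    exact imp_congr (hn e f v w (tp_mono (le_max_left _ _) h))
      (hm e f v w (tp_mono (le_max_right _ _) h))
  | @all l φ ih =>
    obtain ⟨n, hn⟩ := ih
    refine ⟨n + 1, fun {M N r s k} e f v w h => ?_⟩
    obtain ⟨-, h2, h3⟩ := tp_succ_iff.1 h
    have key : ∀ x y, tp r n (Fin.snoc v x : Fin (k + 1) → M) =
        tp s n (Fin.snoc w y : Fin (k + 1) → N) →
      (@BoundedFormula.Realize L3 M (memStr r) α _ φ (fun a => v (e a)) (Fin.snoc (fun a => v (f a)) x) ↔
       @BoundedFormula.Realize L3 N (memStr s) α _ φ (fun a => w (e a)) (Fin.snoc (fun a => w (f a)) y)) := by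
      intro x y hxy
      have := hn (fun a => (e a).castSucc) (Fin.snoc (α := fun _ => Fin (k + 1))
        (fun a => (f a).castSucc) (Fin.last k)) _ _ hxy
      simp only [Fin.snoc_castSucc] at this
      have e1 : (fun a => (Fin.snoc v x : Fin (k + 1) → M) ((Fin.snoc (α := fun _ => Fin (k + 1))
        (fun a => (f a).castSucc) (Fin.last k) : Fin (l + 1) → Fin (k + 1)) a)) =
          (Fin.snoc (fun a => v (f a)) x : Fin (l + 1) → M) := by
        funext a
        refine Fin.lastCases ?_ (fun a => ?_) a <;> simp
      have e2 : (fun a => (Fin.snoc w y : Fin (k + 1) → N) ((Fin.snoc (α := fun _ => Fin (k + 1))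
        (fun a => (f a).castSucc) (Fin.last k) : Fin (l + 1) → Fin (k + 1)) a)) =
          (Fin.snoc (fun a => w (f a)) y : Fin (l + 1) → N) := by
        funext a
        refine Fin.lastCases ?_ (fun a => ?_) a <;> simp
      rw [e1, e2] at this
      exact this
    constructor
    · intro hx y
      obtain ⟨x, hxy⟩ := h3 y
      exact (key x y hxy).1 (hx x)
    · intro hy x
      obtain ⟨y, hxy⟩ := h2 x
      exact (key x y hxy).2 (hy y)

theorem mstr_eq_memStr {V : Type u} (dom : V → Prop) (r : V → V → Prop) :
    mstr dom r (fun _ => False) (fun _ => False) = memStr (fun a b : {x // dom x} => r a.1 b.1) := by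
  refine Structure.ext ?_ ?_
  · funext n f; exact nomatch f
  · funext n R; cases R <;> rfl

end Types

section Internal

variable {V : Type u} {r : V → V → Prop} [hr : ZFm r]

/-- `p` is a partial isomorphism. -/
def PIso (r : V → V → Prop) [ZFm r] (p : V) : Prop := ∀ x y z w, r (op r x y) p → r (op r z w) p →
  (r x z ↔ r y w) ∧ (x = z ↔ y = w)

/-- Recursion step for the back-and-forth systems. -/
noncomputable def efStep (r : V → V → Prop) [ZFm r] (h N n s : V) : V :=
  sepS r (fin r (prd r h N)) (fun p => PIso r p ∧ ∀ k, r k n →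
    (∀ x, r x h → ∃ y, r y N ∧ r (adj r p (op r x y)) (app r s k)) ∧
    ∀ y, r y N → ∃ x, r x h ∧ r (adj r p (op r x y)) (app r s k))

/-- Finite partial maps from `h` to `N` which are `n`-equivalences. -/
noncomputable def ef (r : V → V → Prop) [ZFm r] (h N n : V) : V := recF r (efStep r h N) n

/-- The subset of `m` defined by a type of rank `n` over `s`, where `t` is a finite set of
realizations. -/
noncomputable def dsub (r : V → V → Prop) [ZFm r] (m n s t : V) : V :=
  sepS r m (fun x => ∃ y, r y t ∧ r (adj r (imS r s (fun z => op r z z)) (op r x y)) (ef r m m n))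

end Internal

section Comp
variable {ι : Type w} {V : ι → Type u} {r : ∀ i, V i → V i → Prop} {P : (∀ i, V i) → Prop} {n : ℕ}

theorem DFn.comp4 {F : ∀ i, V i → V i → V i → V i → V i}
    (h : DFn r P (fun i (v : Fin 4 → V i) => F i (v 0) (v 1) (v 2) (v 3)))
    (f g k l : ∀ i, (Fin n → V i) → V i) [hf : DFn r P f] [hg : DFn r P g] [hk : DFn r P k]
    [hl : DFn r P l] : DFn r P (fun i v => F i (f i v) (g i v) (k i v) (l i v)) :=
  DFn.compv h ![f, g, k, l] (by intro j; fin_cases j <;> assumption)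

end Comp

section Fns
variable {ι : Type w} {V : ι → Type u} {r : ∀ i, V i → V i → Prop} {P : (∀ i, V i) → Prop} {n : ℕ}
  [hr : ∀ i, ZFm (r i)] (f g h k : ∀ i, (Fin n → V i) → V i) [DFn r P f] [DFn r P g] [DFn r P h]
  [DFn r P k]

instance : Df r P (fun i v => PIso (r i) (f i v)) :=
  Df.comp1 (Q := fun i => PIso (r i)) (by unfold PIso; infer_instance) f
instance : DFn r P (fun i v => efStep (r i) (f i v) (g i v) (h i v) (k i v)) :=
  DFn.comp4 (F := fun i => efStep (r i)) (by unfold efStep; infer_instance) f g h k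
instance : DFn r P (fun i v => ef (r i) (f i v) (g i v) (h i v)) :=
  DFn.comp3 (F := fun i => ef (r i)) (by unfold ef; infer_instance) f g h
instance : DFn r P (fun i v => dsub (r i) (f i v) (g i v) (h i v) (k i v)) :=
  DFn.comp4 (F := fun i => dsub (r i)) (by unfold dsub; infer_instance) f g h k
end Fns

section FiniteConj
variable {ι : Type w} {V : ι → Type u} {r : ∀ i, V i → V i → Prop} {P : (∀ i, V i) → Prop} {n : ℕ}

theorem Df.prop (p : Prop) : Df r P (fun i (_ : Fin n → V i) => p) := by
  have h : Df r P (fun i (_ : Fin n → V i) => ∀ y : V i, y = y) := inferInstance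
  by_cases hp : p
  · exact h.congr fun i v => by simp [hp]
  · exact (inferInstance : Df r P (fun i (_ : Fin n → V i) => ¬ ∀ y : V i, y = y)).congr
      fun i v => by simp [hp]

theorem Df.finAll {α : Type*} [Finite α] {R : α → ∀ i, (Fin n → V i) → Prop}
    (h : ∀ a, Df r P (R a)) : Df r P (fun i v => ∀ a, R a i v) := by
  obtain ⟨N, ⟨e⟩⟩ := Finite.exists_equiv_fin α
  have : ∀ k : ℕ, Df r P (fun i v => ∀ a, (e a : ℕ) < k → R a i v) := fun k => by
    induction k with
    | zero => exact (Df.prop True).congr fun i v => by simp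
    | succ k ih =>
      by_cases hk : k < N
      · haveI := h (e.symm ⟨k, hk⟩)
        refine (inferInstance : Df r P (fun i v => (∀ a, (e a : ℕ) < k → R a i v) ∧
          R (e.symm ⟨k, hk⟩) i v)).congr fun i v => ⟨?_, ?_⟩
        · rintro ⟨h1, h2⟩ a ha
          rcases (Nat.lt_succ_iff.1 ha).lt_or_eq with h3 | h3
          · exact h1 a h3
          · obtain rfl : a = e.symm ⟨k, hk⟩ := by rw [Equiv.eq_symm_apply]; exact Fin.ext h3
            exact h2
        · exact fun H => ⟨fun a ha => H a (ha.trans (Nat.lt_succ_self _)), H _ (by simp)⟩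
      · exact ih.congr fun i v => forall_congr' fun a => by
          have := (e a).2
          exact imp_congr_left ⟨fun h => h.trans (Nat.lt_succ_self _), fun _ => by omega⟩
  exact (this N).congr fun i v => ⟨fun H a => H a (e a).2, fun H a _ => H a⟩

theorem Df.tp_eq (m : ℕ) {k : ℕ} (τ : Typ m k) :
    Df r P (fun i v => tp (r i) m v = τ) := by
  have hat : ∀ {k : ℕ} (τ : Set (Fin k × Fin k) × Set (Fin k × Fin k)),
      Df r P (fun i v => atp (r i) v = τ) := fun {k} τ => by
    refine Df.congr (R := fun i v => ∀ q : Fin k × Fin k, (r i (v q.1) (v q.2) ↔ q ∈ τ.1) ∧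
      (v q.1 = v q.2 ↔ q ∈ τ.2)) (Df.finAll fun q => ?_) fun i v => ?_
    · haveI := fun p => Df.prop (V := V) (r := r)
        (P := P) (n := k) p
      infer_instance
    · change _ ↔ atp (r i) v = τ
      rw [Prod.ext_iff, Set.ext_iff, Set.ext_iff, forall_and]
      exact Iff.rfl
  induction m generalizing k with
  | zero => exact hat τ
  | succ m ih =>
    refine Df.congr (R := fun i v => atp (r i) v = τ.1 ∧ ∀ τ' : Typ m (k + 1),
      ((∃ x, tp (r i) m (Fin.snoc v x : Fin (k + 1) → V i) = τ') ↔ τ' ∈ τ.2)) ?_ fun i v => ?_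
    · haveI := hat τ.1
      haveI := Df.finAll (V := V) (r := r) (P := P)
        (R := fun τ' : Typ m (k + 1) => fun i v =>
          ((∃ x, tp (r i) m (Fin.snoc v x : Fin (k + 1) → V i) = τ') ↔ τ' ∈ τ.2)) fun τ' => by
          haveI := Df.prop (V := V) (r := r) (P := P) (n := k) (τ' ∈ τ.2)
          haveI := (ih τ').ex'
          infer_instance
      infer_instance
    · change _ ↔ tp (r i) (m + 1) v = τ
      refine Iff.trans (and_congr Iff.rfl ?_) (Prod.ext_iff (x := tp (r i) (m + 1) v)).symm
      dsimp only [tp]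
      rw [Set.ext_iff]
      exact forall_congr' fun τ' => by
        rw [Set.mem_ofPred_eq]
        exact iff_congr (exists_congr fun _ => eq_comm) Iff.rfl

end FiniteConj

section Correct

variable {V : Type u} {r : V → V → Prop} [hr : ZFm r]

/-- The elements of a set. -/
abbrev Sub (r : V → V → Prop) (m : V) : Type u := {x : V // r x m}

/-- The induced membership relation on the elements of a set. -/
abbrev srel (r : V → V → Prop) (m : V) : Sub r m → Sub r m → Prop := fun a b => r a.1 b.1

theorem mem_ef_nat {h N p : V} {n : ℕ} : r p (ef r h N (nat r n)) ↔
    r p (fin r (prd r h N)) ∧ PIso r p ∧ ∀ k < n,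
    (∀ x, r x h → ∃ y, r y N ∧ r (adj r p (op r x y)) (ef r h N (nat r k))) ∧
    ∀ y, r y N → ∃ x, r x h ∧ r (adj r p (op r x y)) (ef r h N (nat r k)) := by
  have e : ∀ k < n, app r (lamS r (tc r (nat r n)) (recF r (efStep r h N))) (nat r k) =
      ef r h N (nat r k) := fun k hk => recF_nat (efStep r h N) hk
  rw [ef, recF_eq (r := r), efStep, mem_sepS (r := r)]
  refine and_congr Iff.rfl (and_congr Iff.rfl ?_)
  constructor
  · intro H k hk
    rw [← e k hk]
    exact H _ (nat_mem_nat.2 hk)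
  · rintro H x hk
    obtain ⟨k, hk', rfl⟩ := mem_nat.1 hk
    rw [e k hk']
    exact H k hk'

theorem ef_mono {h N p : V} {n l : ℕ} (hl : l ≤ n) (hp : r p (ef r h N (nat r n))) :
    r p (ef r h N (nat r l)) :=
  let ⟨h1, h2, h3⟩ := mem_ef_nat.1 hp
  mem_ef_nat.2 ⟨h1, h2, fun k hk => h3 k (hk.trans_le hl)⟩

/-- `p` is the finite relation relating `v i` to `w i`. -/
def IsGr (r : V → V → Prop) [ZFm r] (p : V) {k : ℕ} (v w : Fin k → V) : Prop :=
  ∀ z, r z p ↔ ∃ i, z = op r (v i) (w i)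

theorem IsGr.adj {p : V} {k : ℕ} {v w : Fin k → V} (h : IsGr r p v w) (x y : V) :
    IsGr r (adj r p (op r x y)) (Fin.snoc v x : Fin (k + 1) → V) (Fin.snoc w y) := by
  intro z
  rw [mem_adj (r := r), h z]
  constructor
  · rintro (⟨i, rfl⟩ | rfl)
    · exact ⟨i.castSucc, by simp⟩
    · exact ⟨Fin.last k, by simp⟩
  · rintro ⟨i, rfl⟩
    refine Fin.lastCases ?_ (fun i => ?_) i
    · right; simp
    · left; exact ⟨i, by simp⟩

theorem coe_snoc {m : V} {k : ℕ} (v : Fin k → Sub r m) (x : Sub r m) :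
    (fun i => ((Fin.snoc v x : Fin (k + 1) → Sub r m) i).1) =
      (Fin.snoc (fun i => (v i).1) x.1 : Fin (k + 1) → V) := by
  funext i
  refine Fin.lastCases ?_ (fun i => ?_) i <;> simp

theorem isGr_pIso_iff {h N : V} {k : ℕ} {p : V} {v : Fin k → Sub r h} {w : Fin k → Sub r N}
    (hp : IsGr r p (fun i => (v i).1) (fun i => (w i).1)) :
    (r p (fin r (prd r h N)) ∧ PIso r p) ↔ atp (srel r h) v = atp (srel r N) w := by
  have h1 : r p (fin r (prd r h N)) := by
    refine mem_fin.2 ⟨List.ofFn fun i => op r (v i).1 (w i).1, ?_, hr.ext fun z => ?_⟩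
    · intro z hz
      obtain ⟨i, rfl⟩ := (List.mem_ofFn' _ _).1 hz
      exact mem_prd.2 ⟨_, _, (v i).2, (w i).2, rfl⟩
    · rw [hp z, mem_lset (r := r), List.mem_ofFn']
      exact exists_congr fun i => eq_comm
  rw [atp_eq_iff, and_iff_right h1]
  constructor
  · intro H i j
    have := H _ _ _ _ ((hp _).2 ⟨i, rfl⟩) ((hp _).2 ⟨j, rfl⟩)
    exact ⟨this.1, by rw [Subtype.ext_iff, Subtype.ext_iff]; exact this.2⟩
  · intro H x y x' y' hx hy
    obtain ⟨i, hi⟩ := (hp _).1 hx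
    obtain ⟨j, hj⟩ := (hp _).1 hy
    obtain ⟨rfl, rfl⟩ := op_inj.1 hi
    obtain ⟨rfl, rfl⟩ := op_inj.1 hj
    have := H i j
    rw [Subtype.ext_iff, Subtype.ext_iff] at this
    exact this

theorem mem_ef_iff {h N : V} {n k : ℕ} {p : V} {v : Fin k → Sub r h} {w : Fin k → Sub r N}
    (hp : IsGr r p (fun i => (v i).1) (fun i => (w i).1)) :
    r p (ef r h N (nat r n)) ↔ tp (srel r h) n v = tp (srel r N) n w := by
  induction n generalizing k p with
  | zero =>
    refine mem_ef_nat.trans (Iff.trans ?_ (isGr_pIso_iff hp))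
    simp
  | succ n ih =>
    have step : ∀ (x : Sub r h) (y : Sub r N), r (adj r p (op r x.1 y.1)) (ef r h N (nat r n)) ↔
        tp (srel r h) n (Fin.snoc v x : Fin (k + 1) → Sub r h) =
        tp (srel r N) n (Fin.snoc w y : Fin (k + 1) → Sub r N) := fun x y => by
      refine ih ?_
      rw [coe_snoc, coe_snoc]
      exact hp.adj x.1 y.1
    rw [tp_succ_iff, mem_ef_nat (r := r), ← and_assoc, isGr_pIso_iff hp]
    refine and_congr Iff.rfl ?_
    constructor
    · intro H
      obtain ⟨h1, h2⟩ := H n (Nat.lt_succ_self n)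
      exact ⟨fun x => let ⟨y, hy, h⟩ := h1 x.1 x.2; ⟨⟨y, hy⟩, (step x ⟨y, hy⟩).1 h⟩,
        fun y => let ⟨x, hx, h⟩ := h2 y.1 y.2; ⟨⟨x, hx⟩, (step ⟨x, hx⟩ y).1 h⟩⟩
    · rintro ⟨h1, h2⟩ l hl
      have hl' : l ≤ n := Nat.lt_succ_iff.1 hl
      exact ⟨fun x hx => let ⟨y, h⟩ := h1 ⟨x, hx⟩; ⟨y.1, y.2, ef_mono hl' ((step ⟨x, hx⟩ y).2 h)⟩,
        fun y hy => let ⟨x, h⟩ := h2 ⟨y, hy⟩; ⟨x.1, x.2, ef_mono hl' ((step x ⟨y, hy⟩).2 h)⟩⟩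

/-- `s` is the set of the entries of `v`. -/
def IsRg (r : V → V → Prop) (s : V) {k : ℕ} (v : Fin k → V) : Prop := ∀ z, r z s ↔ ∃ i, z = v i

theorem exists_isRg {m : V} {k : ℕ} (v : Fin k → Sub r m) :
    ∃ s, r s (fin r m) ∧ IsRg r s (fun i => (v i).1) := by
  refine ⟨_, mem_fin.2 ⟨List.ofFn fun i => (v i).1, ?_, rfl⟩, fun z => ?_⟩
  · intro z hz
    obtain ⟨i, rfl⟩ := (List.mem_ofFn' _ _).1 hz
    exact (v i).2
  · rw [mem_lset (r := r), List.mem_ofFn']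
    exact exists_congr fun i => eq_comm

theorem exists_isRg_of_mem {m s : V} (hs : r s (fin r m)) :
    ∃ (k : ℕ) (v : Fin k → Sub r m), IsRg r s (fun i => (v i).1) := by
  obtain ⟨l, hl, rfl⟩ := mem_fin.1 hs
  refine ⟨l.length, fun i => ⟨l.get i, hl _ (List.get_mem l i)⟩, fun z => ?_⟩
  rw [mem_lset (r := r), List.mem_iff_get]
  exact exists_congr fun i => eq_comm

theorem mem_dsub {m s t x : V} {n k : ℕ} {v : Fin k → Sub r m}
    (hs : IsRg r s (fun i => (v i).1)) (ht : SubW r t m) : r x (dsub r m (nat r n) s t) ↔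
      ∃ (hx : r x m) (y : Sub r m), r y.1 t ∧
        tp (srel r m) n (Fin.snoc v y : Fin (k + 1) → Sub r m) =
        tp (srel r m) n (Fin.snoc v ⟨x, hx⟩ : Fin (k + 1) → Sub r m) := by
  have hg : IsGr r (imS r s (fun z => op r z z)) (fun i => (v i).1) (fun i => (v i).1) := by
    intro z
    rw [mem_imS (r := r)]
    constructor
    · rintro ⟨y, hy, rfl⟩
      obtain ⟨i, rfl⟩ := (hs y).1 hy
      exact ⟨i, rfl⟩
    · rintro ⟨i, rfl⟩
      exact ⟨_, (hs _).2 ⟨i, rfl⟩, rfl⟩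
  have step : ∀ x y : Sub r m, r (adj r (imS r s (fun z => op r z z)) (op r x.1 y.1))
      (ef r m m (nat r n)) ↔ tp (srel r m) n (Fin.snoc v x : Fin (k + 1) → Sub r m) =
        tp (srel r m) n (Fin.snoc v y : Fin (k + 1) → Sub r m) := fun x y => by
    refine mem_ef_iff ?_
    rw [coe_snoc, coe_snoc]
    exact hg.adj x.1 y.1
  rw [dsub, mem_sepS (r := r)]
  constructor
  · rintro ⟨hx, y, hy, h⟩
    exact ⟨hx, ⟨y, ht y hy⟩, hy, ((step ⟨x, hx⟩ ⟨y, ht y hy⟩).1 h).symm⟩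
  · rintro ⟨hx, y, hy, h⟩
    exact ⟨hx, y.1, hy, (step ⟨x, hx⟩ y).2 h.symm⟩

theorem dsub_sub {m n s t : V} : SubW r (dsub r m n s t) m := fun _ hx => (mem_sepS.1 hx).1

/-- Sets invariant under types over finitely many parameters are of the form `dsub`. -/
theorem exists_dsub {m : V} {n k : ℕ} {v : Fin k → Sub r m} {Q : Sub r m → Prop}
    (hQ : ∀ x y : Sub r m, tp (srel r m) n (Fin.snoc v x : Fin (k + 1) → Sub r m) =
        tp (srel r m) n (Fin.snoc v y : Fin (k + 1) → Sub r m) → Q x → Q y) :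
    ∃ s t, r s (fin r m) ∧ r t (fin r m) ∧
      ∀ x, r x (dsub r m (nat r n) s t) ↔ ∃ hx : r x m, Q ⟨x, hx⟩ := by
  obtain ⟨s, hs, hs'⟩ := exists_isRg v
  let T := {τ : Typ n (k + 1) // ∃ y : Sub r m, Q y ∧
    τ = tp (srel r m) n (Fin.snoc v y : Fin (k + 1) → Sub r m)}
  haveI : Finite T := inferInstance
  choose f hf hf' using fun τ : T => τ.2
  obtain ⟨N, ⟨e⟩⟩ := Finite.exists_equiv_fin T
  obtain ⟨t, ht, ht'⟩ := exists_isRg (fun i => f (e.symm i))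
  refine ⟨s, t, hs, ht, fun x => ?_⟩
  rw [mem_dsub hs' (fun z hz => fin_sub ht hz)]
  refine exists_congr fun hx => ⟨?_, fun h => ?_⟩
  · rintro ⟨y, hy, h⟩
    obtain ⟨i, hi⟩ := (ht' _).1 hy
    obtain rfl : y = f (e.symm i) := Subtype.ext hi
    exact hQ _ _ h (hf _)
  · refine ⟨f ⟨_, ⟨x, hx⟩, h, rfl⟩, (ht' _).2 ⟨e ⟨_, ⟨x, hx⟩, h, rfl⟩, by simp⟩, (hf' ⟨_, ⟨x, hx⟩, h, rfl⟩).symm⟩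

/-- Definable subsets are of the form `dsub`. -/
theorem exists_dsub_of_dfb {m : V} {Q : Sub r m → Prop} (h : Dp (srel r m) Q) :
    ∃ n s t, r s (fin r m) ∧ r t (fin r m) ∧
      ∀ x, r x (dsub r m (nat r n) s t) ↔ ∃ hx : r x m, Q ⟨x, hx⟩ := by
  by_cases hne : Nonempty (Sub r m)
  · obtain ⟨N, φ, prm, hφ⟩ := Dfb.exists_realizeIn h
    obtain ⟨n, hn⟩ := exists_rank.{u, u} φ
    refine ⟨n, exists_dsub (v := prm) fun x y hxy hx => ?_⟩
    have := hn (fun a => a.castSucc) (fun _ => Fin.last N) _ _ hxy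
    simp only [Fin.snoc_castSucc, Fin.snoc_last] at this
    exact (hφ fun _ => y).1 (this.1 ((hφ fun _ => x).2 hx))
  · refine ⟨0, exists_dsub (k := 0) (v := Fin.elim0) fun x => absurd ⟨x⟩ hne⟩

/-- Sets of the form `dsub` are definable. -/
theorem dfb_dsub {m s t : V} {n : ℕ} (hs : r s (fin r m)) (ht : r t (fin r m)) :
    Dp (srel r m) (fun x => r x.1 (dsub r m (nat r n) s t)) := by
  obtain ⟨k, v, hv⟩ := exists_isRg_of_mem hs
  have : Dp (srel r m) (fun x => ∀ τ : Typ n (k + 1), (∃ y : Sub r m, r y.1 t ∧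
        tp (srel r m) n (Fin.snoc v y : Fin (k + 1) → Sub r m) = τ) →
      ¬ tp (srel r m) n (Fin.snoc v x : Fin (k + 1) → Sub r m) = τ) :=
    Df.finAll fun τ => by
      haveI := Df.prop (ι := Unit) (V := fun _ => Sub r m) (r := fun _ => srel r m)
        (P := fun _ => True) (n := 1) (∃ y : Sub r m, r y.1 t ∧
        tp (srel r m) n (Fin.snoc v y : Fin (k + 1) → Sub r m) = τ)
      haveI : Dp (srel r m) (fun x => tp (srel r m) n
          (Fin.snoc v x : Fin (k + 1) → Sub r m) = τ) :=
        ((Df.tp_eq n τ).compv (Fin.lastCases (fun _ w => w 0) fun j _ _ => v j)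
          (Fin.lastCases (by simpa using DFn.var _) fun j => by
            simpa using DFn.const _ _)).congr fun _ w => by
          refine Eq.congr_left (congrArg _ (funext fun j => ?_))
          refine Fin.lastCases ?_ (fun j => ?_) j <;> simp
      infer_instance
  refine (Df.not (hR := this)).congr fun _ x => ?_
  dsimp only
  rw [mem_dsub hv fun z hz => fin_sub ht hz]
  constructor
  · intro h
    push Not at h
    obtain ⟨τ, ⟨y, hy, rfl⟩, h2⟩ := h
    exact ⟨(x 0).2, y, hy, h2.symm⟩
  · rintro ⟨hx, y, hy, h⟩ H
    exact H _ ⟨y, hy, rfl⟩ h.symm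

end Correct

section Ops

variable {V : Type u} (r : V → V → Prop) [hr : ZFm r]

/-- First projection. -/
noncomputable def fst (z : V) : V :=
  sepS r (sUn r (sUn r z)) (fun w => ∃ x y, z = op r x y ∧ r w x)

/-- Second projection. -/
noncomputable def snd (z : V) : V :=
  sepS r (sUn r (sUn r z)) (fun w => ∃ x y, z = op r x y ∧ r w y)

/-- The least element of `a` with `Q`, or `a` if there is none (for `a` an ordinal). -/
noncomputable def lstB (a : V) (Q : V → Prop) : V := sepS r a (fun z => ∀ β, r β a → Q β → r z β)

variable {r}

@[simp] theorem fst_op (x y : V) : fst r (op r x y) = x := by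
  refine hr.ext fun z => ?_
  rw [fst, mem_sepS (r := r)]
  constructor
  · rintro ⟨-, x', y', h, hz⟩
    rwa [(op_inj.1 h).1]
  · exact fun hz => ⟨mem_sUn.2 ⟨x, mem_sUn.2 ⟨up r x x, mem_up.2 (.inl rfl),
      mem_up.2 (.inl rfl)⟩, hz⟩, x, y, rfl, hz⟩

@[simp] theorem snd_op (x y : V) : snd r (op r x y) = y := by
  refine hr.ext fun z => ?_
  rw [snd, mem_sepS (r := r)]
  constructor
  · rintro ⟨-, x', y', h, hz⟩
    rwa [(op_inj.1 h).2]
  · exact fun hz => ⟨mem_sUn.2 ⟨y, mem_sUn.2 ⟨up r x y, mem_up.2 (.inr rfl),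
      mem_up.2 (.inr rfl)⟩, hz⟩, x, y, rfl, hz⟩

theorem dp_lstB (a : V) (Q : V → Prop) [hQ : Dp r Q] :
    Dp r (fun z => ∀ β, r β a → Q β → r z β) := by
  haveI : ∀ {n : ℕ} (f : Unit → (Fin n → V) → V)
    [DFn (ι := Unit) (V := fun _ => V) (fun _ => r) (fun _ => True) f],
    Df (ι := Unit) (V := fun _ => V) (fun _ => r) (fun _ => True) (fun i v => Q (f i v)) :=
    fun f _ => Df.comp1 (Q := fun _ => Q) hQ f
  infer_instance

theorem mem_lstB {a : V} {Q : V → Prop} [hQ : Dp r Q] {z : V} :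
    r z (lstB r a Q) ↔ r z a ∧ ∀ β, r β a → Q β → r z β :=
  haveI := dp_lstB (r := r) a Q
  mem_sepS

theorem lstB_spec {a : V} (ha : OrdW r a) {Q : V → Prop} [Dp r Q] (h : ∃ β, r β a ∧ Q β) :
    r (lstB r a Q) a ∧ Q (lstB r a Q) ∧ ∀ β, r β a → Q β → ¬ r β (lstB r a Q) := by
  obtain ⟨β, h1, ⟨h2, h3⟩, h4⟩ := exists_least (r := r) (Q := fun β => r β a ∧ Q β)
    (let ⟨β, h1, h2⟩ := h; ⟨β, ha.mem h1, h1, h2⟩)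
  have : lstB r a Q = β := by
    refine hr.ext fun z => ?_
    rw [mem_lstB (r := r)]
    constructor
    · exact fun hz => hz.2 β h2 h3
    · refine fun hz => ⟨ha.trans h2 hz, fun γ hγ hq => ?_⟩
      rcases h1.trich (ha.mem hγ) with h | rfl | h
      · exact (ha.mem hγ).trans h hz
      · exact hz
      · exact absurd ⟨hγ, hq⟩ (h4 γ h)
  rw [this]
  exact ⟨h2, h3, fun γ hγ hq hm => h4 γ hm ⟨hγ, hq⟩⟩

end Ops

section Fns
variable {ι : Type w} {V : ι → Type u} {r : ∀ i, V i → V i → Prop} {P : (∀ i, V i) → Prop} {n : ℕ}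
  [hr : ∀ i, ZFm (r i)] (f g h k : ∀ i, (Fin n → V i) → V i) [DFn r P f] [DFn r P g] [DFn r P h]
  [DFn r P k]

instance : DFn r P (fun i v => fst (r i) (f i v)) :=
  DFn.comp1 (F := fun i => fst (r i)) (by unfold fst; infer_instance) f
instance : DFn r P (fun i v => snd (r i) (f i v)) :=
  DFn.comp1 (F := fun i => snd (r i)) (by unfold snd; infer_instance) f

instance DFn.lstB {a : ∀ i, (Fin n → V i) → V i} {Q : ∀ i, (Fin n → V i) → V i → Prop}
    [ha : DFn r P a] [h : Df r P (fun i (w : Fin (n + 1) → V i) =>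
      Q i (fun j => w j.castSucc) (w (Fin.last n)))] :
    DFn r P (fun i v => lstB (r i) (a i v) (fun x => Q i v x)) := by
  unfold VLC.lstB
  haveI := ha.lift
  haveI := ha.lift.lift
  haveI : Df r P (fun i (w : Fin (n + 2) → V i) =>
      Q i (fun j => w j.castSucc.castSucc) (w (Fin.last (n + 1)))) :=
    (h.rename (m := n + 2) (Fin.lastCases (Fin.last (n + 1)) fun j => j.castSucc.castSucc)).congr
      fun i v => by simp
  infer_instance

open Classical in
instance DFn.ite {C : ∀ i, (Fin n → V i) → Prop} [hC : Df r P C] :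
    DFn r P (fun i v => if C i v then f i v else g i v) := by
  haveI : Df r P (fun i (w : Fin (n + 1) → V i) => C i (fun j => w j.castSucc)) := hC.rename Fin.castSucc
  haveI := (inferInstance : DFn r P f).lift
  haveI := (inferInstance : DFn r P g).lift
  refine ⟨Df.congr (R := fun i w => (C i (fun j => w j.castSucc) →
    w (Fin.last n) = f i (fun j => w j.castSucc)) ∧ (¬ C i (fun j => w j.castSucc) →
    w (Fin.last n) = g i (fun j => w j.castSucc))) inferInstance fun i w => ?_⟩
  by_cases hc : C i (fun j => w j.castSucc) <;> simp [hc]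
end Fns

/-- A transitive embedding between structures. -/
structure TEmb {V : Type u} {V' : Type v} (r : V → V → Prop) (r' : V' → V' → Prop) where
  /-- The underlying function. -/
  i : V → V'
  inj : Function.Injective i
  mem' : ∀ x y, r' (i x) (i y) ↔ r x y
  trans : ∀ x w, r' w (i x) → ∃ y, r y x ∧ w = i y

namespace TEmb

variable {V : Type u} {V' : Type v} {r : V → V → Prop} {r' : V' → V' → Prop} [hr : ZFm r]
  [hr' : ZFm r'] (T : TEmb r r')

omit hr hr' in
@[simp] theorem mem {x y : V} : r' (T.i x) (T.i y) ↔ r x y := T.mem' x y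
omit hr hr' in
@[simp] theorem eq_iff {x y : V} : T.i x = T.i y ↔ x = y := T.inj.eq_iff

theorem setEq {A : V} {B : V'} (h1 : ∀ z, r z A ↔ r' (T.i z) B)
    (h2 : ∀ w, r' w B → ∃ z, w = T.i z) : T.i A = B := by
  refine hr'.ext fun w => ⟨fun h => ?_, fun h => ?_⟩
  · obtain ⟨z, hz, rfl⟩ := T.trans _ _ h
    exact (h1 z).1 hz
  · obtain ⟨z, rfl⟩ := h2 w h
    exact T.mem.2 ((h1 z).2 h)

omit hr hr' in
theorem ball {a : V} {Q : V' → Prop} : (∀ w, r' w (T.i a) → Q w) ↔ ∀ x, r x a → Q (T.i x) :=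
  ⟨fun h x hx => h _ (T.mem.2 hx), fun h w hw => by
    obtain ⟨z, hz, rfl⟩ := T.trans _ _ hw; exact h z hz⟩

omit hr hr' in
theorem bex {a : V} {Q : V' → Prop} : (∃ w, r' w (T.i a) ∧ Q w) ↔ ∃ x, r x a ∧ Q (T.i x) :=
  ⟨fun ⟨w, hw, h⟩ => by obtain ⟨z, hz, rfl⟩ := T.trans _ _ hw; exact ⟨z, hz, h⟩,
    fun ⟨x, hx, h⟩ => ⟨_, T.mem.2 hx, h⟩⟩

omit hr hr' in
@[simp] theorem transW {a : V} : TransW r' (T.i a) ↔ TransW r a := by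
  have h1 : TransW r a ↔ ∀ x, r x a → ∀ y, r y x → r y a :=
    ⟨fun h x hx y => h x y hx, fun h x y hx => h x hx y⟩
  have h2 : TransW r' (T.i a) ↔ ∀ x, r' x (T.i a) → ∀ y, r' y x → r' y (T.i a) :=
    ⟨fun h x hx y => h x y hx, fun h x y hx => h x hx y⟩
  rw [h1, h2, T.ball]
  exact forall₂_congr fun x _ => T.ball.trans (by simp)

omit hr hr' in
@[simp] theorem ordW {a : V} : OrdW r' (T.i a) ↔ OrdW r a := by
  refine and_congr T.transW (T.ball.trans ?_)
  simp

@[simp] theorem emp : T.i (emp r) = emp r' :=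
  T.setEq (fun z => by simp [mem_emp]) fun w hw => absurd hw mem_emp

@[simp] theorem up (x y : V) : T.i (up r x y) = up r' (T.i x) (T.i y) :=
  T.setEq (fun z => by simp [mem_up]) fun w hw => by rcases mem_up.1 hw with rfl | rfl <;> exact ⟨_, rfl⟩

@[simp] theorem op (x y : V) : T.i (op r x y) = op r' (T.i x) (T.i y) := by
  simp [VLC.op]

@[simp] theorem adj (x y : V) : T.i (adj r x y) = adj r' (T.i x) (T.i y) :=
  T.setEq (fun z => by simp [mem_adj]) fun w hw => by
    rcases mem_adj.1 hw with h | rfl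
    · obtain ⟨z, -, rfl⟩ := T.trans _ _ h; exact ⟨_, rfl⟩
    · exact ⟨_, rfl⟩

@[simp] theorem succ (x : V) : T.i (succ r x) = succ r' (T.i x) := by simp [VLC.succ]

@[simp] theorem sUn (x : V) : T.i (sUn r x) = sUn r' (T.i x) :=
  T.setEq (fun z => by rw [mem_sUn (r := r), mem_sUn (r := r'), T.bex]; simp) fun w hw => by
    obtain ⟨z, hz, h⟩ := mem_sUn.1 hw
    obtain ⟨z, -, rfl⟩ := T.trans _ _ hz
    obtain ⟨z, -, rfl⟩ := T.trans _ _ h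
    exact ⟨_, rfl⟩

theorem sepS {a : V} {Q : V → Prop} {Q' : V' → Prop} [Dp r Q] [Dp r' Q']
    (h : ∀ x, r x a → (Q x ↔ Q' (T.i x))) : T.i (sepS r a Q) = sepS r' (T.i a) Q' :=
  T.setEq (fun z => by
    rw [mem_sepS (r := r), mem_sepS (r := r'), T.mem]
    exact and_congr_right (h z)) fun w hw => by
    obtain ⟨z, -, rfl⟩ := T.trans _ _ (mem_sepS.1 hw).1
    exact ⟨_, rfl⟩

theorem imS {a : V} {F : V → V} {F' : V' → V'} [Df₁ r F] [Df₁ r' F']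
    (h : ∀ x, r x a → T.i (F x) = F' (T.i x)) : T.i (imS r a F) = imS r' (T.i a) F' :=
  T.setEq (fun z => by
    rw [mem_imS (r := r), mem_imS (r := r'), T.bex]
    exact exists_congr fun x => and_congr_right fun hx => by rw [← h x hx, T.eq_iff]) fun w hw => by
    obtain ⟨z, hz, rfl⟩ := mem_imS.1 hw
    obtain ⟨z, h3, rfl⟩ := T.trans _ _ hz
    exact ⟨F z, (h z h3).symm⟩

theorem iUn {a : V} {F : V → V} {F' : V' → V'} [Df₁ r F] [Df₁ r' F']
    (h : ∀ x, r x a → T.i (F x) = F' (T.i x)) : T.i (iUn r a F) = iUn r' (T.i a) F' :=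
  T.setEq (fun z => by
    rw [mem_iUn (r := r), mem_iUn (r := r'), T.bex]
    exact exists_congr fun x => and_congr_right fun hx => by rw [← h x hx, T.mem]) fun w hw => by
    obtain ⟨z, hz, hw⟩ := mem_iUn.1 hw
    obtain ⟨z, h3, rfl⟩ := T.trans _ _ hz
    rw [← h z h3] at hw
    obtain ⟨z, -, rfl⟩ := T.trans _ _ hw
    exact ⟨_, rfl⟩

theorem tc (x : V) : T.i (tc r x) = tc r' (T.i x) := by
  induction x using hr.wf.induction with
  | _ x ih =>
  refine T.setEq (fun z => ?_) fun w hw => ?_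
  · rw [mem_tc_iff (r := r), mem_tc_iff (r := r'), T.bex, T.mem]
    refine or_congr Iff.rfl (exists_congr fun y => and_congr_right fun hy => ?_)
    rw [← ih y hy, T.mem]
  · rcases mem_tc_iff.1 hw with h | ⟨y, hy, h⟩
    · obtain ⟨z, -, rfl⟩ := T.trans _ _ h; exact ⟨_, rfl⟩
    · obtain ⟨y, hy', rfl⟩ := T.trans _ _ hy
      rw [← ih y hy'] at h
      obtain ⟨z, -, rfl⟩ := T.trans _ _ h; exact ⟨_, rfl⟩

theorem lamS {a : V} {F : V → V} {F' : V' → V'} [Df₁ r F] [Df₁ r' F']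
    (h : ∀ x, r x a → T.i (F x) = F' (T.i x)) : T.i (lamS r a F) = lamS r' (T.i a) F' :=
  T.setEq (fun z => by
    rw [mem_lamS (r := r), mem_lamS (r := r'), T.bex]
    exact exists_congr fun x => and_congr_right fun hx => by rw [← h x hx, ← T.op, T.eq_iff])
    fun w hw => by
    obtain ⟨z, hz, rfl⟩ := mem_lamS.1 hw
    obtain ⟨z, h3, rfl⟩ := T.trans _ _ hz
    exact ⟨VLC.op r z (F z), by rw [T.op, h z h3]⟩

theorem recF {G : V → V → V} {G' : V' → V' → V'} [Df₂ r G] [Df₂ r' G']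
    (h : ∀ x s, T.i (G x s) = G' (T.i x) (T.i s)) (x : V) :
    T.i (recF r G x) = recF r' G' (T.i x) := by
  induction x using (wf_tc (r := r)).induction with
  | _ x ih =>
  rw [recF_eq (r := r), recF_eq (r := r'), h, T.lamS (F' := VLC.recF r' G') ih, T.tc]

@[simp] theorem app (f x : V) : T.i (app r f x) = app r' (T.i f) (T.i x) := by
  rw [VLC.app, VLC.app, T.sUn, T.sepS (Q' := fun y => r' (VLC.op r' (T.i x) y) (T.i f)), T.sUn, T.sUn]
  intro y _
  rw [← T.op, T.mem]

omit hr hr' in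
theorem limitOrdW {a : V} : LimitOrdW r' (T.i a) ↔ LimitOrdW r a := by
  refine and_congr T.ordW (and_congr ?_ (T.ball.trans ?_))
  · have := T.bex (a := a) (Q := fun _ => True)
    simpa using this
  · exact forall₂_congr fun x _ => T.bex.trans (by simp)

@[simp] theorem om : T.i (om r) = om r' := by
  refine isOmegaW_unique ⟨T.limitOrdW.2 isOmegaW_om.1, T.ball.2 fun x hx => ?_⟩ isOmegaW_om
  rw [T.limitOrdW]
  exact isOmegaW_om.2 x hx

@[simp] theorem prd (a b : V) : T.i (prd r a b) = prd r' (T.i a) (T.i b) := by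
  rw [VLC.prd, VLC.prd, T.iUn (F' := fun x => VLC.imS r' (T.i b) (fun y => VLC.op r' x y))]
  intro x _
  rw [T.imS (F' := fun y => VLC.op r' (T.i x) y)]
  intro y _
  simp

theorem fin (a : V) : T.i (fin r a) = fin r' (T.i a) := by
  rw [VLC.fin, VLC.fin, T.iUn (F' := VLC.recF r' (finStep r' (T.i a))), T.om]
  intro n _
  refine T.recF (fun n s => ?_) n
  rw [finStep, finStep, T.adj, T.emp, T.iUn (F' := fun k => VLC.iUn r' (VLC.app r' (T.i s) k)
    (fun p => VLC.imS r' (T.i a) (fun x => VLC.adj r' p x)))]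
  intro k _
  rw [T.iUn (F' := fun p => VLC.imS r' (T.i a) (fun x => VLC.adj r' p x)), T.app]
  intro p _
  rw [T.imS (F' := fun x => VLC.adj r' (T.i p) x)]
  intro x _
  simp

theorem pIso {p : V} : PIso r' (T.i p) ↔ PIso r p := by
  constructor
  · intro h x y x' y' h1 h2
    have := h (T.i x) (T.i y) (T.i x') (T.i y')
    simp only [← T.op, T.mem, T.eq_iff] at this
    exact this h1 h2
  · intro h a b a' b' h1 h2
    have key : ∀ {a b : V'}, r' (VLC.op r' a b) (T.i p) → ∃ x y, a = T.i x ∧ b = T.i y := by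
      intro a b h
      obtain ⟨z, -, h⟩ := T.trans _ _ h
      have h1 : r' (VLC.up r' a b) (T.i z) := h ▸ mem_up.2 (.inr rfl)
      obtain ⟨u, -, h2⟩ := T.trans _ _ h1
      obtain ⟨x, -, hx⟩ := T.trans u a (h2 ▸ mem_up.2 (.inl rfl))
      obtain ⟨y, -, hy⟩ := T.trans u b (h2 ▸ mem_up.2 (.inr rfl))
      exact ⟨x, y, hx, hy⟩
    obtain ⟨x, y, rfl, rfl⟩ := key h1
    obtain ⟨x', y', rfl, rfl⟩ := key h2
    rw [← T.op, T.mem] at h1 h2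
    have := h x y x' y' h1 h2
    simpa using this

theorem ef (h N n : V) : T.i (ef r h N n) = ef r' (T.i h) (T.i N) (T.i n) := by
  rw [VLC.ef, VLC.ef]
  refine T.recF (fun n s => ?_) n
  rw [efStep, efStep, ← T.prd, ← T.fin]
  refine T.sepS fun p _ => and_congr T.pIso.symm ?_
  rw [T.ball]
  refine forall₂_congr fun k _ => and_congr ?_ ?_
  · rw [T.ball]
    refine forall₂_congr fun x _ => ?_
    rw [T.bex]
    simp only [← T.op, ← T.adj, ← T.app, T.mem]
  · rw [T.ball]
    refine forall₂_congr fun x _ => ?_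
    rw [T.bex]
    simp only [← T.op, ← T.adj, ← T.app, T.mem]

@[simp] theorem dsub (m n s t : V) : T.i (dsub r m n s t) = dsub r' (T.i m) (T.i n) (T.i s) (T.i t) := by
  rw [VLC.dsub, VLC.dsub]
  refine T.sepS fun x _ => ?_
  rw [T.bex, ← T.imS (F := fun z => VLC.op r z z) (F' := fun z => VLC.op r' z z) (by simp)]
  simp only [← T.op, ← T.adj, ← T.ef, T.mem]

@[simp] theorem fst (z : V) : T.i (fst r z) = fst r' (T.i z) := by
  rw [VLC.fst, VLC.fst, ← T.sUn, ← T.sUn]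
  refine T.sepS fun x _ => ?_
  constructor
  · rintro ⟨a, b, rfl, h⟩; exact ⟨T.i a, T.i b, by simp, by simpa⟩
  · rintro ⟨a, b, h, hx⟩
    obtain ⟨u, -, hu⟩ := T.trans z (VLC.up r' a b) (h ▸ mem_up.2 (.inr rfl))
    obtain ⟨a, -, rfl⟩ := T.trans u a (hu ▸ mem_up.2 (.inl rfl))
    obtain ⟨b, -, rfl⟩ := T.trans u b (hu ▸ mem_up.2 (.inr rfl))
    rw [← T.op, T.eq_iff] at h
    exact ⟨a, b, h, T.mem.1 hx⟩

@[simp] theorem snd (z : V) : T.i (snd r z) = snd r' (T.i z) := by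
  rw [VLC.snd, VLC.snd, ← T.sUn, ← T.sUn]
  refine T.sepS fun x _ => ?_
  constructor
  · rintro ⟨a, b, rfl, h⟩; exact ⟨T.i a, T.i b, by simp, by simpa⟩
  · rintro ⟨a, b, h, hx⟩
    obtain ⟨u, -, hu⟩ := T.trans z (VLC.up r' a b) (h ▸ mem_up.2 (.inr rfl))
    obtain ⟨a, -, rfl⟩ := T.trans u a (hu ▸ mem_up.2 (.inl rfl))
    obtain ⟨b, -, rfl⟩ := T.trans u b (hu ▸ mem_up.2 (.inr rfl))
    rw [← T.op, T.eq_iff] at h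
    exact ⟨a, b, h, T.mem.1 hx⟩

theorem lstB {a : V} {Q : V → Prop} {Q' : V' → Prop} [Dp r Q] [Dp r' Q']
    (h : ∀ x, r x a → (Q x ↔ Q' (T.i x))) : T.i (lstB r a Q) = lstB r' (T.i a) Q' := by
  haveI := dp_lstB (r := r) a Q
  haveI := dp_lstB (r := r') (T.i a) Q'
  refine T.sepS fun z _ => ?_
  rw [T.ball]
  exact forall₂_congr fun x hx => by rw [h x hx, T.mem]

end TEmb

section Induct

variable {ι : Type w} {V : ι → Type u} {r : ∀ i, V i → V i → Prop} {P : (∀ i, V i) → Prop}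

/-- Terms: variables and parameters. -/
def IsTm (P : (∀ i, V i) → Prop) {n : ℕ} (t : ∀ i, (Fin n → V i) → V i) : Prop :=
  (∃ j, t = fun _ v => v j) ∨ ∃ c, P c ∧ t = fun i _ => c i

theorem Df.induct {C : ∀ n, (∀ i, (Fin n → V i) → Prop) → Prop}
    (hmem : ∀ n (t s : ∀ i, (Fin n → V i) → V i), IsTm P t → IsTm P s →
      C n (fun i v => r i (t i v) (s i v)))
    (heq : ∀ n (t s : ∀ i, (Fin n → V i) → V i), IsTm P t → IsTm P s →
      C n (fun i v => t i v = s i v))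
    (hbot : ∀ n, C n (fun _ _ => False))
    (himp : ∀ n (R S : ∀ i, (Fin n → V i) → Prop), C n R → C n S → C n (fun i v => R i v → S i v))
    (hall : ∀ n (R : ∀ i, (Fin (n + 1) → V i) → Prop), C (n + 1) R →
      C n (fun i v => ∀ y, R i (Fin.snoc (α := fun _ => V i) v y)))
    {n : ℕ} {R : ∀ i, (Fin n → V i) → Prop} (h : Df r P R) : C n R := by
  have key : ∀ {k : ℕ} (φ : L3.BoundedFormula ({c : ∀ i, V i // P c} ⊕ Fin n) k),
      C (n + k) (fun i w => @BoundedFormula.Realize L3 (V i) (memStr (r i)) _ k φ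
        (Sum.elim (fun c => c.1 i) (fun j => w (Fin.castAdd k j))) (fun j => w (Fin.natAdd n j))) := by
    intro k φ
    have tm : ∀ {k : ℕ} (t : L3.Term (({c : ∀ i, V i // P c} ⊕ Fin n) ⊕ Fin k)),
        IsTm P (fun i (w : Fin (n + k) → V i) => @Term.realize L3 (V i) (memStr (r i)) _
          (Sum.elim (Sum.elim (fun c => c.1 i) (fun j => w (Fin.castAdd k j)))
            (fun j => w (Fin.natAdd n j))) t) := by
      intro k t
      cases t with
      | var x =>
        rcases x with (c | j) | j
        · exact .inr ⟨c.1, c.2, rfl⟩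
        · exact .inl ⟨Fin.castAdd k j, rfl⟩
        · exact .inl ⟨Fin.natAdd n j, rfl⟩
      | func f => exact nomatch f
    induction φ with
    | falsum => exact hbot _
    | equal t s => exact heq _ _ _ (tm t) (tm s)
    | rel R ts =>
      cases R with
      | u1 => exact hbot _
      | u2 => exact hbot _
      | mem => exact hmem _ _ _ (tm (ts 0)) (tm (ts 1))
    | imp φ ψ h1 h2 => exact himp _ _ _ h1 h2
    | all φ ih =>
      rename_i k
      have e : (fun i (w : Fin (n + k) → V i) => @BoundedFormula.Realize L3 (V i) (memStr (r i)) _ k φ.all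
          (Sum.elim (fun c => c.1 i) (fun j => w (Fin.castAdd k j))) (fun j => w (Fin.natAdd n j))) =
          fun i w => ∀ y, @BoundedFormula.Realize L3 (V i) (memStr (r i)) _ (k + 1) φ
          (Sum.elim (fun c => c.1 i)
            (fun j => (Fin.snoc (α := fun _ => V i) w y : Fin (n + k + 1) → V i) (Fin.castAdd (k + 1) j)))
            (fun j => (Fin.snoc (α := fun _ => V i) w y : Fin (n + k + 1) → V i) (Fin.natAdd n j)) := by
        funext i w
        letI := memStr (r i)
        rw [BoundedFormula.realize_all]
        refine forall_congr fun y => ?_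
        congr 1
        · ext x
          rcases x with c | j
          · rfl
          · exact (Fin.snoc_castSucc (α := fun _ => V i) (i := Fin.castAdd k j) (x := y) (p := w)).symm
        · ext j
          refine Fin.lastCases ?_ (fun j => ?_) j
          · rw [Fin.snoc_last]
            exact (Fin.snoc_last (α := fun _ => V i) (n := n + k) (p := w) (x := y)).symm
          · rw [Fin.snoc_castSucc]
            exact (Fin.snoc_castSucc (α := fun _ => V i) (i := Fin.natAdd n j) (x := y) (p := w)).symm
      rw [e]
      exact hall _ _ ih
  obtain ⟨φ, hφ⟩ := h.out
  have := key φ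
  have e : R = fun i w => @BoundedFormula.Realize L3 (V i) (memStr (r i)) _ 0 φ
      (Sum.elim (fun c => c.1 i) (fun j => w (Fin.castAdd 0 j))) (fun j => w (Fin.natAdd n j)) := by
    funext i w
    rw [← hφ]
    exact congrArg (fun x => @BoundedFormula.Realize L3 (V i) (memStr (r i)) _ 0 φ
      (Sum.elim (fun c => c.1 i) w) x) (funext fun j : Fin 0 => j.elim0)
  rw [e]
  exact this

/-- Relativization of a definable relation to a definable class. -/
theorem Df.relativize {T : ∀ i, V i → Prop} (hT : Df r P (fun i (v : Fin 1 → V i) => T i (v 0)))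
    {Q : (∀ i, {x : V i // T i x}) → Prop} (hQ : ∀ c, Q c → P (fun i => (c i).1)) {n : ℕ}
    {R : ∀ i, (Fin n → {x : V i // T i x}) → Prop}
    (h : Df (V := fun i => {x : V i // T i x}) (fun i a b => r i a.1 b.1) Q R) :
    Df r P (fun i v => ∃ h : ∀ j, T i (v j), R i (fun j => ⟨v j, h j⟩)) := by
  haveI all : ∀ n, Df r P (fun i (v : Fin n → V i) => ∀ j, T i (v j)) := fun n =>
    Df.finAll (R := fun (j : Fin n) i (v : Fin n → V i) => T i (v j)) fun j =>
      hT.rename (fun _ => j)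
  have tm : ∀ {n : ℕ} (t : ∀ i, (Fin n → {x : V i // T i x}) → {x : V i // T i x}), IsTm Q t →
      ∃ s : ∀ i, (Fin n → V i) → V i, DFn r P s ∧ ∀ i v, (t i v).1 = s i (fun j => (v j).1) := by
    rintro n t (⟨j, rfl⟩ | ⟨c, hc, rfl⟩)
    · exact ⟨fun i v => v j, inferInstance, fun _ _ => rfl⟩
    · exact ⟨fun i _ => (c i).1, DFn.constP _ (hQ c hc), fun _ _ => rfl⟩
  refine Df.induct (C := fun n R => Df r P (fun i v => ∃ h : ∀ j, T i (v j), R i (fun j => ⟨v j, h j⟩)))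
    ?_ ?_ ?_ ?_ ?_ h
  · intro n t s ht hs
    obtain ⟨t', h1, h2⟩ := tm t ht
    obtain ⟨s', h3, h4⟩ := tm s hs
    refine (inferInstance : Df r P (fun i v => (∀ j, T i (v j)) ∧ r i (t' i v) (s' i v))).congr
      fun i v => ?_
    simp only [h2, h4, exists_prop]
  · intro n t s ht hs
    obtain ⟨t', h1, h2⟩ := tm t ht
    obtain ⟨s', h3, h4⟩ := tm s hs
    refine (inferInstance : Df r P (fun i v => (∀ j, T i (v j)) ∧ (t' i v) = (s' i v))).congr
      fun i v => ?_
    simp only [Subtype.ext_iff, h2, h4, exists_prop]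
  · intro n
    refine (Df.prop False).congr fun i v => by simp
  · intro n R S hR hS
    refine (inferInstance : Df r P (fun i v => (∀ j, T i (v j)) ∧
      ((∃ h : ∀ j, T i (v j), R i (fun j => ⟨v j, h j⟩)) →
        (∃ h : ∀ j, T i (v j), S i (fun j => ⟨v j, h j⟩))))).congr fun i v => ?_
    exact ⟨fun ⟨h1, h2⟩ => ⟨h1, fun h3 => (h2 ⟨h1, h3⟩).2⟩, fun ⟨h1, h2⟩ => ⟨h1, fun ⟨_, h3⟩ => ⟨h1, h2 h3⟩⟩⟩
  · intro n R hR
    have h1 : Df r P (fun i (v : Fin n → V i) => ∃ y : V i, T i y ∧ ¬ ∃ h : ∀ j : Fin (n + 1),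
        T i ((Fin.snoc v y : Fin (n + 1) → V i) j), R i (fun j => ⟨_, h j⟩)) := by
      haveI : Df r P (fun i (w : Fin (n + 1) → V i) => T i (w (Fin.last n))) := hT.rename (fun _ => Fin.last n)
      haveI : Df r P (fun i (w : Fin (n + 1) → V i) => T i (w (Fin.last n)) ∧
        ¬ ∃ h : ∀ j, T i (w j), R i (fun j => ⟨w j, h j⟩)) := inferInstance
      exact this.ex'.congr fun i v => by simp only [Fin.snoc_last]
    have hs : ∀ {i} (v : Fin n → V i) (y : {x // T i x}) (h : ∀ j : Fin (n + 1),
        T i ((Fin.snoc v y.1 : Fin (n + 1) → V i) j)), (fun j => (⟨_, h j⟩ : {x // T i x})) =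
        Fin.snoc (α := fun _ => {x // T i x}) (fun j => ⟨v j, by simpa using h j.castSucc⟩) y := by
      intro i v y h
      funext j
      refine Fin.lastCases ?_ (fun j => ?_) j <;> simp
    refine (inferInstance : Df r P (fun i v => (∀ j, T i (v j)) ∧ ¬ ∃ y : V i, T i y ∧ ¬ ∃ h : ∀ j : Fin (n + 1),
        T i ((Fin.snoc v y : Fin (n + 1) → V i) j), R i (fun j => ⟨_, h j⟩))).congr fun i v => ?_
    constructor
    · rintro ⟨h2, h3⟩
      refine ⟨h2, fun y => ?_⟩
      by_contra h4
      refine h3 ⟨y.1, y.2, fun ⟨h5, h6⟩ => h4 ?_⟩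
      rwa [← hs v y h5]
    · rintro ⟨h2, h3⟩
      refine ⟨h2, fun ⟨y, hy, h4⟩ => h4 ⟨?_, ?_⟩⟩
      · refine Fin.lastCases ?_ fun j => ?_ <;> simp [hy, h2]
      · rw [hs v ⟨y, hy⟩]
        convert h3 ⟨y, hy⟩

theorem Df.relativize₁ {V : Type u} {r : V → V → Prop} {T : V → Prop} [hT : Dp r T]
    {R : {x : V // T x} → Prop} (h : Dp (fun a b : {x : V // T x} => r a.1 b.1) R) :
    Dp r (fun x => ∃ h : T x, R ⟨x, h⟩) :=
  (Df.relativize (ι := Unit) (V := fun _ => V) (T := fun _ => T) hT (Q := fun _ => True)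
    (fun _ _ => trivial) h).congr fun _ v =>
    ⟨fun ⟨h1, h2⟩ => ⟨h1 0, h2⟩, fun ⟨h1, h2⟩ => ⟨fun j => (Fin.fin_one_eq_zero j) ▸ h1, by
      convert h2 using 1⟩⟩

theorem Df.relativize₂ {V : Type u} {r : V → V → Prop} {T : V → Prop} [hT : Dp r T]
    {R : {x : V // T x} → {x : V // T x} → Prop} (h : Dp₂ (fun a b : {x : V // T x} => r a.1 b.1) R) :
    Dp₂ r (fun x y => ∃ (h : T x) (h' : T y), R ⟨x, h⟩ ⟨y, h'⟩) :=
  (Df.relativize (ι := Unit) (V := fun _ => V) (T := fun _ => T) hT (Q := fun _ => True)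
    (fun _ _ => trivial) h).congr fun _ v =>
    ⟨fun ⟨h1, h2⟩ => ⟨h1 0, h1 1, h2⟩, fun ⟨h1, h1', h2⟩ => ⟨fun j => by
      fin_cases j
      · exact h1
      · exact h1', h2⟩⟩

end Induct

section Ops

variable {V : Type u} {r : V → V → Prop} [hr : ZFm r]

theorem Dp.app {Q : V → Prop} (hQ : Dp r Q) {n : ℕ} (f : Unit → (Fin n → V) → V)
    [DFn (ι := Unit) (V := fun _ => V) (fun _ => r) (fun _ => True) f] :
    Df (ι := Unit) (V := fun _ => V) (fun _ => r) (fun _ => True) (fun i v => Q (f i v)) :=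
  Df.comp1 (Q := fun _ => Q) hQ f

theorem Dp₂.app {Q : V → V → Prop} (hQ : Dp₂ r Q) {n : ℕ} (f g : Unit → (Fin n → V) → V)
    [DFn (ι := Unit) (V := fun _ => V) (fun _ => r) (fun _ => True) f]
    [DFn (ι := Unit) (V := fun _ => V) (fun _ => r) (fun _ => True) g] :
    Df (ι := Unit) (V := fun _ => V) (fun _ => r) (fun _ => True) (fun i v => Q (f i v) (g i v)) :=
  Df.comp2 (Q := fun _ => Q) hQ f g

theorem Df₁.app {F : V → V} (hF : Df₁ r F) {n : ℕ} (f : Unit → (Fin n → V) → V)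
    [DFn (ι := Unit) (V := fun _ => V) (fun _ => r) (fun _ => True) f] :
    DFn (ι := Unit) (V := fun _ => V) (fun _ => r) (fun _ => True) (fun i v => F (f i v)) :=
  DFn.comp1 (F := fun _ => F) hF f

/-- The least ordinal with `Q`, and `∅` if there is none. -/
noncomputable def lst (r : V → V → Prop) [ZFm r] (Q : V → Prop) : V :=
  cset r (fun z => (∃ β, OrdW r β ∧ Q β) ∧ ∀ β, OrdW r β → Q β → r z β)

theorem exists_lst (Q : V → Prop) :
    ∃ b, ∀ z, r z b ↔ ((∃ β, OrdW r β ∧ Q β) ∧ ∀ β, OrdW r β → Q β → r z β) := by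
  by_cases h : ∃ β, OrdW r β ∧ Q β
  · obtain ⟨α, h1, h2, h3⟩ := exists_least h
    refine ⟨α, fun z => ⟨fun hz => ⟨h, fun β hb hq => ?_⟩, fun hz => hz.2 α h1 h2⟩⟩
    rcases h1.trich hb with h | rfl | h
    · exact hb.trans h hz
    · exact hz
    · exact absurd hq (h3 β h)
  · exact ⟨emp r, fun z => ⟨fun hz => absurd hz mem_emp, fun hz => absurd hz.1 h⟩⟩

theorem lst_spec {Q : V → Prop} (h : ∃ β, OrdW r β ∧ Q β) :
    OrdW r (lst r Q) ∧ Q (lst r Q) ∧ ∀ β, r β (lst r Q) → ¬ Q β := by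
  obtain ⟨α, h1, h2, h3⟩ := exists_least h
  have : lst r Q = α := by
    refine hr.ext fun z => (mem_cset (exists_lst Q)).trans ⟨fun hz => hz.2 α h1 h2, fun hz => ⟨h, fun β hb hq => ?_⟩⟩
    rcases h1.trich hb with h | rfl | h
    · exact hb.trans h hz
    · exact hz
    · exact absurd hq (h3 β h)
  rw [this]
  exact ⟨h1, h2, h3⟩

theorem lst_eq {Q : V → Prop} {α : V} (h1 : OrdW r α) (h2 : Q α) (h3 : ∀ β, r β α → ¬ Q β) :
    lst r Q = α := by
  obtain ⟨h4, h5, h6⟩ := lst_spec (r := r) ⟨α, h1, h2⟩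
  rcases h1.trich h4 with h | h | h
  · exact absurd h2 (h6 _ h)
  · exact h.symm
  · exact absurd h5 (h3 _ h)

theorem ordW_lst (Q : V → Prop) : OrdW r (lst r Q) := by
  by_cases h : ∃ β, OrdW r β ∧ Q β
  · exact (lst_spec h).1
  · have : lst r Q = emp r := eq_emp.2 fun z hz => h ((mem_cset (exists_lst Q)).1 hz).1
    rw [this]; exact ordW_emp

instance DFn.lst {ι : Type w} {V : ι → Type u} {r : ∀ i, V i → V i → Prop} {P : (∀ i, V i) → Prop}
    {n : ℕ} [hr : ∀ i, ZFm (r i)] {Q : ∀ i, (Fin n → V i) → V i → Prop}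
    [h : Df r P (fun i (w : Fin (n + 1) → V i) => Q i (fun j => w j.castSucc) (w (Fin.last n)))] :
    DFn r P (fun i v => lst (r i) (Q i v)) := by
  unfold VLC.lst
  haveI : Df r P (fun i (w : Fin (n + 2) → V i) =>
      Q i (fun j => w j.castSucc.castSucc) (w (Fin.last (n + 1)))) :=
    (h.rename (m := n + 2) (Fin.lastCases (Fin.last (n + 1)) fun j => j.castSucc.castSucc)).congr
      fun i v => by simp
  exact DFn.cset (R := fun i v z => (∃ β, OrdW (r i) β ∧ Q i v β) ∧ ∀ β, OrdW (r i) β → Q i v β → r i z β)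
    fun i v => exists_lst _

theorem OrdW.un {α β : V} (ha : OrdW r α) (hb : OrdW r β) : OrdW r (VLC.un r α β) := by
  refine ⟨fun a b h1 h2 => ?_, fun a h1 => ?_⟩
  · rcases mem_un.1 h1 with h | h
    · exact mem_un.2 (.inl (ha.trans h h2))
    · exact mem_un.2 (.inr (hb.trans h h2))
  · rcases mem_un.1 h1 with h | h
    · exact (ha.mem h).1
    · exact (hb.mem h).1

theorem OrdW.iUn {a : V} {F : V → V} [Df₁ r F] (h : ∀ x, r x a → OrdW r (F x)) :
    OrdW r (VLC.iUn r a F) := by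
  refine ⟨fun x y h1 h2 => ?_, fun x h1 => ?_⟩
  · obtain ⟨z, hz, h1⟩ := mem_iUn.1 h1
    exact mem_iUn.2 ⟨z, hz, (h z hz).trans h1 h2⟩
  · obtain ⟨z, hz, h1⟩ := mem_iUn.1 h1
    exact ((h z hz).mem h1).1

/-- The step function of `itr`. -/
noncomputable def itrStep (r : V → V → Prop) [ZFm r] (F : V → V) (a n s : V) : V :=
  un r a (iUn r n (fun k => F (app r s k)))

/-- The union of the finite stages of the iteration of `x ↦ x ∪ F x` from `a`. -/
noncomputable def itr (r : V → V → Prop) [ZFm r] (F : V → V) (a : V) : V :=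
  iUn r (om r) (recF r (itrStep r F a))

/-- The `n`-th stage of `itr`. -/
noncomputable def itn (r : V → V → Prop) [ZFm r] (F : V → V) (a : V) (n : ℕ) : V :=
  recF r (itrStep r F a) (nat r n)

variable {F : V → V} {a : V}

theorem df_itrStep (a : V) [hF : Df₁ r F] : Df₂ r (itrStep r F a) := by
  haveI : ∀ {n : ℕ} (f : Unit → (Fin n → V) → V)
    [DFn (ι := Unit) (V := fun _ => V) (fun _ => r) (fun _ => True) f],
    DFn (ι := Unit) (V := fun _ => V) (fun _ => r) (fun _ => True) (fun i v => F (f i v)) :=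
    fun f _ => Df₁.app hF f
  unfold itrStep
  infer_instance

theorem mem_itn [hF : Df₁ r F] {n : ℕ} {z : V} : r z (itn r F a n) ↔ r z a ∨ ∃ k < n, r z (F (itn r F a k)) := by
  haveI := df_itrStep (r := r) (F := F) a
  haveI : ∀ {n : ℕ} (f : Unit → (Fin n → V) → V)
    [DFn (ι := Unit) (V := fun _ => V) (fun _ => r) (fun _ => True) f],
    DFn (ι := Unit) (V := fun _ => V) (fun _ => r) (fun _ => True) (fun i v => F (f i v)) :=
    fun f _ => Df₁.app hF f
  rw [itn, recF_eq (r := r), itrStep, mem_un (r := r), mem_iUn (r := r)]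
  refine or_congr Iff.rfl ?_
  constructor
  · rintro ⟨k, hk, hz⟩
    obtain ⟨k, hkn, rfl⟩ := mem_nat.1 hk
    rw [recF_nat _ hkn] at hz
    exact ⟨k, hkn, hz⟩
  · rintro ⟨k, hkn, hz⟩
    exact ⟨_, nat_mem_nat.2 hkn, by rwa [recF_nat _ hkn]⟩

theorem mem_itr [Df₁ r F] {z : V} : r z (itr r F a) ↔ ∃ n, r z (itn r F a n) := by
  haveI := df_itrStep (r := r) (F := F) a
  rw [itr, mem_iUn (r := r)]
  constructor
  · rintro ⟨n, hn, hz⟩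
    obtain ⟨n, rfl⟩ := mem_om.1 hn
    exact ⟨n, hz⟩
  · rintro ⟨n, hz⟩
    exact ⟨_, nat_mem_om n, hz⟩

theorem itn_mono [Df₁ r F] {m n : ℕ} (h : m ≤ n) : SubW r (itn r F a m) (itn r F a n) := fun z hz => by
  rcases mem_itn.1 hz with hz | ⟨k, hk, hz⟩
  · exact mem_itn.2 (.inl hz)
  · exact mem_itn.2 (.inr ⟨k, by omega, hz⟩)

theorem sub_itr [Df₁ r F] : SubW r a (itr r F a) := fun z hz => mem_itr.2 ⟨0, mem_itn.2 (.inl hz)⟩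

theorem itr_step [Df₁ r F] {n : ℕ} {z : V} (hz : r z (F (itn r F a n))) : r z (itr r F a) :=
  mem_itr.2 ⟨n + 1, mem_itn.2 (.inr ⟨n, by omega, hz⟩)⟩

theorem ordW_itr [Df₁ r F] (ha : OrdW r a) (hF : ∀ x, OrdW r x → OrdW r (F x)) : OrdW r (itr r F a) := by
  have h1 : ∀ n, OrdW r (itn r F a n) := by
    intro n
    induction n using Nat.strong_induction_on with
    | _ n ih =>
    refine ⟨fun x y hx hy => ?_, fun x hx => ?_⟩
    · rcases mem_itn.1 hx with hx | ⟨k, hk, hx⟩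
      · exact mem_itn.2 (.inl (ha.trans hx hy))
      · exact mem_itn.2 (.inr ⟨k, hk, (hF _ (ih k hk)).trans hx hy⟩)
    · rcases mem_itn.1 hx with hx | ⟨k, hk, hx⟩
      · exact (ha.mem hx).1
      · exact ((hF _ (ih k hk)).mem hx).1
  refine ⟨fun x y hx hy => ?_, fun x hx => ?_⟩
  · obtain ⟨n, hn⟩ := mem_itr.1 hx
    exact mem_itr.2 ⟨n, (h1 n).trans hn hy⟩
  · obtain ⟨n, hn⟩ := mem_itr.1 hx
    exact ((h1 n).mem hn).1

/-- `γ` is closed under the function `g`. -/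
def ClU (r : V → V → Prop) (g : V → V) (γ : V) : Prop := ∀ α, r α γ → ∃ δ, r δ γ ∧ SubW r (g α) δ

theorem exists_closed (g : V → V) [hg : Df₁ r g] (ho : ∀ α, OrdW r α → OrdW r (g α)) {α : V}
    (ha : OrdW r α) : ∃ γ, LimitOrdW r γ ∧ r α γ ∧ ClU r g γ := by
  haveI : ∀ {n : ℕ} (f : Unit → (Fin n → V) → V)
    [DFn (ι := Unit) (V := fun _ => V) (fun _ => r) (fun _ => True) f],
    DFn (ι := Unit) (V := fun _ => V) (fun _ => r) (fun _ => True) (fun i v => g (f i v)) :=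
    fun f _ => Df₁.app hg f
  let F : V → V := fun x => iUn r x (fun y => un r (succ r (succ r y)) (succ r (g y)))
  haveI : Df₁ r F := inferInstanceAs (Df₁ r fun x => iUn r x (fun y => un r (succ r (succ r y)) (succ r (g y))))
  have h1 : OrdW r (itr r F (succ r α)) := ordW_itr ha.succ fun x hx => OrdW.iUn fun y hy =>
    (hx.mem hy).succ.succ.un (ho y (hx.mem hy)).succ
  have h2 : r α (itr r F (succ r α)) := sub_itr _ (self_mem_succ α)
  refine ⟨_, ⟨h1, ⟨α, h2⟩, fun x hx => ⟨succ r x, ?_, self_mem_succ x⟩⟩, h2, fun x hx => ⟨g x, ?_, fun _ h => h⟩⟩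
  · obtain ⟨n, hn⟩ := mem_itr.1 hx
    exact itr_step (n := n) (mem_iUn.2 ⟨x, hn, mem_un.2 (.inl (self_mem_succ _))⟩)
  · obtain ⟨n, hn⟩ := mem_itr.1 hx
    exact itr_step (n := n) (mem_iUn.2 ⟨x, hn, mem_un.2 (.inr (self_mem_succ _))⟩)

end Ops

section Reflect

variable {V : Type u} {r : V → V → Prop} [hr : ZFm r]

theorem exists_bound_tuple (E : V → V) [hE : Df₁ r E] (n : ℕ) (f : (Fin (n + 1) → V) → V)
    (hf : DFn (ι := Unit) (V := fun _ => V) (fun _ => r) (fun _ => True) (fun _ => f))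
    (ho : ∀ v, OrdW r (f v)) : ∃ F : V → V, Df₁ r F ∧ (∀ x, OrdW r (F x)) ∧
      ∀ α (v : Fin n → V), (∀ j, r (v j) (E α)) → SubW r (f (Fin.cons α v)) (F α) := by
  haveI : ∀ {n : ℕ} (f : Unit → (Fin n → V) → V)
    [DFn (ι := Unit) (V := fun _ => V) (fun _ => r) (fun _ => True) f],
    DFn (ι := Unit) (V := fun _ => V) (fun _ => r) (fun _ => True) (fun i v => E (f i v)) :=
    fun f _ => Df₁.app hE f
  induction n with
  | zero =>
    refine ⟨fun x => f (fun _ => x), ⟨(hf.out.rename (m := 2) (Fin.lastCases 1 fun _ => 0)).congr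
      fun _ v => ?_⟩, fun x => ho _, fun α v _ => ?_⟩
    · rw [show (fun j : Fin 1 => v ((Fin.lastCases 1 fun _ => 0 : Fin 2 → Fin 2) j.castSucc)) = fun _ => v 0 from by
        funext j; rw [Fin.fin_one_eq_zero j]; rfl]
      rfl
    · have : (Fin.cons α v : Fin 1 → V) = fun _ => α := by
        funext j; rw [Fin.fin_one_eq_zero j]; rfl
      rw [show f (Fin.cons α v) = f (fun _ => α) from congrArg f this]
      exact fun _ h => h
  | succ n ih =>
    haveI h3 : DFn (ι := Unit) (V := fun _ => V) (fun _ => r) (fun _ => True)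
        (fun _ (w : Fin (n + 1 + 1) → V) => f (Fin.snoc (α := fun _ => V) (fun j => w j.castSucc) (w (Fin.last _)))) :=
      ⟨hf.out.congr fun _ v => by
        have : (Fin.snoc (α := fun _ => V) (fun j : Fin (n + 1) => v j.castSucc.castSucc)
          (v (Fin.last (n + 1)).castSucc) : Fin (n + 2) → V) = fun j => v j.castSucc := by
          funext j; refine Fin.lastCases ?_ (fun j => ?_) j <;> simp
        rw [this]⟩
    obtain ⟨F, h1, h2, h3⟩ := ih
      (fun w => iUn r (E (w 0)) (fun x => f (Fin.snoc (α := fun _ => V) w x))) inferInstance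
      (fun w => by
        haveI : Df₁ r (fun x => f (Fin.snoc (α := fun _ => V) w x)) :=
          DFn.fixv (F := fun (_ : Unit) w x => f (Fin.snoc (α := fun _ => V) w x)) h3 () w
        exact OrdW.iUn fun x _ => ho _)
    refine ⟨F, h1, h2, fun α v hv z hz => h3 α (fun j => v j.castSucc) (fun j => hv _) z ?_⟩
    haveI : Df₁ r (fun x => f (Fin.snoc (α := fun _ => V) (Fin.cons α fun j => v j.castSucc) x)) :=
      DFn.fixv (F := fun (_ : Unit) w x => f (Fin.snoc (α := fun _ => V) w x)) (by assumption) () _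
    refine mem_iUn.2 ⟨v (Fin.last n), hv _, ?_⟩
    have : (Fin.cons α v : Fin (n + 2) → V) =
        Fin.snoc (α := fun _ => V) (Fin.cons α fun j => v j.castSucc) (v (Fin.last n)) := by
      rw [← Fin.cons_snoc_eq_snoc_cons]
      congr 1
      funext j; refine Fin.lastCases ?_ (fun j => ?_) j <;> simp
    rwa [← this]

theorem Df.allv {ι : Type w} {V : ι → Type u} {r : ∀ i, V i → V i → Prop} {P : (∀ i, V i) → Prop} {n : ℕ}
    {R : ∀ i, (Fin (n + 1) → V i) → Prop} (h : Df r P R) :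
    Df r P (fun i (v : Fin n → V i) => ∀ y : V i, R i (Fin.snoc (α := fun _ => V i) v y)) :=
  (@Df.not _ _ _ _ _ _ (Df.ex' (@Df.not _ _ _ _ _ _ h))).congr fun i v => by simp

variable (E : V → V) [hE : Df₁ r E]

/-- The class `⋃_α E α`. -/
def Lv (r : V → V → Prop) (E : V → V) (x : V) : Prop := ∃ α, OrdW r α ∧ r x (E α)

/-- The property of a definable relation over the class `Lv r E` reflecting to `E γ` for all `γ` closed
under `g`. -/
def RflAt (g : V → V) {n : ℕ} (R : (Fin n → {x : V // Lv r E x}) → Prop) : Prop :=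
  ∃ Q : V → (Fin n → V) → Prop, ∀ γ, LimitOrdW r γ → ClU r g γ →
    Dfb (srel r (E γ)) (fun w => Q γ (fun j => (w j).1)) ∧
    ∀ w : Fin n → {x : V // Lv r E x}, (∀ j, r (w j).1 (E γ)) → (R w ↔ Q γ (fun j => (w j).1))

theorem ClU.mono {g g' : V → V} (h : ∀ x, SubW r (g x) (g' x)) {γ : V} (hc : ClU r g' γ) : ClU r g γ :=
  fun α ha => let ⟨δ, h1, h2⟩ := hc α ha; ⟨δ, h1, fun z hz => h2 z (h α z hz)⟩

variable (mono : ∀ α β, OrdW r β → r α β → SubW r (E α) (E β))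
  (cont : ∀ γ x, LimitOrdW r γ → r x (E γ) → ∃ α, r α γ ∧ r x (E α))

include mono in
theorem Lv.bound {α : V} (ha : OrdW r α) {x : V} (hx : r x (E α)) {β : V} (hb : OrdW r β)
    (h : SubW r α β) : r x (E β) := by
  rcases ha.trich hb with h1 | rfl | h1
  · exact mono _ _ hb h1 x hx
  · exact hx
  · exact absurd (h _ h1) (ZFm.not_self β)

include mono cont in
theorem exists_rflAt {n : ℕ} {R : (Fin n → {x : V // Lv r E x}) → Prop}
    (h : Dfb (fun a b : {x : V // Lv r E x} => r a.1 b.1) R) :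
    ∃ g : V → V, Df₁ r g ∧ (∀ x, OrdW r (g x)) ∧ RflAt E g R := by
  haveI : ∀ {n : ℕ} (f : Unit → (Fin n → V) → V)
    [DFn (ι := Unit) (V := fun _ => V) (fun _ => r) (fun _ => True) f],
    DFn (ι := Unit) (V := fun _ => V) (fun _ => r) (fun _ => True) (fun i v => E (f i v)) :=
    fun f _ => Df₁.app hE f
  haveI hT : Dp r (Lv r E) := by unfold Lv; infer_instance
  have lim0 : ∀ {g γ}, LimitOrdW r γ → ClU r g γ → ∀ β, g = (fun _ => β) → OrdW r β → SubW r β γ := by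
    rintro g γ hγ hc β rfl hb z hz
    obtain ⟨x, hx⟩ := hγ.2.1
    obtain ⟨δ, h1, h2⟩ := hc x hx
    exact hγ.1.trans h1 (h2 z hz)
  -- terms
  have tm : ∀ {n : ℕ} (t : Unit → (Fin n → {x : V // Lv r E x}) → {x : V // Lv r E x}),
      IsTm (fun _ => True) t → ∃ β, OrdW r β ∧ ∃ s : (Fin n → V) → V, (∀ w, (t () w).1 = s (fun j => (w j).1)) ∧
        ∀ γ, LimitOrdW r γ → SubW r β γ → ∃ s' : (Fin n → Sub r (E γ)) → Sub r (E γ),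
          DFn (ι := Unit) (V := fun _ => Sub r (E γ)) (fun _ => srel r (E γ)) (fun _ => True) (fun _ => s') ∧
          ∀ w, (s' w).1 = s (fun j => (w j).1) := by
    rintro n t (⟨j, rfl⟩ | ⟨c, -, rfl⟩)
    · exact ⟨emp r, ordW_emp, fun v => v j, fun _ => rfl, fun γ _ _ => ⟨fun w => w j, inferInstance, fun _ => rfl⟩⟩
    · obtain ⟨β, h1, h2⟩ := (c ()).2
      exact ⟨β, h1, fun _ => (c ()).1, fun _ => rfl, fun γ hγ hs =>
        ⟨fun _ => ⟨(c ()).1, Lv.bound E mono h1 h2 hγ.1 hs⟩, inferInstance, fun _ => rfl⟩⟩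
  have tmd : ∀ {n : ℕ} (t s : Unit → (Fin n → {x : V // Lv r E x}) → {x : V // Lv r E x}),
      IsTm (fun _ => True) t → IsTm (fun _ => True) s → 
      Dfb (fun a b : {x : V // Lv r E x} => r a.1 b.1) (fun v => r (t () v).1 (s () v).1) ∧
      Dfb (fun a b : {x : V // Lv r E x} => r a.1 b.1) (fun v => t () v = s () v) := by
    have : ∀ {n : ℕ} (t : Unit → (Fin n → {x : V // Lv r E x}) → {x : V // Lv r E x}), IsTm (fun _ => True) t →
      DFn (ι := Unit) (V := fun _ => {x : V // Lv r E x}) (fun _ a b => r a.1 b.1) (fun _ => True) t := by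
      rintro n t (⟨j, rfl⟩ | ⟨c, -, rfl⟩)
      · infer_instance
      · exact DFn.constP _ trivial
    intro n t s ht hs
    haveI h1 := this t ht
    haveI h2 := this s hs
    exact ⟨Df.mem (f := t) (g := s), Df.eq (f := t) (g := s)⟩
  refine Df.induct (ι := Unit) (V := fun _ => {x : V // Lv r E x}) (r := fun _ a b => r a.1 b.1)
    (P := fun _ => True)
    (C := fun n R => ∃ g : V → V, Df₁ r g ∧ (∀ x, OrdW r (g x)) ∧ Dfb (fun a b : {x : V // Lv r E x} => r a.1 b.1) (R ()) ∧
      RflAt E g (R ())) ?_ ?_ ?_ ?_ ?_ h |>.imp fun g h => ⟨h.1, h.2.1, h.2.2.2⟩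
  · intro n t s ht hs
    obtain ⟨β, hb, t1, ht1, ht2⟩ := tm t ht
    obtain ⟨β', hb', s1, hs1, hs2⟩ := tm s hs
    refine ⟨fun _ => un r β β', inferInstance, fun _ => hb.un hb', (tmd t s ht hs).1, fun _ v => r (t1 v) (s1 v), fun γ hγ hc => ?_⟩
    have hs := lim0 hγ hc _ rfl (hb.un hb')
    obtain ⟨t2, ht3, ht4⟩ := ht2 γ hγ fun z hz => hs z (mem_un.2 (.inl hz))
    obtain ⟨s2, hs3, hs4⟩ := hs2 γ hγ fun z hz => hs z (mem_un.2 (.inr hz))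
    refine ⟨?_, fun w _ => by simp only [ht1, hs1]⟩
    simp only [← ht4, ← hs4]
    exact Df.mem (f := fun _ => t2) (g := fun _ => s2)
  · intro n t s ht hs
    obtain ⟨β, hb, t1, ht1, ht2⟩ := tm t ht
    obtain ⟨β', hb', s1, hs1, hs2⟩ := tm s hs
    refine ⟨fun _ => un r β β', inferInstance, fun _ => hb.un hb', (tmd t s ht hs).2, fun _ v => t1 v = s1 v, fun γ hγ hc => ?_⟩
    have hs := lim0 hγ hc _ rfl (hb.un hb')
    obtain ⟨t2, ht3, ht4⟩ := ht2 γ hγ fun z hz => hs z (mem_un.2 (.inl hz))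
    obtain ⟨s2, hs3, hs4⟩ := hs2 γ hγ fun z hz => hs z (mem_un.2 (.inr hz))
    refine ⟨?_, fun w _ => by simp only [Subtype.ext_iff, ht1, hs1]⟩
    simp only [← ht4, ← hs4, ← Subtype.ext_iff]
    exact Df.eq (f := fun _ => t2) (g := fun _ => s2)
  · exact fun n => ⟨fun _ => emp r, inferInstance, fun _ => ordW_emp, Df.prop False, fun _ _ => False, fun γ _ _ =>
      ⟨Df.prop False, fun _ _ => Iff.rfl⟩⟩
  · rintro n R S ⟨g, h1, h2, h3, Q, h4⟩ ⟨g', h1', h2', h3', Q', h4'⟩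
    refine ⟨fun x => un r (g x) (g' x), DFn.comp2 (F := fun _ => un r) inferInstance _ _, fun x => (h2 x).un (h2' x),
      Df.imp, fun γ v => Q γ v → Q' γ v, fun γ hγ hc => ?_⟩
    obtain ⟨h5, h6⟩ := h4 γ hγ (hc.mono fun x z hz => mem_un.2 (.inl hz))
    obtain ⟨h5', h6'⟩ := h4' γ hγ (hc.mono fun x z hz => mem_un.2 (.inr hz))
    exact ⟨Df.imp, fun w hw => imp_congr (h6 w hw) (h6' w hw)⟩
  · rintro n R ⟨g, h1, h2, h3, Q, h4⟩
    have hR : Df (ι := Unit) (V := fun _ => V) (fun _ => r) (fun _ => True) (fun _ (v : Fin (n + 1) → V) =>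
        ∃ h : ∀ j, Lv r E (v j), ¬ R () (fun j => ⟨v j, h j⟩)) :=
      Df.relativize (ι := Unit) (V := fun _ => V) (T := fun _ => Lv r E) hT (Q := fun _ => True)
        (fun _ _ => trivial) (R := fun i v => ¬ R i v) Df.not
    set R' := fun (v : Fin (n + 1) → V) => ∃ h : ∀ j, Lv r E (v j), ¬ R () (fun j => ⟨v j, h j⟩) with hR'
    haveI : Df (ι := Unit) (V := fun _ => V) (fun _ => r) (fun _ => True) (fun _ (w : Fin (n + 1 + 1 + 1) → V) =>
        R' (Fin.snoc (α := fun _ => V) (fun j => w (Fin.castSucc (Fin.castSucc j.succ))) (w (Fin.last _)))) :=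
      (hR.rename (Fin.lastCases (Fin.last _) fun j => Fin.castSucc (Fin.castSucc j.succ))).congr fun _ w => by
        have : (fun j => w ((Fin.lastCases (Fin.last _) (fun j => Fin.castSucc (Fin.castSucc j.succ)) : Fin (n + 1) → Fin (n + 1 + 1 + 1)) j)) =
          (Fin.snoc (α := fun _ => V) (fun j => w (Fin.castSucc (Fin.castSucc j.succ))) (w (Fin.last _)) : Fin (n + 1) → V) := by
          funext j; refine Fin.lastCases ?_ (fun j => ?_) j <;> simp
        rw [← this]
    obtain ⟨F, hF1, hF2, hF3⟩ := exists_bound_tuple E n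
      (fun w => lst r (fun β => ∃ y, r y (E β) ∧ R' (Fin.snoc (α := fun _ => V) (fun j => w j.succ) y)))
      inferInstance (fun _ => ordW_lst _)
    refine ⟨fun x => un r (g x) (F x), DFn.comp2 (F := fun _ => un r) inferInstance _ _, fun x => (h2 x).un (hF2 x),
      Df.allv h3, fun γ v => ∀ y, r y (E γ) → Q γ (Fin.snoc (α := fun _ => V) v y), fun γ hγ hc => ?_⟩
    obtain ⟨h5, h6⟩ := h4 γ hγ (hc.mono fun x z hz => mem_un.2 (.inl hz))
    have sn : ∀ {T : V → Prop} (w : Fin n → {x : V // T x}) (y : {x : V // T x}),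
        (fun j => ((Fin.snoc (α := fun _ => {x : V // T x}) w y : Fin (n + 1) → {x : V // T x}) j).1) =
          (Fin.snoc (α := fun _ => V) (fun j => (w j).1) y.1 : Fin (n + 1) → V) := fun w y => by
      funext j; refine Fin.lastCases ?_ (fun j => ?_) j <;> simp
    refine ⟨(Df.allv h5).congr fun _ w => ⟨fun h y hy => ?_, fun h y => ?_⟩, fun w hw => ⟨fun h y hy => ?_, fun h y => ?_⟩⟩
    · have := h ⟨y, hy⟩
      dsimp only at this
      rwa [sn] at this
    · dsimp only
      rw [sn]
      exact h _ y.2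
    · have := (h6 (Fin.snoc w ⟨y, γ, hγ.1, hy⟩) fun j => by
        refine Fin.lastCases ?_ (fun j => ?_) j
        · simpa using hy
        · simpa using hw j).1 (h _)
      rwa [sn] at this
    · by_contra hy
      obtain ⟨α, hα, hα'⟩ : ∃ α, r α γ ∧ ∀ j, r (w j).1 (E α) := by
        choose f hf1 hf2 using fun j => cont γ _ hγ (hw j)
        have : ∀ m : ℕ, ∃ α, r α γ ∧ ∀ j : Fin n, (j : ℕ) < m → r (w j).1 (E α) := by
          intro m
          induction m with
          | zero => exact ⟨_, hγ.2.1.choose_spec, fun j hj => absurd hj (by omega)⟩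
          | succ m ih =>
            obtain ⟨α, h1, h2⟩ := ih
            by_cases hm : m < n
            · have ho := (hγ.1.mem h1).un (hγ.1.mem (hf1 ⟨m, hm⟩))
              refine ⟨un r α (f ⟨m, hm⟩), ?_, fun j hj => ?_⟩
              · rcases (hγ.1.mem h1).trich (hγ.1.mem (hf1 ⟨m, hm⟩)) with h | rfl | h
                · rw [show un r α (f ⟨m, hm⟩) = f ⟨m, hm⟩ from hr.ext fun z => mem_un.trans
                    ⟨fun h' => h'.elim (fun h' => (hγ.1.mem (hf1 _)).trans h h') id, .inr⟩]
                  exact hf1 _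
                · rwa [show un r (f ⟨m, hm⟩) (f ⟨m, hm⟩) = f ⟨m, hm⟩ from hr.ext fun z => mem_un.trans
                    ⟨fun h' => h'.elim id id, .inr⟩]
                · rwa [show un r α (f ⟨m, hm⟩) = α from hr.ext fun z => mem_un.trans
                    ⟨fun h' => h'.elim id (fun h' => (hγ.1.mem h1).trans h h'), .inl⟩]
              · rcases Nat.lt_succ_iff_lt_or_eq.1 hj with hj | hj
                · exact Lv.bound E mono (hγ.1.mem h1) (h2 j hj) ho fun z hz => mem_un.2 (.inl hz)
                · obtain rfl : j = ⟨m, hm⟩ := Fin.ext hj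
                  exact Lv.bound E mono (hγ.1.mem (hf1 _)) (hf2 _) ho fun z hz => mem_un.2 (.inr hz)
            · exact ⟨α, h1, fun j _ => h2 j (by omega)⟩
        exact (this n).imp fun α h => ⟨h.1, fun j => h.2 j j.2⟩
      obtain ⟨δ, hδ, hs⟩ := hc α hα
      have hex : ∃ β, OrdW r β ∧ ∃ y, r y (E β) ∧ R' (Fin.snoc (α := fun _ => V) (fun j => (w j).1) y) := by
        obtain ⟨β, hβ, hyβ⟩ := y.2
        refine ⟨β, hβ, y.1, hyβ, ?_⟩
        rw [← sn]
        exact ⟨fun j => (Fin.snoc (α := fun _ => {x : V // Lv r E x}) w y j : {x : V // Lv r E x}).2, hy⟩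
      obtain ⟨h7, ⟨z, hz, hz2⟩, -⟩ := lst_spec hex
      have hzγ : r z (E γ) := by
        refine Lv.bound E mono h7 hz hγ.1 fun x hx => hγ.1.trans hδ (hs x (mem_un.2 (.inr (hF3 α (fun j => (w j).1) hα' x ?_))))
        simpa using hx
      obtain ⟨h8, h9⟩ := hz2
      refine h9 (((h6 _ fun j => ?_).2 (h z hzγ)))
      refine Fin.lastCases ?_ (fun j => ?_) j
      · simpa using hzγ
      · simpa using hw j

end Reflect

/-- The membership relation of a class. -/
abbrev crel {V : Type u} (r : V → V → Prop) (T : V → Prop) : {x : V // T x} → {x : V // T x} → Prop :=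
  fun a b => r a.1 b.1

section Crel

variable {V : Type u} {r : V → V → Prop} {T : V → Prop} (tr : ∀ x y, T x → r y x → T y)

include tr

theorem crel_transW {a : {x : V // T x}} : TransW (crel r T) a ↔ TransW r a.1 :=
  ⟨fun h x y hx hy => h ⟨x, tr _ _ a.2 hx⟩ ⟨y, tr _ _ (tr _ _ a.2 hx) hy⟩ hx hy, fun h x y hx hy => h x.1 y.1 hx hy⟩

theorem crel_ordW {a : {x : V // T x}} : OrdW (crel r T) a ↔ OrdW r a.1 :=
  and_congr (crel_transW tr) ⟨fun h x hx => (crel_transW tr).1 (h ⟨x, tr _ _ a.2 hx⟩ hx),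
    fun h x hx => (crel_transW tr).2 (h x.1 hx)⟩

theorem crel_limitOrdW {a : {x : V // T x}} : LimitOrdW (crel r T) a ↔ LimitOrdW r a.1 :=
  and_congr (crel_ordW tr) (and_congr ⟨fun ⟨x, hx⟩ => ⟨x.1, hx⟩, fun ⟨x, hx⟩ => ⟨⟨x, tr _ _ a.2 hx⟩, hx⟩⟩
    ⟨fun h x hx => let ⟨y, h1, h2⟩ := h ⟨x, tr _ _ a.2 hx⟩ hx; ⟨y.1, h1, h2⟩,
      fun h x hx => let ⟨y, h1, h2⟩ := h x.1 hx; ⟨⟨y, tr _ _ a.2 h1⟩, h1, h2⟩⟩)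

theorem crel_isOmegaW {a : {x : V // T x}} : IsOmegaW (crel r T) a ↔ IsOmegaW r a.1 :=
  and_congr (crel_limitOrdW tr) ⟨fun h x hx hl => h ⟨x, tr _ _ a.2 hx⟩ hx ((crel_limitOrdW tr).2 hl),
    fun h x hx hl => h x.1 hx ((crel_limitOrdW tr).1 hl)⟩

theorem crel_isUPair {a b c : {x : V // T x}} : IsUPair (crel r T) a b c ↔ IsUPair r a.1 b.1 c.1 :=
  ⟨fun h z => ⟨fun hz => ((h ⟨z, tr _ _ a.2 hz⟩).1 hz).imp (congrArg Subtype.val) (congrArg Subtype.val), fun hz => by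
    rcases hz with rfl | rfl
    · exact (h b).2 (.inl rfl)
    · exact (h c).2 (.inr rfl)⟩, fun h z => (h z.1).trans (by rw [Subtype.ext_iff, Subtype.ext_iff])⟩

end Crel

section Hier

variable {V : Type u} {r : V → V → Prop} [hr : ZFm r]

theorem exists_limit {α : V} (ha : OrdW r α) : ∃ γ, LimitOrdW r γ ∧ r α γ :=
  let ⟨γ, h1, h2, _⟩ := exists_closed (r := r) (fun _ => emp r) (fun _ _ => ordW_emp) ha
  ⟨γ, h1, h2⟩

theorem exists_limit₂ {α β : V} (ha : OrdW r α) (hb : OrdW r β) : ∃ γ, LimitOrdW r γ ∧ r α γ ∧ r β γ := by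
  obtain ⟨γ, h1, h2⟩ := exists_limit (ha.un hb).succ
  refine ⟨γ, h1, h1.1.le_trans ?_ (h1.1.trans h2 (self_mem_succ _)), h1.1.le_trans ?_ (h1.1.trans h2 (self_mem_succ _))⟩
  · exact (ha.sub_iff (ha.un hb)).1 fun z hz => mem_un.2 (.inl hz)
  · exact (hb.sub_iff (ha.un hb)).1 fun z hz => mem_un.2 (.inr hz)

variable (E : V → V) [hE : Df₁ r E]
  (mono : ∀ α β, OrdW r β → r α β → SubW r (E α) (E β))
  (cont : ∀ γ x, LimitOrdW r γ → r x (E γ) → ∃ α, r α γ ∧ r x (E α))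
  (tr : ∀ α, OrdW r α → TransW r (E α))
  (hdef : ∀ γ, LimitOrdW r γ → ∀ Q : Sub r (E γ) → Prop, Dp (srel r (E γ)) Q →
    ∃ b, Lv r E b ∧ ∀ x, r x b ↔ ∃ hx, Q ⟨x, hx⟩)
  (hom : Lv r E (om r))

include tr in
theorem Lv.trans {x y : V} (h : Lv r E x) (hy : r y x) : Lv r E y :=
  let ⟨α, h1, h2⟩ := h; ⟨α, h1, tr α h1 _ _ h2 hy⟩

include mono cont tr hdef in
/-- Definable separation in `Lv`. -/
theorem Lv.sep {Q : {x : V // Lv r E x} → Prop} (hQ : Dp (crel r (Lv r E)) Q) (a : {x : V // Lv r E x}) :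
    ∃ b : {x : V // Lv r E x}, ∀ x : {x : V // Lv r E x}, r x.1 b.1 ↔ r x.1 a.1 ∧ Q x := by
  obtain ⟨α, h1, h2⟩ := a.2
  obtain ⟨g, hg, ho, Q', h3⟩ := exists_rflAt E mono cont (n := 1)
    (R := fun v => r (v 0).1 a.1 ∧ Q (v 0))
    (@Df.and _ _ _ _ _ _ _ (Df.mem (r := fun _ => crel r (Lv r E)) (f := fun _ v => v 0) (g := fun _ _ => a)) hQ)
  obtain ⟨γ, hγ, hα, hc⟩ := exists_closed g (fun x _ => ho x) h1
  obtain ⟨h4, h5⟩ := h3 γ hγ hc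
  obtain ⟨b, hb, hb'⟩ := hdef γ hγ (fun x => Q' γ (fun _ => x.1)) (Df.congr h4 fun _ v => by
    have : (fun j => (v j).1) = fun _ => (v 0).1 := by
      funext j
      rw [Fin.fin_one_eq_zero j]
    dsimp only
    rw [this])
  refine ⟨⟨b, hb⟩, fun x => (hb' x.1).trans ⟨fun ⟨hx, h⟩ => (h5 (fun _ => x) fun _ => hx).2 h, fun h => ?_⟩⟩
  have hx : r x.1 (E γ) := mono α γ hγ.1 hα _ (tr α h1 _ _ h2 h.1)
  exact ⟨hx, (h5 (fun _ => x) fun _ => hx).1 h⟩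

include mono cont tr hdef hom in
theorem zfm_Lv : ZFm (crel r (Lv r E)) := by
  haveI : ∀ {n : ℕ} (f : Unit → (Fin n → V) → V)
    [DFn (ι := Unit) (V := fun _ => V) (fun _ => r) (fun _ => True) f],
    DFn (ι := Unit) (V := fun _ => V) (fun _ => r) (fun _ => True) (fun i v => E (f i v)) :=
    fun f _ => Df₁.app hE f
  haveI hT : Dp r (Lv r E) := by unfold Lv; infer_instance
  have tr' : ∀ x y, Lv r E x → r y x → Lv r E y := fun x y => Lv.trans E tr
  have top : ∀ γ, LimitOrdW r γ → Lv r E (E γ) := fun γ hγ => by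
    obtain ⟨b, hb, h⟩ := hdef γ hγ (fun _ => True) (Df.prop True)
    rwa [show E γ = b from hr.ext fun z => by rw [h]; simp]
  refine ⟨InvImage.wf _ hr.wf, fun {x y} h => Subtype.ext (hr.ext fun z => ⟨fun hz => (h ⟨z, tr' _ _ x.2 hz⟩).1 hz,
    fun hz => (h ⟨z, tr' _ _ y.2 hz⟩).2 hz⟩), fun x y => ?_, fun x => ?_, ⟨⟨om r, hom⟩, (crel_isOmegaW tr').2 isOmegaW_om⟩,
    fun Q hQ a => Lv.sep E mono cont tr hdef hQ a, fun Q hQ a hf => ?_⟩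
  · obtain ⟨α, h1, h2⟩ := x.2
    obtain ⟨β, h3, h4⟩ := y.2
    obtain ⟨γ, hγ, h5, h6⟩ := exists_limit₂ h1 h3
    have hx := mono _ _ hγ.1 h5 _ h2
    have hy := mono _ _ hγ.1 h6 _ h4
    obtain ⟨b, hb, hb'⟩ := hdef γ hγ (fun z => z = ⟨x.1, hx⟩ ∨ z = ⟨y.1, hy⟩) inferInstance
    refine ⟨⟨b, hb⟩, fun z => (hb' z.1).trans ⟨fun ⟨_, h⟩ => ?_, fun h => ?_⟩⟩
    · simpa [Subtype.ext_iff] using h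
    · rcases h with rfl | rfl
      · exact ⟨hx, .inl rfl⟩
      · exact ⟨hy, .inr rfl⟩
  · obtain ⟨α, h1, h2⟩ := x.2
    obtain ⟨γ, hγ, h5⟩ := exists_limit h1
    have hx := mono _ _ hγ.1 h5 _ h2
    obtain ⟨b, hb, hb'⟩ := hdef γ hγ (fun z => ∃ y, srel r (E γ) y ⟨x.1, hx⟩ ∧ srel r (E γ) z y) inferInstance
    refine ⟨⟨b, hb⟩, fun z => (hb' z.1).trans ⟨fun ⟨_, y, h, h'⟩ => ⟨⟨y.1, γ, hγ.1, y.2⟩, h, h'⟩, fun ⟨y, h, h'⟩ => ?_⟩⟩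
    have hy := tr _ hγ.1 _ _ hx h
    exact ⟨tr _ hγ.1 _ _ hy h', ⟨y.1, hy⟩, h, h'⟩
  · haveI hQ' := Df.relativize₂ (T := Lv r E) (R := Q) hQ
    haveI : ∀ {n : ℕ} (f g : Unit → (Fin n → V) → V)
      [DFn (ι := Unit) (V := fun _ => V) (fun _ => r) (fun _ => True) f]
      [DFn (ι := Unit) (V := fun _ => V) (fun _ => r) (fun _ => True) g],
      Df (ι := Unit) (V := fun _ => V) (fun _ => r) (fun _ => True) (fun i v => ∃ (h : Lv r E (f i v)) (h' : Lv r E (g i v)),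
        Q ⟨f i v, h⟩ ⟨g i v, h'⟩) := fun f g _ _ => Dp₂.app hQ' f g
    let B := iUn r a.1 (fun x => succ r (lst r (fun β => ∃ y, r y (E β) ∧ ∃ (h : Lv r E x) (h' : Lv r E y), Q ⟨x, h⟩ ⟨y, h'⟩)))
    have hB : OrdW r B := OrdW.iUn fun x hx => (ordW_lst _).succ
    obtain ⟨γ, hγ, hBγ⟩ := exists_limit hB
    obtain ⟨b, hb⟩ := Lv.sep E mono cont tr hdef (Q := fun y => ∃ x, crel r (Lv r E) x a ∧ Q x y) (by
      haveI : ∀ {n : ℕ} (f g : Unit → (Fin n → {x : V // Lv r E x}) → {x : V // Lv r E x})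
        [DFn (ι := Unit) (V := fun _ => {x : V // Lv r E x}) (fun _ => crel r (Lv r E)) (fun _ => True) f]
        [DFn (ι := Unit) (V := fun _ => {x : V // Lv r E x}) (fun _ => crel r (Lv r E)) (fun _ => True) g],
        Df (ι := Unit) (V := fun _ => {x : V // Lv r E x}) (fun _ => crel r (Lv r E)) (fun _ => True) (fun i v =>
        Q (f i v) (g i v)) := fun f g _ _ => Df.comp2 (Q := fun _ => Q) hQ f g
      infer_instance) ⟨E γ, top γ hγ⟩
    refine ⟨b, fun y => (hb y).trans ⟨And.right, fun h => ⟨?_, h⟩⟩⟩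
    obtain ⟨x, hx, hxy⟩ := h
    obtain ⟨α, h1, h2⟩ := y.2
    obtain ⟨h3, ⟨y', h4, h5, h6, h7⟩, -⟩ := lst_spec (r := r) (Q := fun β => ∃ y, r y (E β) ∧
      ∃ (h : Lv r E x) (h' : Lv r E y), Q ⟨x, h⟩ ⟨y, h'⟩) ⟨α, h1, y.1, h2, x.2, y.2, hxy⟩
    obtain rfl := hf _ _ _ hx hxy h7
    exact Lv.bound E mono h3 h4 hγ.1 fun z hz => hγ.1.trans hBγ (mem_iUn.2 ⟨x.1, hx, mem_succ.2 (.inl hz)⟩)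

end Hier

section Ops

variable {V : Type u} (r : V → V → Prop) [hr : ZFm r]

/-- The least `μ ≤ a` such that some pair of ordinals `≤ μ` is not in `A`. -/
noncomputable def prM (a A : V) : V :=
  lstB r (succ r a) (fun μ => ∃ x, r x (succ r μ) ∧ ∃ y, r y (succ r μ) ∧ ¬ r (op r x y) A)

/-- The first coordinate of the least pair of ordinals not in `A`. -/
noncomputable def prX (a A : V) : V :=
  lstB r (succ r (prM r a A)) (fun x => ∃ y, r y (succ r (prM r a A)) ∧ ¬ r (op r x y) A)

/-- The second coordinate of the least pair of ordinals not in `A`. -/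
noncomputable def prY (a A : V) : V :=
  lstB r (succ r (prM r a A)) (fun y => ¬ r (op r (prX r a A) y) A)

/-- The recursion step of `prf`. -/
noncomputable def prStep (a s : V) : V :=
  op r (prX r a (imS r a (app r s))) (prY r a (imS r a (app r s)))

/-- A definable bijection of the ordinals with the pairs of ordinals. -/
noncomputable def prf (a : V) : V := recF r (prStep r) a

end Ops

section Fns
variable {ι : Type w} {V : ι → Type u} {r : ∀ i, V i → V i → Prop} {P : (∀ i, V i) → Prop} {n : ℕ}
  [hr : ∀ i, ZFm (r i)] (f g : ∀ i, (Fin n → V i) → V i) [DFn r P f] [DFn r P g]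

instance : DFn r P (fun i v => prM (r i) (f i v) (g i v)) :=
  DFn.comp2 (F := fun i => prM (r i)) (by unfold prM; infer_instance) f g
instance : DFn r P (fun i v => prX (r i) (f i v) (g i v)) :=
  DFn.comp2 (F := fun i => prX (r i)) (by unfold prX; infer_instance) f g
instance : DFn r P (fun i v => prY (r i) (f i v) (g i v)) :=
  DFn.comp2 (F := fun i => prY (r i)) (by unfold prY; infer_instance) f g
instance : DFn r P (fun i v => prStep (r i) (f i v) (g i v)) :=
  DFn.comp2 (F := fun i => prStep (r i)) (by unfold prStep; infer_instance) f g
instance : DFn r P (fun i v => prf (r i) (f i v)) :=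
  DFn.comp1 (F := fun i => prf (r i)) (by unfold prf; infer_instance) f
end Fns

section Pairing

variable {V : Type u} {r : V → V → Prop} [hr : ZFm r]

theorem OrdW.mem_succ_iff {α β : V} (ha : OrdW r α) (hb : OrdW r β) : r α (VLC.succ r β) ↔ SubW r α β := by
  rw [mem_succ (r := r), ha.sub_iff hb]

theorem recF_ord {G : V → V → V} [Df₂ r G] {α : V} (h : OrdW r α) :
    recF r G α = G α (lamS r α (recF r G)) := by
  rw [recF_eq (r := r), h.tc]

theorem prf_eq {α : V} (h : OrdW r α) :
    prf r α = op r (prX r α (imS r α (prf r))) (prY r α (imS r α (prf r))) := by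
  have : imS r α (app r (lamS r α (prf r))) = imS r α (prf r) := hr.ext fun z => by
    rw [mem_imS (r := r), mem_imS (r := r)]
    exact exists_congr fun x => and_congr_right fun hx => by rw [app_lamS hx]
  rw [prf, recF_ord h, prStep, show recF r (prStep r) = prf r from rfl, this]

theorem prf_spec {α : V} (h : OrdW r α) : ∃ x y, prf r α = op r x y ∧ r x (succ r α) ∧
    r y (succ r α) ∧ (∀ β, r β α → prf r β ≠ op r x y) ∧
    ∀ μ, OrdW r μ → (∃ x y, r x (succ r μ) ∧ r y (succ r μ) ∧ ∀ β, r β α → prf r β ≠ op r x y) →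
      r x (succ r μ) ∧ r y (succ r μ) := by
  induction α using hr.wf.induction with
  | _ α ih =>
  set A := imS r α (prf r) with hA
  have mA : ∀ x y, ¬ r (op r x y) A ↔ ∀ β, r β α → prf r β ≠ op r x y := fun x y => by
    rw [hA, mem_imS (r := r)]
    push Not
    exact forall₂_congr fun _ _ => ne_comm
  have hα : ¬ r (op r α α) A := (mA _ _).2 fun β hβ he => by
    obtain ⟨x, y, h1, h2, -⟩ := ih β hβ (h.mem hβ)
    obtain ⟨rfl, -⟩ := op_inj.1 (he.symm.trans h1)
    rcases mem_succ.1 h2 with h2 | rfl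
    · exact hr.not_self _ ((h.mem hβ).trans h2 hβ)
    · exact hr.not_self _ hβ
  obtain ⟨m1, ⟨x0, m2, y0, m3, m4⟩, m5⟩ := lstB_spec (r := r) h.succ
    (Q := fun μ => ∃ x, r x (succ r μ) ∧ ∃ y, r y (succ r μ) ∧ ¬ r (op r x y) A)
    ⟨α, self_mem_succ α, α, self_mem_succ α, α, self_mem_succ α, hα⟩
  change r (prM r α A) _ at m1
  change r _ (succ r (prM r α A)) at m2 m3
  have hM : OrdW r (prM r α A) := h.succ.mem m1
  obtain ⟨x1, ⟨y1, x2, x3⟩, -⟩ := lstB_spec (r := r) hM.succ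
    (Q := fun x => ∃ y, r y (succ r (prM r α A)) ∧ ¬ r (op r x y) A) ⟨x0, m2, y0, m3, m4⟩
  change r (prX r α A) _ at x1
  obtain ⟨y2, y3, -⟩ := lstB_spec (r := r) hM.succ
    (Q := fun y => ¬ r (op r (prX r α A) y) A) ⟨y1, x2, x3⟩
  change r (prY r α A) _ at y2
  have le : SubW r (succ r (prM r α A)) (succ r α) := fun z hz => by
    rw [(hM.succ.mem hz).mem_succ_iff h]
    rw [(hM.succ.mem hz).mem_succ_iff hM] at hz
    rw [hM.mem_succ_iff h] at m1
    exact fun w hw => m1 w (hz w hw)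
  refine ⟨prX r α A, prY r α A, prf_eq h, le _ x1, le _ y2, (mA _ _).1 y3, ?_⟩
  rintro μ hμ ⟨x, y, hx, hy, hxy⟩
  have : SubW r (prM r α A) μ := by
    by_cases hc : r μ (succ r α)
    · exact (hM.sub_iff hμ).2 (by
        rcases hM.trich hμ with h | h | h
        · exact .inl h
        · exact .inr h
        · exact absurd h (m5 μ hc ⟨x, hx, y, hy, (mA _ _).2 hxy⟩))
    · exact fun z hz => hμ.not_mem h.succ hc z (h.succ.trans m1 hz)
  have h1 := hM.succ.mem x1
  have h2 := hM.succ.mem y2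
  rw [h1.mem_succ_iff hM] at x1
  rw [h2.mem_succ_iff hM] at y2
  rw [h1.mem_succ_iff hμ, h2.mem_succ_iff hμ]
  exact ⟨fun w hw => this w (x1 w hw), fun w hw => this w (y2 w hw)⟩

theorem prf_inj {α β : V} (ha : OrdW r α) (hb : OrdW r β) (h : prf r α = prf r β) : α = β := by
  rcases ha.trich hb with h1 | h1 | h1
  · obtain ⟨x, y, h2, -, -, h3, -⟩ := prf_spec hb
    exact absurd (h.trans h2) (h3 _ h1)
  · exact h1
  · obtain ⟨x, y, h2, -, -, h3, -⟩ := prf_spec ha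
    exact absurd (h.symm.trans h2) (h3 _ h1)

theorem exists_prf {x y : V} (hx : OrdW r x) (hy : OrdW r y) : ∃ α, OrdW r α ∧ prf r α = op r x y := by
  by_contra! hc
  have hμ := hx.un hy
  set μ := un r x y
  have key : ∀ α, OrdW r α → r (prf r α) (prd r (succ r μ) (succ r μ)) := fun α ha => by
    obtain ⟨x', y', h1, -, -, -, h2⟩ := prf_spec ha
    obtain ⟨h3, h4⟩ := h2 μ hμ ⟨x, y, (hx.mem_succ_iff hμ).2 fun z hz => mem_un.2 (.inl hz),
      (hy.mem_succ_iff hμ).2 fun z hz => mem_un.2 (.inr hz), fun β hβ => hc β (ha.mem hβ)⟩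
    exact mem_prd.2 ⟨_, _, h3, h4, h1⟩
  have hO : OrdW r (iUn r (prd r (succ r μ) (succ r μ)) (fun z => succ r (lst r (fun β => prf r β = z)))) :=
    OrdW.iUn fun z _ => (ordW_lst _).succ
  refine hr.not_self _ (mem_iUn (r := r)
    (F := fun z => succ r (lst r (fun β => prf r β = z))) |>.2 ⟨_, key _ hO, ?_⟩)
  set O := iUn r (prd r (succ r μ) (succ r μ)) (fun z => succ r (lst r (fun β => prf r β = z)))
  have : lst r (fun β => prf r β = prf r O) = O := lst_eq hO rfl fun β hβ he =>
    hr.not_self O (by rwa [prf_inj (hO.mem hβ) hO he] at hβ)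
  show r O (succ r (lst r (fun β => prf r β = prf r O)))
  rw [this]
  exact self_mem_succ _

theorem prf_op {α x y : V} (h : OrdW r α) (he : prf r α = op r x y) :
    OrdW r x ∧ OrdW r y ∧ SubW r x α ∧ SubW r y α := by
  obtain ⟨x', y', h1, h2, h3, -⟩ := prf_spec h
  obtain ⟨rfl, rfl⟩ := op_inj.1 (he.symm.trans h1)
  have hx := h.succ.mem h2
  have hy := h.succ.mem h3
  exact ⟨hx, hy, (hx.mem_succ_iff h).1 h2, (hy.mem_succ_iff h).1 h3⟩

end Pairing

namespace TEmb

variable {V : Type u} {V' : Type v} {r : V → V → Prop} {r' : V' → V' → Prop} [hr : ZFm r]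
  [hr' : ZFm r'] (T : TEmb r r')

theorem prM (a A : V) : T.i (prM r a A) = prM r' (T.i a) (T.i A) := by
  rw [VLC.prM, VLC.prM, ← T.succ]
  refine T.lstB fun x hx => ?_
  rw [← T.succ, T.bex]
  simp only [T.bex, ← T.op, T.mem]

theorem prX (a A : V) : T.i (prX r a A) = prX r' (T.i a) (T.i A) := by
  rw [VLC.prX, VLC.prX, ← T.prM, ← T.succ]
  refine T.lstB fun x hx => ?_
  simp only [T.bex, ← T.op, T.mem]

theorem prY (a A : V) : T.i (prY r a A) = prY r' (T.i a) (T.i A) := by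
  rw [VLC.prY, VLC.prY, ← T.prM, ← T.prX, ← T.succ]
  refine T.lstB fun x hx => ?_
  simp only [← T.op, T.mem]

@[simp] theorem prf (a : V) : T.i (prf r a) = prf r' (T.i a) := by
  refine T.recF (fun x s => ?_) a
  rw [prStep, prStep, T.op, T.prX, T.prY, T.imS (F' := VLC.app r' (T.i s)) fun x _ => T.app _ _]

end TEmb

section Ops

variable {V : Type u} (r : V → V → Prop) [hr : ZFm r]

/-- The operation coded by an ordinal. -/
noncomputable def dk (a : V) : V := fst r (prf r (fst r (prf r a)))
/-- The first argument coded by an ordinal. -/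
noncomputable def da (a : V) : V := fst r (prf r (snd r (prf r a)))
/-- The second argument coded by an ordinal. -/
noncomputable def db (a : V) : V := snd r (prf r (snd r (prf r a)))

open Classical in
/-- The recursion step of `e`. -/
noncomputable def eStep (a s : V) : V :=
  if r (da r a) a ∧ r (db r a) a then
    if dk r a = emp r then adj r (app r s (da r a)) (app r s (db r a))
    else dsub r (imS r (da r a) (app r s)) (fst r (app r s (db r a)))
      (fst r (snd r (app r s (db r a)))) (snd r (snd r (app r s (db r a))))
  else emp r

/-- The enumeration of the constructible sets by ordinals. -/
noncomputable def e (a : V) : V := recF r (eStep r) a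

/-- The set of the constructible sets with index in `a`. -/
noncomputable def ee (a : V) : V := imS r a (e r)

end Ops

section Fns
variable {ι : Type w} {V : ι → Type u} {r : ∀ i, V i → V i → Prop} {P : (∀ i, V i) → Prop} {n : ℕ}
  [hr : ∀ i, ZFm (r i)] (f g : ∀ i, (Fin n → V i) → V i) [DFn r P f] [DFn r P g]

instance DFn.ite_dec {C : ∀ i, (Fin n → V i) → Prop} [d : ∀ i v, Decidable (C i v)] [hC : Df r P C] :
    DFn r P (fun i v => if C i v then f i v else g i v) := by
  have := DFn.ite (r := r) (P := P) f g (C := C)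
  convert this

instance : DFn r P (fun i v => dk (r i) (f i v)) :=
  DFn.comp1 (F := fun i => dk (r i)) (by unfold dk; infer_instance) f
instance : DFn r P (fun i v => da (r i) (f i v)) :=
  DFn.comp1 (F := fun i => da (r i)) (by unfold da; infer_instance) f
instance : DFn r P (fun i v => db (r i) (f i v)) :=
  DFn.comp1 (F := fun i => db (r i)) (by unfold db; infer_instance) f
instance : DFn r P (fun i v => eStep (r i) (f i v) (g i v)) :=
  DFn.comp2 (F := fun i => eStep (r i)) (by unfold eStep; infer_instance) f g
instance : DFn r P (fun i v => e (r i) (f i v)) :=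
  DFn.comp1 (F := fun i => e (r i)) (by unfold e; infer_instance) f
instance : DFn r P (fun i v => ee (r i) (f i v)) :=
  DFn.comp1 (F := fun i => ee (r i)) (by unfold ee; infer_instance) f
end Fns

section Hierarchy

variable {V : Type u} {r : V → V → Prop} [hr : ZFm r]

theorem imS_congr {a : V} {F F' : V → V} [Df₁ r F] [Df₁ r F'] (h : ∀ x, r x a → F x = F' x) :
    imS r a F = imS r a F' := hr.ext fun z => by
  rw [mem_imS (r := r), mem_imS (r := r)]
  exact exists_congr fun x => and_congr_right fun hx => by rw [h x hx]

theorem mem_ee {a x : V} : r x (ee r a) ↔ ∃ β, r β a ∧ x = e r β := mem_imS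

open Classical in
theorem e_eq {α : V} (h : OrdW r α) : e r α = if r (da r α) α ∧ r (db r α) α then
    if dk r α = emp r then adj r (e r (da r α)) (e r (db r α))
    else dsub r (ee r (da r α)) (fst r (e r (db r α)))
      (fst r (snd r (e r (db r α)))) (snd r (snd r (e r (db r α))))
  else emp r := by
  conv_lhs => rw [e, recF_ord h, eStep]
  split_ifs with h1 h2
  · rw [app_lamS h1.1, app_lamS h1.2]; rfl
  · rw [app_lamS h1.2]
    have : imS r (da r α) (app r (lamS r α (recF r (eStep r)))) = ee r (da r α) :=
      imS_congr fun x hx => app_lamS (h.trans h1.1 hx)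
    rw [this]; rfl
  · rfl

theorem exists_code {k a b : V} (hk : OrdW r k) (ha : OrdW r a) (hb : OrdW r b) :
    ∃ α, OrdW r α ∧ dk r α = k ∧ da r α = a ∧ db r α = b ∧ r a α ∧ r b α := by
  have hd := (ha.un hb).succ
  obtain ⟨q1, h1, h2⟩ := exists_prf hk hd
  obtain ⟨q2, h3, h4⟩ := exists_prf ha hb
  obtain ⟨α, h5, h6⟩ := exists_prf h1 h3
  have h7 := (prf_op h1 h2).2.2.2
  have h8 := (prf_op h5 h6).2.2.1
  have h9 : r (un r a b) α := h8 _ (h7 _ (self_mem_succ _))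
  refine ⟨α, h5, by simp [dk, h6, h2], by simp [da, h6, h4], by simp [db, h6, h4], h5.le_trans ?_ h9, h5.le_trans ?_ h9⟩
  · exact (ha.sub_iff (ha.un hb)).1 fun z hz => mem_un.2 (.inl hz)
  · exact (hb.sub_iff (ha.un hb)).1 fun z hz => mem_un.2 (.inr hz)

theorem ee_mono {α β : V} (hb : OrdW r β) (h : r α β) : SubW r (ee r α) (ee r β) := fun z hz =>
  let ⟨γ, h1, h2⟩ := mem_ee.1 hz
  mem_ee.2 ⟨γ, hb.trans h h1, h2⟩

theorem e_sub {α : V} (h : OrdW r α) : SubW r (e r α) (ee r α) := by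
  induction α using hr.wf.induction with
  | _ α ih =>
  intro z hz
  rw [e_eq h] at hz
  split_ifs at hz with h1 h2
  · rcases mem_adj.1 hz with h3 | rfl
    · exact ee_mono h h1.1 _ (ih _ h1.1 (h.mem h1.1) _ h3)
    · exact mem_ee.2 ⟨_, h1.2, rfl⟩
  · exact ee_mono h h1.1 _ (dsub_sub _ hz)
  · exact absurd hz mem_emp

theorem transW_ee {α : V} (h : OrdW r α) : TransW r (ee r α) := fun x y hx hy => by
  obtain ⟨β, h1, rfl⟩ := mem_ee.1 hx
  exact ee_mono h h1 _ (e_sub (h.mem h1) _ hy)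

/-- The class of the sets enumerated by `e`. -/
abbrev Ce (r : V → V → Prop) [ZFm r] : V → Prop := Lv r (ee r)

instance {ι : Type w} {V : ι → Type u} {r : ∀ i, V i → V i → Prop} {P : (∀ i, V i) → Prop} {n : ℕ}
    [hr : ∀ i, ZFm (r i)] (f : ∀ i, (Fin n → V i) → V i) [DFn r P f] :
    Df r P (fun i v => Ce (r i) (f i v)) :=
  Df.comp1 (Q := fun i => Ce (r i)) (by unfold Ce Lv; infer_instance) f

theorem ce_iff {x : V} : Ce r x ↔ ∃ α, OrdW r α ∧ x = e r α :=
  ⟨fun ⟨α, h1, h2⟩ => let ⟨β, h3, h4⟩ := mem_ee.1 h2; ⟨β, h1.mem h3, h4⟩,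
    fun ⟨α, h1, h2⟩ => ⟨succ r α, h1.succ, mem_ee.2 ⟨α, self_mem_succ α, h2⟩⟩⟩

theorem Ce.e {α : V} (h : OrdW r α) : Ce r (VLC.e r α) := ce_iff.2 ⟨α, h, rfl⟩

theorem Ce.tr (x y : V) (h : Ce r x) (hy : r y x) : Ce r y :=
  let ⟨α, h1, h2⟩ := h; ⟨α, h1, transW_ee h1 _ _ h2 hy⟩

theorem e_emp : e r (emp r) = emp r := by
  rw [e_eq ordW_emp, if_neg fun h => mem_emp h.1]

theorem Ce.emp : Ce r (emp r) := ce_iff.2 ⟨_, ordW_emp, e_emp.symm⟩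

theorem exists_e_adj {a b : V} (ha : OrdW r a) (hb : OrdW r b) :
    ∃ α, OrdW r α ∧ r a α ∧ r b α ∧ e r α = adj r (e r a) (e r b) := by
  obtain ⟨α, h1, h2, rfl, rfl, h5, h6⟩ := exists_code (r := r) ordW_emp ha hb
  exact ⟨α, h1, h5, h6, by rw [e_eq h1, if_pos ⟨h5, h6⟩, if_pos h2]⟩

theorem Ce.adj {x y : V} (hx : Ce r x) (hy : Ce r y) : Ce r (adj r x y) := by
  obtain ⟨a, ha, rfl⟩ := ce_iff.1 hx
  obtain ⟨b, hb, rfl⟩ := ce_iff.1 hy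
  obtain ⟨α, h, -, -, h'⟩ := exists_e_adj ha hb
  exact ce_iff.2 ⟨α, h, h'.symm⟩

theorem up_eq_adj (x y : V) : up r x y = VLC.adj r (VLC.adj r (VLC.emp r) x) y := hr.ext fun z => by
  rw [mem_up (r := r), mem_adj (r := r), mem_adj (r := r)]
  simp [mem_emp]

theorem Ce.up {x y : V} (hx : Ce r x) (hy : Ce r y) : Ce r (up r x y) := by
  rw [up_eq_adj]; exact (Ce.emp.adj hx).adj hy

theorem Ce.op {x y : V} (hx : Ce r x) (hy : Ce r y) : Ce r (op r x y) := (hx.up hx).up (hx.up hy)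

theorem Ce.lset {l : List V} (h : ∀ x ∈ l, Ce r x) : Ce r (lset r l) := by
  induction l with
  | nil => exact Ce.emp
  | cons x l ih => exact (ih fun y hy => h y (by simp [hy])).adj (h x (by simp))

theorem Ce.fin {a p : V} (ha : ∀ x, r x a → Ce r x) (h : r p (fin r a)) : Ce r p := by
  obtain ⟨l, h1, rfl⟩ := mem_fin.1 h
  exact Ce.lset fun x hx => ha x (h1 x hx)

theorem Ce.nat (n : ℕ) : Ce r (nat r n) := by
  induction n with
  | zero => exact Ce.emp
  | succ n ih => exact ih.adj ih

theorem Ce.of_mem_ee {γ x : V} (hγ : OrdW r γ) (h : r x (ee r γ)) : Ce r x := ⟨γ, hγ, h⟩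

theorem Ce.exists_def {γ : V} (hγ : OrdW r γ) {Q : Sub r (ee r γ) → Prop} (h : Dp (srel r (ee r γ)) Q) :
    ∃ b, Ce r b ∧ ∀ x, r x b ↔ ∃ hx, Q ⟨x, hx⟩ := by
  obtain ⟨n, s, t, hs, ht, H⟩ := exists_dsub_of_dfb h
  have := (Ce.nat n).op ((Ce.fin (fun x => Ce.of_mem_ee hγ) hs).op (Ce.fin (fun x => Ce.of_mem_ee hγ) ht))
  obtain ⟨b, hb, hb'⟩ := ce_iff.1 this
  obtain ⟨α, h1, h2, rfl, rfl, h5, h6⟩ := exists_code (r := r) (ordW_nat 1) hγ hb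
  refine ⟨_, Ce.e h1, fun x => (Iff.of_eq ?_).trans (H x)⟩
  rw [e_eq h1, if_pos ⟨h5, h6⟩, if_neg, ← hb']
  · simp
  · rw [h2]
    exact fun h => mem_emp (r := r) (h ▸ nat_mem_nat.2 (Nat.zero_lt_one) : r (VLC.nat r 0) _)

theorem Ce.ee {γ : V} (hγ : OrdW r γ) : Ce r (VLC.ee r γ) := by
  obtain ⟨b, hb, h⟩ := Ce.exists_def hγ (Q := fun _ => True) (Df.prop True)
  rwa [show VLC.ee r γ = b from hr.ext fun z => by rw [h]; simp]

theorem exists_ee_sup {a : V} (h : ∀ x, r x a → Ce r x) : ∃ γ, OrdW r γ ∧ SubW r a (ee r γ) := by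
  refine ⟨iUn r a (fun z => succ r (lst r (fun β => z = e r β))),
    OrdW.iUn fun z _ => (ordW_lst _).succ, fun z hz => mem_ee.2 ⟨lst r (fun β => z = e r β),
    mem_iUn.2 ⟨z, hz, self_mem_succ _⟩, ?_⟩⟩
  exact (lst_spec (Q := fun β => z = e r β) (ce_iff.1 (h z hz))).2.1

theorem Ce.ord {α : V} (h : OrdW r α) : Ce r α := by
  induction α using hr.wf.induction with
  | _ α ih =>
  obtain ⟨γ, hγ, hs⟩ := exists_ee_sup fun β hβ => ih β hβ (h.mem hβ)
  obtain ⟨b, hb, hb'⟩ := Ce.exists_def hγ (Q := fun x => OrdW (srel r (VLC.ee r γ)) x) inferInstance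
  have tr : ∀ x y, r x (VLC.ee r γ) → r y x → r y (VLC.ee r γ) := fun x y => transW_ee hγ x y
  have hb2 : ∀ x, r x b ↔ r x (VLC.ee r γ) ∧ OrdW r x := fun x => by
    rw [hb']
    exact ⟨fun ⟨h1, h2⟩ => ⟨h1, (crel_ordW tr).1 h2⟩, fun ⟨h1, h2⟩ => ⟨h1, (crel_ordW tr).2 h2⟩⟩
  have ho : OrdW r b := ⟨fun x y hx hy => (hb2 _).2 ⟨tr _ _ ((hb2 _).1 hx).1 hy, ((hb2 _).1 hx).2.mem hy⟩,
    fun x hx => ((hb2 _).1 hx).2.1⟩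
  rcases (h.sub_iff ho).1 fun β hβ => (hb2 _).2 ⟨hs β hβ, h.mem hβ⟩ with h1 | rfl
  · exact Ce.tr _ _ hb h1
  · exact hb

instance zfm_ce : ZFm (crel r (Ce r)) := by
  refine zfm_Lv (ee r) (fun α β => ee_mono) (fun γ x hγ hx => ?_) (fun α => transW_ee)
    (fun γ hγ Q hQ => Ce.exists_def hγ.1 hQ) (Ce.ord ordW_om)
  obtain ⟨β, h1, h2⟩ := mem_ee.1 hx
  exact ⟨_, succ_mem_of_limit hγ h1, mem_ee.2 ⟨β, self_mem_succ β, h2⟩⟩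

/-- Every set is enumerated by `e`. -/
def VE (r : V → V → Prop) [ZFm r] : Prop := ∀ x, ∃ α, OrdW r α ∧ x = e r α

/-- Every set has a power set. -/
def Pw (r : V → V → Prop) : Prop := ∀ x, ∃ p, IsPowW r p x

/-- Every set of nonempty sets has a choice function. -/
def Ch (r : V → V → Prop) : Prop := ∀ a, (∀ x, r x a → ∃ y, r y x) →
  ∃ f, IsFunOn r f a ∧ ∀ x y, r x a → FApp r f x y → r y x

theorem VE.ch (h : VE r) : Ch r := fun a ha =>
  ⟨lamS r a (fun x => e r (lst r (fun β => r (e r β) x))), isFunOn_lamS _ _, fun x y hx hy => by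
    rw [(fApp_lamS.1 hy).2]
    obtain ⟨y, hy⟩ := ha x hx
    obtain ⟨α, h1, rfl⟩ := h y
    exact (lst_spec (Q := fun β => r (e r β) x) ⟨α, h1, hy⟩).2.1⟩

/-- The inclusion of a transitive class. -/
def TEmb.incl {T : V → Prop} (tr : ∀ x y, T x → r y x → T y) : TEmb (crel r T) r where
  i := Subtype.val
  inj := Subtype.val_injective
  mem' _ _ := Iff.rfl
  trans x w h := ⟨⟨w, tr _ _ x.2 h⟩, h, rfl⟩

end Hierarchy

namespace TEmb

variable {V : Type u} {V' : Type v} {r : V → V → Prop} {r' : V' → V' → Prop} [hr : ZFm r]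
  [hr' : ZFm r'] (T : TEmb r r')

@[simp] theorem dk (a : V) : T.i (dk r a) = dk r' (T.i a) := by simp [VLC.dk]
@[simp] theorem da (a : V) : T.i (da r a) = da r' (T.i a) := by simp [VLC.da]
@[simp] theorem db (a : V) : T.i (db r a) = db r' (T.i a) := by simp [VLC.db]

@[simp] theorem e (a : V) : T.i (e r a) = e r' (T.i a) := by
  refine T.recF (fun x s => ?_) a
  have h1 : VLC.dk r' (T.i x) = VLC.emp r' ↔ VLC.dk r x = VLC.emp r := by
    rw [← T.dk, ← T.emp, T.eq_iff]
  rw [eStep, eStep, h1, ← T.da, ← T.db, T.mem, T.mem]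
  split_ifs
  · simp
  · rw [T.dsub, T.imS (F' := VLC.app r' (T.i s)) fun x _ => T.app _ _]; simp
  · simp

@[simp] theorem ee (a : V) : T.i (ee r a) = ee r' (T.i a) := T.imS fun x _ => T.e x

end TEmb

section Inner
variable {V : Type u} {r : V → V → Prop} [hr : ZFm r]

theorem ve_ce : VE (crel r (Ce r)) := fun x => by
  obtain ⟨α, h1, h2⟩ := ce_iff.1 x.2
  refine ⟨⟨α, Ce.ord h1⟩, (crel_ordW Ce.tr).2 h1, Subtype.ext ?_⟩
  rw [h2]
  exact ((TEmb.incl (r := r) Ce.tr).e ⟨α, Ce.ord h1⟩).symm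

theorem pw_ce (h : Pw r) : Pw (crel r (Ce r)) := fun a => by
  obtain ⟨p, hp⟩ := h a.1
  obtain ⟨γ, h1, h2⟩ := exists_ee_sup (r := r) (a := sepS r p (Ce r)) fun x hx => (mem_sepS.1 hx).2
  refine ⟨sepS (crel r (Ce r)) ⟨ee r γ, Ce.ee h1⟩ (fun x => SubW (crel r (Ce r)) x a), fun z =>
    mem_sepS.trans ⟨fun h => h.2, fun h => ⟨h2 z.1 (mem_sepS.2 ⟨(hp z.1).2 fun w hw => ?_, z.2⟩), h⟩⟩⟩
  exact h ⟨w, Ce.tr _ _ z.2 hw⟩ hw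
end Inner

theorem fin_one_eta {α : Type u} (w : Fin 1 → α) : (fun _ => w 0) = w :=
  funext fun i => by rw [Subsingleton.elim i 0]

theorem fin_two_eta {α : Type u} (w : Fin 2 → α) : ![w 0, w 1] = w := funext fun i => by fin_cases i <;> rfl

theorem ZFUniv.zfm (u : ZFUniv.{u}) : ZFm u.mem := by
  haveI : Nonempty u.V := ⟨u.infinity.choose⟩
  refine ⟨u.wf, u.extensionality _ _, u.pairing, u.unions, u.infinity, fun Q hQ a => ?_, fun Q hQ a hf => ?_⟩
  · obtain ⟨n, φ, prm, h⟩ := Dfb.exists_realizeIn (m := 1) hQ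
    obtain ⟨b, hb⟩ := u.separation n φ prm a
    exact ⟨b, fun x => by rw [hb, h]⟩
  · obtain ⟨n, φ, prm, h⟩ := Dfb.exists_realizeIn (m := 2) hQ
    obtain ⟨b, hb⟩ := u.replacement n φ prm a (fun x y y' hx h1 h2 => hf x y y' hx ((h _).1 h1) ((h _).1 h2))
    exact ⟨b, fun y => by rw [hb]; exact exists_congr fun x => and_congr_right fun _ => h _⟩

/-- The universe given by a structure satisfying the axioms. -/
def ZFm.univ {V : Type u} {r : V → V → Prop} (h : ZFm r) (hp : Pw r) (hc : Ch r) : ZFUniv.{u} where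
  V := V
  mem := r
  wf := h.wf
  extensionality _ _ := h.ext
  pairing := h.pairing
  unions := h.unions
  power := hp
  infinity := h.infinity
  separation n φ prm a := h.sep (fun x => RealizeIn r φ prm (fun _ => x)) ((Dfb.realizeIn φ prm).congr fun _ w =>
      Iff.of_eq (congrArg _ (fin_one_eta w).symm)) a
  replacement n φ prm a hf := h.repl (fun x y => RealizeIn r φ prm ![x, y]) ((Dfb.realizeIn φ prm).congr fun _ w =>
      Iff.of_eq (congrArg _ (fin_two_eta w).symm)) a hf
  choice := hc

section Levels

variable {V : Type u} (r : V → V → Prop) [hr : ZFm r]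

/-- The set of the definable subsets of `m`. -/
noncomputable def lD (m : V) : V :=
  iUn r (om r) (fun n => iUn r (fin r m) (fun s => imS r (fin r m) (fun t => dsub r m n s t)))

/-- The recursion step of `lvl`. -/
noncomputable def lvStep (a s : V) : V := iUn r a (fun β => lD r (app r s β))

/-- The levels of the constructible hierarchy. -/
noncomputable def lvl (a : V) : V := recF r (lvStep r) a

end Levels

section Fns
variable {ι : Type w} {V : ι → Type u} {r : ∀ i, V i → V i → Prop} {P : (∀ i, V i) → Prop} {n : ℕ}
  [hr : ∀ i, ZFm (r i)] (f g : ∀ i, (Fin n → V i) → V i) [DFn r P f] [DFn r P g]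
instance : DFn r P (fun i v => lD (r i) (f i v)) :=
  DFn.comp1 (F := fun i => lD (r i)) (by unfold lD; infer_instance) f
instance : DFn r P (fun i v => lvStep (r i) (f i v) (g i v)) :=
  DFn.comp2 (F := fun i => lvStep (r i)) (by unfold lvStep; infer_instance) f g
end Fns

namespace TEmb

variable {V : Type u} {V' : Type v} {r : V → V → Prop} {r' : V' → V' → Prop} [hr : ZFm r]
  [hr' : ZFm r'] (T : TEmb r r')

theorem lD (m : V) : T.i (lD r m) = lD r' (T.i m) := by
  rw [VLC.lD, VLC.lD, ← T.om, ← T.fin]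
  refine T.iUn fun n _ => ?_
  refine T.iUn (F' := fun s => VLC.imS r' (T.i (VLC.fin r m)) (fun t => VLC.dsub r' (T.i m) (T.i n) s t)) fun s _ => ?_
  exact T.imS (F' := fun t => VLC.dsub r' (T.i m) (T.i n) (T.i s) t) fun t _ => T.dsub m n s t

theorem lvl (a : V) : T.i (lvl r a) = lvl r' (T.i a) := by
  refine T.recF (fun x s => ?_) a
  exact T.iUn (F' := fun β => VLC.lD r' (VLC.app r' (T.i s) β)) fun β _ => by rw [T.lD, T.app]

end TEmb

section Bridge

variable (u : ZFUniv.{u}) [hr : ZFm u.mem]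

theorem defOverSet_iff {m x : u.V} : DefOverSet u m x ↔ u.mem x (lD u.mem m) := by
  have e : ∀ {n : ℕ} (φ : L3.BoundedFormula (Fin n) 1) (prm : Fin n → Sub u.mem m) (y : Sub u.mem m),
      RealizeSub (u.mem · m) u.mem φ prm (fun _ => y) ↔ RealizeIn (srel u.mem m) φ prm (fun _ => y) := by
    intro n φ prm y
    rw [RealizeSub, mstr_eq_memStr]; rfl
  rw [lD, mem_iUn (r := u.mem)]
  constructor
  · rintro ⟨hs, n, φ, prm, h⟩
    obtain ⟨k, s, t, hs', ht, H⟩ := exists_dsub_of_dfb (r := u.mem) (m := m)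
      (Q := fun y => RealizeIn (srel u.mem m) φ prm (fun _ => y)) ((Dfb.realizeIn φ prm).congr fun _ w =>
        Iff.of_eq (congrArg _ (fin_one_eta w).symm))
    refine ⟨nat u.mem k, nat_mem_om k, mem_iUn.2 ⟨s, hs', mem_imS.2 ⟨t, ht, hr.ext fun y => ?_⟩⟩⟩
    rw [H]
    exact ⟨fun hy => ⟨hs y hy, (e _ _ _).1 ((h y _).1 hy)⟩, fun ⟨h1, h2⟩ => (h y h1).2 ((e _ _ _).2 h2)⟩
  · rintro ⟨k, hk, h⟩
    obtain ⟨s, hs, h⟩ := mem_iUn.1 h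
    obtain ⟨t, ht, rfl⟩ := mem_imS.1 h
    obtain ⟨n, rfl⟩ := mem_om.1 hk
    refine ⟨dsub_sub, ?_⟩
    by_cases hne : Nonempty (Sub u.mem m)
    · obtain ⟨N, φ, prm, H⟩ := Dfb.exists_realizeIn (m := 1) (dfb_dsub (n := n) hs ht)
      exact ⟨N, φ, prm, fun y hy => ((e φ prm ⟨y, hy⟩).trans (H _)).symm⟩
    · exact ⟨0, ⊥, Fin.elim0, fun y hy => absurd ⟨⟨y, hy⟩⟩ hne⟩

theorem isL_iff {α ℓ : u.V} (h : OrdW u.mem α) : IsL u α ℓ ↔ ℓ = lvl u.mem α := by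
  induction α using hr.wf.induction generalizing ℓ with
  | _ α ih =>
  rw [IsL, WellFounded.fix_eq]
  change (∀ x, u.mem x ℓ ↔ ∃ β, ∃ hβ : u.mem β α, ∃ ℓβ, IsL u β ℓβ ∧ DefOverSet u ℓβ x) ↔ _
  have : ∀ x, u.mem x (lvl u.mem α) ↔ ∃ β, ∃ hβ : u.mem β α, ∃ ℓβ, IsL u β ℓβ ∧ DefOverSet u ℓβ x := fun x => by
    rw [lvl, recF_ord h, lvStep, mem_iUn (r := u.mem)]
    constructor
    · rintro ⟨β, hβ, hx⟩
      rw [app_lamS hβ] at hx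
      exact ⟨β, hβ, _, (ih β hβ (h.mem hβ)).2 rfl, (defOverSet_iff u).2 hx⟩
    · rintro ⟨β, hβ, _, hL, hx⟩
      obtain rfl := (ih β hβ (h.mem hβ)).1 hL
      exact ⟨β, hβ, by rw [app_lamS hβ]; exact (defOverSet_iff u).1 hx⟩
  simp only [← this]
  exact ⟨fun h => hr.ext h, fun h x => by rw [h]⟩

theorem VeqL.ve (h : VeqL u) : VE u.mem := fun x => by
  obtain ⟨α, ℓ, h1, h2, h3⟩ := h x
  rw [isL_iff u h1] at h2
  subst h2
  refine ce_iff.1 (Ce.tr _ _ ?_ h3)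
  have := (TEmb.incl (r := u.mem) Ce.tr).lvl ⟨α, Ce.ord h1⟩
  change Ce u.mem (lvl u.mem ((TEmb.incl (r := u.mem) Ce.tr).i ⟨α, Ce.ord h1⟩))
  rw [← this]
  exact (lvl (crel u.mem (Ce u.mem)) _).2

end Bridge

/-- A structure for the language of set theory. -/
structure St where
  /-- The carrier. -/
  V : Type u
  /-- The membership relation. -/
  r : V → V → Prop

/-- A well-founded model of ZF without power set. -/
structure ZSt extends St.{u} where
  zf : ZFm r

instance (i : ZSt.{u}) : ZFm i.r := i.zf

/-- Parameter-free definability, uniformly over all structures. -/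
abbrev Dst {n : ℕ} (R : ∀ i : St.{u}, (Fin n → i.V) → Prop) : Prop :=
  Df (ι := St.{u}) (V := fun i => i.V) (fun i => i.r) (fun _ => False) R

/-- Parameter-free definability, uniformly over all models of ZF without power set. -/
abbrev Dz {n : ℕ} (R : ∀ i : ZSt.{u}, (Fin n → i.V) → Prop) : Prop :=
  Df (ι := ZSt.{u}) (V := fun i => i.V) (fun i => i.r) (fun _ => False) R

/-- Elementary maps. -/
def Elm {V V' : Type u} (r : V → V → Prop) (r' : V' → V' → Prop) (i : V → V') : Prop :=
  ∀ (n : ℕ) (φ : L3.Formula (Fin n)) (v : Fin n → V),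
    @Formula.Realize L3 V' (memStr r') _ φ (fun j => i (v j)) ↔
      @Formula.Realize L3 V (memStr r) _ φ v

theorem Df.elm {ι : Type w} {V : ι → Type u} {r : ∀ i, V i → V i → Prop} {n : ℕ}
    {R : ∀ i, (Fin n → V i) → Prop} (h : Df r (fun _ => False) R) {i j : ι} {f : V i → V j}
    (hf : Elm (r i) (r j) f) (v : Fin n → V i) : R j (fun k => f (v k)) ↔ R i v := by
  obtain ⟨φ, hφ⟩ := h.out
  let g : {c : ∀ i, V i // False} ⊕ Fin n → Fin n := Sum.elim (fun c => c.2.elim) id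
  have key : ∀ i (v : Fin n → V i),
      @Formula.Realize L3 (V i) (memStr (r i)) _ (φ.relabel g) v ↔ R i v := by
    intro i v
    letI := memStr (r i)
    rw [Formula.realize_relabel, ← hφ]
    refine iff_of_eq (congrArg _ ?_)
    ext x
    rcases x with c | x
    · exact c.2.elim
    · rfl
  rw [← key, ← key]
  exact hf n _ v

theorem Df.all_tuple {ι : Type w} {V : ι → Type u} {r : ∀ i, V i → V i → Prop}
    {P : (∀ i, V i) → Prop} : ∀ {n : ℕ} {R : ∀ i, (Fin n → V i) → Prop} (h : Df r P R),
    Df r P (fun i (_ : Fin 0 → V i) => ∀ v, R i v)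
  | 0, R, h => h.congr fun i v => ⟨fun h w => Subsingleton.elim v w ▸ h, fun h => h v⟩
  | n + 1, R, h => by
    haveI := h.ex'
    haveI h2 : Df r P (fun i (v : Fin n → V i) =>
        ¬ ∃ y : V i, ¬ R i (Fin.snoc (α := fun _ => V i) v y)) := by
      haveI : Df r P (fun i v => ¬ R i v) := Df.not (hR := h)
      haveI := this.ex'
      infer_instance
    refine (Df.all_tuple h2).congr fun i _ => ?_
    simp only [not_exists, not_not]
    exact ⟨fun h w => by simpa using h (Fin.init w) (w (Fin.last n)), fun h v y => h _⟩

theorem Dst.realizeIn {k m : ℕ} (φ : L3.BoundedFormula (Fin k) m) :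
    Dst (fun (i : St.{u}) (v : Fin (k + m) → i.V) =>
      RealizeIn i.r φ (fun j => v (Fin.castAdd m j)) (fun j => v (Fin.natAdd k j))) := by
  refine ⟨φ.toFormula.relabel (Sum.elim (fun j => .inr (Fin.castAdd m j))
    (fun j => .inr (Fin.natAdd k j))), fun i v => ?_⟩
  letI := memStr i.r
  rw [Formula.realize_relabel, BoundedFormula.realize_toFormula]
  exact Iff.rfl

section Elm

variable {V V' : Type u} {r : V → V → Prop} {r' : V' → V' → Prop} {i : V → V'}

theorem Elm.df (hi : Elm r r' i) {n : ℕ} {R : ∀ i : St.{u}, (Fin n → i.V) → Prop} (h : Dst R)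
    (v : Fin n → V) : R ⟨V', r'⟩ (fun k => i (v k)) ↔ R ⟨V, r⟩ v :=
  Df.elm (V := fun i : St.{u} => i.V) (r := fun i => i.r) h (i := ⟨V, r⟩) (j := ⟨V', r'⟩) hi v

theorem Elm.dfz [hr : ZFm r] [hr' : ZFm r'] (hi : Elm r r' i) {n : ℕ}
    {R : ∀ i : ZSt.{u}, (Fin n → i.V) → Prop} (h : Dz R)
    (v : Fin n → V) : R ⟨⟨V', r'⟩, hr'⟩ (fun k => i (v k)) ↔ R ⟨⟨V, r⟩, hr⟩ v :=
  Df.elm (V := fun i : ZSt.{u} => i.V) (r := fun i => i.r) h (i := ⟨⟨V, r⟩, hr⟩)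
    (j := ⟨⟨V', r'⟩, hr'⟩) hi v

theorem Elm.sent (hi : Elm r r' i) {R : St.{u} → Prop}
    (h : Dst (fun (i : St.{u}) (_ : Fin 0 → i.V) => R i)) : R ⟨V', r'⟩ ↔ R ⟨V, r⟩ :=
  hi.df h Fin.elim0

theorem Elm.sentz [hr : ZFm r] [hr' : ZFm r'] (hi : Elm r r' i) {R : ZSt.{u} → Prop}
    (h : Dz (fun i (_ : Fin 0 → i.V) => R i)) : R ⟨⟨V', r'⟩, hr'⟩ ↔ R ⟨⟨V, r⟩, hr⟩ :=
  hi.dfz h Fin.elim0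

theorem Elm.of_iso (e : V ≃ V') (he : ∀ x y, r' (e x) (e y) ↔ r x y) : Elm r r' e := by
  intro n φ v
  letI := memStr r
  letI := memStr r'
  let E : V ≃[L3] V' :=
    { e with
      map_fun' := fun {n} f => nomatch f
      map_rel' := by
        intro n R x
        cases R
        · exact Iff.rfl
        · exact Iff.rfl
        · exact he _ _ }
  exact StrongHomClass.realize_formula (g := E) φ

theorem Elm.comp {V'' : Type u} {r'' : V'' → V'' → Prop} {j : V' → V''} (hj : Elm r' r'' j)
    (hi : Elm r r' i) : Elm r r'' (fun x => j (i x)) :=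
  fun n φ v => (hj n φ _).trans (hi n φ v)

end Elm

section Transfer

variable {V V' : Type u} {r : V → V → Prop} {r' : V' → V' → Prop} {i : V → V'}

theorem Dst.zf_ext : Dst (fun (i : St.{u}) (_ : Fin 0 → i.V) =>
    ∀ x y : i.V, (∀ z, i.r z x ↔ i.r z y) → x = y) := by infer_instance

theorem Dst.zf_pairing : Dst (fun (i : St.{u}) (_ : Fin 0 → i.V) =>
    ∀ x y : i.V, ∃ z, ∀ w, i.r w z ↔ (w = x ∨ w = y)) := by infer_instance

theorem Dst.zf_unions : Dst (fun (i : St.{u}) (_ : Fin 0 → i.V) =>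
    ∀ x : i.V, ∃ z, ∀ w, i.r w z ↔ ∃ y, i.r y x ∧ i.r w y) := by infer_instance

theorem Dst.zf_infinity : Dst (fun (i : St.{u}) (_ : Fin 0 → i.V) => ∃ o : i.V, IsOmegaW i.r o) := by
  infer_instance

theorem Dst.zf_sep {k : ℕ} (φ : L3.BoundedFormula (Fin k) 1) : Dst (fun (i : St.{u}) (_ : Fin 0 → i.V) =>
    ∀ (v : Fin k → i.V) (a : i.V), ∃ b, ∀ x, i.r x b ↔ (i.r x a ∧ RealizeIn i.r φ v ![x])) := by
  refine Df.all_tuple (V := fun i : St.{u} => i.V) (r := fun i => i.r) (P := fun _ => False) (R := fun (i : St.{u}) (v : Fin k → i.V) =>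
    ∀ (a : i.V), ∃ b, ∀ x, i.r x b ↔ (i.r x a ∧ RealizeIn i.r φ v ![x])) ?_
  haveI : Dst (fun (i : St.{u}) (v : Fin (k + 1 + 1 + 1) → i.V) => RealizeIn i.r φ
      (fun j => v j.castSucc.castSucc.castSucc) ![v (Fin.last (k + 2))]) :=
    ((Dst.realizeIn φ).rename (m := k + 1 + 1 + 1)
      (Fin.addCases (fun j => j.castSucc.castSucc.castSucc) (fun _ => Fin.last _))).congr
      fun i v => by
        simp only [Fin.addCases_left, Fin.addCases_right]
        refine iff_of_eq (congrArg _ (funext fun x => ?_))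
        rw [Fin.fin_one_eq_zero x]; rfl
  infer_instance

theorem Dst.zf_repl {k : ℕ} (φ : L3.BoundedFormula (Fin k) 2) : Dst (fun (i : St.{u}) (_ : Fin 0 → i.V) =>
    ∀ (v : Fin k → i.V) (a : i.V), (∀ x y y', i.r x a → RealizeIn i.r φ v ![x, y] →
      RealizeIn i.r φ v ![x, y'] → y = y') →
      ∃ b, ∀ y, i.r y b ↔ ∃ x, i.r x a ∧ RealizeIn i.r φ v ![x, y]) := by
  refine Df.all_tuple (V := fun i : St.{u} => i.V) (r := fun i => i.r) (P := fun _ => False) (R := fun (i : St.{u}) (v : Fin k → i.V) =>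
    ∀ (a : i.V), (∀ x y y', i.r x a → RealizeIn i.r φ v ![x, y] →
      RealizeIn i.r φ v ![x, y'] → y = y') →
      ∃ b, ∀ y, i.r y b ↔ ∃ x, i.r x a ∧ RealizeIn i.r φ v ![x, y]) ?_
  haveI key : ∀ {m : ℕ} (ρ : Fin k → Fin m) (s t : Fin m), Dst (fun (i : St.{u}) (v : Fin m → i.V) =>
      RealizeIn i.r φ (fun j => v (ρ j)) ![v s, v t]) := fun ρ s t =>
    ((Dst.realizeIn φ).rename (Fin.addCases ρ ![s, t])).congr
      fun i v => by
        simp only [Fin.addCases_left, Fin.addCases_right]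
        refine iff_of_eq (congrArg _ (funext fun x => ?_))
        fin_cases x <;> rfl
  haveI h1 : Dst (fun (i : St.{u}) (v : Fin (k + 1 + 1 + 1 + 1) → i.V) => RealizeIn i.r φ
      (fun j => v j.castSucc.castSucc.castSucc.castSucc)
      ![v (Fin.last (k + 1)).castSucc.castSucc, v (Fin.last (k + 2)).castSucc]) :=
    key (fun j => j.castSucc.castSucc.castSucc.castSucc) _ _
  haveI h2 : Dst (fun (i : St.{u}) (v : Fin (k + 1 + 1 + 1 + 1) → i.V) => RealizeIn i.r φ
      (fun j => v j.castSucc.castSucc.castSucc.castSucc)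
      ![v (Fin.last (k + 1)).castSucc.castSucc, v (Fin.last (k + 3))]) :=
    key (fun j => j.castSucc.castSucc.castSucc.castSucc) _ _
  haveI h3 : Dst (fun (i : St.{u}) (v : Fin (k + 1 + 1 + 1 + 1) → i.V) => RealizeIn i.r φ
      (fun j => v j.castSucc.castSucc.castSucc.castSucc)
      ![v (Fin.last (k + 3)), v (Fin.last (k + 2)).castSucc]) :=
    key (fun j => j.castSucc.castSucc.castSucc.castSucc) _ _
  infer_instance

/-- Elementary equivalence transfers ZF without power set to well-founded structures. -/
theorem zfm_of_sent [hr : ZFm r] (hi : ∀ {R : St.{u} → Prop},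
    Dst (fun (i : St.{u}) (_ : Fin 0 → i.V) => R i) → (R ⟨V', r'⟩ ↔ R ⟨V, r⟩))
    (wf : WellFounded r') : ZFm r' := by
  haveI : Nonempty V' := ⟨((hi Dst.zf_infinity).2 hr.infinity).choose⟩
  refine ⟨wf, ?_, ?_, ?_, ?_, ?_, ?_⟩
  · exact fun {x y} => (hi Dst.zf_ext).2 (fun x y => hr.ext) x y
  · exact (hi Dst.zf_pairing).2 hr.pairing
  · exact (hi Dst.zf_unions).2 hr.unions
  · exact (hi Dst.zf_infinity).2 hr.infinity
  · intro Q hQ a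
    obtain ⟨N, φ, prm, h⟩ := Dfb.exists_realizeIn hQ
    have := (hi (Dst.zf_sep φ)).2 (fun v a => hr.sep (fun x => RealizeIn r φ v ![x])
      ((Dfb.realizeIn φ v).congr fun _ w => iff_of_eq (congrArg _ (funext fun j => by
        rw [Subsingleton.elim j 0]; rfl))) a) prm a
    obtain ⟨b, hb⟩ := this
    exact ⟨b, fun x => (hb x).trans (and_congr_right fun _ => h ![x])⟩
  · intro Q hQ a hf
    obtain ⟨N, φ, prm, h⟩ := Dfb.exists_realizeIn hQ
    have h' : ∀ x y, RealizeIn r' φ prm ![x, y] ↔ Q x y := fun x y => h ![x, y]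
    have := (hi (Dst.zf_repl φ)).2 (fun v a => hr.repl (fun x y => RealizeIn r φ v ![x, y])
      ((Dfb.realizeIn φ v).congr fun _ w => iff_of_eq (congrArg _ (fin_two_eta w).symm)) a) prm a
    simp only [h'] at this
    exact this hf

theorem Elm.zfm [hr : ZFm r] (hi : Elm r r' i) (wf : WellFounded r') : ZFm r' :=
  zfm_of_sent (fun h => hi.sent h) wf

theorem Elm.zfm_rev [hr : ZFm r'] (hi : Elm r r' i) (wf : WellFounded r) : ZFm r :=
  zfm_of_sent (fun h => (hi.sent h).symm) wf

end Transfer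

section Small

variable {V : Type u} {r : V → V → Prop} [hr : ZFm r]

/-- A notion of smallness of sets. -/
structure Small (r : V → V → Prop) [ZFm r] (B : V → Prop) : Prop where
  dp : Dp r B
  im : ∀ Q : V → V → Prop, Dp₂ r Q → ∀ a b, B a →
    (∀ x y y', r x a → Q x y → Q x y' → y = y') → (∀ y, r y b → ∃ x, r x a ∧ Q x y) → B b
  sUn : ∀ a, B a → (∀ x, r x a → B x) → B (sUn r a)
  up : ∀ x y, B (up r x y)
  om : B (om r)

variable {B : V → Prop}

theorem Small.sub (h : Small r B) {a b : V} (ha : B a) (hb : SubW r b a) : B b :=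
  h.im (fun x y => x = y) inferInstance a b ha (fun _ _ _ _ h h' => h.symm.trans h')
    fun y hy => ⟨y, hb y hy, rfl⟩

theorem Small.imS (h : Small r B) {a : V} (F : V → V) [hF : Df₁ r F] (ha : B a) : B (imS r a F) :=
  h.im (fun x y => y = F x) hF.out a _ ha (fun _ _ _ _ h h' => h.trans h'.symm)
    fun y hy => mem_imS.1 hy

theorem Small.iUn (h : Small r B) {a : V} (F : V → V) [hF : Df₁ r F] (ha : B a)
    (hx : ∀ x, r x a → B (F x)) : B (iUn r a F) :=
  h.sub (h.sUn _ (h.imS F ha) fun y hy => by obtain ⟨x, hx', rfl⟩ := mem_imS.1 hy; exact hx x hx')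
    fun y hy => by
      obtain ⟨x, hx', hy⟩ := (mem_iUn (F := F)).1 hy
      exact mem_sUn.2 ⟨_, mem_imS.2 ⟨x, hx', rfl⟩, hy⟩

theorem Small.un (h : Small r B) {a b : V} (ha : B a) (hb : B b) : B (un r a b) :=
  h.sub (h.sUn _ (h.up a b) fun x hx => by rcases mem_up.1 hx with rfl | rfl <;> assumption)
    fun y hy => by
      rcases mem_un.1 hy with hy | hy
      · exact mem_sUn.2 ⟨a, mem_up.2 (.inl rfl), hy⟩
      · exact mem_sUn.2 ⟨b, mem_up.2 (.inr rfl), hy⟩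

theorem Small.adj (h : Small r B) {a b : V} (ha : B a) : B (adj r a b) :=
  h.sub (h.un ha (h.up b b)) fun y hy => mem_un.2 ((mem_adj.1 hy).imp_right fun e =>
    mem_up.2 (.inl e))

/-- The sets whose transitive closure is small. -/
def Her (r : V → V → Prop) [ZFm r] (B : V → Prop) (x : V) : Prop := B (tc r x)

theorem Small.dpHer (h : Small r B) : Dp r (Her r B) :=
  haveI := h.dp
  Dp.app h.dp (fun _ v => tc r (v 0))

theorem Small.her_mem (h : Small r B) (x y : V) (hx : Her r B x) (hy : r y x) : Her r B y :=
  h.sub hx (tc_subset (fun z hz => trans_tc x _ _ (mem_tc_of_mem hy) hz) (trans_tc x))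

theorem Small.small (h : Small r B) {x : V} (hx : Her r B x) : B x :=
  h.sub hx fun _ => mem_tc_of_mem

theorem Small.her_of (h : Small r B) {a : V} (ha : B a) (hx : ∀ x, r x a → Her r B x) :
    Her r B a :=
  h.sub (h.un ha (h.iUn (tc r) ha hx)) fun z hz => mem_un.2
    ((mem_tc_iff.1 hz).imp_right fun ⟨y, hy, h⟩ => (mem_iUn (F := tc r)).2 ⟨y, hy, h⟩)

theorem Small.her_om (h : Small r B) : Her r B (VLC.om r) := by
  unfold Her; rw [tc_eq_self ordW_om.1]; exact h.om

theorem Small.zfm (h : Small r B) : ZFm (crel r (Her r B)) := by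
  haveI := h.dpHer
  have tr := h.her_mem
  have sub : ∀ {a b : V}, Her r B a → SubW r b a → Her r B b := fun ha hb =>
    h.her_of (h.sub (h.small ha) hb) fun x hx => h.her_mem _ x ha (hb x hx)
  refine ⟨InvImage.wf Subtype.val hr.wf, ?_, ?_, ?_, ?_, ?_, ?_⟩
  · intro x y hxy
    exact Subtype.ext (hr.ext fun z => ⟨fun hz => (hxy ⟨z, tr _ _ x.2 hz⟩).1 hz,
      fun hz => (hxy ⟨z, tr _ _ y.2 hz⟩).2 hz⟩)
  · intro x y
    refine ⟨⟨VLC.up r x.1 y.1, h.her_of (h.up _ _) fun z hz => ?_⟩,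
      (crel_isUPair tr).2 fun z => mem_up⟩
    rcases mem_up.1 hz with rfl | rfl
    exacts [x.2, y.2]
  · intro x
    refine ⟨⟨VLC.sUn r x.1, h.her_of (h.sub x.2 fun z hz => ?_) fun z hz => ?_⟩, fun z => ?_⟩
    · obtain ⟨y, hy, hz⟩ := mem_sUn.1 hz
      exact trans_tc _ _ _ (mem_tc_of_mem hy) hz
    · obtain ⟨y, hy, hz⟩ := mem_sUn.1 hz
      exact tr _ _ (tr _ _ x.2 hy) hz
    · refine mem_sUn.trans ⟨fun ⟨y, hy, hz⟩ => ⟨⟨y, tr _ _ x.2 hy⟩, hy, hz⟩,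
        fun ⟨y, hy, hz⟩ => ⟨y.1, hy, hz⟩⟩
  · exact ⟨⟨_, h.her_om⟩, (crel_isOmegaW tr).2 isOmegaW_om⟩
  · intro Q hQ a
    obtain ⟨b, hb⟩ := hr.sep _ (Df.relativize₁ hQ) a.1
    refine ⟨⟨b, sub a.2 fun x hx => ((hb x).1 hx).1⟩, fun x => (hb x.1).trans
      (and_congr_right fun _ => ⟨fun ⟨_, h⟩ => h, fun h => ⟨x.2, h⟩⟩)⟩
  · intro Q hQ a hf
    obtain ⟨b, hb⟩ := hr.repl _ (Df.relativize₂ hQ) a.1 fun x y y' hx ⟨h1, h2, h3⟩ ⟨_, h5, h6⟩ =>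
      congrArg Subtype.val (hf ⟨x, h1⟩ ⟨y, h2⟩ ⟨y', h5⟩ hx h3 h6)
    refine ⟨⟨b, h.her_of (h.im _ (Df.relativize₂ hQ) a.1 b (h.small a.2) ?_ fun y hy => (hb y).1 hy)
      fun y hy => ?_⟩, fun y => (hb y.1).trans ⟨fun ⟨x, hx, h1, h2, h3⟩ => ⟨⟨x, h1⟩, hx, h3⟩,
        fun ⟨x, hx, h⟩ => ⟨x.1, hx, x.2, y.2, h⟩⟩⟩
    · exact fun x y y' hx ⟨h1, h2, h3⟩ ⟨_, h5, h6⟩ =>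
        congrArg Subtype.val (hf ⟨x, h1⟩ ⟨y, h2⟩ ⟨y', h5⟩ hx h3 h6)
    · obtain ⟨x, hx, h1, h2, h3⟩ := (hb y).1 hy
      exact h2

/-- Every partial function from `a` to `θ` is bounded. -/
def Bd (r : V → V → Prop) (θ a : V) : Prop :=
  ∀ R, (∀ x γ γ', FApp r R x γ → FApp r R x γ' → γ = γ') →
    ∃ β, r β θ ∧ ∀ x γ, r x a → r γ θ → FApp r R x γ → r γ β

/-- Regular uncountable limit ordinals. -/
def Rg (r : V → V → Prop) [ZFm r] (θ : V) : Prop :=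
  LimitOrdW r θ ∧ r (om r) θ ∧ ∀ β, r β θ → Bd r θ β

theorem RegUncW.rg {θ : V} (h : RegUncW r θ) : Rg r θ := by
  obtain ⟨⟨⟨ho, hc⟩, hreg⟩, o, hio, hoθ⟩ := h
  obtain rfl := eq_om_iff.2 hio
  have hemp : r (emp r) θ := emp_mem ho ⟨_, hoθ⟩
  have hb : ∀ β, r β θ → Bd r θ β := by
    intro β hβ R hR
    let f := sepS r (prd r β θ) (fun z => FApp r R (fst r z) (snd r z) ∨
      (snd r z = emp r ∧ ¬ ∃ γ, r γ θ ∧ FApp r R (fst r z) γ))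
    have hf : ∀ x γ, FApp r f x γ ↔ r x β ∧ r γ θ ∧ (FApp r R x γ ∨
      (γ = emp r ∧ ¬ ∃ γ, r γ θ ∧ FApp r R x γ)) := by
      intro x γ
      rw [fApp_iff (r := r), mem_sepS (r := r), mem_prd (r := r)]
      simp only [fst_op, snd_op]
      constructor
      · rintro ⟨⟨x', y', hx, hy, e⟩, h⟩
        obtain ⟨rfl, rfl⟩ := op_inj.1 e
        exact ⟨hx, hy, h⟩
      · exact fun ⟨hx, hy, h⟩ => ⟨⟨_, _, hx, hy, rfl⟩, h⟩
    have hfun : IsFunOn r f β := by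
      refine ⟨fun z hz => ?_, fun x hx => ?_, fun x y y' h h' => ?_⟩
      · obtain ⟨x, y, hx, hy, rfl⟩ := mem_prd.1 (mem_sepS.1 hz).1
        exact ⟨x, y, hx, isOPair_op _ _⟩
      · by_cases hn : ∃ γ, r γ θ ∧ FApp r R x γ
        · obtain ⟨γ, h1, h2⟩ := hn
          exact ⟨γ, (hf _ _).2 ⟨hx, h1, .inl h2⟩⟩
        · exact ⟨_, (hf _ _).2 ⟨hx, hemp, .inr ⟨rfl, hn⟩⟩⟩
      · obtain ⟨_, hy, h | ⟨rfl, hn⟩⟩ := (hf _ _).1 h <;>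
        obtain ⟨_, hy', h' | ⟨rfl, hn'⟩⟩ := (hf _ _).1 h'
        · exact hR _ _ _ h h'
        · exact absurd ⟨_, hy, h⟩ hn'
        · exact absurd ⟨_, hy', h'⟩ hn
        · rfl
    obtain ⟨γ, hγ, h⟩ := hreg β f hβ hfun fun x y h => ((hf x y).1 h).2.1
    exact ⟨γ, hγ, fun x γ hx hγ h' => h x γ ((hf x γ).2 ⟨hx, hγ, .inl h'⟩)⟩
  refine ⟨⟨ho, ⟨_, hoθ⟩, fun x hx => ?_⟩, hoθ, hb⟩
  obtain ⟨β, hβ, h⟩ := hb _ hoθ (lamS r (om r) (fun _ => x)) fun z γ γ' h h' =>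
    ((fApp_lamS (F := fun _ => x)).1 h).2.trans ((fApp_lamS (F := fun _ => x)).1 h').2.symm
  exact ⟨β, hβ, h _ x (emp_mem ordW_om isOmegaW_om.1.2.1) hx
    ((fApp_lamS (F := fun _ => x)).2 ⟨emp_mem ordW_om isOmegaW_om.1.2.1, rfl⟩)⟩

theorem Bd.bdd {θ a : V} (h : Bd r θ a) (Q : V → V → Prop) [hQ : Dp₂ r Q]
    (hf : ∀ x y y', r x a → Q x y → Q x y' → y = y') :
    ∃ β, r β θ ∧ ∀ x γ, r x a → r γ θ → Q x γ → r γ β := by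
  haveI : ∀ {n : ℕ} (f g : Unit → (Fin n → V) → V)
    [DFn (ι := Unit) (V := fun _ => V) (fun _ => r) (fun _ => True) f]
    [DFn (ι := Unit) (V := fun _ => V) (fun _ => r) (fun _ => True) g],
    Df (ι := Unit) (V := fun _ => V) (fun _ => r) (fun _ => True) (fun i v => Q (f i v) (g i v)) :=
    fun f g => Dp₂.app hQ f g
  let R := sepS r (prd r a θ) (fun z => Q (fst r z) (snd r z))
  have hR : ∀ x γ, FApp r R x γ ↔ r x a ∧ r γ θ ∧ Q x γ := by
    intro x γ
    rw [fApp_iff (r := r), mem_sepS (r := r), mem_prd (r := r)]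
    simp only [fst_op, snd_op]
    constructor
    · rintro ⟨⟨x', y', hx, hy, e⟩, h⟩
      obtain ⟨rfl, rfl⟩ := op_inj.1 e
      exact ⟨hx, hy, h⟩
    · exact fun ⟨hx, hy, h⟩ => ⟨⟨_, _, hx, hy, rfl⟩, h⟩
  obtain ⟨β, hβ, h⟩ := h R fun x γ γ' h h' =>
    hf x γ γ' ((hR _ _).1 h).1 ((hR _ _).1 h).2.2 ((hR _ _).1 h').2.2
  exact ⟨β, hβ, fun x γ hx hγ hq => h x γ hx hγ ((hR _ _).2 ⟨hx, hγ, hq⟩)⟩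

theorem Rg.small {θ : V} (h : Rg r θ) : Small r (Bd r θ) := by
  obtain ⟨hl, hom, hb⟩ := h
  refine ⟨by unfold Bd; infer_instance, ?_, ?_, ?_, hb _ hom⟩
  · intro Q hQ a b ha hf hq R hR
    haveI : ∀ {n : ℕ} (f g : Unit → (Fin n → V) → V)
      [DFn (ι := Unit) (V := fun _ => V) (fun _ => r) (fun _ => True) f]
      [DFn (ι := Unit) (V := fun _ => V) (fun _ => r) (fun _ => True) g],
      Df (ι := Unit) (V := fun _ => V) (fun _ => r) (fun _ => True) (fun i v => Q (f i v) (g i v)) :=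
      fun f g => Dp₂.app hQ f g
    obtain ⟨β, hβ, h⟩ := ha.bdd (fun x γ => ∃ y, Q x y ∧ FApp r R y γ) fun x y y' hx
      ⟨z, h1, h2⟩ ⟨z', h3, h4⟩ => hR z _ _ h2 (hf x _ _ hx h1 h3 ▸ h4)
    exact ⟨β, hβ, fun y γ hy hγ h' => let ⟨x, hx, h''⟩ := hq y hy; h x γ hx hγ ⟨y, h'', h'⟩⟩
  · intro a ha hx R hR
    have key : ∀ x, r x a → ∃ β, r β θ ∧ ∀ z γ, r z x → r γ θ → FApp r R z γ → r γ β :=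
      fun x h => hx x h R hR
    obtain ⟨β, hβ, h⟩ := ha.bdd (fun x β => β = lst r (fun β => r β θ ∧ ∀ z, r z x → ∀ γ, r γ θ →
      FApp r R z γ → r γ β)) fun _ _ _ _ h h' => h.trans h'.symm
    refine ⟨β, hβ, fun z γ hz hγ hzg => ?_⟩
    obtain ⟨x, hxa, hzx⟩ := mem_sUn.1 hz
    obtain ⟨β', hβ', h'⟩ := key x hxa
    have := lst_spec (r := r) (Q := fun β => r β θ ∧ ∀ z, r z x → ∀ γ, r γ θ →
      FApp r R z γ → r γ β) ⟨β', hl.1.mem hβ', hβ', fun z hz γ => h' z γ hz⟩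
    exact (hl.1.mem hβ).trans (h x _ hxa this.2.1.1 rfl) (this.2.1.2 z hzx γ hγ hzg)
  · intro x y R hR
    have key : ∀ x, ∃ β, r β θ ∧ ∀ γ, r γ θ → FApp r R x γ → r γ β := by
      intro x
      by_cases h : ∃ γ, r γ θ ∧ FApp r R x γ
      · obtain ⟨γ, h1, h2⟩ := h
        exact ⟨_, succ_mem_of_limit hl h1, fun γ' _ h' => hR _ _ _ h' h2 ▸ self_mem_succ _⟩
      · obtain ⟨γ, hγ⟩ := hl.2.1
        exact ⟨γ, hγ, fun γ' h1 h2 => absurd ⟨_, h1, h2⟩ h⟩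
    obtain ⟨β, hβ, h⟩ := key x
    obtain ⟨β', hβ', h'⟩ := key y
    rcases (hl.1.mem hβ).trich (hl.1.mem hβ') with e | rfl | e
    · refine ⟨β', hβ', fun z γ hz hγ hh => ?_⟩
      rcases mem_up.1 hz with rfl | rfl
      · exact (hl.1.mem hβ').trans e (h _ hγ hh)
      · exact h' _ hγ hh
    · refine ⟨β, hβ, fun z γ hz hγ hh => ?_⟩
      rcases mem_up.1 hz with rfl | rfl
      · exact h _ hγ hh
      · exact h' _ hγ hh
    · refine ⟨β, hβ, fun z γ hz hγ hh => ?_⟩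
      rcases mem_up.1 hz with rfl | rfl
      · exact h _ hγ hh
      · exact (hl.1.mem hβ).trans e (h' _ hγ hh)

theorem Rg.mem_of_bd {θ α : V} (h : Rg r θ) (hα : OrdW r α) (hb : Bd r θ α) : r α θ := by
  by_contra hn
  have hs : SubW r θ α := hα.not_mem h.1.1 hn
  obtain ⟨β, hβ, h'⟩ := hb.bdd (fun x y => x = y) fun _ _ _ _ h h' => h.symm.trans h'
  exact hr.not_self β (h' β β (hs β hβ) hβ rfl)

theorem Rg.bd_of_cardLt {θ a : V} (h : Rg r θ) (ha : CardLtW r a θ) : Bd r θ a := by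
  obtain ⟨β, f, hβ, hf, hinj⟩ := ha
  refine h.small.im (fun x y => FApp r f y x) inferInstance β a (h.2.2 β hβ)
    (fun x y y' _ h h' => hinj _ _ _ h h') fun y hy => ?_
  obtain ⟨x, hx⟩ := hf.1.2.1 y hy
  exact ⟨x, hf.2 _ _ hx, hx⟩

end Small

section Hull

variable {V : Type u} {r : V → V → Prop} [hr : ZFm r]

/-- The inclusion of a subset. -/
def incl {m X : V} (hX : SubW r X m) (x : Sub r X) : Sub r m := ⟨x.1, hX _ x.2⟩

theorem elm_of_tp {M N : Type u} {s : M → M → Prop} {t : N → N → Prop} {i : M → N}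
    (h : ∀ (n : ℕ) {k : ℕ} (v : Fin k → M), tp s n v = tp t n (fun j => i (v j))) : Elm s t i := by
  intro k φ v
  obtain ⟨n, hn⟩ := exists_rank.{u, u} φ
  have := hn (fun a => a) (fun j : Fin 0 => Fin.elim0 j) _ _ (h n v)
  refine Iff.trans (iff_of_eq ?_) (this.symm.trans (iff_of_eq ?_))
  · letI := memStr t
    exact congrArg (BoundedFormula.Realize φ fun a => i (v a)) (funext fun j => Fin.elim0 j)
  · letI := memStr s
    exact congrArg (BoundedFormula.Realize φ v) (funext fun j => Fin.elim0 j)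

theorem hull_elm {m X : V} (hX : SubW r X m)
    (hc : ∀ n s t, r s (fin r X) → r t (fin r X) → (∃ x, r x m ∧ ¬ r x (dsub r m (nat r n) s t)) →
      ∃ x, r x X ∧ ¬ r x (dsub r m (nat r n) s t)) : Elm (srel r X) (srel r m) (incl hX) := by
  have tv : ∀ (n : ℕ) {k : ℕ} (v : Fin k → Sub r X) (x : Sub r m), ∃ y : Sub r X,
      tp (srel r m) n (Fin.snoc (fun j => incl hX (v j)) (incl hX y) : Fin (k + 1) → Sub r m) =
      tp (srel r m) n (Fin.snoc (fun j => incl hX (v j)) x : Fin (k + 1) → Sub r m) := by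
    intro n k v x
    by_contra hcon
    push Not at hcon
    obtain ⟨s, hs, hs'⟩ := exists_isRg v
    let T := {τ : Typ n (k + 1) // ∃ y : Sub r X,
      τ = tp (srel r m) n (Fin.snoc (fun j => incl hX (v j)) (incl hX y) : Fin (k + 1) → Sub r m)}
    haveI : Finite T := inferInstance
    choose f hf using fun τ : T => τ.2
    obtain ⟨N, ⟨e⟩⟩ := Finite.exists_equiv_fin T
    obtain ⟨t, ht, ht'⟩ := exists_isRg (fun i => f (e.symm i))
    have htm : SubW r t m := fun z hz => by
      obtain ⟨i, rfl⟩ := (ht' z).1 hz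
      exact hX _ (f _).2
    have hmem := fun x => mem_dsub (r := r) (m := m) (s := s) (t := t) (x := x) (n := n)
      (v := fun j => incl hX (v j)) hs' htm
    obtain ⟨z, hzX, hz⟩ := hc n s t hs ht ⟨x.1, x.2, fun hx => by
      obtain ⟨_, y, hy, hxy⟩ := (hmem _).1 hx
      obtain ⟨i, hi⟩ := (ht' _).1 hy
      have hi : y = incl hX (f (e.symm i)) := Subtype.ext hi
      exact hcon (f (e.symm i)) (by rw [← hi, ← hxy])⟩
    refine hz ((hmem z).2 ⟨hX _ hzX, incl hX (f ⟨_, ⟨z, hzX⟩, rfl⟩), ?_, ?_⟩)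
    · exact (ht' _).2 ⟨e ⟨_, ⟨z, hzX⟩, rfl⟩, by simp only [e.symm_apply_apply]; rfl⟩
    · exact (hf ⟨_, ⟨z, hzX⟩, rfl⟩).symm
  refine elm_of_tp fun n => ?_
  induction n with
  | zero =>
    intro k v
    refine atp_eq_iff.2 fun i j => ⟨Iff.rfl, ?_⟩
    simp [incl, Subtype.ext_iff]
  | succ n ih =>
    intro k v
    have sn : ∀ y : Sub r X, (fun j => incl hX ((Fin.snoc v y : Fin (k + 1) → Sub r X) j)) =
        (Fin.snoc (fun j => incl hX (v j)) (incl hX y) : Fin (k + 1) → Sub r m) := fun y => by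
      ext j
      refine Fin.lastCases ?_ (fun j => ?_) j <;> simp
    refine tp_succ_iff.2 ⟨?_, fun x => ⟨incl hX x, ?_⟩, fun x => ?_⟩
    · refine atp_eq_iff.2 fun i j => ⟨Iff.rfl, ?_⟩
      simp [incl, Subtype.ext_iff]
    · rw [ih, sn]
    · obtain ⟨y, hy⟩ := tv n v x
      exact ⟨y, by rw [ih, sn, hy]⟩

end Hull

section Collapse

variable {V : Type u} {r : V → V → Prop} [hr : ZFm r]

/-- The step of the Mostowski collapse of `X`. -/
noncomputable def colStep (r : V → V → Prop) [ZFm r] (X y s : V) : V :=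
  imS r (sepS r y (fun z => r z X)) (fun z => app r s z)

/-- The Mostowski collapse of `X`. -/
noncomputable def col (r : V → V → Prop) [ZFm r] (X : V) : V → V := recF r (colStep r X)

instance (X : V) : Df₂ r (colStep r X) := by unfold colStep; infer_instance
instance (X : V) : Df₁ r (col r X) := by unfold col; infer_instance

theorem mem_col {X y z : V} : r z (col r X y) ↔ ∃ x, r x y ∧ r x X ∧ z = col r X x := by
  rw [col, recF_eq, colStep, mem_imS (r := r)]
  constructor
  · rintro ⟨x, hx, rfl⟩
    obtain ⟨h1, h2⟩ := mem_sepS.1 hx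
    exact ⟨x, h1, h2, app_lamS (mem_tc_of_mem h1)⟩
  · rintro ⟨x, h1, h2, rfl⟩
    exact ⟨x, mem_sepS.2 ⟨h1, h2⟩, (app_lamS (mem_tc_of_mem h1)).symm⟩

theorem col_eq_self {X y : V} (h : SubW r (tc r y) X) : col r X y = y := by
  induction y using hr.wf.induction with
  | _ y ih =>
  refine hr.ext fun z => mem_col.trans ?_
  have : ∀ x, r x y → col r X x = x := fun x hx =>
    ih x hx fun w hw => h _ (tc_subset (fun z hz => trans_tc y _ _ (mem_tc_of_mem hx) hz)
      (trans_tc y) _ hw)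
  constructor
  · rintro ⟨x, hx, -, rfl⟩
    rwa [this x hx]
  · exact fun hz => ⟨z, hz, h _ (mem_tc_of_mem hz), (this z hz).symm⟩

/-- The range of the Mostowski collapse. -/
noncomputable def colS (r : V → V → Prop) [ZFm r] (X : V) : V := imS r X (col r X)

theorem mem_colS {X y : V} : r y (colS r X) ↔ ∃ x, r x X ∧ y = col r X x := mem_imS

theorem trans_colS {X : V} : TransW r (colS r X) := fun x y hx hy => by
  obtain ⟨x, -, rfl⟩ := mem_colS.1 hx
  obtain ⟨z, -, hz, rfl⟩ := mem_col.1 hy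
  exact mem_colS.2 ⟨z, hz, rfl⟩

theorem col_inj {X : V} (hX : ZFm (srel r X)) {x y : V} (hx : r x X) (hy : r y X)
    (h : col r X x = col r X y) : x = y := by
  induction x using hr.wf.induction generalizing y with
  | _ x ih =>
  refine congrArg Subtype.val (hX.ext (x := ⟨x, hx⟩) (y := ⟨y, hy⟩) fun z => ⟨fun hz => ?_, fun hz => ?_⟩)
  · obtain ⟨w, h1, h2, h3⟩ := mem_col.1 (h ▸ mem_col.2 ⟨z.1, hz, z.2, rfl⟩)
    have := ih z.1 hz z.2 h2 h3
    show r z.1 y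
    rwa [this]
  · obtain ⟨w, h1, h2, h3⟩ := mem_col.1 (h.symm ▸ mem_col.2 ⟨z.1, hz, z.2, rfl⟩)
    have := ih w h1 h2 z.2 h3.symm
    show r z.1 x
    rwa [← this]

theorem col_elm {X : V} (hX : ZFm (srel r X)) : Elm (srel r X) (srel r (colS r X))
    (fun x => ⟨col r X x.1, mem_colS.2 ⟨x.1, x.2, rfl⟩⟩) := by
  let e : Sub r X ≃ Sub r (colS r X) := Equiv.ofBijective
    (fun x => ⟨col r X x.1, mem_colS.2 ⟨x.1, x.2, rfl⟩⟩) ⟨fun x y h =>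
      Subtype.ext (col_inj hX x.2 y.2 (congrArg Subtype.val h)), fun y => by
        obtain ⟨x, hx, h⟩ := mem_colS.1 y.2
        exact ⟨⟨x, hx⟩, Subtype.ext h.symm⟩⟩
  refine Elm.of_iso e fun x y => ?_
  constructor
  · intro h
    obtain ⟨w, h1, h2, h3⟩ := mem_col.1 h
    have := col_inj hX x.2 h2 h3
    show r x.1 y.1
    rwa [this]
  · exact fun h => mem_col.2 ⟨x.1, h, x.2, rfl⟩

end Collapse

/-- `f` maps a subset of `y` onto a superset of `a`. -/
def Cov (r : V → V → Prop) (f y a : V) : Prop :=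
  (∀ x z z', r x y → FApp r f x z → FApp r f x z' → z = z') ∧ ∀ z, r z a → ∃ x, r x y ∧ FApp r f x z

/-- `a` is the image of a subset of `y`. -/
def Le (r : V → V → Prop) (y a : V) : Prop := ∃ f, Cov r f y a

instance {ι : Type w} {V : ι → Type u} {r : ∀ i, V i → V i → Prop} {P : (∀ i, V i) → Prop} {n : ℕ}
    (f g h : ∀ i, (Fin n → V i) → V i) [DFn r P f] [DFn r P g] [DFn r P h] :
    Df r P (fun i v => Cov (r i) (f i v) (g i v) (h i v)) :=
  Df.comp3 (Q := fun i => Cov (r i)) (by unfold Cov; infer_instance) f g h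

instance {ι : Type w} {V : ι → Type u} {r : ∀ i, V i → V i → Prop} {P : (∀ i, V i) → Prop} {n : ℕ}
    (f g : ∀ i, (Fin n → V i) → V i) [DFn r P f] [DFn r P g] :
    Df r P (fun i v => Le (r i) (f i v) (g i v)) :=
  Df.comp2 (Q := fun i => Le (r i)) (by unfold Le; infer_instance) f g

section Cover

variable {V : Type u} {r : V → V → Prop} [hr : ZFm r] {y : V}

theorem Le.of {a : V} (Q : V → V → Prop) (hQ : Dp₂ r Q)
    (hf : ∀ x z z', r x y → Q x z → Q x z' → z = z') (hc : ∀ z, r z a → ∃ x, r x y ∧ Q x z) :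
    Le r y a := by
  haveI : ∀ {n : ℕ} (f g : Unit → (Fin n → V) → V)
    [DFn (ι := Unit) (V := fun _ => V) (fun _ => r) (fun _ => True) f]
    [DFn (ι := Unit) (V := fun _ => V) (fun _ => r) (fun _ => True) g],
    Df (ι := Unit) (V := fun _ => V) (fun _ => r) (fun _ => True) (fun i v => Q (f i v) (g i v)) :=
    fun f g _ _ => Dp₂.app hQ f g
  have key : ∀ x z, FApp r (sepS r (prd r y a) (fun p => Q (fst r p) (snd r p))) x z ↔
      r x y ∧ r z a ∧ Q x z := fun x z => by
    rw [fApp_iff, mem_sepS (r := r), mem_prd (r := r)]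
    simp only [fst_op, snd_op, op_inj]
    constructor
    · rintro ⟨⟨x', z', h1, h2, rfl, rfl⟩, h⟩; exact ⟨h1, h2, h⟩
    · rintro ⟨h1, h2, h⟩; exact ⟨⟨x, z, h1, h2, rfl, rfl⟩, h⟩
  refine ⟨_, fun x z z' hx h h' => hf x z z' hx ((key _ _).1 h).2.2 ((key _ _).1 h').2.2,
    fun z hz => ?_⟩
  obtain ⟨x, hx, h⟩ := hc z hz
  exact ⟨x, hx, (key _ _).2 ⟨hx, hz, h⟩⟩

theorem Le.refl_of_sub {a : V} (h : SubW r a y) : Le r y a :=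
  Le.of (fun x z => x = z) inferInstance (fun _ _ _ _ h h' => h.symm.trans h') fun z hz => ⟨z, h z hz, rfl⟩

theorem VE.small_le (hv : VE r) (hom : SubW r (om r) y) (hop : ∀ x z, r x y → r z y → r (op r x z) y) :
    Small r (Le r y) := by
  refine ⟨by infer_instance, ?_, ?_, ?_, Le.refl_of_sub hom⟩
  · intro Q hQ a b ⟨f, hf, hc⟩ hQf hb
    haveI : ∀ {n : ℕ} (f g : Unit → (Fin n → V) → V)
      [DFn (ι := Unit) (V := fun _ => V) (fun _ => r) (fun _ => True) f]
      [DFn (ι := Unit) (V := fun _ => V) (fun _ => r) (fun _ => True) g],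
      Df (ι := Unit) (V := fun _ => V) (fun _ => r) (fun _ => True) (fun i v => Q (f i v) (g i v)) :=
      fun f g _ _ => Dp₂.app hQ f g
    refine Le.of (fun x z => ∃ w, r w a ∧ FApp r f x w ∧ Q w z) inferInstance ?_ fun z hz => ?_
    · rintro x z z' hx ⟨w, h1, h2, h3⟩ ⟨w', h4, h5, h6⟩
      obtain rfl := hf _ _ _ hx h2 h5
      exact hQf w _ _ h1 h3 h6
    · obtain ⟨w, hw, h⟩ := hb z hz
      obtain ⟨x, hx, h'⟩ := hc w hw
      exact ⟨x, hx, w, hw, h', h⟩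
  · intro a ⟨f, hf, hc⟩ ha
    let g : V → V := fun w => e r (lst r (fun α => Cov r (e r α) y w))
    haveI : Df₁ r g := by unfold g; infer_instance
    haveI : ∀ {n : ℕ} (f : Unit → (Fin n → V) → V)
      [DFn (ι := Unit) (V := fun _ => V) (fun _ => r) (fun _ => True) f],
      DFn (ι := Unit) (V := fun _ => V) (fun _ => r) (fun _ => True) (fun i v => g (f i v)) :=
      fun f _ => Df₁.app (by infer_instance) f
    have hg : ∀ w, r w a → Cov r (g w) y w := fun w hw => by
      obtain ⟨f, hf⟩ := ha w hw
      obtain ⟨α, hα, rfl⟩ := hv f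
      exact (lst_spec (r := r) (Q := fun α => Cov r (e r α) y w) ⟨α, hα, hf⟩).2.1
    refine Le.of (fun x z => ∃ x1 x2 w, r x1 y ∧ r x2 y ∧ x = op r x1 x2 ∧ r w a ∧ FApp r f x1 w ∧ FApp r (g w) x2 z)
      inferInstance ?_ fun z hz => ?_
    · rintro x z z' hx ⟨x1, x2, w, h1, h2, rfl, h3, h4, h5⟩ ⟨y1, y2, w', h1', h2', he, h3', h4', h5'⟩
      obtain ⟨rfl, rfl⟩ := op_inj.1 he
      obtain rfl := hf _ _ _ h1 h4 h4'
      exact (hg w h3).1 _ _ _ h2 h5 h5'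
    · obtain ⟨w, hw, hzw⟩ := mem_sUn.1 hz
      obtain ⟨x1, h1, h1'⟩ := hc w hw
      obtain ⟨x2, h2, h2'⟩ := (hg w hw).2 z hzw
      exact ⟨op r x1 x2, hop _ _ h1 h2, x1, x2, w, h1, h2, rfl, hw, h1', h2'⟩
  · intro a b
    refine Le.of (fun x z => (x = emp r ∧ z = a) ∨ (x ≠ emp r ∧ z = b)) inferInstance ?_ fun z hz => ?_
    · rintro x z z' - (⟨h, rfl⟩ | ⟨h, rfl⟩) (⟨h', rfl⟩ | ⟨h', rfl⟩)
      · rfl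
      · exact absurd h h'
      · exact absurd h' h
      · rfl
    · rcases mem_up.1 hz with rfl | rfl
      · exact ⟨emp r, hom _ (nat_mem_om 0), .inl ⟨rfl, rfl⟩⟩
      · exact ⟨nat r 1, hom _ (nat_mem_om 1), .inr ⟨fun h => by
          have := nat_inj (r := r) (k := 1) (n := 0) h
          omega, rfl⟩⟩

/-- `R` codes the ordinal `α` as a quotient of a linear preorder on a subset of `y`. -/
def Codes (r : V → V → Prop) [ZFm r] (y R α : V) : Prop :=
  ∃ f, Cov r f y α ∧ ∀ a b, r a y → r b y → (r (op r a b) R ↔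
    ∃ γ γ', r γ α ∧ r γ' α ∧ FApp r f a γ ∧ FApp r f b γ' ∧ (r γ γ' ∨ γ = γ'))

instance {ι : Type w} {V : ι → Type u} {r : ∀ i, V i → V i → Prop} [∀ i, ZFm (r i)]
    {P : (∀ i, V i) → Prop} {n : ℕ}
    (f g h : ∀ i, (Fin n → V i) → V i) [DFn r P f] [DFn r P g] [DFn r P h] :
    Df r P (fun i v => Codes (r i) (f i v) (g i v) (h i v)) :=
  Df.comp3 (Q := fun i => Codes (r i)) (by unfold Codes; infer_instance) f g h

theorem Codes.sub {R α β : V} (hα : OrdW r α) (hβ : OrdW r β) (h : Codes r y R α)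
    (h' : Codes r y R β) : SubW r α β := by
  obtain ⟨f, ⟨hf, hc⟩, hR⟩ := h
  obtain ⟨g, ⟨hg, hd⟩, hS⟩ := h'
  have le : ∀ a b γ γ' δ δ', r a y → r b y → r γ α → r γ' α → r δ β → r δ' β → FApp r f a γ → FApp r f b γ' →
      FApp r g a δ → FApp r g b δ' → ((r γ γ' ∨ γ = γ') ↔ (r δ δ' ∨ δ = δ')) := by
    intro a b γ γ' δ δ' ha hb h1 h2 h3 h4 fa fb ga gb
    have e1 := hR a b ha hb
    have e2 := hS a b ha hb
    constructor
    · intro h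
      obtain ⟨ε, ε', -, -, h5, h6, h7⟩ := e2.1 (e1.2 ⟨γ, γ', h1, h2, fa, fb, h⟩)
      rwa [hg _ _ _ ha ga h5, hg _ _ _ hb gb h6]
    · intro h
      obtain ⟨ε, ε', -, -, h5, h6, h7⟩ := e1.1 (e2.2 ⟨δ, δ', h3, h4, ga, gb, h⟩)
      rwa [hf _ _ _ ha fa h5, hf _ _ _ hb fb h6]
  have dg : ∀ a γ, r a y → r γ α → FApp r f a γ → ∃ δ, r δ β ∧ FApp r g a δ := by
    intro a γ ha h1 fa
    obtain ⟨δ, -, h2, -, h3, -⟩ := (hS a a ha ha).1 ((hR a a ha ha).2 ⟨γ, γ, h1, h1, fa, fa, .inr rfl⟩)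
    exact ⟨δ, h2, h3⟩
  have df : ∀ a γ, r a y → r γ β → FApp r g a γ → ∃ δ, r δ α ∧ FApp r f a δ := by
    intro a γ ha h1 fa
    obtain ⟨δ, -, h2, -, h3, -⟩ := (hR a a ha ha).1 ((hS a a ha ha).2 ⟨γ, γ, h1, h1, fa, fa, .inr rfl⟩)
    exact ⟨δ, h2, h3⟩
  have nlt : ∀ {o γ δ : V}, OrdW r o → r γ o → r δ o → (r γ δ ↔ ¬ (r δ γ ∨ δ = γ)) := by
    intro o γ δ ho h1 h2
    constructor
    · rintro h (h' | rfl)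
      · exact hr.not_self _ ((ho.mem h1).trans h' h)
      · exact hr.not_self _ h
    · intro h
      rcases (ho.mem h1).trich (ho.mem h2) with h' | h' | h'
      · exact h'
      · exact absurd (.inr h'.symm) h
      · exact absurd (.inl h') h
  have key : ∀ γ, r γ α → ∀ a, r a y → FApp r f a γ → r γ β ∧ FApp r g a γ := by
    intro γ
    induction γ using hr.wf.induction with
    | _ γ ih =>
    intro hγ a ha fa
    obtain ⟨δ, hδ, ga⟩ := dg a γ ha hγ fa
    suffices γ = δ by subst this; exact ⟨hδ, ga⟩
    refine hr.ext fun ε => ⟨fun hε => ?_, fun hε => ?_⟩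
    · have hεα := hα.trans hγ hε
      obtain ⟨b, hb, fb⟩ := hc ε hεα
      obtain ⟨h1, gb⟩ := ih ε hε hεα b hb fb
      rw [nlt hβ h1 hδ, ← le a b γ ε δ ε ha hb hγ hεα hδ h1 fa fb ga gb, ← nlt hα hεα hγ]
      exact hε
    · have hεβ := hβ.trans hδ hε
      obtain ⟨b, hb, gb⟩ := hd ε hεβ
      obtain ⟨ε', h1, fb⟩ := df b ε hb hεβ gb
      have h2 : r ε' γ := by
        rw [nlt hα h1 hγ, le a b γ ε' δ ε ha hb hγ h1 hδ hεβ fa fb ga gb, ← nlt hβ hεβ hδ]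
        exact hε
      obtain ⟨h3, gb'⟩ := ih ε' h2 h1 b hb fb
      rwa [hg _ _ _ hb gb gb']
  intro γ hγ
  obtain ⟨a, ha, fa⟩ := hc γ hγ
  exact (key γ hγ a ha fa).1

theorem exists_hartogs (hp : Pw r) (y : V) : ∃ δ, OrdW r δ ∧ ∀ α, r α δ ↔ OrdW r α ∧ Le r y α := by
  obtain ⟨p, hp⟩ := hp (prd r y y)
  obtain ⟨δ, hδ, h⟩ := exists_ord_bound (r := r) (x := imS r p (fun R => lst r (fun α => Codes r y R α)))
    fun z hz => by obtain ⟨R, -, rfl⟩ := mem_imS.1 hz; exact ordW_lst _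
  have key : ∀ α, OrdW r α → Le r y α → r α δ := by
    intro α hα ⟨f, hf⟩
    let R := sepS r (prd r y y) (fun p => ∃ γ γ', r γ α ∧ r γ' α ∧ FApp r f (fst r p) γ ∧
      FApp r f (snd r p) γ' ∧ (r γ γ' ∨ γ = γ'))
    have hR : Codes r y R α := ⟨f, hf, fun a b ha hb => by
      unfold R
      rw [mem_sepS (r := r), mem_prd (r := r)]
      simp only [fst_op, snd_op]
      exact and_iff_right ⟨a, b, ha, hb, rfl⟩⟩
    refine h _ (mem_imS.2 ⟨R, (hp R).2 fun z hz => (mem_sepS.1 hz).1, ?_⟩)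
    obtain ⟨h1, h2, -⟩ := lst_spec (r := r) (Q := fun α => Codes r y R α) ⟨α, hα, hR⟩
    exact hr.ext fun z => ⟨fun hz => hR.sub hα h1 h2 z hz, fun hz => h2.sub h1 hα hR z hz⟩
  refine ⟨sepS r δ (Le r y), ⟨fun α γ hα hγ => ?_, fun x hx => (hδ.mem (mem_sepS.1 hx).1).1⟩, fun α => ?_⟩
  · obtain ⟨h1, f, h2, h3⟩ := mem_sepS.1 hα
    exact mem_sepS.2 ⟨hδ.trans h1 hγ, f, h2, fun z hz => h3 z ((hδ.mem h1).trans hγ hz)⟩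
  · rw [mem_sepS (r := r)]
    exact ⟨fun h => ⟨hδ.mem h.1, h.2⟩, fun h => ⟨key _ h.1 h.2, h.2⟩⟩

end Cover

theorem Dz.ve : Dz (fun (i : ZSt.{u}) (_ : Fin 0 → i.V) => VE i.r) := by unfold VE; infer_instance

section Closure

variable {V : Type u} {r : V → V → Prop} [hr : ZFm r] {B : V → Prop} {F : V → V} {a : V}

theorem exists_fin_itn [Df₁ r F] {s : V} (hs : r s (fin r (itr r F a))) :
    ∃ n, r s (fin r (itn r F a n)) := by
  obtain ⟨l, hl, rfl⟩ := mem_fin.1 hs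
  suffices ∃ n, ∀ x ∈ l, r x (itn r F a n) from
    let ⟨n, h⟩ := this; ⟨n, mem_fin.2 ⟨l, h, rfl⟩⟩
  clear hs
  induction l with
  | nil => exact ⟨0, by simp⟩
  | cons x l ih =>
    obtain ⟨n, hn⟩ := ih fun x hx => hl x (by simp [hx])
    obtain ⟨m, hm⟩ := mem_itr.1 (hl x (by simp))
    refine ⟨max m n, fun z hz => ?_⟩
    rcases List.mem_cons.1 hz with rfl | hz
    · exact itn_mono (le_max_left _ _) _ hm
    · exact itn_mono (le_max_right _ _) _ (hn z hz)

theorem fin_mono {b : V} (h : SubW r a b) : SubW r (fin r a) (fin r b) := fun s hs => by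
  obtain ⟨l, hl, rfl⟩ := mem_fin.1 hs
  exact mem_fin.2 ⟨l, fun x hx => h x (hl x hx), rfl⟩

theorem Small.nat (h : Small r B) (n : ℕ) : B (nat r n) :=
  h.sub h.om fun _ hx => ordW_om.1 _ _ (nat_mem_om n) hx

theorem Small.itn (h : Small r B) [hF : Df₁ r F] (ha : B a) (hB : ∀ x, B x → B (F x)) (n : ℕ) :
    B (itn r F a n) := by
  haveI : ∀ {n : ℕ} (f : Unit → (Fin n → V) → V)
    [DFn (ι := Unit) (V := fun _ => V) (fun _ => r) (fun _ => True) f],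
    DFn (ι := Unit) (V := fun _ => V) (fun _ => r) (fun _ => True) (fun i v => F (f i v)) :=
    fun f _ => Df₁.app hF f
  haveI := df_itrStep (r := r) (F := F) a
  induction n using Nat.strong_induction_on with
  | _ n ih =>
  have : B (VLC.iUn r (VLC.nat r n) (fun k => F (recF r (itrStep r F a) k))) := by
    refine h.iUn _ (h.nat n) fun k hk => ?_
    obtain ⟨k, hkn, rfl⟩ := mem_nat.1 hk
    exact hB _ (ih k hkn)
  refine h.sub (h.un ha this) fun z hz => mem_un.2 ((mem_itn.1 hz).imp_right ?_)
  rintro ⟨k, hk, hz⟩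
  exact (mem_iUn (F := fun k => F (recF r (itrStep r F a) k))).2
    ⟨VLC.nat r k, nat_mem_nat.2 hk, hz⟩

theorem Small.itr (h : Small r B) [hF : Df₁ r F] (ha : B a) (hB : ∀ x, B x → B (F x)) :
    B (itr r F a) := by
  haveI := df_itrStep (r := r) (F := F) a
  refine h.iUn _ h.om fun k hk => ?_
  obtain ⟨k, rfl⟩ := mem_om.1 hk
  exact h.itn ha hB k

theorem Small.fin (h : Small r B) (ha : B a) : B (fin r a) := by
  have key : ∀ n, B (recF r (finStep r a) (VLC.nat r n)) := by
    intro n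
    induction n using Nat.strong_induction_on with
    | _ n ih =>
    have : B (VLC.iUn r (VLC.nat r n) (fun k => VLC.iUn r (recF r (finStep r a) k)
        (fun q => VLC.imS r a (fun x => VLC.adj r q x)))) := by
      refine h.iUn _ (h.nat n) fun k hk => ?_
      obtain ⟨k, hkn, rfl⟩ := mem_nat.1 hk
      exact h.iUn _ (ih k hkn) fun q _ => h.imS _ ha
    refine h.sub (h.adj (b := VLC.emp r) this) fun z hz => mem_adj.2 ((mem_finStep_nat.1 hz).symm.imp_left ?_)
    rintro ⟨k, hk, q, x, hq, hx, rfl⟩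
    rw [mem_iUn (r := r)]
    refine ⟨VLC.nat r k, nat_mem_nat.2 hk, ?_⟩
    rw [mem_iUn (r := r)]
    refine ⟨q, hq, ?_⟩
    rw [mem_imS (r := r)]
    exact ⟨x, hx, rfl⟩
  unfold VLC.fin
  refine h.iUn _ h.om fun k hk => ?_
  obtain ⟨k, rfl⟩ := mem_om.1 hk
  exact key k

end Closure

section Condensation

variable {V : Type u} {r : V → V → Prop} [hr : ZFm r] {y : V}

theorem ee_hartogs {δ : V} (hs : Small r (Le r y)) (hδ : ∀ α, r α δ ↔ OrdW r α ∧ Le r y α) :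
    ∃ _ : ZFm (srel r (ee r δ)), VE (srel r (ee r δ)) := by
  haveI := hs.zfm
  have her : ∀ α, OrdW r α → (Her r (Le r y) α ↔ Le r y α) := fun α hα => by
    unfold Her; rw [tc_eq_self hα.1]
  have h1 : ∀ x : {x // Her r (Le r y) x}, Ce (crel r (Her r (Le r y))) x ↔ r x.1 (ee r δ) := by
    intro x
    rw [ce_iff, VLC.mem_ee (r := r)]
    constructor
    · rintro ⟨α, h1, rfl⟩
      have h2 := (crel_ordW hs.her_mem).1 h1
      exact ⟨α.1, (hδ _).2 ⟨h2, (her _ h2).1 α.2⟩, (TEmb.incl hs.her_mem).e α⟩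
    · rintro ⟨α, h1, h⟩
      obtain ⟨h2, h3⟩ := (hδ _).1 h1
      refine ⟨⟨α, (her _ h2).2 h3⟩, (crel_ordW hs.her_mem).2 h2, Subtype.ext (h.trans ?_)⟩
      exact ((TEmb.incl hs.her_mem).e ⟨α, (her _ h2).2 h3⟩).symm
  let f : {x // Ce (crel r (Her r (Le r y))) x} ≃ Sub r (ee r δ) := Equiv.ofBijective
    (fun x => ⟨x.1.1, (h1 _).1 x.2⟩) ⟨fun a b h => Subtype.ext (Subtype.ext (by simpa using h)), by
      rintro ⟨x, hx⟩
      obtain ⟨α, h2, rfl⟩ := mem_ee.1 hx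
      obtain ⟨h3, h4⟩ := (hδ _).1 h2
      have : Her r (Le r y) (e r α) := by
        have := (TEmb.incl hs.her_mem).e ⟨α, (her _ h3).2 h4⟩
        exact this ▸ (e (crel r (Her r (Le r y))) ⟨α, (her _ h3).2 h4⟩).2
      exact ⟨⟨⟨_, this⟩, (h1 _).2 hx⟩, rfl⟩⟩
  have el : Elm (crel (crel r (Her r (Le r y))) (Ce (crel r (Her r (Le r y))))) (srel r (ee r δ)) f :=
    Elm.of_iso f fun x y => Iff.rfl
  haveI := el.zfm (InvImage.wf Subtype.val hr.wf)
  exact ⟨this, (el.sentz Dz.ve).2 ve_ce⟩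

theorem exists_index_of_trans {Y : V} (tr : TransW r Y) (hz : ZFm (srel r Y)) (hv : VE (srel r Y))
    {x : V} (hx : r x Y) : ∃ α, r α Y ∧ OrdW r α ∧ x = e r α := by
  obtain ⟨α, h1, h2⟩ := hv ⟨x, hx⟩
  have tr' : ∀ x z, r x Y → r z x → r z Y := fun x z => tr x z
  haveI : ZFm (crel r (fun x => r x Y)) := hz
  refine ⟨α.1, α.2, (crel_ordW tr').1 h1, ?_⟩
  exact (congrArg Subtype.val h2).trans ((TEmb.incl tr').e α)

/-- Condensation: the constructible sets of hereditary size below a regular `θ` appear before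
stage `θ`. -/
theorem Rg.mem_ee {θ x : V} (hθ : Rg r θ) (hv : VE r) (hp : Pw r) (hx : Bd r θ (tc r x)) :
    r x (ee r θ) := by
  have hB := hθ.small
  obtain ⟨α, hα, hxα⟩ := hv x
  let y := itr r (fun a => prd r a a) (un r (om r) (succ r α))
  have hy0 : SubW r (un r (om r) (succ r α)) y := sub_itr
  have hs : Small r (Le r y) := hv.small_le (fun z hz => hy0 _ (mem_un.2 (.inl hz))) fun x z hx hz => by
    obtain ⟨m, hm⟩ := mem_itr.1 hx
    obtain ⟨n, hn⟩ := mem_itr.1 hz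
    exact itr_step (n := max m n) (mem_prd.2 ⟨x, z, itn_mono (le_max_left _ _) _ hm,
      itn_mono (le_max_right _ _) _ hn, rfl⟩)
  obtain ⟨δ, hδo, hδ⟩ := exists_hartogs hp y
  obtain ⟨hK, hKv⟩ := ee_hartogs hs hδ
  set K := ee r δ with hKd
  have hKt : TransW r K := transW_ee hδo
  have hxK : r x K := VLC.mem_ee.2 ⟨α, (hδ α).2 ⟨hα, Le.refl_of_sub fun z hz =>
    hy0 _ (mem_un.2 (.inr (mem_succ.2 (.inl hz))))⟩, hxα⟩
  have hδ0 : ∃ β, r β δ := let ⟨β, h, _⟩ := VLC.mem_ee.1 hxK; ⟨β, h⟩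
  let g : V → V → V → V := fun n s t => e r (lst r (fun β => r β δ ∧
    (¬ r (e r β) (dsub r K n s t) ∨ ∀ z, r z K → r z (dsub r K n s t))))
  have hg : ∀ n s t, r (g n s t) K ∧ (¬ r (g n s t) (dsub r K n s t) ∨ ∀ z, r z K → r z (dsub r K n s t)) := by
    intro n s t
    have : ∃ β, OrdW r β ∧ r β δ ∧ (¬ r (e r β) (dsub r K n s t) ∨ ∀ z, r z K → r z (dsub r K n s t)) := by
      by_cases h : ∀ z, r z K → r z (dsub r K n s t)
      · obtain ⟨β, hβ⟩ := hδ0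
        exact ⟨β, hδo.mem hβ, hβ, .inr h⟩
      · push Not at h
        obtain ⟨z, hz, hz'⟩ := h
        obtain ⟨β, hβ, rfl⟩ := VLC.mem_ee.1 hz
        exact ⟨β, hδo.mem hβ, hβ, .inl hz'⟩
    obtain ⟨-, ⟨h1, h2⟩, -⟩ := lst_spec (r := r) this
    exact ⟨VLC.mem_ee.2 ⟨_, h1, rfl⟩, h2⟩
  let F : V → V := fun X => iUn r (om r) (fun n => iUn r (fin r X) (fun s => imS r (fin r X) (fun t => g n s t)))
  haveI hF : Df₁ r F := by unfold F g; infer_instance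
  have mF : ∀ X z, r z (F X) ↔ ∃ n s t, r n (om r) ∧ r s (fin r X) ∧ r t (fin r X) ∧ z = g n s t := by
    intro X z
    unfold F
    rw [mem_iUn (r := r)]
    constructor
    · rintro ⟨n, hn, hz⟩
      rw [mem_iUn (r := r)] at hz
      obtain ⟨s, hs, hz⟩ := hz
      rw [mem_imS (r := r)] at hz
      obtain ⟨t, ht, hz⟩ := hz
      exact ⟨n, s, t, hn, hs, ht, hz⟩
    · rintro ⟨n, s, t, hn, hs, ht, hz⟩
      refine ⟨n, hn, ?_⟩
      rw [mem_iUn (r := r)]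
      refine ⟨s, hs, ?_⟩
      rw [mem_imS (r := r)]
      exact ⟨t, ht, hz⟩
  let a := adj r (tc r x) x
  let X := itr r F a
  have ha : SubW r a K := fun z hz => by
    rcases mem_adj.1 hz with hz | rfl
    · exact tc_subset (fun w hw => hKt _ _ hxK hw) hKt _ hz
    · exact hxK
  have hX : SubW r X K := fun z hz => by
    obtain ⟨n, hz⟩ := mem_itr.1 hz
    rcases mem_itn.1 hz with hz | ⟨k, -, hz⟩
    · exact ha z hz
    · obtain ⟨n, s, t, -, -, -, rfl⟩ := (mF _ _).1 hz
      exact (hg n s t).1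
  have hXB : Bd r θ X := by
    refine hB.itr (hB.adj hx) fun X hX => ?_
    unfold F
    refine hB.iUn _ hB.om fun n _ => hB.iUn _ (hB.fin hX) fun s _ => hB.imS _ (hB.fin hX)
  have el : Elm (srel r X) (srel r K) (incl hX) := hull_elm hX fun n s t hs ht ⟨w, hw, hw'⟩ => by
    obtain ⟨i, hi⟩ := exists_fin_itn hs
    obtain ⟨j, hj⟩ := exists_fin_itn ht
    refine ⟨g (nat r n) s t, itr_step (n := max i j) ((mF _ _).2 ⟨_, s, t, nat_mem_om n,
      fin_mono (itn_mono (le_max_left _ _)) _ hi, fin_mono (itn_mono (le_max_right _ _)) _ hj, rfl⟩), ?_⟩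
    exact (hg (nat r n) s t).2.resolve_right fun h => hw' (h w hw)
  haveI hXz := el.zfm_rev (InvImage.wf Subtype.val hr.wf)
  have hXv : VE (srel r X) := (el.sentz Dz.ve).1 hKv
  have el2 := col_elm hXz
  haveI hYz := el2.zfm (InvImage.wf Subtype.val hr.wf)
  have hYv : VE (srel r (colS r X)) := (el2.sentz Dz.ve).2 hXv
  have hxY : r x (colS r X) := mem_colS.2 ⟨x, sub_itr _ (mem_adj.2 (.inr rfl)),
    (col_eq_self fun z hz => sub_itr _ (mem_adj.2 (.inl hz))).symm⟩
  obtain ⟨β, hβ, hβo, hxβ⟩ := exists_index_of_trans trans_colS hYz hYv hxY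
  exact VLC.mem_ee.2 ⟨β, hθ.mem_of_bd hβo (hB.sub (hB.imS (col r X) hXB) fun z hz => trans_colS _ _ hβ hz), hxβ⟩

end Condensation

section HW

variable {V : Type u} {r : V → V → Prop} [hr : ZFm r] {θ : V}

theorem Rg.cardLt_of_bd (hθ : Rg r θ) (hp : Pw r) (hc : Ch r) {a : V} (ha : Bd r θ a) :
    CardLtW r a θ := by
  obtain ⟨p, hp⟩ := hp a
  obtain ⟨f, hf, hf'⟩ := hc (sepS r p (fun x => ∃ y, r y x)) fun x hx => (mem_sepS.1 hx).2
  let rest : V → V := fun s => sepS r a (fun x => ∀ y z, r y s → IsOPair r y z x → False)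
  let G : V → V → V := fun α s => app r f (sepS r a (fun x => ¬ ∃ β, r β α ∧ x = app r s β))
  haveI : Df₂ r G := by unfold G; infer_instance
  let g : V → V := recF r G
  haveI : Df₁ r g := by unfold g; infer_instance
  let R : V → V := fun α => sepS r a (fun x => ¬ ∃ β, r β α ∧ x = g β)
  haveI : Df₁ r R := by unfold R; infer_instance
  have hR : ∀ α x, r x (R α) ↔ r x a ∧ ¬ ∃ β, r β α ∧ x = g β := fun α x => by
    unfold R; rw [mem_sepS (r := r)]
  have hg : ∀ α, OrdW r α → g α = app r f (R α) := by
    intro α hα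
    have : g α = G α (lamS r (tc r α) g) := recF_eq G α
    rw [this]
    refine congrArg (app r f) (hr.ext fun x => ?_)
    rw [hR, mem_sepS (r := r)]
    refine and_congr_right fun _ => not_congr (exists_congr fun β => and_congr_right fun hβ => ?_)
    rw [app_lamS (mem_tc_of_mem hβ)]
  have hgm : ∀ α, OrdW r α → (∃ x, r x (R α)) → r (g α) (R α) := by
    intro α hα hx
    have hm : r (R α) (sepS r p (fun x => ∃ y, r y x)) :=
      mem_sepS.2 ⟨(hp _).2 fun z hz => ((hR _ _).1 hz).1, hx⟩
    rw [hg α hα]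
    exact hf' _ _ hm (hf.fApp_app hm)
  have hinj : ∀ α, OrdW r α → (∀ β, r β α → ∃ x, r x (R β)) → ∀ β γ, r β α → r γ α → g β = g γ → β = γ := by
    have : ∀ α, OrdW r α → (∀ β, r β α → ∃ x, r x (R β)) → ∀ β γ, r β α → r γ α → g β = g γ → ¬ r β γ := by
      intro α hα h β γ hβ hγ he hlt
      exact ((hR _ _).1 (hgm γ (hα.mem hγ) (h γ hγ))).2 ⟨β, hlt, he.symm⟩
    intro α hα h β γ hβ hγ he
    rcases (hα.mem hβ).trich (hα.mem hγ) with h' | h' | h'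
    · exact absurd h' (this α hα h β γ hβ hγ he)
    · exact h'
    · exact absurd h' (this α hα h γ β hγ hβ he.symm)
  have hex : ∃ α, OrdW r α ∧ ¬ ∃ x, r x (R α) := by
    by_contra hcon
    push Not at hcon
    have hall : ∀ β, r β θ → ∃ x, r x (R β) := fun β hβ => hcon β (hθ.1.1.mem hβ)
    obtain ⟨β, hβ, h⟩ := ha.bdd (fun x γ => r γ θ ∧ x = g γ) fun x y y' _ h h' =>
      hinj θ hθ.1.1 hall _ _ h.1 h'.1 (h.2.symm.trans h'.2)
    have := h (g β) β ((hR _ _).1 (hgm β (hθ.1.1.mem hβ) (hall β hβ))).1 hβ ⟨hβ, rfl⟩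
    exact hr.not_self _ this
  obtain ⟨α, hα, hemp, hmin⟩ := exists_least hex
  have hne : ∀ β, r β α → ∃ x, r x (R β) := fun β hβ => by
    by_contra h; exact hmin β hβ h
  have hαθ : r α θ := hθ.mem_of_bd hα (hθ.small.im (fun x γ => r γ α ∧ x = g γ) inferInstance a α ha
    (fun x y y' _ h h' => hinj α hα hne _ _ h.1 h'.1 (h.2.symm.trans h'.2)) fun γ hγ =>
      ⟨g γ, ((hR _ _).1 (hgm γ (hα.mem hγ) (hne γ hγ))).1, hγ, rfl⟩)
  have hcov : ∀ x, r x a → ∃ β, r β α ∧ x = g β := fun x hx => by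
    by_contra h; exact hemp ⟨x, (hR _ _).2 ⟨hx, h⟩⟩
  let k : V → V := fun x => lst r (fun β => r β α ∧ x = g β)
  haveI : Df₁ r k := by unfold k; infer_instance
  have hk : ∀ x, r x a → r (k x) α ∧ x = g (k x) := fun x hx => by
    obtain ⟨β, h1, h2⟩ := hcov x hx
    exact (lst_spec (r := r) (Q := fun β => r β α ∧ x = g β) ⟨β, hα.mem h1, h1, h2⟩).2.1
  refine ⟨α, lamS r a k, hαθ, ⟨isFunOn_lamS _ _, fun x y h => ?_⟩, fun x x' y h h' => ?_⟩
  · rw [(fApp_lamS.1 h).2]; exact (hk x (fApp_lamS.1 h).1).1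
  · obtain ⟨hx, rfl⟩ := fApp_lamS.1 h
    obtain ⟨hx', h⟩ := fApp_lamS.1 h'
    rw [(hk x hx).2, h, ← (hk x' hx').2]

theorem inHW_iff {x : V} : InHW r θ x ↔ CardLtW r (tc r x) θ :=
  ⟨fun ⟨t, h1, h2⟩ => by rwa [← eq_tc_iff.2 h1], fun h => ⟨_, tcw_tc x, h⟩⟩

variable {h : V} (hθ : Rg r θ) (hp : Pw r) (hc : Ch r) (hh : IsHW r θ h)
include hθ hp hc hh

theorem IsHW.mem_iff {x : V} : r x h ↔ Her r (Bd r θ) x :=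
  (hh x).trans (inHW_iff.trans ⟨hθ.bd_of_cardLt, hθ.cardLt_of_bd hp hc⟩)

theorem IsHW.trans : TransW r h := fun x y hx hy =>
  (hh.mem_iff hθ hp hc).2 (hθ.small.her_mem _ _ ((hh.mem_iff hθ hp hc).1 hx) hy)

theorem IsHW.ord {α : V} (hα : OrdW r α) : r α h ↔ r α θ := by
  rw [hh.mem_iff hθ hp hc, Her, tc_eq_self hα.1]
  exact ⟨hθ.mem_of_bd hα, hθ.2.2 α⟩

theorem IsHW.zfm : ZFm (srel r h) := by
  haveI := hθ.small.zfm
  let f : {x // Her r (Bd r θ) x} ≃ Sub r h := Equiv.subtypeEquivRight fun x => (hh.mem_iff hθ hp hc).symm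
  have el : Elm (crel r (Her r (Bd r θ))) (srel r h) f := Elm.of_iso f fun x y => Iff.rfl
  exact el.zfm (InvImage.wf Subtype.val hr.wf)

end HW

section HWE

variable {V : Type u} {r : V → V → Prop} [hr : ZFm r] {θ : V}

theorem e_mem {m α : V} (hm : ZFm (srel r m)) (tr : TransW r m) (hα : OrdW r α) (h : r α m) : r (e r α) m := by
  have tr' : ∀ x z, r x m → r z x → r z m := fun x z => tr x z
  haveI : ZFm (crel r (fun x => r x m)) := hm
  exact (TEmb.incl tr').e ⟨α, h⟩ ▸ (e (crel r (fun x => r x m)) ⟨α, h⟩).2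

theorem e_cardLt (hθ : OrdW r θ) {α : V} (hα : r α θ) : CardLtW r (tc r (e r α)) θ := by
  have hαo := hθ.mem hα
  have hs : SubW r (tc r (e r α)) (ee r α) := tc_subset (e_sub hαo) (transW_ee hαo)
  have hk : ∀ x, r x (tc r (e r α)) → r (lst r (fun β => x = e r β)) α ∧ x = e r (lst r (fun β => x = e r β)) := by
    intro x hx
    obtain ⟨β, h1, h2⟩ := mem_ee.1 (hs x hx)
    obtain ⟨h3, h4, h5⟩ := lst_spec (r := r) (Q := fun β => x = e r β) ⟨β, hαo.mem h1, h2⟩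
    refine ⟨?_, h4⟩
    by_contra h6
    exact h5 β (h3.not_mem hαo h6 _ h1) h2
  refine ⟨α, lamS r (tc r (e r α)) (fun x => lst r (fun β => x = e r β)), hα, ⟨isFunOn_lamS _ _, fun x y h => ?_⟩,
    fun x x' y h h' => ?_⟩
  · rw [(fApp_lamS.1 h).2]; exact (hk x (fApp_lamS.1 h).1).1
  · obtain ⟨hx, rfl⟩ := fApp_lamS.1 h
    obtain ⟨hx', h⟩ := fApp_lamS.1 h'
    rw [(hk x hx).2, h, ← (hk x' hx').2]

variable (hθ : Rg r θ) (hp : Pw r) (hv : VE r)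
include hθ hp hv

theorem isHW_ee : IsHW r θ (ee r θ) := fun x => by
  rw [inHW_iff]
  exact ⟨fun h => let ⟨α, h1, h2⟩ := mem_ee.1 h; h2 ▸ e_cardLt hθ.1.1 h1,
    fun h => hθ.mem_ee hv hp (hθ.bd_of_cardLt h)⟩

theorem IsHW.eq_ee {h : V} (hh : IsHW r θ h) : h = ee r θ :=
  hr.ext fun x => (hh x).trans (isHW_ee hθ hp hv x).symm

theorem zfm_ee : ZFm (srel r (ee r θ)) := (isHW_ee hθ hp hv).zfm hθ hp hv.ch

theorem ve_ee : @VE _ (srel r (ee r θ)) (zfm_ee hθ hp hv) := by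
  have hz := zfm_ee hθ hp hv
  have tr : ∀ x z, r x (ee r θ) → r z x → r z (ee r θ) := fun x z => transW_ee hθ.1.1 x z
  haveI : ZFm (crel r (fun x => r x (ee r θ))) := hz
  intro x
  obtain ⟨α, h1, h2⟩ := mem_ee.1 x.2
  have hm : r α (ee r θ) := ((isHW_ee hθ hp hv).ord hθ hp hv.ch (hθ.1.1.mem h1)).2 h1
  refine ⟨⟨α, hm⟩, (crel_ordW tr).2 (hθ.1.1.mem h1), Subtype.ext (h2.trans ?_)⟩
  exact ((TEmb.incl tr).e ⟨α, hm⟩).symm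

end HWE

theorem mstr_empty {V : Type u} {dom : V → Prop} {r : V → V → Prop} {A1 A2 : V → Prop}
    (h1 : ∀ x, dom x → ¬ A1 x) (h2 : ∀ x, dom x → ¬ A2 x) :
    mstr dom r A1 A2 = memStr (fun a b : {x // dom x} => r a.1 b.1) := by
  refine Structure.ext ?_ ?_
  · funext n f; exact nomatch f
  · funext n R v
    cases R
    · exact propext ⟨fun h => h1 _ (v 0).2 h, fun h => h.elim⟩
    · exact propext ⟨fun h => h2 _ (v 0).2 h, fun h => h.elim⟩
    · rfl

theorem GenEmb.elm {u : ZFUniv.{u}} {h : u.V} (D : PlainEmb u h) :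
    Elm (srel u.mem h) (srel D.E.W.mem D.tgt) (fun x => eApp D.emb x) := by
  letI S1 := mstr (u.mem · h) u.mem (fun _ => False) (fun _ => False)
  letI S2 := mstr (D.E.W.mem · D.tgt) D.E.W.mem (D.E.W.mem · D.bset) D.b2
  have key : ∀ {n} (φ : L3.Formula (Fin n)) (v : Fin n → {x // u.mem x h}),
      φ.Realize (fun k => eApp D.emb (v k)) ↔ φ.Realize v := fun φ v =>
    @ElementaryEmbedding.map_formula L3 _ _ S1 S2 D.emb _ φ v
  have hu : ∀ (R : Rels 1), (∀ x : {x // u.mem x h}, ¬ Structure.RelMap (L := L3) R ![x]) →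
      ∀ y : {y // D.E.W.mem y D.tgt}, ¬ Structure.RelMap (L := L3) R ![y] := by
    intro R hR
    let φ : L3.Formula (Fin 0) :=
      (BoundedFormula.all (BoundedFormula.not (BoundedFormula.rel (L := L3) (l := 1) (n := 1) R
        (fun _ => Term.var (Sum.inr 0)))))
    have ev : ∀ {X : Type u} (x : X), (fun _ : Fin 1 => (Fin.snoc default x : Fin 1 → X) 0) = ![x] := by
      intro X x; funext k; fin_cases k; rfl
    have h1 : φ.Realize (Fin.elim0 : Fin 0 → {x // u.mem x h}) := by
      intro x
      have := hR x
      rw [← ev x] at this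
      exact this
    have h2 := (key φ Fin.elim0).2 h1
    intro y
    have := h2 y
    rw [← ev y]
    exact this
  have e2 : S2 = memStr (srel D.E.W.mem D.tgt) :=
    mstr_empty (fun x hx hA => hu .u1 (fun _ h => h) ⟨x, hx⟩ hA)
      (fun x hx hA => hu .u2 (fun _ h => h) ⟨x, hx⟩ hA)
  have e1 : S1 = memStr (srel u.mem h) := mstr_eq_memStr _ _
  intro n φ v
  have := key φ v
  rwa [e1, e2] at this

section Rank

variable {V : Type u} (r : V → V → Prop) [hr : ZFm r]

/-- The rank of a set. -/
noncomputable def rk : V → V := recF r (fun x f => iUn r x (fun y => succ r (app r f y)))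

instance Df₁.rk : Df₁ r (rk r) := by unfold VLC.rk; infer_instance

variable {r}

theorem mem_rk {x z : V} : r z (rk r x) ↔ ∃ y, r y x ∧ r z (succ r (rk r y)) := by
  have : rk r x = iUn r x (fun y => succ r (app r (lamS r (tc r x) (rk r)) y)) :=
    recF_eq (r := r) (fun x f => iUn r x (fun y => succ r (app r f y))) x
  rw [this, mem_iUn (r := r) (F := fun y => succ r (app r (lamS r (tc r x) (rk r)) y))]
  refine exists_congr fun y => and_congr_right fun hy => ?_
  rw [app_lamS (mem_tc_of_mem hy)]

theorem ordW_rk (x : V) : OrdW r (rk r x) := by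
  induction x using hr.wf.induction with
  | _ x ih =>
  refine ⟨fun a b ha hb => ?_, fun a ha => ?_⟩
  · obtain ⟨y, hy, ha⟩ := mem_rk.1 ha
    exact mem_rk.2 ⟨y, hy, (ih y hy).succ.trans ha hb⟩
  · obtain ⟨y, hy, ha⟩ := mem_rk.1 ha
    exact (ih y hy).succ.2 a ha

theorem rk_mem {x y : V} (h : r y x) : r (rk r y) (rk r x) := mem_rk.2 ⟨y, h, self_mem_succ _⟩

end Rank

namespace Extension

variable {u : ZFUniv.{u}} (E : Extension u)

/-- The inclusion of the ground universe as a transitive embedding. -/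
def temb : TEmb u.mem E.W.mem := ⟨E.inc, E.inc_inj, E.inc_mem, E.inc_trans⟩

theorem mem_rk_of_mem_val {τ α : u.V} (hα : OrdW u.mem α) (h : E.W.mem (E.inc α) (E.val τ)) :
    haveI := u.zfm; u.mem α (rk u.mem τ) := by
  haveI := u.zfm
  induction τ using (inferInstance : ZFm u.mem).wf.transGen.induction generalizing α with
  | _ τ ih =>
  obtain ⟨σ, p, z, hz, hp, -, he⟩ := (E.val_spec _ _).1 h
  obtain rfl := isOPair_iff.1 hp
  have h1 : u.mem σ (up u.mem σ σ) := mem_up.2 (.inl rfl)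
  have h2 : u.mem (up u.mem σ σ) (op u.mem σ p) := mem_up.2 (.inl rfl)
  have hlt : u.mem (rk u.mem σ) (rk u.mem τ) :=
    (ordW_rk τ).trans ((ordW_rk τ).trans (rk_mem hz) (rk_mem h2)) (rk_mem h1)
  have hno : ¬ u.mem (rk u.mem σ) α := fun hlt' => by
    have := ih σ (.tail (.tail (.single h1) h2) hz) (ordW_rk σ)
      (he ▸ (E.inc_mem _ _).2 hlt')
    exact (inferInstance : ZFm u.mem).not_self _ this
  rcases hα.trich (ordW_rk σ) with h | h | h
  · exact (ordW_rk τ).trans hlt h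
  · exact h ▸ hlt
  · exact absurd h hno

/-- A set-forcing extension has the same ordinals. -/
theorem exists_inc_ord {w : E.W.V} (hw : OrdW E.W.mem w) : ∃ α, OrdW u.mem α ∧ w = E.inc α := by
  haveI := u.zfm
  haveI := E.W.zfm
  obtain ⟨τ, rfl⟩ := E.val_surj w
  rcases hw.trich (E.temb.ordW.2 (ordW_rk (r := u.mem) τ)) with h | h | h
  · obtain ⟨α, h1, h2⟩ := E.inc_trans _ _ h
    exact ⟨α, (ordW_rk τ).mem h1, h2⟩
  · exact ⟨_, ordW_rk τ, h⟩
  · exact absurd (E.mem_rk_of_mem_val (ordW_rk τ) h) ((inferInstance : ZFm u.mem).not_self _)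

end Extension

section ElmOrd

variable {V V' : Type u} {r : V → V → Prop} {r' : V' → V' → Prop} [hr : ZFm r] [hr' : ZFm r']
  {h : V} {N : V'} (trh : TransW r h) (trN : TransW r' N) {j : Sub r h → Sub r' N}
  (el : Elm (srel r h) (srel r' N) j)
include el

theorem Elm.mem_iff {x y : Sub r h} : r' (j x).1 (j y).1 ↔ r x.1 y.1 :=
  el.df (R := fun i v => i.r (v 0) (v 1)) (by infer_instance) ![x, y]

include trh trN

theorem Elm.ordW {x : Sub r h} : OrdW r' (j x).1 ↔ OrdW r x.1 := by
  have h1 : OrdW (srel r' N) (j x) ↔ OrdW (srel r h) x :=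
    el.df (R := fun i v => OrdW i.r (v 0)) (by infer_instance) ![x]
  have h2 := crel_ordW (r := r) (T := fun x => r x h) (fun x y hx hy => trh x y hx hy) (a := x)
  have h3 := crel_ordW (r := r') (T := fun x => r' x N) (fun x y hx hy => trN x y hx hy) (a := j x)
  exact h3.symm.trans (h1.trans h2)

/-- Elementary maps do not move ordinals downwards. -/
theorem Elm.sub_ord (T : TEmb r r') {α : V} (hα : OrdW r α) (hm : r α h) :
    SubW r' (T.i α) (j ⟨α, hm⟩).1 := by
  induction α using hr.wf.induction with
  | _ α ih =>
  intro w hw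
  obtain ⟨β, hβ, rfl⟩ := T.trans _ _ hw
  have hβh := trh _ _ hm hβ
  have h1 := ih β hβ (hα.mem hβ) hβh
  have h2 : r' (j ⟨β, hβh⟩).1 (j ⟨α, hm⟩).1 := el.mem_iff.2 hβ
  have o1 := (el.ordW trh trN (x := ⟨α, hm⟩)).2 hα
  rcases ((T.ordW.2 (hα.mem hβ)).sub_iff (o1.mem h2)).1 h1 with h | h
  · exact o1.trans h2 h
  · exact h ▸ h2

theorem Elm.ord_mem (T : TEmb r r') {α : V} (hα : OrdW r α) (hm : r α h) : r' (T.i α) N := by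
  have o1 := (el.ordW trh trN (x := ⟨α, hm⟩)).2 hα
  rcases ((T.ordW.2 hα).sub_iff o1).1 (el.sub_ord trh trN T hα hm) with h | h
  · exact trN _ _ (j _).2 h
  · exact h ▸ (j _).2

end ElmOrd

/-- In `L`, the target of a generic embedding of `H_θ` is an initial segment of `L`. -/
theorem GenEmb.tgt_eq {u : ZFUniv.{u}} (hv : haveI := u.zfm; VE u.mem) {θ h : u.V}
    (hθ : haveI := u.zfm; Rg u.mem θ) (hh : IsHW u.mem θ h) (D : PlainEmb u h) (ht : D.tgtTrans) :
    haveI := u.zfm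
    h = ee u.mem θ ∧ D.hSub ∧ ∃ β, OrdW u.mem β ∧ D.tgt = D.E.inc (ee u.mem β) := by
  haveI := u.zfm
  haveI iW := D.E.W.zfm
  obtain rfl := hh.eq_ee hθ u.power hv
  have trh : TransW u.mem (ee u.mem θ) := transW_ee hθ.1.1
  haveI z1 : ZFm (srel u.mem (ee u.mem θ)) := zfm_ee hθ u.power hv
  haveI z2 : ZFm (srel D.E.W.mem D.tgt) := D.elm.zfm (InvImage.wf Subtype.val iW.wf)
  have v2 : VE (srel D.E.W.mem D.tgt) := (D.elm.sentz Dz.ve).2 (ve_ee hθ u.power hv)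
  let T := D.E.temb
  have ho : OrdW D.E.W.mem (sepS D.E.W.mem D.tgt (fun x => OrdW D.E.W.mem x)) :=
    ⟨fun x y hx hy => mem_sepS.2 ⟨ht _ _ (mem_sepS.1 hx).1 hy, (mem_sepS.1 hx).2.mem hy⟩,
      fun x hx => (mem_sepS.1 hx).2.1⟩
  obtain ⟨β, hβ, he⟩ := D.E.exists_inc_ord ho
  have hm : ∀ α, D.E.W.mem (D.E.inc α) D.tgt → OrdW u.mem α → u.mem α β := fun α h1 h2 =>
    (D.E.inc_mem _ _).1 (he ▸ mem_sepS.2 ⟨h1, T.ordW.2 h2⟩)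
  have hN : D.tgt = D.E.inc (ee u.mem β) := by
    refine iW.ext fun x => ?_
    rw [show D.E.inc (ee u.mem β) = _ from T.ee β, mem_ee (r := D.E.W.mem)]
    constructor
    · intro hx
      obtain ⟨α, h1, h2, h3⟩ := exists_index_of_trans ht z2 v2 hx
      exact ⟨α, by rw [show T.i β = _ from he.symm]; exact mem_sepS.2 ⟨h1, h2⟩, h3⟩
    · rintro ⟨α, h1, rfl⟩
      rw [show T.i β = _ from he.symm] at h1
      obtain ⟨h1, h2⟩ := mem_sepS.1 h1
      exact e_mem z2 ht h2 h1
  refine ⟨rfl, fun x hx => ?_, β, hβ, hN⟩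
  obtain ⟨α, h1, rfl⟩ := mem_ee.1 hx
  have hαo := hθ.1.1.mem h1
  have hαh : u.mem α (ee u.mem θ) := ((isHW_ee hθ u.power hv).ord hθ u.power hv.ch hαo).2 h1
  have := D.elm.ord_mem trh ht T hαo hαh
  rw [hN, D.E.inc_mem]
  exact mem_ee.2 ⟨α, hm α this hαo, rfl⟩

theorem FaintMeasAt.virtPreStrong {u : ZFUniv.{u}} (hu : VeqL u) {θ κ : u.V} (hθ : RegUncW u.mem θ)
    (hf : FaintMeasAt u θ κ) : VirtPreStrongAt u θ κ := by
  haveI := u.zfm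
  obtain ⟨h, hh, D, ht, hc⟩ := hf
  obtain ⟨rfl, hs, β, hβ, hN⟩ := GenEmb.tgt_eq hu.ve hθ.rg hh D ht
  exact ⟨_, hh, _, D, hN, transW_ee hβ, hc, hs⟩

theorem VirtStrongAt.faintMeas {u : ZFUniv.{u}} {θ κ : u.V} (hf : VirtStrongAt u θ κ) : FaintMeasAt u θ κ := by
  obtain ⟨h, hh, N, D, hN, ht, hc, -⟩ := hf
  refine ⟨h, hh, D, ?_, hc⟩
  have hN : D.tgt = D.E.inc N := hN
  unfold GenEmb.tgtTrans
  rw [hN]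
  intro x y hx hy
  obtain ⟨x', hx', rfl⟩ := D.E.inc_trans _ _ hx
  obtain ⟨y', hy', rfl⟩ := D.E.inc_trans _ _ hy
  exact (D.E.inc_mem _ _).2 (ht _ _ hx' ((D.E.inc_mem _ _).1 hy))

theorem Df.formula {ι : Type w} {V : ι → Type u} {r : ∀ i, V i → V i → Prop}
    {P : (∀ i, V i) → Prop} {N : ℕ} (φ : L3.Formula (Fin N)) :
    Df r P (fun i v => @Formula.Realize L3 (V i) (memStr (r i)) _ φ v) := by
  refine ⟨φ.relabel Sum.inr, fun i v => ?_⟩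
  letI := memStr (r i)
  rw [Formula.realize_relabel]
  rfl

/-- A structure for the language of set theory with a distinguished point. -/
structure Pst extends St.{u} where
  /-- The distinguished point. -/
  c : V

/-- Elementary maps restrict to definable subclasses. -/
theorem Elm.restrict_of {V V' : Type u} {r : V → V → Prop} {r' : V' → V' → Prop}
    {T : V → Prop} {T' : V' → Prop} {i : V → V'} (hi : ∀ x, T x → T' (i x))
    (h : ∀ {n} (φ : L3.Formula (Fin n)) (v : Fin n → V) (hv : ∀ k, T (v k)),
      (∃ hv' : ∀ k, T' (i (v k)), @Formula.Realize L3 _ (memStr (crel r' T')) _ φ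
        (fun k => ⟨i (v k), hv' k⟩)) ↔
      (∃ hv : ∀ k, T (v k), @Formula.Realize L3 _ (memStr (crel r T)) _ φ (fun k => ⟨v k, hv k⟩))) :
    Elm (crel r T) (crel r' T') (fun x => ⟨i x.1, hi _ x.2⟩) := fun n φ v => by
  have := h φ (fun k => (v k).1) (fun k => (v k).2)
  exact ⟨fun h1 => (this.1 ⟨fun k => hi _ (v k).2, h1⟩).2, fun h1 => (this.2 ⟨fun k => (v k).2, h1⟩).2⟩

theorem Elm.ce {V V' : Type u} {r : V → V → Prop} {r' : V' → V' → Prop} [hr : ZFm r] [hr' : ZFm r']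
    {i : V → V'} (el : Elm r r' i) : ∃ hi : ∀ x, Ce r x → Ce r' (i x),
      Elm (crel r (Ce r)) (crel r' (Ce r')) (fun x => ⟨i x.1, hi _ x.2⟩) := by
  have hT : Dz (fun i (v : Fin 1 → i.V) => Ce i.r (v 0)) := by unfold Ce Lv; infer_instance
  have hi : ∀ x, Ce r x → Ce r' (i x) := fun x h => (el.dfz hT ![x]).2 h
  refine ⟨hi, Elm.restrict_of hi fun φ v hv => ?_⟩
  have := Df.relativize hT (Q := fun _ => False) (fun _ h => h) (Df.formula φ)
  exact el.dfz this v

theorem Elm.sub {V V' : Type u} {r : V → V → Prop} {r' : V' → V' → Prop}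
    {i : V → V'} (el : Elm r r' i) (m : V) : ∃ hi : ∀ x, r x m → r' (i x) (i m),
      Elm (srel r m) (srel r' (i m)) (fun x => ⟨i x.1, hi _ x.2⟩) := by
  have hi : ∀ x, r x m → r' (i x) (i m) := fun x h =>
    (el.df (R := fun i v => i.r (v 0) (v 1)) (by infer_instance) ![x, m]).2 h
  refine ⟨hi, Elm.restrict_of (T := fun x => r x m) (T' := fun x => r' x (i m)) hi fun {n} φ v hv => ?_⟩
  let P : (∀ i : Pst.{u}, i.V) → Prop := fun c => c = fun i => i.c
  have hT : Df (ι := Pst.{u}) (V := fun i => i.V) (fun i => i.r) P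
      (fun i (v : Fin 1 → i.V) => i.r (v 0) i.c) := by
    haveI : ∀ {n}, DFn (ι := Pst.{u}) (V := fun i => i.V) (fun i => i.r) P
      (fun i (v : Fin n → i.V) => i.c) := fun {n} => DFn.constP (P := P) (fun i => i.c) rfl
    infer_instance
  obtain ⟨ψ, hψ⟩ := (Df.relativize (T := fun (i : Pst.{u}) x => i.r x i.c) hT (Q := fun _ => False)
    (fun _ h => h.elim) (Df.formula φ)).out
  let g : {c : ∀ i : Pst.{u}, i.V // P c} ⊕ Fin n → Fin (n + 1) := Sum.elim (fun _ => 0) Fin.succ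
  have key : ∀ (i : Pst.{u}) (v : Fin n → i.V),
      @Formula.Realize L3 _ (memStr i.r) _ (ψ.relabel g) (Fin.cons i.c v) ↔
        ∃ h : ∀ k, i.r (v k) i.c, @Formula.Realize L3 _ (memStr (crel i.r (fun x => i.r x i.c))) _ φ
          (fun k => ⟨v k, h k⟩) := by
    intro i v
    letI := memStr i.r
    rw [Formula.realize_relabel]
    refine Iff.trans ?_ (hψ i v)
    refine iff_of_eq (congrArg _ ?_)
    ext x
    rcases x with ⟨c, rfl⟩ | x
    · rfl
    · rfl
  have e1 := key ⟨⟨V, r⟩, m⟩ v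
  have e2 := key ⟨⟨V', r'⟩, i m⟩ (fun k => i (v k))
  refine e2.symm.trans (Iff.trans ?_ e1)
  have := el _ (ψ.relabel g) (Fin.cons m v)
  rw [← this]
  refine iff_of_eq (congrArg _ ?_)
  ext k
  refine Fin.cases rfl (fun k => rfl) k

theorem Elm.symm_equiv {V V' : Type u} {r : V → V → Prop} {r' : V' → V' → Prop} (e : V ≃ V')
    (he : ∀ x y, r' (e x) (e y) ↔ r x y) : Elm r' r e.symm :=
  Elm.of_iso e.symm fun x y => by rw [← he]; simp

/-- Composition of transitive embeddings. -/
def TEmb.comp {V : Type u} {V' : Type v} {V'' : Type w} {r : V → V → Prop} {r' : V' → V' → Prop}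
    {r'' : V'' → V'' → Prop} (S : TEmb r' r'') (T : TEmb r r') : TEmb r r'' where
  i x := S.i (T.i x)
  inj := S.inj.comp T.inj
  mem' x y := (S.mem' _ _).trans (T.mem' _ _)
  trans x w h := by
    obtain ⟨y, h1, rfl⟩ := S.trans _ _ h
    obtain ⟨z, h2, rfl⟩ := T.trans _ _ h1
    exact ⟨z, h2, rfl⟩

section LPart

variable {V V' : Type u} {r : V → V → Prop} {r' : V' → V' → Prop} [hr : ZFm r] [hr' : ZFm r']

theorem ce_srel_iff {N : V} (tr : TransW r N) [hz : ZFm (srel r N)] {x : Sub r N} :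
    Ce (srel r N) x ↔ ∃ α, r α N ∧ OrdW r α ∧ x.1 = e r α := by
  have tr' : ∀ x z, r x N → r z x → r z N := fun x z => tr x z
  haveI : ZFm (crel r (fun x => r x N)) := hz
  rw [ce_iff]
  constructor
  · rintro ⟨α, h1, rfl⟩
    exact ⟨α.1, α.2, (crel_ordW tr').1 h1, (TEmb.incl tr').e α⟩
  · rintro ⟨α, h1, h2, h3⟩
    refine ⟨⟨α, h1⟩, (crel_ordW tr').2 h2, Subtype.ext (h3.trans ?_)⟩
    exact ((TEmb.incl tr').e ⟨α, h1⟩).symm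

theorem exists_ce_equiv (T : TEmb r r') {N : V'} (tr : TransW r' N) [hz : ZFm (srel r' N)] {β : V}
    (hβ : ∀ α, OrdW r' α → (r' α N ↔ r' α (T.i β))) (hβo : OrdW r β) :
    ∃ f : Sub r (ee r β) ≃ {x : Sub r' N // Ce (srel r' N) x}, ∀ x, (f x).1.1 = T.i x.1 := by
  have h1 : ∀ x, r x (ee r β) → ∃ h : r' (T.i x) N, Ce (srel r' N) ⟨T.i x, h⟩ := by
    intro x hx
    obtain ⟨α, h1, rfl⟩ := mem_ee.1 hx
    have hα := T.ordW.2 (hβo.mem h1)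
    have hm : r' (T.i α) N := (hβ _ hα).2 ((T.mem' _ _).2 h1)
    have he := T.e α
    exact ⟨he ▸ e_mem hz tr hα hm, (ce_srel_iff tr).2 ⟨_, hm, hα, he⟩⟩
  refine ⟨Equiv.ofBijective (fun x => ⟨⟨T.i x.1, (h1 x.1 x.2).choose⟩, (h1 x.1 x.2).choose_spec⟩)
    ⟨fun a b h => ?_, fun ⟨⟨x, hx⟩, hx'⟩ => ?_⟩, fun x => rfl⟩
  · exact Subtype.ext (T.inj (congrArg (fun z => z.1.1) h))
  · obtain ⟨α, h1, h2, h3⟩ := (ce_srel_iff tr).1 hx'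
    obtain ⟨α, h4, rfl⟩ := T.trans _ _ ((hβ α h2).1 h1)
    exact ⟨⟨e r α, mem_ee.2 ⟨α, h4, rfl⟩⟩, Subtype.ext (Subtype.ext ((T.e α).trans h3.symm))⟩

end LPart

/-- An elementary map between levels of the constructible hierarchy with critical point `κ`. -/
structure JEmb {V : Type u} (r : V → V → Prop) [ZFm r] (θ κ β : V) where
  /-- The map. -/
  j : Sub r (ee r θ) → Sub r (ee r β)
  ord : OrdW r β
  el : Elm (srel r (ee r θ)) (srel r (ee r β)) j
  hκ : r κ (ee r θ)
  fix : ∀ α (hα : r α (ee r θ)), r α κ → (j ⟨α, hα⟩).1 = α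
  mov : (j ⟨κ, hκ⟩).1 ≠ κ

section Down

variable {V V' : Type u} {r : V → V → Prop} {r' : V' → V' → Prop} [hr : ZFm r] [hr' : ZFm r']
  (T : TEmb r r')
include T

namespace TEmb

theorem isOPair {a b c : V} : IsOPair r' (T.i a) (T.i b) (T.i c) ↔ IsOPair r a b c := by
  rw [isOPair_iff, isOPair_iff, ← T.op, T.eq_iff]

theorem fApp {a b c : V} : FApp r' (T.i a) (T.i b) (T.i c) ↔ FApp r a b c := by
  rw [fApp_iff, fApp_iff, ← T.op, T.mem]

theorem fApp_of {f : V} {x y : V'} (h : FApp r' (T.i f) x y) :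
    ∃ a b, x = T.i a ∧ y = T.i b ∧ FApp r f a b := by
  obtain ⟨z, hz, hp⟩ := h
  obtain ⟨z, h1, rfl⟩ := T.trans _ _ hz
  have h2 : r' (VLC.up r' x y) (T.i z) := by rw [isOPair_iff.1 hp]; exact mem_up.2 (.inr rfl)
  obtain ⟨w, h3, h4⟩ := T.trans _ _ h2
  have hx : r' x (T.i w) := h4 ▸ mem_up.2 (.inl rfl)
  have hy : r' y (T.i w) := h4 ▸ mem_up.2 (.inr rfl)
  obtain ⟨a, -, rfl⟩ := T.trans _ _ hx
  obtain ⟨b, -, rfl⟩ := T.trans _ _ hy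
  exact ⟨a, b, rfl, rfl, z, h1, T.isOPair.1 hp⟩

theorem isFunOn {f a : V} : IsFunOn r' (T.i f) (T.i a) ↔ IsFunOn r f a := by
  constructor
  · rintro ⟨h1, h2, h3⟩
    refine ⟨fun z hz => ?_, fun x hx => ?_, fun x y y' h h' => ?_⟩
    · obtain ⟨x, y, hx, hp⟩ := h1 _ ((T.mem' _ _).2 hz)
      obtain ⟨a', b', rfl, rfl, -⟩ := T.fApp_of (f := f) ⟨_, (T.mem' _ _).2 hz, hp⟩
      exact ⟨a', b', (T.mem' _ _).1 hx, T.isOPair.1 hp⟩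
    · obtain ⟨y, hy⟩ := h2 _ ((T.mem' _ _).2 hx)
      obtain ⟨a', b', h4, rfl, h5⟩ := T.fApp_of hy
      exact ⟨b', T.inj h4 ▸ h5⟩
    · exact T.inj (h3 _ _ _ (T.fApp.2 h) (T.fApp.2 h'))
  · rintro ⟨h1, h2, h3⟩
    refine ⟨fun z hz => ?_, fun x hx => ?_, fun x y y' h h' => ?_⟩
    · obtain ⟨z, hz', rfl⟩ := T.trans _ _ hz
      obtain ⟨x, y, hx, hp⟩ := h1 _ hz'
      exact ⟨_, _, (T.mem' _ _).2 hx, T.isOPair.2 hp⟩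
    · obtain ⟨x, hx', rfl⟩ := T.trans _ _ hx
      obtain ⟨y, hy⟩ := h2 _ hx'
      exact ⟨_, T.fApp.2 hy⟩
    · obtain ⟨a', b', rfl, rfl, k⟩ := T.fApp_of h
      obtain ⟨a'', b'', h4, rfl, k'⟩ := T.fApp_of h'
      obtain rfl := T.inj h4
      rw [h3 _ _ _ k k']

theorem isFuncW {f a b : V} : IsFuncW r' (T.i f) (T.i a) (T.i b) ↔ IsFuncW r f a b := by
  refine and_congr T.isFunOn ⟨fun h x y hx => (T.mem' _ _).1 (h _ _ (T.fApp.2 hx)), fun h x y hx => ?_⟩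
  obtain ⟨a', b', rfl, rfl, k⟩ := T.fApp_of hx
  exact (T.mem' _ _).2 (h _ _ k)

theorem isInjW {f a b : V} : IsInjW r' (T.i f) (T.i a) (T.i b) ↔ IsInjW r f a b := by
  refine and_congr T.isFuncW ⟨fun h x x' y hx hx' => T.inj (h _ _ _ (T.fApp.2 hx) (T.fApp.2 hx')),
    fun h x x' y hx hx' => ?_⟩
  obtain ⟨a', b', rfl, rfl, k⟩ := T.fApp_of hx
  obtain ⟨a'', b'', rfl, h4, k'⟩ := T.fApp_of hx'
  obtain rfl := T.inj h4
  rw [h _ _ _ k k']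

theorem isSurjW {f a b : V} (h : IsSurjW r f a b) : IsSurjW r' (T.i f) (T.i a) (T.i b) :=
  ⟨T.isFuncW.2 h.1, fun y hy => by
    obtain ⟨y', hy', rfl⟩ := T.trans _ _ hy
    obtain ⟨x, hx, hf⟩ := h.2 y' hy'
    exact ⟨_, (T.mem' _ _).2 hx, T.fApp.2 hf⟩⟩

theorem isCardW {κ : V} (h : IsCardW r' (T.i κ)) : IsCardW r κ :=
  ⟨T.ordW.1 h.1, fun β hβ ⟨f, h1, h2⟩ => h.2 _ ((T.mem' _ _).2 hβ) ⟨_, T.isInjW.2 h1, T.isSurjW h2⟩⟩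

theorem regularW {κ : V} (h : RegularW r' (T.i κ)) : RegularW r κ := by
  refine ⟨T.isCardW h.1, fun β f hβ hf h2 => ?_⟩
  obtain ⟨γ, h3, h4⟩ := h.2 _ (T.i f) ((T.mem' _ _).2 hβ) (T.isFunOn.2 hf) fun x y hxy => by
    obtain ⟨a, b, rfl, rfl, h⟩ := T.fApp_of hxy
    exact (T.mem' _ _).2 (h2 _ _ h)
  obtain ⟨γ, h5, rfl⟩ := T.trans _ _ h3
  exact ⟨γ, h5, fun x y hxy => (T.mem' _ _).1 (h4 _ _ (T.fApp.2 hxy))⟩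

theorem regUncW {κ : V} (h : RegUncW r' (T.i κ)) : RegUncW r κ := by
  refine ⟨T.regularW h.1, ?_⟩
  obtain ⟨o, h1, h2⟩ := h.2
  obtain ⟨o, h3, rfl⟩ := T.trans _ _ h2
  refine ⟨o, ?_, h3⟩
  have := eq_om_iff.2 h1
  rw [← T.om, T.eq_iff] at this
  exact eq_om_iff.1 this

end TEmb

end Down

/-- The constructible part of a generic embedding. -/
theorem FaintMeasAt.exists_jemb {u : ZFUniv.{u}} {θ κ : u.V} (hθ : RegUncW u.mem θ)
    (hκ : IsCardW u.mem κ) (hκθ : u.mem κ θ) (hf : FaintMeasAt u θ κ) :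
    ∃ (V : Type u) (r : V → V → Prop) (_ : ZFm r) (θ κ β : V), VE r ∧ Pw r ∧ RegUncW r θ ∧
      IsCardW r κ ∧ r κ θ ∧ Nonempty (JEmb r θ κ β) := by
  haveI := u.zfm
  obtain ⟨h, hh, D, ht, hc⟩ := hf
  haveI iW := D.E.W.zfm
  have trh := hh.trans hθ.rg u.power u.choice
  haveI z1 : ZFm (srel u.mem h) := hh.zfm hθ.rg u.power u.choice
  haveI z2 : ZFm (srel D.E.W.mem D.tgt) := D.elm.zfm (InvImage.wf Subtype.val iW.wf)
  have ho : OrdW D.E.W.mem (sepS D.E.W.mem D.tgt (fun x => OrdW D.E.W.mem x)) :=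
    ⟨fun x y hx hy => mem_sepS.2 ⟨ht _ _ (mem_sepS.1 hx).1 hy, (mem_sepS.1 hx).2.mem hy⟩,
      fun x hx => (mem_sepS.1 hx).2.1⟩
  obtain ⟨β, hβ, he⟩ := D.E.exists_inc_ord ho
  let T1 : TEmb (crel u.mem (Ce u.mem)) u.mem := TEmb.incl Ce.tr
  let T2 := D.E.temb.comp T1
  let θ' : {x // Ce u.mem x} := ⟨θ, Ce.ord hθ.rg.1.1⟩
  let κ' : {x // Ce u.mem x} := ⟨κ, Ce.ord hκ.1⟩
  let β' : {x // Ce u.mem x} := ⟨β, Ce.ord hβ⟩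
  have hθ' : RegUncW (crel u.mem (Ce u.mem)) θ' := T1.regUncW hθ
  have hκ' : IsCardW (crel u.mem (Ce u.mem)) κ' := T1.isCardW hκ
  have hv : VE (crel u.mem (Ce u.mem)) := ve_ce
  have hp : Pw (crel u.mem (Ce u.mem)) := pw_ce u.power
  obtain ⟨f, hf⟩ := exists_ce_equiv T1 (N := h) trh (β := θ')
    (fun α hα => hh.ord hθ.rg u.power u.choice hα) (T1.ordW.1 hθ.rg.1.1)
  obtain ⟨g, hg⟩ := exists_ce_equiv T2 (N := D.tgt) ht (β := β') (fun α hα => by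
    rw [show T2.i β' = _ from he.symm, mem_sepS (r := D.E.W.mem)]
    exact ⟨fun h => ⟨h, hα⟩, fun h => h.1⟩) (T1.ordW.1 hβ)
  obtain ⟨hi, el⟩ := D.elm.ce
  have e1 : Elm (srel (crel u.mem (Ce u.mem)) (ee (crel u.mem (Ce u.mem)) θ'))
      (crel (srel u.mem h) (Ce (srel u.mem h))) f := Elm.of_iso f fun x y => by
    show u.mem (f x).1.1 (f y).1.1 ↔ u.mem x.1.1 y.1.1
    rw [hf, hf]; rfl
  have e2 := Elm.symm_equiv (r := srel (crel u.mem (Ce u.mem)) (ee (crel u.mem (Ce u.mem)) β'))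
      (r' := crel (srel D.E.W.mem D.tgt) (Ce (srel D.E.W.mem D.tgt))) g fun x y => by
    show D.E.W.mem (g x).1.1 (g y).1.1 ↔ u.mem x.1.1 y.1.1
    rw [hg, hg]; exact T2.mem' _ _
  have hj : ∀ (x) (hx : u.mem x.1.1 h), T2.i (g.symm ⟨eApp D.emb (f x).1, hi _ (f x).2⟩).1 =
      (eApp D.emb ⟨x.1.1, hx⟩).1 := by
    intro x hx
    rw [← hg, Equiv.apply_symm_apply]
    show (eApp D.emb (f x).1).1 = _
    rw [show (f x).1 = ⟨x.1.1, hx⟩ from Subtype.ext (hf x)]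
  have hκe : crel u.mem (Ce u.mem) κ' (ee (crel u.mem (Ce u.mem)) θ') :=
    ((isHW_ee hθ'.rg hp hv).ord hθ'.rg hp hv.ch hκ'.1).2 hκθ
  obtain ⟨-, hκh, hfix, hmov⟩ := hc
  have hmem : ∀ x : Sub (crel u.mem (Ce u.mem)) (ee (crel u.mem (Ce u.mem)) θ'), u.mem x.1.1 h :=
    fun x => by
    have := (f x).1.2
    rwa [hf x] at this
  refine ⟨_, crel u.mem (Ce u.mem), inferInstance, θ', κ', β', hv, hp, hθ', hκ', hκθ,
    ⟨⟨_, T1.ordW.1 hβ, e2.comp (el.comp e1), hκe, fun α hα hακ => T2.inj ?_, fun heq => ?_⟩⟩⟩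
  · rw [hj _ (hmem ⟨α, hα⟩)]
    exact hfix _ _ hακ
  · have := hj ⟨κ', hκe⟩ hκh
    rw [heq] at this
    exact hmov this.symm

section Improve

variable {V : Type u} {r : V → V → Prop} [hr : ZFm r]

theorem IsFunOn.eq_imS {f b : V} (hf : IsFunOn r f b) : f = imS r b (fun x => op r x (app r f x)) := by
  refine hr.ext fun z => ?_
  rw [mem_imS (r := r) (F := fun x => op r x (app r f x))]
  constructor
  · intro hz
    obtain ⟨x, y, hx, hp⟩ := hf.1 _ hz
    exact ⟨x, hx, by rw [isOPair_iff.1 hp, (hf.fApp_iff.1 ⟨z, hz, hp⟩).2]⟩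
  · rintro ⟨x, hx, rfl⟩
    exact VLC.fApp_iff.1 (hf.fApp_iff.2 ⟨hx, rfl⟩)

theorem IsFunOn.mem_of_trans {h f b : V} (trh : TransW r h) [hz : ZFm (srel r h)] (hf : IsFunOn r f b)
    (hB : ∀ a, (∃ y, r y h ∧ a = imS r y (fun x => op r x (app r f x))) → (∀ x, r x a → r x h) → r a h)
    (hb : r b h) (hv : ∀ x y, FApp r f x y → r y h) : r f h := by
  have tr : ∀ x z, r x h → r z x → r z h := fun x z => trh x z
  haveI : ZFm (crel r (fun x => r x h)) := hz
  refine hB _ ⟨b, hb, hf.eq_imS⟩ fun z hz => ?_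
  obtain ⟨x, y, hx, hp⟩ := hf.1 _ hz
  have hx' := trh _ _ hb hx
  have hy' := hv _ _ ⟨z, hz, hp⟩
  obtain rfl := isOPair_iff.1 hp
  have := (TEmb.incl tr).op ⟨x, hx'⟩ ⟨y, hy'⟩
  exact this ▸ (op (crel r (fun x => r x h)) ⟨x, hx'⟩ ⟨y, hy'⟩).2

/-- An element of a transitive set as a substructure. -/
def subEquiv {M : V} (tr : TransW r M) (m : Sub r M) {a : V} (ha : a = m.1) :
    Sub r a ≃ Sub (srel r M) m where
  toFun x := ⟨⟨x.1, tr _ _ m.2 (ha ▸ x.2)⟩, by obtain ⟨x, hx⟩ := x; subst ha; exact hx⟩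
  invFun x := ⟨x.1.1, by subst ha; exact x.2⟩
  left_inv _ := rfl
  right_inv _ := rfl

variable {θ κ β : V} (hθ : Rg r θ) (hp : Pw r) (hv : VE r)
include hθ hp hv

theorem fun_mem_ee {f b : V} (hf : IsFunOn r f b) (hb : r b (ee r θ)) (hv' : ∀ x y, FApp r f x y → r y (ee r θ)) :
    r f (ee r θ) := by
  haveI := zfm_ee hθ hp hv
  have hm := fun x => (isHW_ee hθ hp hv).mem_iff hθ hp hv.ch (x := x)
  refine hf.mem_of_trans (transW_ee hθ.1.1) (fun a ha hx => ?_) hb hv'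
  obtain ⟨y, hy, rfl⟩ := ha
  rw [hm]
  exact hθ.small.her_of (hθ.small.imS _ (hθ.small.small ((hm _).1 hy))) fun x h => (hm _).1 (hx x h)

/-- Regularity of ordinals below `θ` is computed correctly in `H_θ`. -/
theorem regularW_of_ee {c : Sub r (ee r θ)} (h : RegularW (srel r (ee r θ)) c) : RegularW r c.1 := by
  have trh := transW_ee (r := r) hθ.1.1
  have tr : ∀ x z, r x (ee r θ) → r z x → r z (ee r θ) := fun x z => trh x z
  haveI hz : ZFm (crel r (fun x => r x (ee r θ))) := zfm_ee hθ hp hv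
  let T : TEmb (crel r (fun x => r x (ee r θ))) r := TEmb.incl tr
  have hc : ∀ x, r x c.1 → r x (ee r θ) := fun x => trh _ _ c.2
  refine ⟨⟨T.ordW.2 h.1.1, fun b hb ⟨f, h1, h2⟩ => ?_⟩, fun b f hb hf h2 => ?_⟩
  · have hfh := fun_mem_ee hθ hp hv h1.1.1 (hc _ hb) fun x y hxy => hc _ (h1.1.2 _ _ hxy)
    refine h.1.2 ⟨b, hc _ hb⟩ hb ⟨⟨f, hfh⟩, T.isInjW.1 h1, T.isFuncW.1 h1.1, fun y hy => ?_⟩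
    obtain ⟨x, hx, hxy⟩ := h2.2 y.1 hy
    exact ⟨⟨x, hc _ (hb |> fun hb => (T.ordW.2 h.1.1).1 _ _ hb hx)⟩, hx, T.fApp.1 hxy⟩
  · have hfh := fun_mem_ee hθ hp hv hf (hc _ hb) fun x y hxy => hc _ (h2 _ _ hxy)
    obtain ⟨γ, h3, h4⟩ := h.2 ⟨b, hc _ hb⟩ ⟨f, hfh⟩ hb (T.isFunOn.1 hf) fun x y hxy => h2 _ _ (T.fApp.2 hxy)
    refine ⟨γ.1, h3, fun x y hxy => ?_⟩
    obtain ⟨a, b', rfl, rfl, hab⟩ := T.fApp_of (f := ⟨f, hfh⟩) hxy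
    exact h4 _ _ hab

theorem JEmb.improve (hθ' : RegUncW r θ) (hκ : IsCardW r κ) (hκθ : r κ θ) (J : JEmb r θ κ β) :
    ∃ (θ' β' : V) (J' : JEmb r θ' κ β'), RegUncW r θ' ∧ r κ θ' ∧ r θ' (J'.j ⟨κ, J'.hκ⟩).1 := by
  have trh := transW_ee (r := r) hθ.1.1
  have trN := transW_ee (r := r) J.ord
  have trh' : ∀ x z, r x (ee r θ) → r z x → r z (ee r θ) := fun x z => trh x z
  have trN' : ∀ x z, r x (ee r β) → r z x → r z (ee r β) := fun x z => trN x z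
  haveI z1 : ZFm (srel r (ee r θ)) := zfm_ee hθ hp hv
  haveI z2 : ZFm (srel r (ee r β)) := J.el.zfm (InvImage.wf Subtype.val hr.wf)
  haveI z1' : ZFm (crel r (fun x => r x (ee r θ))) := z1
  haveI z2' : ZFm (crel r (fun x => r x (ee r β))) := z2
  let Th : TEmb (srel r (ee r θ)) r := TEmb.incl trh'
  let TN : TEmb (srel r (ee r β)) r := TEmb.incl trN'
  let I : TEmb r r := ⟨id, Function.injective_id, fun _ _ => Iff.rfl, fun x w h => ⟨w, h, rfl⟩⟩
  have ho : ∀ α, OrdW r α → (r α (ee r θ) ↔ r α θ) := fun α hα => (isHW_ee hθ hp hv).ord hθ hp hv.ch hα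
  have hsub : ∀ x, r x (ee r θ) → r x (ee r β) := by
    intro x hx
    obtain ⟨α, h1, rfl⟩ := mem_ee.1 hx
    have hα := hθ.1.1.mem h1
    exact e_mem z2 trN hα (J.el.ord_mem trh trN I hα ((ho _ hα).2 h1))
  let S : TEmb (srel r (ee r θ)) (srel r (ee r β)) := ⟨fun x => ⟨x.1, hsub _ x.2⟩,
    fun x y h => Subtype.ext (congrArg (fun z => z.1) h :), fun _ _ => Iff.rfl,
    fun x w h => ⟨⟨w.1, trh _ _ x.2 h⟩, h, rfl⟩⟩
  let k : Sub r (ee r θ) := ⟨κ, J.hκ⟩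
  have hJo : OrdW r (J.j k).1 := (J.el.ordW trh trN).2 hκ.1
  have hκJ : r κ (J.j k).1 := by
    rcases (hκ.1.sub_iff hJo).1 (J.el.sub_ord trh trN I hκ.1 J.hκ) with h | h
    · exact h
    · exact absurd h.symm J.mov
  rcases hθ.1.1.trich hJo with hc | hc
  · exact ⟨θ, β, J, hθ', hκθ, hc⟩
  · have hle : SubW r (J.j k).1 θ := (hJo.sub_iff hθ.1.1).2 (hc.symm.imp_right Eq.symm)
    have fx : ∀ α (hα : r α κ), J.j ⟨α, trh _ _ J.hκ hα⟩ = S.i ⟨α, trh _ _ J.hκ hα⟩ := fun α hα =>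
      Subtype.ext (J.fix _ _ hα)
    have hreg : RegularW r κ := by
      refine ⟨hκ, fun b f hb hf hv' => by_contra fun hno => ?_⟩
      push Not at hno
      have hfh := fun_mem_ee hθ hp hv hf (trh _ _ J.hκ hb) fun x y hxy => trh _ _ J.hκ (hv' _ _ hxy)
      have h1 := (J.el.df (R := fun i v => ∀ γ, i.r γ (v 1) → ∃ x y, FApp i.r (v 0) x y ∧ ¬ i.r y γ)
        (by infer_instance) ![⟨f, hfh⟩, k]).2 fun γ hγ => by
          obtain ⟨x, y, h1, h2⟩ := hno _ hγ
          obtain ⟨x, y, rfl, rfl, h1⟩ := Th.fApp_of (f := ⟨f, hfh⟩) h1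
          exact ⟨x, y, Th.fApp.1 h1, h2⟩
      obtain ⟨x, y, h1, h2⟩ := h1 (S.i k) hκJ
      have h3 := (J.el.df (R := fun i v => ∀ x y, FApp i.r (v 0) x y → i.r x (v 1) ∧
          ∀ y', FApp i.r (v 0) x y' → y = y')
        (by infer_instance) ![⟨f, hfh⟩, ⟨b, trh _ _ J.hκ hb⟩]).2 fun x y hxy => by
          have := Th.fApp.2 hxy
          exact ⟨(hf.fApp_iff.1 this).1, fun y' h => Subtype.ext (hf.2.2 _ _ _ this (Th.fApp.2 h))⟩
      have h4 : r x.1 (J.j ⟨b, trh _ _ J.hκ hb⟩).1 := (h3 _ _ h1).1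
      rw [fx b hb] at h4
      obtain ⟨z, hz⟩ := hf.2.1 _ h4
      have hzκ := hv' _ _ hz
      have hxκ := hκ.1.1 _ _ hb h4
      have h5 := (J.el.df (R := fun i v => FApp i.r (v 0) (v 1) (v 2)) (by infer_instance)
        ![⟨f, hfh⟩, ⟨x.1, trh _ _ J.hκ hxκ⟩, ⟨z, trh _ _ J.hκ hzκ⟩]).2 (Th.fApp.1 hz)
      have h6 : FApp (srel r (ee r β)) (J.j ⟨f, hfh⟩) (J.j ⟨x.1, trh _ _ J.hκ hxκ⟩)
        (J.j ⟨z, trh _ _ J.hκ hzκ⟩) := h5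
      rw [fx _ hxκ, fx _ hzκ] at h6
      exact h2 ((h3 _ _ h1).2 _ h6 ▸ hzκ)
    have hom : r (om r) κ := by
      have nf : J.j k ≠ S.i k := fun h => J.mov (congrArg (fun z => z.1) h :)
      have hlim : LimitOrdW r κ := by
        rcases ord_cases hκ.1 with h | ⟨b, hb, h⟩ | h
        · have h1 : k = emp (srel r (ee r θ)) := Th.inj (h.trans Th.emp.symm)
          have h2 := (J.el.dfz (R := fun i v => v 0 = emp i.r) (by infer_instance) ![k]).2 h1
          exact absurd (h2.trans (S.emp.symm.trans (congrArg S.i h1.symm))) nf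
        · have h1 : k = succ (srel r (ee r θ)) ⟨b, trh _ _ J.hκ hb⟩ := Th.inj (h.trans (Th.succ ⟨b, trh _ _ J.hκ hb⟩).symm)
          have h2 := (J.el.dfz (R := fun i v => v 0 = succ i.r (v 1)) (by infer_instance)
            ![k, ⟨b, trh _ _ J.hκ hb⟩]).2 h1
          have h3 : J.j k = succ (srel r (ee r β)) (J.j ⟨b, trh _ _ J.hκ hb⟩) := h2
          rw [fx b hb] at h3
          exact absurd (h3.trans ((S.succ _).symm.trans (congrArg S.i h1.symm))) nf
        · exact h
      rcases ordW_om.trich hκ.1 with h | h | h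
      · exact h
      · have h1 : k = om (srel r (ee r θ)) := Th.inj (h.symm.trans Th.om.symm)
        have h2 := (J.el.dfz (R := fun i v => v 0 = om i.r) (by infer_instance) ![k]).2 h1
        exact absurd (h2.trans (S.om.symm.trans (congrArg S.i h1.symm))) nf
      · exact absurd hlim (isOmegaW_om.2 _ h)
    have h1 : ∀ α : Sub r (ee r θ), r α.1 κ → ∃ c : Sub r (ee r θ), r c.1 κ ∧ r α.1 c.1 ∧
        RegularW (srel r (ee r θ)) c := fun α hα =>
      (J.el.df (R := fun i v => ∃ c, i.r c (v 1) ∧ i.r (v 0) c ∧ RegularW i.r c) (by infer_instance)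
        ![α, k]).1 ⟨S.i k, hκJ, by
          show r (J.j α).1 κ
          rw [show α = ⟨α.1, trh _ _ J.hκ hα⟩ from rfl, fx _ hα]; exact hα, TN.regularW hreg⟩
    obtain ⟨c, h2, h3, h4⟩ := (J.el.df (R := fun i v => ∀ α, i.r α (v 0) → ∃ c, i.r c (v 0) ∧ i.r α c ∧
      RegularW i.r c) (by infer_instance) ![k]).2 h1 (S.i k) hκJ
    have hcθ := hle _ h2
    have hco := hθ.1.1.mem hcθ
    let c' : Sub r (ee r θ) := ⟨c.1, (ho _ hco).2 hcθ⟩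
    have hcr : RegUncW r c.1 := ⟨regularW_of_ee hθ hp hv (c := c') (S.regularW h4), _, isOmegaW_om,
      hco.trans h3 hom⟩
    have e1 : ee r c.1 = (ee (srel r (ee r θ)) c').1 := (Th.ee c').symm
    have e2 : J.j (ee (srel r (ee r θ)) c') = ee (srel r (ee r β)) (J.j c') :=
      (J.el.dfz (R := fun i v => v 0 = ee i.r (v 1)) (by infer_instance) ![_, c']).2 rfl
    have e3 : ee r (J.j c').1 = (J.j (ee (srel r (ee r θ)) c')).1 := by rw [e2]; exact (TN.ee _).symm
    obtain ⟨hi, el⟩ := J.el.sub (ee (srel r (ee r θ)) c')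
    have i1 := Elm.of_iso (r := srel r (ee r c.1)) (r' := srel (srel r (ee r θ)) _) (subEquiv trh _ e1)
      fun _ _ => Iff.rfl
    have i2 := Elm.symm_equiv (r := srel r (ee r (J.j c').1)) (r' := srel (srel r (ee r β)) _)
      (subEquiv trN _ e3) fun _ _ => Iff.rfl
    exact ⟨c.1, (J.j c').1, ⟨_, (J.el.ordW trh trN).2 hco, i2.comp (el.comp i1),
      ((isHW_ee hcr.rg hp hv).ord hcr.rg hp hv.ch hκ.1).2 h3, fun α hα hακ => J.fix _ _ hακ, J.mov⟩,
      hcr, h3, h2⟩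

end Improve

/-- A set of forcing conditions with a generic filter. -/
structure Frc {V : Type u} (r : V → V → Prop) where
  /-- The set of conditions. -/
  pos : V
  /-- The order of the conditions. -/
  lerel : V
  /-- The generic filter. -/
  G : V → Prop
  le_pairs : ∀ z, r z lerel → ∃ p q, r p pos ∧ r q pos ∧ IsOPair r z p q
  le_refl : ∀ p, r p pos → RelIn r lerel p p
  le_trans : ∀ p q s, RelIn r lerel p q → RelIn r lerel q s → RelIn r lerel p s
  G_sub : ∀ p, G p → r p pos
  G_ne : ∃ p, G p
  G_up : ∀ p q, G p → r q pos → RelIn r lerel p q → G q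
  G_dir : ∀ p q, G p → G q → ∃ s, G s ∧ RelIn r lerel s p ∧ RelIn r lerel s q
  G_gen : ∀ D, (∀ d, r d D → r d pos) →
    (∀ p, r p pos → ∃ d, r d D ∧ RelIn r lerel d p) → ∃ p, G p ∧ r p D

section Frc

variable {V : Type u} {r : V → V → Prop} [hr : ZFm r] (F : Frc r)

namespace Frc

/-- The order of the conditions. -/
def L (p q : V) : Prop := r (op r p q) F.lerel

theorem L_iff {p q : V} : RelIn r F.lerel p q ↔ F.L p q := relIn_iff

theorem L.refl {p : V} (h : r p F.pos) : F.L p p := F.L_iff.1 (F.le_refl p h)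

theorem L.trans {p q s : V} (h : F.L p q) (h' : F.L q s) : F.L p s :=
  F.L_iff.1 (F.le_trans p q s (F.L_iff.2 h) (F.L_iff.2 h'))

theorem L.mem {p q : V} (h : F.L p q) : r p F.pos ∧ r q F.pos := by
  obtain ⟨p', q', h1, h2, h3⟩ := F.le_pairs _ h
  obtain ⟨rfl, rfl⟩ := op_inj.1 (isOPair_iff.1 h3)
  exact ⟨h1, h2⟩

theorem G_le {p q : V} (hp : F.G p) (h : F.L p q) : F.G q :=
  F.G_up p q hp (VLC.Frc.L.mem F h).2 (F.L_iff.2 h)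

theorem exists_le {p q : V} (hp : F.G p) (hq : F.G q) : ∃ s, F.G s ∧ F.L s p ∧ F.L s q := by
  obtain ⟨s, h1, h2, h3⟩ := F.G_dir p q hp hq
  exact ⟨s, h1, F.L_iff.1 h2, F.L_iff.1 h3⟩

instance {n : ℕ} {f g : (Fin n → V) → V}
    [DFn (ι := Unit) (V := fun _ => V) (fun _ => r) (fun _ => True) (fun _ => f)]
    [DFn (ι := Unit) (V := fun _ => V) (fun _ => r) (fun _ => True) (fun _ => g)] :
    Dfb r (fun v => F.L (f v) (g v)) := by unfold L; infer_instance

theorem gen {Q : V → Prop} (hQ : Dp r Q) (h : ∀ p, r p F.pos → ∃ d, F.L d p ∧ Q d) : ∃ p, F.G p ∧ Q p := by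
  obtain ⟨p, h1, h2⟩ := F.G_gen (sepS r F.pos Q) (fun d hd => (mem_sepS.1 hd).1) fun p hp => by
    obtain ⟨d, h1, h2⟩ := h p hp
    exact ⟨d, mem_sepS.2 ⟨(VLC.Frc.L.mem F h1).1, h2⟩, F.L_iff.2 h1⟩
  exact ⟨p, h1, (mem_sepS.1 h2).2⟩

/-- The set `A` of conditions is hereditary and meets the generic filter exactly if `R` holds. -/
structure Tr (A : V → Prop) (R : Prop) : Prop where
  mono : ∀ p q, F.L q p → A p → A q
  truth : R ↔ ∃ p, F.G p ∧ A p

variable {F}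

theorem Tr.congr {A A' : V → Prop} {R R' : Prop} (h : F.Tr A R) (hA : ∀ p, A p ↔ A' p) (hR : R ↔ R') :
    F.Tr A' R' := by
  obtain rfl : A = A' := funext fun p => propext (hA p)
  rwa [← propext hR]

theorem Tr.const (R : Prop) : F.Tr (fun _ => R) R :=
  ⟨fun _ _ _ h => h, fun h => F.G_ne.imp fun _ hp => ⟨hp, h⟩, fun ⟨_, _, h⟩ => h⟩

theorem Tr.cond (s : V) : F.Tr (fun p => F.L p s) (F.G s) :=
  ⟨fun _ _ h h' => VLC.Frc.L.trans F h h', fun h => ⟨s, h, VLC.Frc.L.refl F (F.G_sub _ h)⟩,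
    fun ⟨_, hp, h⟩ => F.G_le hp h⟩

theorem Tr.and {A B : V → Prop} {R S : Prop} (h : F.Tr A R) (h' : F.Tr B S) :
    F.Tr (fun p => A p ∧ B p) (R ∧ S) := by
  refine ⟨fun p q hq hA => ⟨h.mono p q hq hA.1, h'.mono p q hq hA.2⟩, fun ⟨h1, h2⟩ => ?_,
    fun ⟨p, hp, h1, h2⟩ => ⟨h.truth.2 ⟨p, hp, h1⟩, h'.truth.2 ⟨p, hp, h2⟩⟩⟩
  obtain ⟨p, hp, h1⟩ := h.truth.1 h1
  obtain ⟨q, hq, h2⟩ := h'.truth.1 h2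
  obtain ⟨s, hs, h3, h4⟩ := F.exists_le hp hq
  exact ⟨s, hs, h.mono _ _ h3 h1, h'.mono _ _ h4 h2⟩

theorem Tr.ex {α : Sort*} {A : α → V → Prop} {R : α → Prop} (h : ∀ x, F.Tr (A x) (R x)) :
    F.Tr (fun p => ∃ x, A x p) (∃ x, R x) :=
  ⟨fun p q hq ⟨x, hx⟩ => ⟨x, (h x).mono p q hq hx⟩,
    fun ⟨x, hx⟩ => let ⟨p, hp, h1⟩ := (h x).truth.1 hx; ⟨p, hp, x, h1⟩,
    fun ⟨p, hp, x, h1⟩ => ⟨x, (h x).truth.2 ⟨p, hp, h1⟩⟩⟩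

theorem Tr.or {A B : V → Prop} {R S : Prop} (h : F.Tr A R) (h' : F.Tr B S) :
    F.Tr (fun p => A p ∨ B p) (R ∨ S) :=
  ⟨fun p q hq => Or.imp (h.mono p q hq) (h'.mono p q hq), by
    rw [h.truth, h'.truth, ← exists_or]
    simp only [and_or_left]⟩

theorem Tr.not {A : V → Prop} {R : Prop} (h : F.Tr A R) (hA : Dp r A) :
    F.Tr (fun p => ∀ q, F.L q p → ¬ A q) (¬ R) := by
  refine ⟨fun p q hq h1 s hs => h1 s (VLC.Frc.L.trans F hs hq), fun hR => ?_, fun ⟨p, hp, h1⟩ h2 => ?_⟩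
  · haveI : Dp r (fun q => A q) := hA
    haveI : ∀ {n : ℕ} (f : (Fin n → V) → V)
      [DFn (ι := Unit) (V := fun _ => V) (fun _ => r) (fun _ => True) (fun _ => f)],
        Dfb r (fun v => A (f v)) := fun f => Dp.app hA _
    obtain ⟨p, hp, h1⟩ := F.gen (Q := fun p => A p ∨ ∀ q, F.L q p → ¬ A q) (by infer_instance)
      fun p hp => by
        by_cases h1 : ∃ q, F.L q p ∧ A q
        · exact h1.imp fun q hq => ⟨hq.1, .inl hq.2⟩
        · push Not at h1
          exact ⟨p, VLC.Frc.L.refl F hp, .inr h1⟩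
    exact ⟨p, hp, h1.resolve_left fun h2 => hR (h.truth.2 ⟨p, hp, h2⟩)⟩
  · obtain ⟨q, hq, h3⟩ := h.truth.1 h2
    obtain ⟨s, hs, h4, h5⟩ := F.exists_le hp hq
    exact h1 s h4 (h.mono _ _ h5 h3)

theorem Tr.pos : F.Tr (fun p => r p F.pos) True :=
  ⟨fun _ _ h _ => (VLC.Frc.L.mem F h).1, ⟨fun _ => F.G_ne.imp fun p hp => ⟨hp, F.G_sub p hp⟩, fun _ => trivial⟩⟩

theorem Tr.ac {c : Prop} {A : V → Prop} {R : Prop} (h : c → F.Tr A R) :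
    F.Tr (fun p => c ∧ A p) (c ∧ R) := by
  by_cases hc : c
  · simpa [hc] using h hc
  · simpa [hc] using Tr.const (F := F) False

theorem mem_tc_of_transGen {x y : V} (h : Relation.TransGen r x y) : r x (tc r y) := by
  induction h with
  | single h => exact mem_tc_of_mem h
  | tail _ h ih => exact mem_tc_iff.2 (.inr ⟨_, h, ih⟩)

theorem transGen_of_op_mem {σ p τ : V} (h : r (op r σ p) τ) : Relation.TransGen r σ τ :=
  .tail (.tail (.single (mem_up.2 (.inl rfl) : r σ (up r σ σ))) (mem_up.2 (.inl rfl))) h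

variable (F)

/-- The value of a name. -/
noncomputable def vl : V → ZFSet.{u} :=
  hr.wf.transGen.fix fun τ ih => ZFSet.range fun x : {x : V × V // r (op r x.1 x.2) τ ∧ F.G x.2} =>
    ih x.1.1 (transGen_of_op_mem x.2.1)

theorem mem_vl {τ : V} {x : ZFSet.{u}} : x ∈ F.vl τ ↔ ∃ σ p, r (op r σ p) τ ∧ F.G p ∧ x = F.vl σ := by
  rw [vl, WellFounded.fix_eq, ZFSet.mem_range]
  constructor
  · rintro ⟨⟨⟨σ, p⟩, h1, h2⟩, rfl⟩
    exact ⟨σ, p, h1, h2, rfl⟩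
  · rintro ⟨σ, p, h1, h2, rfl⟩
    exact ⟨⟨⟨σ, p⟩, h1, h2⟩, rfl⟩

/-- Forced inequality of names, by recursion; the second name is taken from the set `t`. -/
noncomputable def ne (t τ : V) : V :=
  recF r (fun τ f => sepS r (prd r t F.pos) (fun z =>
    (∃ π s, r (op r π s) τ ∧ F.L (snd r z) s ∧ ∀ q, F.L q (snd r z) →
      ¬ ∃ π' s', r (op r π' s') (fst r z) ∧ F.L q s' ∧ ∀ u, F.L u q → ¬ r (op r π' u) (app r f π)) ∨
    (∃ π' s', r (op r π' s') (fst r z) ∧ F.L (snd r z) s' ∧ ∀ q, F.L q (snd r z) →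
      ¬ ∃ π s, r (op r π s) τ ∧ F.L q s ∧ ∀ u, F.L u q → ¬ r (op r π' u) (app r f π)))) τ

instance {n : ℕ} {f g : (Fin n → V) → V}
    [DFn (ι := Unit) (V := fun _ => V) (fun _ => r) (fun _ => True) (fun _ => f)]
    [DFn (ι := Unit) (V := fun _ => V) (fun _ => r) (fun _ => True) (fun _ => g)] :
    DFn (ι := Unit) (V := fun _ => V) (fun _ => r) (fun _ => True) (fun _ v => F.ne (f v) (g v)) :=
  DFn.comp2 (F := fun _ => F.ne) (by unfold ne; infer_instance) _ _

variable {F} {t : V} (ht : TransW r t)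
include ht

theorem op_mem_ne {τ σ p : V} (hσ : r σ t) : r (op r σ p) (F.ne t τ) ↔ r p F.pos ∧
    ((∃ π s, r (op r π s) τ ∧ F.L p s ∧ ∀ q, F.L q p →
      ¬ ∃ π' s', r (op r π' s') σ ∧ F.L q s' ∧ ∀ u, F.L u q → ¬ r (op r π' u) (F.ne t π)) ∨
    (∃ π' s', r (op r π' s') σ ∧ F.L p s' ∧ ∀ q, F.L q p →
      ¬ ∃ π s, r (op r π s) τ ∧ F.L q s ∧ ∀ u, F.L u q → ¬ r (op r π' u) (F.ne t π))) := by
  rw [ne, recF_eq, mem_sepS (r := r), mem_prd (r := r)]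
  have h1 : ∀ {π s : V}, r (op r π s) τ → app r (lamS r (tc r τ) (F.ne t)) π = F.ne t π := fun h =>
    app_lamS (F := F.ne t) (mem_tc_of_transGen (transGen_of_op_mem h))
  change _ ∧ (_ ∨ _) ↔ _
  simp only [fst_op, snd_op]
  refine and_congr ⟨fun ⟨x, y, _, h2, h3⟩ => (op_inj.1 h3).2 ▸ h2, fun h => ⟨_, _, hσ, h, rfl⟩⟩ (or_congr ?_ ?_)
  · exact exists_congr fun π => exists_congr fun s => and_congr_right fun h => by
      change _ ∧ (∀ q, _ → ¬ ∃ π' s', _ ∧ _ ∧ ∀ u, _ → ¬ r _ (app r (lamS r (tc r τ) (F.ne t)) π)) ↔ _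
      rw [h1 h]
  · refine exists_congr fun π' => exists_congr fun s' => and_congr_right fun _ => and_congr_right fun _ =>
      forall_congr' fun q => imp_congr_right fun _ => not_congr <| exists_congr fun π => exists_congr fun s =>
      and_congr_right fun h => ?_
    change _ ∧ (∀ u, _ → ¬ r _ (app r (lamS r (tc r τ) (F.ne t)) π)) ↔ _
    rw [h1 h]

theorem tr_ne {τ σ : V} (hσ : r σ t) : F.Tr (fun p => r (op r σ p) (F.ne t τ)) (F.vl τ ≠ F.vl σ) := by
  induction τ using hr.wf.transGen.induction generalizing σ with
  | _ τ ih =>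
  have hm : ∀ {π' s' : V}, r (op r π' s') σ → r π' t := fun {π' s'} h =>
    ht _ _ (ht _ _ (ht _ _ hσ h) (mem_up.2 (.inl rfl) : r (up r π' π') _)) (mem_up.2 (.inl rfl))
  refine (Tr.and Tr.pos (Tr.or
    (Tr.ex fun π => Tr.ex fun s => Tr.ac fun h : r (op r π s) τ => Tr.and (Tr.cond s) (Tr.not (Tr.ex fun π' => Tr.ex fun s' =>
      Tr.ac fun h' : r (op r π' s') σ => Tr.and (Tr.cond s') (Tr.not (ih π (transGen_of_op_mem h) (hm h'))
        inferInstance)) inferInstance))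
    (Tr.ex fun π' => Tr.ex fun s' => Tr.ac fun h' : r (op r π' s') σ => Tr.and (Tr.cond s') (Tr.not (Tr.ex fun π => Tr.ex fun s =>
      Tr.ac fun h : r (op r π s) τ => Tr.and (Tr.cond s) (Tr.not (ih π (transGen_of_op_mem h) (hm h'))
        inferInstance)) inferInstance)))).congr (fun p => (op_mem_ne ht hσ).symm) ?_
  simp only [ne_eq, not_not, true_and]
  constructor
  · rintro (⟨π, s, h, hs, hn⟩ | ⟨π, s, h, hs, hn⟩) he
    · obtain ⟨π', s', h1, h2, h3⟩ := F.mem_vl.1 (he ▸ F.mem_vl.2 ⟨π, s, h, hs, rfl⟩ : F.vl π ∈ F.vl σ)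
      exact hn ⟨π', s', h1, h2, h3⟩
    · obtain ⟨π', s', h1, h2, h3⟩ := F.mem_vl.1 (he ▸ F.mem_vl.2 ⟨π, s, h, hs, rfl⟩ : F.vl π ∈ F.vl τ)
      exact hn ⟨π', s', h1, h2, h3.symm⟩
  · intro h
    by_contra hn
    push Not at hn
    refine h (ZFSet.ext fun x => ?_)
    rw [F.mem_vl, F.mem_vl]
    constructor
    · rintro ⟨π, s, h1, h2, rfl⟩
      exact hn.1 π s h1 h2
    · rintro ⟨π, s, h1, h2, rfl⟩
      obtain ⟨π', s', h3, h4, h5⟩ := hn.2 π s h1 h2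
      exact ⟨π', s', h3, h4, h5.symm⟩

omit ht

theorem tr_eq (τ σ : V) :
    F.Tr (fun p => ∀ q, F.L q p → ¬ r (op r σ q) (F.ne (tc r (up r σ σ)) τ)) (F.vl τ = F.vl σ) :=
  (Tr.not (tr_ne (t := tc r (up r σ σ)) (fun x y hx hy => trans_tc _ _ _ hx hy)
    (mem_tc_of_mem (mem_up.2 (.inl rfl)))) inferInstance).congr (fun _ => Iff.rfl) not_not

theorem tr_mem (τ σ : V) : F.Tr (fun p => ∃ π s, r (op r π s) σ ∧ F.L p s ∧
    ∀ q, F.L q p → ¬ r (op r π q) (F.ne (tc r (up r π π)) τ)) (F.vl τ ∈ F.vl σ) :=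
  (Tr.ex fun π => Tr.ex fun s => Tr.ac fun _ => Tr.and (Tr.cond s) (tr_eq τ π)).congr (fun _ => Iff.rfl)
    F.mem_vl.symm

end Frc

end Frc

namespace Frc

variable {V : Type u} {r : V → V → Prop} [hr : ZFm r] (F : Frc r)

/-- The generic extension. -/
noncomputable abbrev W : Type u := Quotient (Setoid.ker F.vl)

/-- The object with a given name. -/
noncomputable abbrev vq (τ : V) : F.W := Quotient.mk _ τ

/-- The object as a set. -/
noncomputable def zv : F.W → ZFSet.{u} := Quotient.lift F.vl fun _ _ h => h

/-- The membership relation of the generic extension. -/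
def mw (a b : F.W) : Prop := F.zv a ∈ F.zv b

variable {F}

theorem vq_eq {τ σ : V} : F.vq τ = F.vq σ ↔ F.vl τ = F.vl σ := Quotient.eq

theorem mem_vq {τ : V} {w : F.W} : F.mw w (F.vq τ) ↔ ∃ σ p, r (op r σ p) τ ∧ F.G p ∧ w = F.vq σ := by
  obtain ⟨ρ, rfl⟩ := Quotient.exists_rep w
  exact F.mem_vl.trans (by simp only [vq_eq]; rfl)

theorem mw_ext {x y : F.W} (h : ∀ z, F.mw z x ↔ F.mw z y) : x = y := by
  obtain ⟨τ, rfl⟩ := Quotient.exists_rep x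
  obtain ⟨σ, rfl⟩ := Quotient.exists_rep y
  refine vq_eq.2 (ZFSet.ext fun z => ?_)
  have key : ∀ {π : V}, z ∈ F.vl π → ∃ ρ, z = F.vl ρ := fun h => by
    obtain ⟨ρ, p, -, -, h⟩ := F.mem_vl.1 h
    exact ⟨ρ, h⟩
  constructor <;> intro hz <;> obtain ⟨ρ, rfl⟩ := key hz
  · exact (h (F.vq ρ)).1 hz
  · exact (h (F.vq ρ)).2 hz

theorem fd {n : ℕ} {R : (Fin n → F.W) → Prop} (h : Dfb F.mw R) : ∃ B : (Fin (n + 1) → V) → Prop,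
    Dfb r B ∧ ∀ τ : Fin n → V, F.Tr (fun p => B (Fin.snoc (α := fun _ => V) τ p)) (R fun i => F.vq (τ i)) := by
  have tm : ∀ {n : ℕ} {t : ∀ _ : Unit, (Fin n → F.W) → F.W}, IsTm (fun _ => True) t →
      ∃ (f : (Fin (n + 1) → V) → V) (g : (Fin n → V) → V),
        DFn (ι := Unit) (V := fun _ => V) (fun _ => r) (fun _ => True) (fun _ => f) ∧
        (∀ τ p, f (Fin.snoc (α := fun _ => V) τ p) = g τ) ∧ ∀ τ : Fin n → V, t () (fun i => F.vq (τ i)) = F.vq (g τ) := by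
    rintro n t (⟨j, rfl⟩ | ⟨c, -, rfl⟩)
    · exact ⟨fun v => v j.castSucc, fun v => v j, inferInstance, fun τ p => by simp, fun τ => rfl⟩
    · obtain ⟨σ, hσ⟩ := Quotient.exists_rep (c ())
      exact ⟨fun _ => σ, fun _ => σ, inferInstance, fun τ p => rfl, fun τ => hσ.symm⟩
  have hd : ∀ {n : ℕ} {B : (Fin (n + 1) → V) → Prop}, Dfb r B → ∀ τ : Fin n → V,
      Dp r (fun p => B (Fin.snoc (α := fun _ => V) τ p)) := fun {n B} hB τ =>
    (hB.compv (m := 1) (Fin.lastCases (fun _ v => v 0) fun j _ _ => τ j) (Fin.lastCases (by simpa using DFn.var _)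
      fun j => by simp only [Fin.lastCases_castSucc]; infer_instance)).congr fun _ v => by
        refine iff_of_eq (congrArg _ (funext fun j => ?_))
        refine Fin.lastCases ?_ (fun j => ?_) j <;> simp
  have hn : ∀ {n : ℕ} {B : (Fin (n + 1) → V) → Prop}, Dfb r B → Dfb r (fun v : Fin (n + 1) → V =>
      ∀ q, F.L q (v (Fin.last n)) → ¬ B (Fin.snoc (α := fun _ => V) (fun j => v j.castSucc) q)) := fun {n B} hB => by
    haveI : Dfb r (fun w : Fin (n + 1 + 1) → V => B (Fin.snoc (α := fun _ => V) (fun j => w j.castSucc.castSucc)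
        (w (Fin.last (n + 1))))) := (hB.rename (Fin.lastCases (Fin.last _) fun j => j.castSucc.castSucc)).congr
      fun _ v => by
        refine iff_of_eq (congrArg _ (funext fun j => ?_))
        refine Fin.lastCases ?_ (fun j => ?_) j <;> simp
    infer_instance
  refine Df.induct (C := fun n R => ∃ B : (Fin (n + 1) → V) → Prop, Dfb r B ∧ ∀ τ : Fin n → V,
    F.Tr (fun p => B (Fin.snoc (α := fun _ => V) τ p)) (R () fun i => F.vq (τ i))) ?_ ?_ ?_ ?_ ?_ h
  · intro n t s ht hs
    obtain ⟨f, g, h1, h2, h3⟩ := tm ht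
    obtain ⟨f', g', h1', h2', h3'⟩ := tm hs
    refine ⟨fun v => ∃ π s, r (op r π s) (f' v) ∧ F.L (v (Fin.last n)) s ∧
      ∀ q, F.L q (v (Fin.last n)) → ¬ r (op r π q) (F.ne (tc r (up r π π)) (f v)), ?_, fun τ => ?_⟩
    · haveI := h1.lift.lift
      haveI := h1.lift.lift.lift
      haveI := h1'.lift.lift
      infer_instance
    · simp only [h3, h3', h2, h2', Fin.snoc_last]
      exact tr_mem _ _
  · intro n t s ht hs
    obtain ⟨f, g, h1, h2, h3⟩ := tm ht
    obtain ⟨f', g', h1', h2', h3'⟩ := tm hs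
    refine ⟨fun v => ∀ q, F.L q (v (Fin.last n)) →
      ¬ r (op r (f' v) q) (F.ne (tc r (up r (f' v) (f' v))) (f v)), ?_, fun τ => ?_⟩
    · haveI := h1.lift
      haveI := h1'.lift
      infer_instance
    · simp only [h3, h3', h2, h2', Fin.snoc_last, vq_eq]
      exact tr_eq _ _
  · exact fun n => ⟨fun _ => False, Df.prop _, fun τ => Tr.const _⟩
  · rintro n R S ⟨A, hA, hA'⟩ ⟨B, hB, hB'⟩
    haveI := hn hA
    exact ⟨fun v => (∀ q, F.L q (v (Fin.last n)) → ¬ A (Fin.snoc (α := fun _ => V) (fun j => v j.castSucc) q)) ∨ B v,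
      inferInstance, fun τ => (Tr.or (Tr.not (hA' τ) (hd hA τ)) (hB' τ)).congr (fun p => by simp) (by tauto)⟩
  · rintro n R ⟨A, hA, hA'⟩
    haveI : Dfb r (fun w : Fin (n + 1 + 1) → V => ∀ q, F.L q (w (Fin.last n).castSucc) → ¬ A (Fin.snoc (α := fun _ => V)
        (Fin.snoc (α := fun _ => V) (fun j => w j.castSucc.castSucc) (w (Fin.last (n + 1)))) q)) :=
      ((hn hA).rename (Fin.lastCases (Fin.last n).castSucc (Fin.lastCases (Fin.last (n + 1))
        fun j => j.castSucc.castSucc))).congr fun _ v => by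
          simp only [Fin.lastCases_last]
          refine forall_congr' fun q => imp_congr_right fun _ => not_congr (iff_of_eq (congrArg _ (funext fun j => ?_)))
          refine Fin.lastCases ?_ (fun j => Fin.lastCases ?_ (fun j => ?_) j) j <;> simp
    have h1 : Dfb r (fun v : Fin (n + 1) → V => ∃ σ, ∀ q, F.L q (v (Fin.last n)) → ¬ A (Fin.snoc (α := fun _ => V)
        (Fin.snoc (α := fun _ => V) (fun j => v j.castSucc) σ) q)) := by infer_instance
    refine ⟨_, hn h1, fun τ => (Tr.not ((Tr.ex fun σ => Tr.not (hA' (Fin.snoc (α := fun _ => V) τ σ)) (hd hA _)).congr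
      (fun p => ?_) Iff.rfl) (hd h1 τ)).congr (fun p => by simp) ?_⟩
    · simp
    · simp only [not_exists, not_not]
      refine ⟨fun h y => ?_, fun h σ => ?_⟩
      · obtain ⟨σ, rfl⟩ := Quotient.exists_rep y
        convert h σ with j
        refine Fin.lastCases ?_ (fun j => ?_) j <;> simp
      · convert h (F.vq σ) with j
        refine Fin.lastCases ?_ (fun j => ?_) j <;> simp

end Frc

namespace Frc

variable {V : Type u} {r : V → V → Prop} [hr : ZFm r] {F : Frc r}

theorem mem_vq_prd {a : V} {w : F.W} : F.mw w (F.vq (prd r a F.pos)) ↔ ∃ σ, r σ a ∧ w = F.vq σ := by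
  rw [mem_vq]
  constructor
  · rintro ⟨σ, p, h1, -, h2⟩
    obtain ⟨x, y, h3, -, h4⟩ := mem_prd.1 h1
    exact ⟨σ, (op_inj.1 h4).1 ▸ h3, h2⟩
  · rintro ⟨σ, h1, h2⟩
    obtain ⟨p, hp⟩ := F.G_ne
    exact ⟨σ, p, mem_prd.2 ⟨_, _, h1, F.G_sub p hp, rfl⟩, hp, h2⟩

theorem mem_vq_tc {τ : V} {w : F.W} (h : F.mw w (F.vq τ)) : ∃ σ, r σ (tc r τ) ∧ w = F.vq σ := by
  obtain ⟨σ, p, h1, -, h2⟩ := mem_vq.1 h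
  exact ⟨σ, mem_tc_of_transGen (transGen_of_op_mem h1), h2⟩

theorem exists_name {Q : F.W → Prop} (hQ : Dp F.mw Q) (a : V) : ∃ s, SubW r s (prd r a F.pos) ∧
    ∀ w, F.mw w (F.vq s) ↔ (∃ σ, r σ a ∧ w = F.vq σ) ∧ Q w := by
  obtain ⟨B, hB, hB'⟩ := fd hQ
  haveI h2 : Dp₂ r (fun σ p => B ![σ, p]) := hB.congr fun _ v => iff_of_eq (congrArg _ (funext fun j => by
    fin_cases j <;> rfl))
  haveI : Dp r (fun z => B ![fst r z, snd r z]) := h2.app _ _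
  have hT : ∀ σ, F.Tr (fun p => B ![σ, p]) (Q (F.vq σ)) := fun σ => (hB' fun _ => σ).congr
    (fun p => iff_of_eq (congrArg _ (funext fun j => by fin_cases j <;> rfl))) Iff.rfl
  refine ⟨sepS r (prd r a F.pos) fun z => B ![fst r z, snd r z], fun x hx => (mem_sepS.1 hx).1, fun w => ?_⟩
  rw [mem_vq]
  constructor
  · rintro ⟨σ, p, h1, hp, rfl⟩
    obtain ⟨h1, h3⟩ := mem_sepS.1 h1
    rw [fst_op, snd_op] at h3
    obtain ⟨x, y, h4, -, h5⟩ := mem_prd.1 h1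
    exact ⟨⟨σ, (op_inj.1 h5).1 ▸ h4, rfl⟩, (hT σ).truth.2 ⟨p, hp, h3⟩⟩
  · rintro ⟨⟨σ, h1, rfl⟩, h2⟩
    obtain ⟨p, hp, h3⟩ := (hT σ).truth.1 h2
    exact ⟨σ, p, mem_sepS.2 ⟨mem_prd.2 ⟨_, _, h1, F.G_sub p hp, rfl⟩, by rwa [fst_op, snd_op]⟩, hp, rfl⟩

theorem coll {Q : F.W → Prop} (hQ : Dp F.mw Q) (a : V) (h : ∀ w, Q w → ∃ σ, r σ a ∧ w = F.vq σ) :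
    ∃ b, ∀ w, F.mw w b ↔ Q w := by
  obtain ⟨s, -, hs⟩ := exists_name hQ a
  exact ⟨F.vq s, fun w => (hs w).trans ⟨fun h => h.2, fun hw => ⟨h w hw, hw⟩⟩⟩

variable (F)

/-- The canonical name of a set. -/
noncomputable def check (x : V) : V := recF r (fun x f => prd r (imS r x (app r f)) F.pos) x

instance {n : ℕ} {f : (Fin n → V) → V}
    [DFn (ι := Unit) (V := fun _ => V) (fun _ => r) (fun _ => True) (fun _ => f)] :
    DFn (ι := Unit) (V := fun _ => V) (fun _ => r) (fun _ => True) (fun _ v => F.check (f v)) :=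
  DFn.comp1 (F := fun _ => F.check) (by unfold check; infer_instance) _

theorem mem_check {x : V} {w : F.W} : F.mw w (F.vq (F.check x)) ↔ ∃ y, r y x ∧ w = F.vq (F.check y) := by
  rw [check, recF_eq, mem_vq_prd]
  constructor
  · rintro ⟨σ, h1, rfl⟩
    obtain ⟨y, hy, rfl⟩ := (mem_imS (r := r) (F := app r _)).1 h1
    exact ⟨y, hy, congrArg _ (app_lamS (F := F.check) (mem_tc_of_mem hy))⟩
  · rintro ⟨y, hy, rfl⟩
    exact ⟨_, (mem_imS (r := r) (F := app r _)).2 ⟨y, hy, rfl⟩, (congrArg _ (app_lamS (F := F.check) (mem_tc_of_mem hy))).symm⟩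

/-- The inclusion of the ground model. -/
noncomputable def inc : TEmb r F.mw :=
  have inj : ∀ x y, F.vq (F.check x) = F.vq (F.check y) → x = y := fun x => by
    induction x using hr.wf.induction with
    | _ x ih =>
    refine fun y h => hr.ext fun z => ⟨fun hz => ?_, fun hz => ?_⟩
    · obtain ⟨z', h1, h2⟩ := F.mem_check.1 (h ▸ F.mem_check.2 ⟨z, hz, rfl⟩ : F.mw (F.vq (F.check z)) (F.vq (F.check y)))
      exact ih z hz z' h2 ▸ h1
    · obtain ⟨z', h1, h2⟩ := F.mem_check.1 (h ▸ F.mem_check.2 ⟨z, hz, rfl⟩ : F.mw (F.vq (F.check z)) (F.vq (F.check x)))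
      exact ih z' h1 z h2.symm ▸ h1
  { i := fun x => F.vq (F.check x)
    inj := fun x y => inj x y
    mem' := fun x y => F.mem_check.trans ⟨fun ⟨z, h1, h2⟩ => inj _ _ h2 ▸ h1, fun h => ⟨x, h, rfl⟩⟩
    trans := fun x w h => F.mem_check.1 h }

theorem zfm (hv : VE r) : ZFm F.mw where
  wf := InvImage.wf F.zv ZFSet.mem_wf
  ext := mw_ext
  pairing x y := by
    obtain ⟨τ, rfl⟩ := Quotient.exists_rep x
    obtain ⟨σ, rfl⟩ := Quotient.exists_rep y
    exact coll (Q := fun w => w = F.vq τ ∨ w = F.vq σ) inferInstance (up r τ σ) fun w hw => by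
      rcases hw with rfl | rfl
      exacts [⟨_, mem_up.2 (.inl rfl), rfl⟩, ⟨_, mem_up.2 (.inr rfl), rfl⟩]
  unions x := by
    obtain ⟨τ, rfl⟩ := Quotient.exists_rep x
    refine coll (Q := fun w => ∃ y, F.mw y (F.vq τ) ∧ F.mw w y) inferInstance (tc r τ) fun w ⟨y, hy, hw⟩ => ?_
    obtain ⟨σ, hσ, rfl⟩ := mem_vq_tc hy
    obtain ⟨ρ, hρ, rfl⟩ := mem_vq_tc hw
    exact ⟨ρ, tc_mono hσ _ hρ, rfl⟩
  infinity := ⟨F.inc.i (om r), F.inc.limitOrdW.2 isOmegaW_om.1, F.inc.ball.2 fun x hx => by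
    rw [F.inc.limitOrdW]
    exact isOmegaW_om.2 x hx⟩
  sep Q hQ x := by
    obtain ⟨τ, rfl⟩ := Quotient.exists_rep x
    haveI : Dp F.mw (fun x => Q x) := hQ
    exact coll (Q := fun w => F.mw w (F.vq τ) ∧ Q w) inferInstance (tc r τ) fun w hw => mem_vq_tc hw.1
  repl Q hQ x hf := by
    obtain ⟨τ, rfl⟩ := Quotient.exists_rep x
    obtain ⟨B, hB, hB'⟩ := fd hQ
    haveI h3 : Dfb r (fun v : Fin 3 → V => B ![v 0, v 1, v 2]) := hB.congr fun _ v =>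
      iff_of_eq (congrArg _ (funext fun j => by fin_cases j <;> rfl))
    haveI : Dfb r (fun v : Fin (1 + 1) → V => B ![fst r (v (Fin.castSucc 0)), e r (v (Fin.last 1)), snd r (v (Fin.castSucc 0))]) :=
      (h3.compv (m := 2) ![fun _ v => fst r (v 0), fun _ v => e r (v (Fin.last 1)), fun _ v => snd r (v 0)] (by
        intro j; fin_cases j <;> simp <;> infer_instance)).congr fun _ v => Iff.rfl
    have hT : ∀ σ π, F.Tr (fun p => B ![σ, π, p]) (Q (F.vq σ) (F.vq π)) := fun σ π => (hB' ![σ, π]).congr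
      (fun p => iff_of_eq (congrArg _ (funext fun j => by fin_cases j <;> rfl))) Iff.rfl
    haveI : Dfb F.mw (fun v : Fin (1 + 1) → F.W => Q (v (Fin.last 1)) (v (Fin.castSucc 0))) := hQ.rename ![1, 0]
    haveI : Df₁ r (fun z => e r (lst r fun α => B ![fst r z, e r α, snd r z])) := by infer_instance
    refine coll (Q := fun w => ∃ x, F.mw x (F.vq τ) ∧ Q x w) inferInstance
      (imS r (prd r (tc r τ) F.pos) fun z => e r (lst r fun α => B ![fst r z, e r α, snd r z])) ?_
    rintro w ⟨x, hx, hw⟩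
    obtain ⟨σ, hσ, rfl⟩ := mem_vq_tc hx
    obtain ⟨ρ, rfl⟩ := Quotient.exists_rep w
    obtain ⟨p, hp, h1⟩ := (hT σ ρ).truth.1 hw
    obtain ⟨α, hα, rfl⟩ := hv ρ
    have h2 := lst_spec (r := r) (Q := fun α => B ![σ, e r α, p]) ⟨α, hα, h1⟩
    refine ⟨_, mem_imS.2 ⟨op r σ p, mem_prd.2 ⟨σ, p, hσ, F.G_sub p hp, rfl⟩, rfl⟩, ?_⟩
    simp only [fst_op, snd_op]
    exact hf _ _ _ hx hw ((hT σ _).truth.2 ⟨p, hp, h2.2.1⟩)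

variable [hw : ZFm F.mw]

theorem pw (hp : Pw r) : Pw F.mw := fun x => by
  obtain ⟨τ, rfl⟩ := Quotient.exists_rep x
  obtain ⟨a, ha⟩ := hp (prd r (tc r τ) F.pos)
  refine coll (Q := fun w => SubW F.mw w (F.vq τ)) inferInstance a fun w hw => ?_
  obtain ⟨s, h1, h2⟩ := exists_name (Q := fun v => F.mw v w) inferInstance (tc r τ)
  exact ⟨s, (ha s).2 h1, mw_ext fun v => ⟨fun h => (h2 v).2 ⟨mem_vq_tc (hw v h), h⟩, fun h => ((h2 v).1 h).2⟩⟩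

/-- The canonical name of an ordered pair. -/
noncomputable def opn (σ π : V) : V :=
  prd r (up r (prd r (up r σ σ) F.pos) (prd r (up r σ π) F.pos)) F.pos

theorem vq_opn (σ π : V) : F.vq (F.opn σ π) = op F.mw (F.vq σ) (F.vq π) := by
  have h : ∀ a b, F.vq (prd r (up r a b) F.pos) = up F.mw (F.vq a) (F.vq b) := fun a b => mw_ext fun w => by
    rw [mem_vq_prd, mem_up (r := F.mw)]
    simp [mem_up]
  rw [opn, h, h, h, op]

theorem ch (hv : VE r) : Ch F.mw := fun a ha => by
  obtain ⟨τ, rfl⟩ := Quotient.exists_rep a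
  obtain ⟨δ, hδ, hd⟩ := hv (tc r τ)
  haveI : Df₁ r fun β => F.opn (F.check β) (e r β) := by unfold opn; infer_instance
  let g := F.vq (prd r (imS r δ fun β => F.opn (F.check β) (e r β)) F.pos)
  have hg : ∀ x y, F.mw (op F.mw x y) g ↔ ∃ β, r β δ ∧ x = F.inc.i β ∧ y = F.vq (e r β) := fun x y => by
    rw [mem_vq_prd]
    constructor
    · rintro ⟨σ, h1, h2⟩
      obtain ⟨β, hβ, rfl⟩ := (mem_imS (r := r) (F := fun β => F.opn (F.check β) (e r β))).1 h1
      rw [vq_opn, op_inj] at h2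
      exact ⟨β, hβ, h2⟩
    · rintro ⟨β, hβ, rfl, rfl⟩
      exact ⟨_, (mem_imS (r := r) (F := fun β => F.opn (F.check β) (e r β))).2 ⟨β, hβ, rfl⟩, (F.vq_opn _ _).symm⟩
  refine ⟨lamS F.mw (F.vq τ) fun x => app F.mw g (lst F.mw fun β => ∃ y, F.mw y x ∧ F.mw (op F.mw β y) g),
    isFunOn_lamS _ _, fun x y hx hy => ?_⟩
  rw [(fApp_lamS.1 hy).2]
  obtain ⟨y, hy⟩ := ha x hx
  obtain ⟨σ, hσ, rfl⟩ := mem_vq_tc hx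
  obtain ⟨ρ, hρ, rfl⟩ := mem_vq_tc hy
  have h1 := tc_mono hσ _ hρ
  rw [hd] at h1
  obtain ⟨β, hβ, rfl⟩ := mem_ee.1 (e_sub hδ _ h1)
  obtain ⟨h2, ⟨z, hz, h3⟩, -⟩ := lst_spec (r := F.mw) (Q := fun β => ∃ y, F.mw y (F.vq σ) ∧ F.mw (op F.mw β y) g)
    ⟨F.inc.i β, F.inc.ordW.2 (hδ.mem hβ), _, hy, (hg _ _).2 ⟨β, hβ, rfl, rfl⟩⟩
  rwa [app_eq h3 fun y' h4 => ?_]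
  obtain ⟨b, h5, h6, rfl⟩ := (hg _ _).1 h3
  obtain ⟨b', h5', h6', rfl⟩ := (hg _ _).1 h4
  rw [F.inc.inj (h6.symm.trans h6')]

end Frc

section Virtual

variable {V : Type u} {r : V → V → Prop} [hr : ZFm r]

/-- The generic filter as an element of the extension. -/
noncomputable def Frc.Gs (F : Frc r) : F.W := F.vq (imS r F.pos (fun p => op r (F.check p) p))

theorem Frc.mem_Gs {F : Frc r} {w : F.W} : F.mw w F.Gs ↔ ∃ p, F.G p ∧ w = F.inc.i p := by
  refine F.mem_vq.trans ⟨?_, ?_⟩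
  · rintro ⟨σ, p, h1, h2, rfl⟩
    obtain ⟨q, h3, h4⟩ := (mem_imS (r := r) (F := fun p => op r (F.check p) p)).1 h1
    obtain ⟨rfl, rfl⟩ := op_inj.1 h4
    exact ⟨_, h2, rfl⟩
  · rintro ⟨p, hp, rfl⟩
    exact ⟨F.check p, p, (mem_imS (r := r) (F := fun p => op r (F.check p) p)).2 ⟨p, F.G_sub p hp, rfl⟩, hp, rfl⟩

theorem Frc.mem_vq' {F : Frc r} {τ : V} {w : F.W} : F.mw w (F.vq τ) ↔
    ∃ σ p z, r z τ ∧ IsOPair r z σ p ∧ F.G p ∧ w = F.vq σ :=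
  F.mem_vq.trans ⟨fun ⟨σ, p, h1, h2⟩ => ⟨σ, p, _, h1, isOPair_op _ _, h2⟩, fun ⟨σ, p, z, h1, h2, h3⟩ =>
    ⟨σ, p, isOPair_iff.1 h2 ▸ h1, h3⟩⟩

/-- The forcing extension. -/
noncomputable def Frc.extension (F : Frc r) (hp : Pw r) (hv : VE r) : Extension (hr.univ hp hv.ch) :=
  haveI hw : ZFm F.mw := F.zfm hv
  { W := hw.univ (F.pw hp) (F.ch hv)
    inc := F.inc.i
    inc_inj := F.inc.inj
    inc_mem := F.inc.mem'
    inc_trans := F.inc.trans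
    pos := F.pos
    lerel := F.lerel
    le_pairs := F.le_pairs
    le_refl := F.le_refl
    le_trans := F.le_trans
    G := F.G
    G_sub := F.G_sub
    G_ne := F.G_ne
    G_up := F.G_up
    G_dir := F.G_dir
    G_gen := F.G_gen
    Gset := F.Gs
    Gset_spec := fun _ => F.mem_Gs
    val := fun τ => F.vq τ
    val_spec := fun _ _ => F.mem_vq'
    val_surj := fun w => (Quotient.exists_rep w).imp fun _ h => h.symm }

/-- The poset of the elements of a set, ordered by reverse inclusion, has generic filters over countable models. -/
theorem exists_frc [Countable V] (P : V) (hP : ∃ p, r p P) :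
    ∃ F : Frc r, F.pos = P ∧ ∀ p q, F.L p q ↔ r p P ∧ r q P ∧ SubW r q p := by
  letI : Preorder (Sub r P) :=
    { le := fun p q => SubW r p.1 q.1
      le_refl := fun p x h => h
      le_trans := fun p q s h h' x hx => h' x (h x hx) }
  let ι := {D : V // ∀ p : Sub r P, ∃ d : Sub r P, r d.1 D ∧ p ≤ d}
  letI : Encodable ι := Encodable.ofCountable ι
  let 𝒟 : ι → Order.Cofinal (Sub r P) := fun D => ⟨{d | r d.1 D.1}, fun p => D.2 p⟩
  obtain ⟨p₀, h₀⟩ := hP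
  let I := Order.idealOfCofinals (⟨p₀, h₀⟩ : Sub r P) 𝒟
  let le := sepS r (prd r P P) (fun z => SubW r (snd r z) (fst r z))
  have hL : ∀ p q, RelIn r le p q ↔ r p P ∧ r q P ∧ SubW r q p := fun p q => by
    rw [relIn_iff, mem_sepS (r := r), mem_prd (r := r), fst_op, snd_op, ← and_assoc]
    refine and_congr_left fun _ => ⟨?_, fun ⟨h1, h2⟩ => ⟨_, _, h1, h2, rfl⟩⟩
    rintro ⟨x, y, h1, h2, h3⟩
    obtain ⟨rfl, rfl⟩ := op_inj.1 h3
    exact ⟨h1, h2⟩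
  refine ⟨
    { pos := P
      lerel := le
      G := fun p => ∃ h : r p P, (⟨p, h⟩ : Sub r P) ∈ I
      le_pairs := fun z hz => by
        obtain ⟨p, q, h1, h2, rfl⟩ := mem_prd.1 (mem_sepS.1 hz).1
        exact ⟨p, q, h1, h2, isOPair_op _ _⟩
      le_refl := fun p hp => (hL _ _).2 ⟨hp, hp, fun _ h => h⟩
      le_trans := fun p q s h1 h2 => by
        rw [hL] at *
        exact ⟨h1.1, h2.2.1, fun x hx => h1.2.2 x (h2.2.2 x hx)⟩
      G_sub := fun p h => h.1
      G_ne := ⟨p₀, h₀, Order.mem_idealOfCofinals _ 𝒟⟩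
      G_up := fun p q ⟨h, hp⟩ hq hl => ⟨hq, I.lower' (show (⟨q, hq⟩ : Sub r P) ≤ ⟨p, h⟩ from ((hL _ _).1 hl).2.2) hp⟩
      G_dir := fun p q ⟨h1, hp⟩ ⟨h2, hq⟩ => by
        obtain ⟨s, h3, h4, h5⟩ := I.directed' _ hp _ hq
        exact ⟨s.1, ⟨s.2, h3⟩, (hL _ _).2 ⟨s.2, h1, h4⟩, (hL _ _).2 ⟨s.2, h2, h5⟩⟩
      G_gen := fun D h1 h2 => by
        obtain ⟨p, h3, h4⟩ := Order.cofinal_meets_idealOfCofinals (⟨p₀, h₀⟩ : Sub r P) 𝒟 ⟨D, fun p => by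
          obtain ⟨d, h3, h4⟩ := h2 p.1 p.2
          exact ⟨⟨d, h1 d h3⟩, h3, ((hL _ _).1 h4).2.2⟩⟩
        exact ⟨p.1, ⟨p.2, h4⟩, h3⟩ }, rfl, fun p q => relIn_iff.symm.trans (hL p q)⟩

/-- `P` is an extendible set of finite partial elementary maps from `H_θ = h` to `N` with critical point `κ`
sent above `θ`. -/
def Gd (r : V → V → Prop) [ZFm r] (θ κ h N P : V) : Prop :=
  RegUncW r θ ∧ IsCardW r κ ∧ r κ θ ∧ IsHW r θ h ∧ TransW r N ∧ SubW r h N ∧ (∃ p, r p P) ∧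
    (∀ p, r p P → ∀ n, r n (om r) → r p (ef r h N n)) ∧
    (∀ p, r p P → ∀ x y, r (op r x y) p → (r x κ → y = x) ∧ (x = κ → r θ y)) ∧
    ∀ p, r p P → ∀ x, r x h → ∃ q, r q P ∧ SubW r p q ∧ ∃ y, r (op r x y) q

theorem exists_isGr {h N p : V} (hp : r p (fin r (prd r h N))) :
    ∃ (k : ℕ) (v : Fin k → Sub r h) (w : Fin k → Sub r N), IsGr r p (fun i => (v i).1) (fun i => (w i).1) := by
  obtain ⟨l, hl, rfl⟩ := mem_fin.1 hp
  have h1 : ∀ i, ∃ (x : Sub r h) (y : Sub r N), l.get i = op r x.1 y.1 := fun i => by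
    obtain ⟨x, y, h1, h2, h3⟩ := mem_prd.1 (hl _ (l.get_mem i))
    exact ⟨⟨x, h1⟩, ⟨y, h2⟩, h3⟩
  choose v w h2 using h1
  refine ⟨l.length, v, w, fun z => ?_⟩
  rw [mem_lset (r := r), List.mem_iff_get]
  exact exists_congr fun i => by rw [h2, eq_comm]

/-- An elementary map, as an elementary embedding. -/
noncomputable def Elm.emb {V W : Type u} {dV : V → Prop} {rV : V → V → Prop} {dW B1 : W → Prop} {rW : W → W → Prop}
    {j : {x // dV x} → {y // dW y}} (hj : Elm (fun a b : {x // dV x} => rV a.1 b.1) (fun a b : {y // dW y} => rW a.1 b.1) j)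
    (h1 : ∀ y, dW y → ¬ B1 y) :
    ElemEmb dV rV (fun _ => False) (fun _ => False) dW rW B1 (fun _ => False) :=
  @ElementaryEmbedding.mk L3 _ _ (mstr _ _ _ _) (mstr _ _ _ _) j fun n φ v => by
    rw [mstr_empty h1 (fun _ _ h => h), mstr_eq_memStr]
    exact hj n φ v

theorem Gd.virtStrong [Countable V] (hp : Pw r) (hv : VE r) {θ κ h N P : V} (g : Gd r θ κ h N P) :
    VirtStrongAt (hr.univ hp hv.ch) θ κ := by
  obtain ⟨hθ, hκ, hκθ, hh, tN, hN, hP, g1, g2, g3⟩ := g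
  obtain ⟨F, rfl, hF⟩ := exists_frc P hP
  haveI hw : ZFm F.mw := F.zfm hv
  have gfin : ∀ p, F.G p → r p (fin r (prd r h N)) ∧ PIso r p := fun p hp => by
    have := mem_ef_nat.1 (g1 p (F.G_sub p hp) (nat r 0) (nat_mem_om 0))
    exact ⟨this.1, this.2.1⟩
  have gprd : ∀ {p x y}, F.G p → r (op r x y) p → r x h ∧ r y N := fun hp hx => by
    obtain ⟨x', y', h1, h2, h3⟩ := mem_prd.1 (fin_sub (gfin _ hp).1 hx)
    obtain ⟨rfl, rfl⟩ := op_inj.1 h3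
    exact ⟨h1, h2⟩
  have gdir : ∀ {k : ℕ} (f : Fin k → V), (∀ i, F.G (f i)) → ∃ p, F.G p ∧ ∀ i, SubW r (f i) p := by
    intro k
    induction k with
    | zero => exact fun f _ => F.G_ne.imp fun p hp => ⟨hp, fun i => i.elim0⟩
    | succ k ih =>
      intro f hf
      obtain ⟨p, h1, h2⟩ := ih (fun i => f i.castSucc) fun i => hf _
      obtain ⟨s, h3, h4, h5⟩ := F.exists_le h1 (hf (Fin.last k))
      refine ⟨s, h3, fun i => ?_⟩
      cases i using Fin.lastCases with
      | last => exact ((hF _ _).1 h5).2.2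
      | cast i => exact fun x hx => ((hF _ _).1 h4).2.2 x (h2 i x hx)
  have guniq : ∀ {p q x y y'}, F.G p → F.G q → r (op r x y) p → r (op r x y') q → y = y' := fun {p q x y y'} h1 h2 h3 h4 => by
    obtain ⟨s, h5, h6⟩ := gdir ![p, q] (fun i => by fin_cases i <;> assumption)
    exact ((gfin s h5).2 _ _ _ _ (h6 0 _ h3) (h6 1 _ h4)).2.1 rfl
  have tot : ∀ x : Sub r h, ∃ (y : Sub r N) (p : V), F.G p ∧ r (op r x.1 y.1) p := fun x => by
    obtain ⟨p, h1, y, h2⟩ := F.gen (Q := fun p => ∃ y, r (op r x.1 y) p) inferInstance fun p hp => by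
      obtain ⟨q, h1, h2, h3⟩ := g3 p hp x.1 x.2
      exact ⟨q, (hF _ _).2 ⟨h1, hp, h2⟩, h3⟩
    exact ⟨⟨y, (gprd h1 h2).2⟩, p, h1, h2⟩
  choose j f hf hj using tot
  have el : Elm (srel r h) (srel r N) j := by
    intro n φ v
    obtain ⟨p, hp, hs⟩ := gdir (fun i => f (v i)) fun i => hf _
    obtain ⟨k, v', w', hgr⟩ := exists_isGr (gfin p hp).1
    have h1 : ∀ i, ∃ i', v i = v' i' ∧ j (v i) = w' i' := fun i => by
      obtain ⟨i', h1⟩ := (hgr _).1 (hs i _ (hj (v i)))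
      obtain ⟨h2, h3⟩ := op_inj.1 h1
      exact ⟨i', Subtype.ext h2, Subtype.ext h3⟩
    choose e h2 h3 using h1
    obtain ⟨m, hm⟩ := exists_rank.{u, u} φ
    have h4 := (mem_ef_iff hgr).1 (g1 p (F.G_sub p hp) (nat r m) (nat_mem_om m))
    have h5 := (hm e Fin.elim0 v' w' h4).symm
    rw [← funext h2, ← funext h3, Subsingleton.elim (fun a => w' (Fin.elim0 a)) default,
      Subsingleton.elim (fun a => v' (Fin.elim0 a)) default] at h5
    exact h5
  let e : Sub r N ≃ {w // F.mw w (F.inc.i N)} := Equiv.ofBijective (fun x => ⟨F.inc.i x.1, (F.inc.mem' _ _).2 x.2⟩)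
    ⟨fun x y h => Subtype.ext (F.inc.inj (congrArg Subtype.val h)), fun w => by
      obtain ⟨y, h1, h2⟩ := F.inc.trans _ _ w.2
      exact ⟨⟨y, h1⟩, Subtype.ext h2.symm⟩⟩
  have el' := (Elm.of_iso (r := srel r N) (r' := fun a b : {w // F.mw w (F.inc.i N)} => F.mw a.1 b.1) e
    fun x y => F.inc.mem' _ _).comp el
  have hc : ∀ {x y}, FApp F.mw (sUn F.mw F.Gs) x y ↔ ∃ p x' y', F.G p ∧ r (op r x' y') p ∧ x = F.inc.i x' ∧ y = F.inc.i y' := by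
    intro x y
    rw [fApp_iff, mem_sUn (r := F.mw)]
    constructor
    · rintro ⟨a, h1, h2⟩
      obtain ⟨p, h3, rfl⟩ := F.mem_Gs.1 h1
      obtain ⟨z, h4, h5⟩ := F.inc.trans _ _ h2
      obtain ⟨x', y', -, -, rfl⟩ := mem_prd.1 (fin_sub (gfin _ h3).1 h4)
      obtain ⟨rfl, rfl⟩ := op_inj.1 (h5.trans (F.inc.op x' y'))
      exact ⟨p, x', y', h3, h4, rfl, rfl⟩
    · rintro ⟨p, x', y', h1, h2, rfl, rfl⟩
      exact ⟨F.inc.i p, F.mem_Gs.2 ⟨p, h1, rfl⟩, F.inc.op x' y' ▸ (F.inc.mem' _ _).2 h2⟩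
  have hfun : IsFuncW F.mw (sUn F.mw F.Gs) (F.inc.i h) (F.inc.i N) := by
    refine ⟨⟨fun z hz => ?_, fun x hx => ?_, fun x y y' h1 h2 => ?_⟩, fun x y hxy => ?_⟩
    · obtain ⟨a, h1, h2⟩ := (mem_sUn (r := F.mw)).1 hz
      obtain ⟨p, h3, rfl⟩ := F.mem_Gs.1 h1
      obtain ⟨z, h4, rfl⟩ := F.inc.trans _ _ h2
      obtain ⟨x', y', h5, -, rfl⟩ := mem_prd.1 (fin_sub (gfin _ h3).1 h4)
      exact ⟨F.inc.i x', F.inc.i y', (F.inc.mem' _ _).2 h5, F.inc.op x' y' ▸ isOPair_op _ _⟩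
    · obtain ⟨x, h1, rfl⟩ := F.inc.trans _ _ hx
      exact ⟨_, hc.2 ⟨_, _, _, hf ⟨x, h1⟩, hj ⟨x, h1⟩, rfl, rfl⟩⟩
    · obtain ⟨p, a, b, h3, h4, rfl, rfl⟩ := hc.1 h1
      obtain ⟨q, a', b', h5, h6, h7, rfl⟩ := hc.1 h2
      obtain rfl := F.inc.inj h7
      exact congrArg _ (guniq h3 h5 h4 h6)
    · obtain ⟨p, a, b, h3, h4, rfl, rfl⟩ := hc.1 hxy
      exact (F.inc.mem' _ _).2 (gprd h3 h4).2
  obtain ⟨o, ho⟩ : ∃ o, ∀ w, ¬ F.mw w o := ⟨emp F.mw, fun _ => mem_emp⟩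
  generalize sUn F.mw F.Gs = c at hc hfun
  let D : PlainEmb (hr.univ hp hv.ch) h :=
    { E := F.extension hp hv
      tgt := F.inc.i N
      bset := o
      emb := el'.emb fun y _ => ho y
      code := c
      code_fun := hfun
      code_graph := fun x hx => hc.2 ⟨_, _, _, hf ⟨x, hx⟩, hj ⟨x, hx⟩, rfl, rfl⟩ }
  have hκh : r κ h := (hh.ord hθ.rg hp hv.ch hκ.1).2 hκθ
  have hJ := fun x => g2 _ (F.G_sub _ (hf x)) _ _ (hj x)
  refine ⟨h, hh, N, D, rfl, tN, ⟨hκ.1, hκh, fun α hα h1 => ?_, fun h1 => ?_⟩, fun x hx => (F.inc.mem' _ _).2 (hN x hx), hκh,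
    (F.inc.mem' _ _).2 ((hJ ⟨κ, hκh⟩).2 rfl)⟩
  · exact congrArg F.inc.i ((hJ ⟨α, hα⟩).1 h1)
  · have h2 := (hJ ⟨κ, hκh⟩).2 rfl
    rw [show (j ⟨κ, hκh⟩).1 = κ from F.inc.inj h1] at h2
    exact hr.wf.asymmetric _ _ hκθ h2

end Virtual

section Ext
variable {V : Type u} {r : V → V → Prop} [hr : ZFm r]

/-- Recursion step for the rank analysis of extendibility. -/
noncomputable def qqStep (r : V → V → Prop) [ZFm r] (X h s f : V) : V :=
  sepS r X (fun p => ∀ β, r β s → ∀ x, r x h → ∃ q, r q (app r f β) ∧ SubW r p q ∧ ∃ y, r (op r x y) q)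

/-- The elements of `X` which can be extended `α` times within `X`. -/
noncomputable def qq (r : V → V → Prop) [ZFm r] (X h α : V) : V := recF r (qqStep r X h) α

end Ext

section Fns
variable {ι : Type w} {V : ι → Type u} {r : ∀ i, V i → V i → Prop} {P : (∀ i, V i) → Prop} {n : ℕ}
  [hr : ∀ i, ZFm (r i)] (f g h k : ∀ i, (Fin n → V i) → V i) [DFn r P f] [DFn r P g] [DFn r P h]
  [DFn r P k]

instance : DFn r P (fun i v => qqStep (r i) (f i v) (g i v) (h i v) (k i v)) :=
  DFn.comp4 (F := fun i => qqStep (r i)) (by unfold qqStep; infer_instance) f g h k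
instance : DFn r P (fun i v => qq (r i) (f i v) (g i v) (h i v)) :=
  DFn.comp3 (F := fun i => qq (r i)) (by unfold qq; infer_instance) f g h
end Fns

section Ext
variable {V : Type u} {r : V → V → Prop} [hr : ZFm r]

theorem mem_qq {X h α p : V} : r p (qq r X h α) ↔ r p X ∧ ∀ β, r β α → ∀ x, r x h →
    ∃ q, r q (qq r X h β) ∧ SubW r p q ∧ ∃ y, r (op r x y) q := by
  rw [qq, recF_eq, qqStep, mem_sepS (r := r)]
  refine and_congr Iff.rfl (forall_congr' fun β => forall_congr' fun hβ => ?_)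
  rw [app_lamS (F := recF r (qqStep r X h)) (mem_tc_of_mem hβ)]
  exact Iff.rfl

theorem qq_extend {X h p x : V} (hp : ∀ α, OrdW r α → r p (qq r X h α)) (hx : r x h) :
    ∃ q, r q X ∧ (∀ α, OrdW r α → r q (qq r X h α)) ∧ SubW r p q ∧ ∃ y, r (op r x y) q := by
  let Y := sepS r X (fun q => ∃ α, OrdW r α ∧ ¬ r q (qq r X h α))
  have hY : ∀ q, r q Y ↔ r q X ∧ ∃ α, OrdW r α ∧ ¬ r q (qq r X h α) := fun q => mem_sepS (r := r)
  obtain ⟨δ, hδ, hb⟩ := exists_ord_bound (r := r)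
    (x := imS r Y (fun q => lst r (fun α => ¬ r q (qq r X h α)))) fun y hy => by
      rw [mem_imS (r := r)] at hy
      obtain ⟨q, hq, rfl⟩ := hy
      exact (lst_spec ((hY q).1 hq).2).1
  obtain ⟨q, h1, h2⟩ := (mem_qq.1 (hp _ hδ.succ)).2 δ (mem_succ.2 (Or.inr rfl)) x hx
  have h3 := mem_qq.1 h1
  refine ⟨q, h3.1, ?_, h2⟩
  by_contra hc
  push Not at hc
  have hq := (hY q).2 ⟨h3.1, hc⟩
  obtain ⟨l1, l2, -⟩ := lst_spec hc
  have l3 := hb _ (mem_imS.2 ⟨q, hq, rfl⟩)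
  exact l2 (mem_qq.2 ⟨h3.1, fun β hβ => h3.2 β (hδ.trans l3 hβ)⟩)

end Ext

section Good
variable {V : Type u} {r : V → V → Prop} [hr : ZFm r] {θ κ β : V}

theorem JEmb.exists_gd (hθ : RegUncW r θ) (hp : Pw r) (hv : VE r) (hκ : IsCardW r κ) (hκθ : r κ θ)
    (J : JEmb r θ κ β) (hJ : r θ (J.j ⟨κ, J.hκ⟩).1) : ∃ h N P, Gd r θ κ h N P := by
  have hg := hθ.rg
  have z1 : ZFm (srel r (ee r θ)) := zfm_ee hg hp hv
  have z2 : ZFm (srel r (ee r β)) := J.el.zfm (InvImage.wf Subtype.val hr.wf)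
  have trN := transW_ee (r := r) J.ord
  have trh := transW_ee (r := r) hg.1.1
  let I : TEmb r r := ⟨id, Function.injective_id, fun _ _ => Iff.rfl, fun x w h => ⟨w, h, rfl⟩⟩
  have hsub : SubW r (ee r θ) (ee r β) := fun x hx => by
    obtain ⟨α, h1, rfl⟩ := mem_ee.1 hx
    have hα := hg.1.1.mem h1
    exact e_mem z2 trN hα (J.el.ord_mem trh trN I hα ((isHW_ee hg hp hv).ord hg hp hv.ch hα |>.2 h1))
  let X := sepS r (fin r (prd r (ee r θ) (ee r β))) (fun p =>
    (∀ n, r n (om r) → r p (ef r (ee r θ) (ee r β) n)) ∧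
    ∀ x y, r (op r x y) p → (r x κ → y = x) ∧ (x = κ → r θ y))
  have hX : ∀ p, r p X ↔ r p (fin r (prd r (ee r θ) (ee r β))) ∧
    (∀ n, r n (om r) → r p (ef r (ee r θ) (ee r β) n)) ∧
    ∀ x y, r (op r x y) p → (r x κ → y = x) ∧ (x = κ → r θ y) := fun p => mem_sepS (r := r)
  have key : ∀ α (k : ℕ) (v : Fin k → Sub r (ee r θ)) p,
      IsGr r p (fun i => (v i).1) (fun i => (J.j (v i)).1) → r p (qq r X (ee r θ) α) := fun α => by
    induction α using hr.wf.induction with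
    | _ α ih =>
    intro k v p hgr
    have hef : ∀ n, r p (ef r (ee r θ) (ee r β) (nat r n)) := fun n =>
      (mem_ef_iff (w := fun i => J.j (v i)) hgr).2
        ((J.el.df (R := fun i w => tp i.r n w = tp (srel r (ee r θ)) n v) (Df.tp_eq n _) v).2 rfl).symm
    refine mem_qq.2 ⟨(hX p).2 ⟨(mem_ef_nat.1 (hef 0)).1, fun n hn => ?_, fun x y h => ?_⟩, fun γ hγ x hx => ?_⟩
    · obtain ⟨n, rfl⟩ := mem_om.1 hn
      exact hef n
    · obtain ⟨i, hi⟩ := (hgr _).1 h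
      obtain ⟨rfl, rfl⟩ := op_inj.1 hi
      refine ⟨fun h => J.fix _ _ h, fun h => ?_⟩
      have : v i = ⟨κ, J.hκ⟩ := Subtype.ext h
      dsimp only
      rwa [this]
    · refine ⟨adj r p (op r x (J.j ⟨x, hx⟩).1), ih γ hγ (k + 1) (Fin.snoc v ⟨x, hx⟩) _ ?_,
        fun z hz => mem_adj.2 (Or.inl hz), _, mem_adj.2 (Or.inr rfl)⟩
      convert hgr.adj x (J.j ⟨x, hx⟩).1 using 1 <;>
      · funext i
        refine Fin.lastCases ?_ (fun i => ?_) i <;> simp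
  let P := sepS r X (fun p => ∀ α, OrdW r α → r p (qq r X (ee r θ) α))
  have hP : ∀ p, r p P ↔ r p X ∧ ∀ α, OrdW r α → r p (qq r X (ee r θ) α) := fun p => mem_sepS (r := r)
  have he := fun α => key α 0 Fin.elim0 (emp r) fun z => ⟨fun h => (mem_emp h).elim, fun ⟨i, _⟩ => i.elim0⟩
  refine ⟨ee r θ, ee r β, P, hθ, hκ, hκθ, isHW_ee hg hp hv, trN, hsub,
    ⟨emp r, (hP _).2 ⟨(mem_qq.1 (he (emp r))).1, fun α _ => he α⟩⟩,
    fun p h => ((hX p).1 ((hP p).1 h).1).2.1, fun p h => ((hX p).1 ((hP p).1 h).1).2.2, fun p h x hx => ?_⟩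
  obtain ⟨q, h1, h2, h3⟩ := qq_extend ((hP p).1 h).2 hx
  exact ⟨q, (hP q).2 ⟨h1, h2⟩, h3⟩

end Good

theorem l3_card : L3.card ≤ Cardinal.aleph0 := by
  haveI : Countable L3.Symbols := by
    let f : L3.Symbols → ℕ := fun
      | .inl ⟨_, g⟩ => nomatch g
      | .inr ⟨_, .u1⟩ => 0
      | .inr ⟨_, .u2⟩ => 1
      | .inr ⟨_, .mem⟩ => 2
    refine Function.Injective.countable (f := f) ?_
    rintro (⟨_, ⟨⟩⟩ | ⟨_, _ | _ | _⟩) (⟨_, ⟨⟩⟩ | ⟨_, _ | _ | _⟩) h <;> first | rfl | cases h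
  exact Cardinal.mk_le_aleph0

/-- Countable elementary submodels. -/
theorem exists_countable_elm {V : Type u} (r : V → V → Prop) [Infinite V] :
    ∃ S : Set V, Countable S ∧ Elm (fun a b : S => r a.1 b.1) r Subtype.val := by
  letI := memStr r
  obtain ⟨S, -, hS⟩ := exists_elementarySubstructure_card_eq L3 (M := V) ∅ Cardinal.aleph0.{u} le_rfl
    (by simp) (by simpa using l3_card) (by simp)
  refine ⟨S, ?_, fun n φ v => ?_⟩
  · have : Cardinal.mk S ≤ Cardinal.aleph0 := by simpa using hS.le
    exact Cardinal.mk_le_aleph0_iff.1 this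
  · have e : memStr (fun a b : S => r a.1 b.1) = ElementarySubstructure.inducedStructure S :=
      Structure.ext (funext fun n => funext fun f => nomatch f) (funext fun n => funext fun R => by
        cases R <;> rfl)
    change _ ↔ @Formula.Realize L3 S (memStr (fun a b : S => r a.1 b.1)) _ φ v
    rw [e]
    exact S.subtype.map_formula φ v

theorem Dz.gd : Dz (fun (i : ZSt.{u}) (_ : Fin 0 → i.V) => ∃ θ κ h N P, Gd i.r θ κ h N P) := by
  unfold Gd; infer_instance

theorem Dz.pw : Dz (fun (i : ZSt.{u}) (_ : Fin 0 → i.V) => Pw i.r) := by unfold Pw; infer_instance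

theorem exists_virtStrong {V : Type u} {r : V → V → Prop} [hr : ZFm r] {θ κ h N P : V} (hp : Pw r) (hv : VE r)
    (g : Gd r θ κ h N P) : ∃ (u : ZFUniv.{u}) (θ κ : u.V), RegUncW u.mem θ ∧ IsCardW u.mem κ ∧ u.mem κ θ ∧
      VirtStrongAt u θ κ := by
  haveI : Infinite V := Infinite.of_injective (nat r) fun a b h => by
    rcases lt_trichotomy a b with h1 | h1 | h1
    · have := nat_mem_nat (r := r).2 h1
      rw [h] at this
      exact (hr.wf.asymmetric _ _ this this).elim
    · exact h1
    · have := nat_mem_nat (r := r).2 h1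
      rw [h] at this
      exact (hr.wf.asymmetric _ _ this this).elim
  obtain ⟨S, hS, hi⟩ := exists_countable_elm r
  haveI : ZFm (fun a b : S => r a.1 b.1) := hi.zfm_rev (InvImage.wf Subtype.val hr.wf)
  have hp' := (hi.sentz Dz.pw).1 hp
  have hv' := (hi.sentz Dz.ve).1 hv
  obtain ⟨θ, κ, h, N, P, g'⟩ := (hi.sentz Dz.gd).1 ⟨θ, κ, h, N, P, g⟩
  exact ⟨ZFm.univ ‹_› hp' hv'.ch, θ, κ, g'.1, g'.2.1, g'.2.2.1, g'.virtStrong hp' hv'⟩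

end VLC

namespace VLC

/-- **Corollary 3.9.** For any regular uncountable cardinal `θ`, the existence of a
virtually `θ`-strong cardinal is equiconsistent (over ZFC) with the existence of a
faintly `θ`-measurable cardinal — rendered semantically: there is a ZFC universe with a
virtually `θ`-strong cardinal iff there is a ZFC universe with a faintly `θ`-measurable
cardinal. In particular, in any universe satisfying `V = L`, every faintly
`θ`-measurable cardinal is virtually `θ`-pre-strong. -/
theorem virtStrong_equiconsistent_faintMeasurable :
    ((∃ (u : ZFUniv.{u}) (θ κ : u.V), RegUncW u.mem θ ∧ IsCardW u.mem κ ∧ u.mem κ θ ∧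
        VirtStrongAt u θ κ) ↔
      (∃ (u : ZFUniv.{u}) (θ κ : u.V), RegUncW u.mem θ ∧ IsCardW u.mem κ ∧ u.mem κ θ ∧
        FaintMeasAt u θ κ)) ∧
    (∀ u : ZFUniv.{u}, VeqL u → ∀ θ κ : u.V, RegUncW u.mem θ → IsCardW u.mem κ →
      u.mem κ θ → FaintMeasAt u θ κ → VirtPreStrongAt u θ κ) := by
  refine ⟨⟨?_, ?_⟩, fun u hu θ κ hθ _ _ hf => hf.virtPreStrong hu hθ⟩
  · rintro ⟨u, θ, κ, hθ, hκ, hκθ, hf⟩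
    exact ⟨u, θ, κ, hθ, hκ, hκθ, hf.faintMeas⟩
  · rintro ⟨u, θ, κ, hθ, hκ, hκθ, hf⟩
    obtain ⟨V, r, hr, θ, κ, β, hv, hp, hθ, hκ, hκθ, ⟨J⟩⟩ := hf.exists_jemb hθ hκ hκθ
    obtain ⟨θ', β', J', hθ', hκθ', hJ⟩ := JEmb.improve hθ.rg hp hv hθ hκ hκθ J
    obtain ⟨h, N, P, g⟩ := J'.exists_gd hθ' hp hv hκ hκθ' hJ
    exact exists_virtStrong hp hv g

end VLC
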